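/- There exists a real number p₀ with 2.57 < p₀ < 2.58 such that for all real p > 1 the following holds. The infimum, over all triples v₁, v₂, v₃ ∈ ℝ² such that the centrally symmetric hexagon H = convex hull of {v₁, v₂, v₃, −v₁, −v₂, −v₃} contains D_p, of the area of H equals 4^{1 − 1/p}·(1 + τ_p)/(1 − τ_p) if 1 < p ≤ 2 or p ≥ p₀, and equals 2·(2^p − 1)^{1/p} if 2 ≤ p ≤ p₀; here τ_p ∈ [0,1) is determined by 2(1 − τ_p)^p = 1 + τ_p^p. -/

import Mathlib

open scoped Pointwise

/-- The open Minkowski ball `D_p = {(x,y) : |x|^p + |y|^p < 1}` in `ℝ²`. -/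
def ballD (p : ℝ) : Set (ℝ × ℝ) :=
  {v : ℝ × ℝ | |v.1| ^ p + |v.2| ^ p < 1}

/-- The Minkowski curve `C_p = {(x,y) : |x|^p + |y|^p = 1}`, the boundary of `D_p`. -/
def curveC (p : ℝ) : Set (ℝ × ℝ) :=
  {v : ℝ × ℝ | |v.1| ^ p + |v.2| ^ p = 1}

/-- The lattice (ℤ-span) generated by two vectors `a b : ℝ²`. -/
def latticeSet (a b : ℝ × ℝ) : Set (ℝ × ℝ) :=
  {v : ℝ × ℝ | ∃ m n : ℤ, v = (m : ℝ) • a + (n : ℝ) • b}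

/-- The determinant of the 2×2 matrix with rows `a` and `b`. -/
def det2 (a b : ℝ × ℝ) : ℝ := a.1 * b.2 - a.2 * b.1

/-- A lattice with basis `a, b` is admissible for `D` if it meets `D` at most in `0`. -/
def IsAdmissible (D : Set (ℝ × ℝ)) (a b : ℝ × ℝ) : Prop :=
  latticeSet a b ∩ D ⊆ {0}

/-- The critical determinant `Δ(D)`: the infimum of covolumes `|det(a,b)|` over all
full-rank lattices `ℤa + ℤb` admissible for `D` (with value `∞` if none exists). -/
noncomputable def criticalDet (D : Set (ℝ × ℝ)) : ENNReal :=
  sInf {d : ENNReal | ∃ a b : ℝ × ℝ, LinearIndependent ℝ ![a, b] ∧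
    IsAdmissible D a b ∧ d = ENNReal.ofReal |det2 a b|}

/-- `f_p(x) = (1+x)^p - 1` -/
noncomputable def ff (p x : ℝ) : ℝ := (1 + x) ^ p - 1
/-- `g_p(x) = 1 - x^p` -/
noncomputable def gg (p x : ℝ) : ℝ := 1 - x ^ p
/-- `k_p(x) = (1+x)^p - x^p` -/
noncomputable def kk (p x : ℝ) : ℝ := (1 + x) ^ p - x ^ p

/-- the curve of pairs `(a,b)`. -/
def OnC (p a b : ℝ) : Prop := ff p a * ff p b = gg p a * gg p b

lemma OnC.symm {p a b : ℝ} (h : OnC p a b) : OnC p b a := by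
  unfold OnC at *; linarith [mul_comm (ff p a) (ff p b), mul_comm (gg p a) (gg p b)]

lemma ff_lt {p x y : ℝ} (hp : 0 < p) (hx : 0 ≤ x) (hxy : x < y) : ff p x < ff p y := by
  unfold ff
  have := Real.rpow_lt_rpow (by linarith : 0 ≤ 1 + x) (by linarith : 1 + x < 1 + y) hp
  linarith
lemma ff_le {p x y : ℝ} (hp : 0 < p) (hx : 0 ≤ x) (hxy : x ≤ y) : ff p x ≤ ff p y := by
  unfold ff
  have := Real.rpow_le_rpow (by linarith : 0 ≤ 1 + x) (by linarith : 1 + x ≤ 1 + y) hp.le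
  linarith
lemma gg_lt {p x y : ℝ} (hp : 0 < p) (hx : 0 ≤ x) (hxy : x < y) : gg p y < gg p x := by
  unfold gg
  have := Real.rpow_lt_rpow hx hxy hp
  linarith
lemma gg_le {p x y : ℝ} (hp : 0 < p) (hx : 0 ≤ x) (hxy : x ≤ y) : gg p y ≤ gg p x := by
  unfold gg
  have := Real.rpow_le_rpow hx hxy hp.le
  linarith
lemma ff_zero (p : ℝ) : ff p 0 = 0 := by simp [ff]
lemma gg_one (p : ℝ) : gg p 1 = 0 := by simp [gg]
lemma gg_zero {p : ℝ} (hp : 0 < p) : gg p 0 = 1 := by simp [gg, hp.ne']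
lemma ff_pos {p x : ℝ} (hp : 0 < p) (hx : 0 < x) : 0 < ff p x := by
  have := ff_lt hp le_rfl hx; rwa [ff_zero] at this
lemma ff_nonneg {p x : ℝ} (hp : 0 < p) (hx : 0 ≤ x) : 0 ≤ ff p x := by
  have := ff_le hp le_rfl hx; rwa [ff_zero] at this
lemma gg_pos {p x : ℝ} (hp : 0 < p) (h0 : 0 ≤ x) (hx : x < 1) : 0 < gg p x := by
  have := gg_lt hp h0 hx; rwa [gg_one] at this
lemma gg_nonneg {p x : ℝ} (hp : 0 < p) (h0 : 0 ≤ x) (hx : x ≤ 1) : 0 ≤ gg p x := by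
  have := gg_le hp h0 hx; rwa [gg_one] at this

lemma ff_scale {p r x : ℝ} (hp : 0 < p) (hr : p ≤ r) (hx : 0 ≤ x) :
    r / p * ff p x ≤ ff r x := by
  have h1 : 1 ≤ r / p := by rw [le_div_iff₀ hp]; linarith
  have h2 := one_add_mul_self_le_rpow_one_add (s := ff p x)
    (by have := ff_nonneg hp hx; linarith) h1
  have h3 : (1 + ff p x) ^ (r / p) = (1 + x) ^ r := by
    unfold ff
    rw [show (1 + ((1 + x) ^ p - 1)) = (1 + x) ^ p by ring, ← Real.rpow_mul (by linarith)]
    congr 1; field_simp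
  rw [h3] at h2
  unfold ff at *; linarith
lemma gg_scale {p r x : ℝ} (hp : 0 < p) (hr : p ≤ r) (hx : 0 ≤ x) :
    gg r x ≤ r / p * gg p x := by
  have h1 : 1 ≤ r / p := by rw [le_div_iff₀ hp]; linarith
  have h0 : 0 ≤ x ^ p := Real.rpow_nonneg hx p
  have h2 := one_add_mul_self_le_rpow_one_add (s := x ^ p - 1) (by linarith) h1
  have h3 : (1 + (x ^ p - 1)) ^ (r / p) = x ^ r := by
    rw [show (1 + (x ^ p - 1)) = x ^ p by ring, ← Real.rpow_mul hx]
    congr 1; field_simp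
  rw [h3] at h2
  unfold gg at *; linarith

/-- lower bound for `a` from a test at a larger exponent and larger `b`. -/
lemma OnC.lower {p r a b al b1 : ℝ} (hp : 0 < p) (hr : p ≤ r) (ha0 : 0 ≤ a)
    (hb0 : 0 < b) (hb : b ≤ b1) (hb1 : b1 ≤ 1) (hal1 : al ≤ 1)
    (h : OnC p a b) (ht : ff r al * ff r b1 ≤ gg r al * gg r b1) : al ≤ a := by
  by_contra hlt
  push Not at hlt
  have hal0 : 0 < al := lt_of_le_of_lt ha0 hlt
  have hq : 0 < r / p := div_pos (by linarith) hp
  have e1 := ff_scale hp hr hal0.le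
  have e2 := ff_scale hp hr (by linarith : (0:ℝ) ≤ b1)
  have e3 := gg_scale hp hr hal0.le
  have e4 := gg_scale hp hr (by linarith : (0:ℝ) ≤ b1)
  have n1 := ff_pos hp hal0
  have n2 := ff_pos hp (by linarith : (0:ℝ) < b1)
  have n3 := gg_nonneg hp hal0.le hal1
  have n4 := gg_nonneg hp (by linarith : (0:ℝ) ≤ b1) hb1
  have m4 := gg_nonneg (lt_of_lt_of_le hp hr) (by linarith : (0:ℝ) ≤ b1) hb1
  have k1 : (r / p * ff p al) * (r / p * ff p b1) ≤ ff r al * ff r b1 :=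
    mul_le_mul e1 e2 (by positivity) (le_trans (by positivity) e1)
  have k2 : gg r al * gg r b1 ≤ (r / p * gg p al) * (r / p * gg p b1) :=
    mul_le_mul e3 e4 m4 (by positivity)
  have k3 : (r/p)^2 * (ff p al * ff p b1) ≤ (r/p)^2 * (gg p al * gg p b1) := by nlinarith
  have k4 : ff p al * ff p b1 ≤ gg p al * gg p b1 := le_of_mul_le_mul_left k3 (by positivity)
  have f1 := ff_lt hp ha0 hlt
  have f2 := ff_le hp hb0.le hb
  have f3 := gg_lt hp ha0 hlt
  have f4 := gg_le hp hb0.le hb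
  have fb := ff_pos hp hb0
  have k5 : ff p a * ff p b < ff p al * ff p b1 :=
    mul_lt_mul f1 f2 fb n1.le
  have k6 : gg p al * gg p b1 ≤ gg p a * gg p b := mul_le_mul f3.le f4 n4 (by linarith)
  unfold OnC at h
  linarith

/-- upper bound for `a` from a test at a smaller exponent and smaller `b`. -/
lemma OnC.upper {p r a b ah b0 : ℝ} (hp : 0 < r) (hr : r ≤ p) (hah : 0 ≤ ah) (ha1 : a ≤ 1)
    (hb0 : 0 ≤ b0) (hb : b0 ≤ b) (hbp : 0 < b) (hb1 : b < 1)
    (h : OnC p a b) (ht : gg r ah * gg r b0 ≤ ff r ah * ff r b0) : a ≤ ah := by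
  by_contra hlt
  push Not at hlt
  have ha0 : 0 < a := lt_of_le_of_lt hah hlt
  have hp' : 0 < p := by linarith
  have hq : 0 < p / r := div_pos hp' hp
  have e1 := ff_scale hp hr hah
  have e2 := ff_scale hp hr hb0
  have e3 := gg_scale hp hr hah
  have e4 := gg_scale hp hr hb0
  have n1 := ff_nonneg hp hah
  have n2 := ff_nonneg hp hb0
  have n3 := gg_pos hp hah (by linarith)
  have n4 := gg_pos hp hb0 (by linarith)
  have m4 := gg_pos hp' hb0 (by linarith)
  have k1 : (p / r * ff r ah) * (p / r * ff r b0) ≤ ff p ah * ff p b0 :=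
    mul_le_mul e1 e2 (by positivity) (le_trans (by positivity) e1)
  have k2 : gg p ah * gg p b0 ≤ (p / r * gg r ah) * (p / r * gg r b0) :=
    mul_le_mul e3 e4 m4.le (by positivity)
  have k3 : gg p ah * gg p b0 ≤ ff p ah * ff p b0 := by
    have : (p/r)^2 * (gg r ah * gg r b0) ≤ (p/r)^2 * (ff r ah * ff r b0) :=
      mul_le_mul_of_nonneg_left ht (by positivity)
    nlinarith
  have f1 := ff_lt hp' hah hlt
  have f2 := ff_le hp' hb0 hb
  have f3 := gg_lt hp' hah hlt
  have f4 := gg_le hp' hb0 hb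
  have fb := ff_pos hp' hbp
  have fb0 := ff_nonneg hp' hb0
  have fah := ff_nonneg hp' hah
  have k5 : ff p ah * ff p b0 < ff p a * ff p b := by
    calc ff p ah * ff p b0 ≤ ff p ah * ff p b := mul_le_mul_of_nonneg_left f2 fah
      _ < ff p a * ff p b := mul_lt_mul_of_pos_right f1 fb
  have k6 : gg p a * gg p b ≤ gg p ah * gg p b0 :=
    mul_le_mul f3.le f4 (gg_nonneg hp' hbp.le hb1.le) (gg_nonneg hp' hah (by linarith))
  unfold OnC at h
  linarith

lemma OnC.a_lt_one {p a b : ℝ} (hp : 0 < p) (ha0 : 0 ≤ a) (hb0 : 0 < b) (ha1 : a ≤ 1)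
    (h : OnC p a b) : a < 1 := by
  rcases lt_or_eq_of_le ha1 with h1 | h1
  · exact h1
  · subst h1
    unfold OnC at h; rw [gg_one, zero_mul] at h
    have := mul_pos (ff_pos hp one_pos) (ff_pos hp hb0)
    linarith
lemma OnC.a_pos {p a b : ℝ} (hp : 0 < p) (ha0 : 0 ≤ a) (hb0 : 0 ≤ b) (hb1 : b < 1)
    (h : OnC p a b) : 0 < a := by
  rcases lt_or_eq_of_le ha0 with h1 | h1
  · exact h1
  · subst h1
    unfold OnC at h; rw [ff_zero, zero_mul, gg_zero hp, one_mul] at h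
    have := gg_pos hp hb0 hb1
    linarith

/-- `u/(e^u-1)` -/
noncomputable def zet (u : ℝ) : ℝ := u / (Real.exp u - 1)

lemma zet_convex : ConvexOn ℝ (Set.Ioi 0) zet := by
  have hE : ∀ u : ℝ, 0 < u → 0 < Real.exp u - 1 := fun u hu => by
    have := Real.add_one_lt_exp hu.ne'; linarith
  have hinter : interior (Set.Ioi (0:ℝ)) = Set.Ioi 0 := isOpen_Ioi.interior_eq
  refine convexOn_of_hasDerivWithinAt2_nonneg (convex_Ioi 0)
    (f' := fun u => (Real.exp u - 1 - u * Real.exp u) / (Real.exp u - 1) ^ 2)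
    (f'' := fun u => Real.exp u * ((u - 2) * Real.exp u + u + 2) / (Real.exp u - 1) ^ 3) ?_ ?_ ?_ ?_
  · unfold zet
    exact ContinuousOn.div continuousOn_id (by fun_prop) (fun u hu => (hE u hu).ne')
  · intro u hu
    rw [hinter] at hu
    apply HasDerivAt.hasDerivWithinAt
    have h := (hasDerivAt_id u).div ((Real.hasDerivAt_exp u).sub_const 1) (hE u hu).ne'
    refine h.congr_deriv ?_
    simp
  · intro u hu
    rw [hinter] at hu
    apply HasDerivAt.hasDerivWithinAt
    have e := Real.hasDerivAt_exp u
    have hne := (hE u hu).ne'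
    have h := ((e.sub_const 1).sub ((hasDerivAt_id u).mul e)).div ((e.sub_const 1).pow 2)
      (pow_ne_zero 2 hne)
    refine h.congr_deriv ?_
    simp only [Pi.sub_apply, Pi.mul_apply, Pi.pow_apply, id]
    field_simp
    ring
  · intro u hu
    rw [hinter] at hu
    have hu' : 0 < u := hu
    have h1 : 0 ≤ (u - 2) * Real.exp u + u + 2 := by
      have hm : MonotoneOn (fun u => (u - 2) * Real.exp u + u + 2) (Set.Ici (0:ℝ)) := by
        refine monotoneOn_of_hasDerivWithinAt_nonneg (convex_Ici 0)
          (f' := fun u => (u - 1) * Real.exp u + 1) (by fun_prop) ?_ ?_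
        · intro x _
          apply HasDerivAt.hasDerivWithinAt
          have h := ((((hasDerivAt_id x).sub_const 2).mul (Real.hasDerivAt_exp x)).add
            (hasDerivAt_id x)).add_const 2
          refine h.congr_deriv ?_
          simp; ring
        · intro x _
          have h2 := Real.add_one_le_exp (-x)
          have h3 : Real.exp (-x) * Real.exp x = 1 := by rw [← Real.exp_add]; simp
          have h4 := Real.exp_pos x
          nlinarith
      have := hm (show (0:ℝ) ∈ Set.Ici 0 by simp) (show u ∈ Set.Ici 0 from hu'.le) hu'.le
      simpa using this
    have := hE u hu'
    have := Real.exp_pos u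
    positivity

lemma zet_interp {p L : ℝ} (h2 : 2 ≤ p) (h3 : p ≤ 3) (hL : 0 < L) :
    p / (Real.exp (p * L) - 1) ≤
      (3 - p) * (2 / (Real.exp (2 * L) - 1)) + (p - 2) * (3 / (Real.exp (3 * L) - 1)) := by
  have h := zet_convex.2 (show 2 * L ∈ Set.Ioi 0 by simp [hL]) (show 3 * L ∈ Set.Ioi 0 by simp [hL])
    (by linarith : 0 ≤ 3 - p) (by linarith : 0 ≤ p - 2) (by ring)
  simp only [smul_eq_mul] at h
  rw [show (3 - p) * (2 * L) + (p - 2) * (3 * L) = p * L by ring] at h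
  unfold zet at h
  have e1 : p * L / (Real.exp (p * L) - 1) = L * (p / (Real.exp (p * L) - 1)) := by ring
  have e2 : (3 - p) * (2 * L / (Real.exp (2 * L) - 1)) + (p - 2) * (3 * L / (Real.exp (3 * L) - 1))
    = L * ((3 - p) * (2 / (Real.exp (2 * L) - 1)) + (p - 2) * (3 / (Real.exp (3 * L) - 1))) := by
    ring
  rw [e1, e2] at h
  exact le_of_mul_le_mul_left h hL

lemma ff_deriv {p x : ℝ} (hx : 0 ≤ x) :
    HasDerivAt (ff p) (p * (1 + x) ^ (p - 1)) x := by
  unfold ff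
  have h := ((hasDerivAt_id x).const_add 1).rpow_const (p := p) (Or.inl (by simp; linarith))
  have h2 := h.sub_const 1
  refine h2.congr_deriv ?_
  simp
lemma gg_deriv {p x : ℝ} (hx : 0 < x) :
    HasDerivAt (gg p) (-(p * x ^ (p - 1))) x := by
  unfold gg
  have h := (Real.hasDerivAt_rpow_const (p := p) (Or.inl hx.ne')).const_sub 1
  exact h

lemma logder_bound {p x : ℝ} (h2 : 2 ≤ p) (h3 : p ≤ 3) (h0 : 0 < x) (h1 : x < 1) :
    p * (1 + x) ^ (p - 1) / ff p x + p * x ^ (p - 1) / gg p x ≤ 1 / x + 1 / (1 - x) := by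
  have hf := ff_pos (by linarith : 0 < p) h0
  have hg := gg_pos (by linarith : 0 < p) h0.le h1
  have hL : 0 < Real.log (1 + x) := Real.log_pos (by linarith)
  have hM : 0 < Real.log x⁻¹ := Real.log_pos ((one_lt_inv₀ h0).2 h1)
  have z1 := zet_interp h2 h3 hL
  have z2 := zet_interp h2 h3 hM
  have ex : ∀ (c y : ℝ), 0 < y → Real.exp (c * Real.log y) = y ^ c := fun c y hy => by
    rw [Real.rpow_def_of_pos hy, mul_comm]
  have hx1 : (0:ℝ) < 1 + x := by linarith
  have hxi : (0:ℝ) < x⁻¹ := by positivity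
  rw [ex _ _ hx1, ex _ _ hx1, ex _ _ hx1] at z1
  rw [ex _ _ hxi, ex _ _ hxi, ex _ _ hxi] at z2
  have c2 : ∀ y : ℝ, y ^ (2:ℝ) = y ^ 2 := fun y => by norm_cast
  have c3 : ∀ y : ℝ, y ^ (3:ℝ) = y ^ 3 := fun y => by norm_cast
  rw [c2, c3] at z1 z2
  rw [Real.inv_rpow h0.le] at z2
  have hxp : 0 < x ^ p := Real.rpow_pos_of_pos h0 p
  have e1 : p * (1 + x) ^ (p - 1) / ff p x = (p + p / ((1 + x) ^ p - 1)) / (1 + x) := by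
    rw [Real.rpow_sub_one hx1.ne']
    unfold ff at *
    field_simp
    ring
  have e2 : p * x ^ (p - 1) / gg p x = (p / ((x ^ p)⁻¹ - 1)) / x := by
    rw [Real.rpow_sub_one h0.ne']
    unfold gg at *
    have : (x ^ p)⁻¹ - 1 = (1 - x ^ p) / x ^ p := by field_simp
    rw [this]
    field_simp
  rw [e1, e2]
  have f1 : (p + p / ((1 + x) ^ p - 1)) / (1 + x) ≤
     (p + ((3 - p) * (2 / ((1 + x) ^ 2 - 1)) + (p - 2) * (3 / ((1 + x) ^ 3 - 1)))) / (1 + x) := by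
    gcongr
  have f2 : (p / ((x ^ p)⁻¹ - 1)) / x ≤
     ((3 - p) * (2 / (x⁻¹ ^ 2 - 1)) + (p - 2) * (3 / (x⁻¹ ^ 3 - 1))) / x := by
    gcongr
  refine (add_le_add f1 f2).trans ?_
  have hy : 0 < 1 - x := by linarith
  have g1 : 2 / ((1 + x) ^ 2 - 1) = 2 / (x * (2 + x)) := by congr 1; ring
  have g2 : 3 / ((1 + x) ^ 3 - 1) = 3 / (x * (3 + 3 * x + x ^ 2)) := by congr 1; ring
  have g3 : 2 / (x⁻¹ ^ 2 - 1) = 2 * x ^ 2 / ((1 - x) * (1 + x)) := by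
    rw [show x⁻¹ ^ 2 - 1 = (1 - x) * (1 + x) / x ^ 2 by field_simp; ring]
    field_simp
  have g4 : 3 / (x⁻¹ ^ 3 - 1) = 3 * x ^ 3 / ((1 - x) * (1 + x + x ^ 2)) := by
    rw [show x⁻¹ ^ 3 - 1 = (1 - x) * (1 + x + x ^ 2) / x ^ 3 by field_simp; ring]
    field_simp
  rw [g1, g2, g3, g4]
  have i2 : (2 + 2 / (x * (2 + x))) / (1 + x) + (2 * x ^ 2 / ((1 - x) * (1 + x))) / x
      ≤ 1 / x + 1 / (1 - x) := by
    have : 1 / x + 1 / (1 - x) - ((2 + 2 / (x * (2 + x))) / (1 + x) +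
        (2 * x ^ 2 / ((1 - x) * (1 + x))) / x) = (x - x ^ 2) / (x * (1 - x) * (2 + x) * (1 + x)) := by
      field_simp; ring
    have h5 : 0 ≤ (x - x ^ 2) / (x * (1 - x) * (2 + x) * (1 + x)) := by
      apply div_nonneg _ (by positivity); nlinarith
    linarith
  have i3 : (3 + 3 / (x * (3 + 3 * x + x ^ 2))) / (1 + x) + (3 * x ^ 3 / ((1 - x) * (1 + x + x ^ 2))) / x
      ≤ 1 / x + 1 / (1 - x) := by
    have : 1 / x + 1 / (1 - x) - ((3 + 3 / (x * (3 + 3 * x + x ^ 2))) / (1 + x) +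
        (3 * x ^ 3 / ((1 - x) * (1 + x + x ^ 2))) / x) =
        (4 * x ^ 2 - 2 * x ^ 3 - 2 * x ^ 4) / (x * (1 - x) * (3 + 3 * x + x ^ 2) * (1 + x + x ^ 2)) := by
      field_simp; ring
    have h5 : 0 ≤ (4 * x ^ 2 - 2 * x ^ 3 - 2 * x ^ 4) /
        (x * (1 - x) * (3 + 3 * x + x ^ 2) * (1 + x + x ^ 2)) := by
      apply div_nonneg _ (by positivity)
      have : 4 * x ^ 2 - 2 * x ^ 3 - 2 * x ^ 4 = 2 * x^2 * ((1 - x) * (2 + x)) := by ring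
      rw [this]; positivity
    linarith
  have j2 := mul_le_mul_of_nonneg_left i2 (by linarith : 0 ≤ 3 - p)
  have j3 := mul_le_mul_of_nonneg_left i3 (by linarith : 0 ≤ p - 2)
  refine le_trans (le_of_eq ?_) ((add_le_add j2 j3).trans (le_of_eq ?_))
  · ring
  · ring

/-- `Θ_p(x)` -/
noncomputable def Th (p x : ℝ) : ℝ := ff p x * (1 - x) / (x * gg p x)

lemma Th_pos {p x : ℝ} (hp : 0 < p) (h0 : 0 < x) (h1 : x < 1) : 0 < Th p x := by
  unfold Th
  have := ff_pos hp h0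
  have := gg_pos hp h0.le h1
  have : 0 < 1 - x := by linarith
  positivity

lemma Th_anti {p x y : ℝ} (h2 : 2 ≤ p) (h3 : p ≤ 3) (h0 : 0 < x) (hxy : x ≤ y) (h1 : y < 1) :
    Th p y ≤ Th p x := by
  have hp : 0 < p := by linarith
  have hA : AntitoneOn (fun x => Real.log (ff p x) + Real.log (1 - x) - Real.log x
      - Real.log (gg p x)) (Set.Ioo 0 1) := by
    have hd : ∀ x ∈ Set.Ioo (0:ℝ) 1, HasDerivAt (fun x => Real.log (ff p x) + Real.log (1 - x) - Real.log x
      - Real.log (gg p x)) (p * (1 + x) ^ (p - 1) / ff p x + -1 / (1 - x) - x⁻¹ -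
        (-(p * x ^ (p - 1))) / gg p x) x := by
      intro x hx
      have a1 := (ff_deriv (p := p) hx.1.le).log (ff_pos hp hx.1).ne'
      have a2 := (gg_deriv (p := p) hx.1).log (gg_pos hp hx.1.le hx.2).ne'
      have a3 := ((hasDerivAt_id x).const_sub 1).log (by simp; linarith [hx.2] : (1:ℝ) - id x ≠ 0)
      have a4 := Real.hasDerivAt_log hx.1.ne'
      exact ((a1.add a3).sub a4).sub a2
    have hinter : interior (Set.Ioo (0:ℝ) 1) = Set.Ioo 0 1 := isOpen_Ioo.interior_eq
    refine antitoneOn_of_hasDerivWithinAt_nonpos (convex_Ioo 0 1)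
      (fun x hx => (hd x hx).continuousAt.continuousWithinAt)
      (fun x hx => (hd x (by rwa [hinter] at hx)).hasDerivWithinAt) ?_
    intro x hx
    rw [hinter] at hx
    have := logder_bound h2 h3 hx.1 hx.2
    have e1 : -1 / (1 - x) = - (1 / (1 - x)) := by ring
    have e2 : (-(p * x ^ (p - 1))) / gg p x = - (p * x ^ (p - 1) / gg p x) := by ring
    rw [e1, e2, ← one_div]
    linarith
  have hl := hA (show x ∈ Set.Ioo (0:ℝ) 1 from ⟨h0, by linarith⟩) (show y ∈ Set.Ioo (0:ℝ) 1 from ⟨by linarith, h1⟩) hxy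
  have key : ∀ z : ℝ, 0 < z → z < 1 → Real.log (ff p z) + Real.log (1 - z) - Real.log z
      - Real.log (gg p z) = Real.log (Th p z) := by
    intro z hz0 hz1
    have b1 := (ff_pos hp hz0).ne'
    have b2 := (gg_pos hp hz0.le hz1).ne'
    have b3 : 1 - z ≠ 0 := by linarith
    unfold Th
    rw [Real.log_div (mul_ne_zero b1 b3) (mul_ne_zero hz0.ne' b2), Real.log_mul b1 b3,
      Real.log_mul hz0.ne' b2]
    ring
  simp only at hl
  rw [key x h0 (by linarith), key y (by linarith) h1] at hl
  exact (Real.log_le_log_iff (Th_pos hp (by linarith) h1) (Th_pos hp h0 (by linarith))).1 hl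

lemma Th_mono_p {p r x : ℝ} (hp : 0 < p) (hr : p ≤ r) (h0 : 0 < x) (h1 : x < 1) :
    Th p x ≤ Th r x := by
  unfold Th
  have a1 := ff_scale hp hr h0.le
  have a2 := gg_scale hp hr h0.le
  have b1 := ff_pos hp h0
  have b2 := gg_pos hp h0.le h1
  have b3 := gg_pos (lt_of_lt_of_le hp hr) h0.le h1
  have hq : 0 < r / p := div_pos (by linarith) hp
  have h4 : 0 < 1 - x := by linarith
  rw [div_le_div_iff₀ (by positivity) (by positivity)]
  have c1 : ff p x * gg r x ≤ ff r x * gg p x := by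
    have : ff p x * gg r x ≤ ff p x * (r / p * gg p x) := mul_le_mul_of_nonneg_left a2 b1.le
    have : (r / p * ff p x) * gg p x ≤ ff r x * gg p x := mul_le_mul_of_nonneg_right a1 b2.le
    nlinarith
  have := mul_le_mul_of_nonneg_left c1 (by positivity : 0 ≤ x * (1 - x))
  nlinarith

lemma Th_ge_one {p x : ℝ} (h2 : 2 ≤ p) (h3 : p ≤ 3) (h0 : 0 < x) (h1 : x < 1) :
    (2 ^ p - 1) / p ≤ Th p x := by
  have hp : 0 < p := by linarith
  have h : ∀ y ∈ Set.Ico x 1, ff p y / p ≤ Th p x := by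
    intro y hy
    have hy0 : 0 < y := lt_of_lt_of_le h0 hy.1
    refine le_trans ?_ (Th_anti h2 h3 h0 hy.1 hy.2)
    unfold Th
    have b1 := ff_pos hp hy0
    have b2 := gg_pos hp hy0.le hy.2
    rw [div_le_div_iff₀ hp (by positivity)]
    have hB : y * gg p y ≤ (1 - y) * p := by
      have := one_add_mul_self_le_rpow_one_add (s := y - 1) (by linarith) (by linarith : 1 ≤ p)
      rw [show 1 + (y - 1) = y by ring] at this
      unfold gg at *
      nlinarith [hy.2]
    nlinarith
  have hc : Filter.Tendsto (fun y => ff p y / p) (nhdsWithin 1 (Set.Iio 1)) (nhds (ff p 1 / p)) := by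
    have := ((ff_deriv (p := p) (zero_le_one)).continuousAt).div_const p
    exact this.tendsto.mono_left nhdsWithin_le_nhds
  have := le_of_tendsto hc (by
    filter_upwards [Ico_mem_nhdsLT h1] with y hy using h y hy)
  unfold ff at this
  rwa [show (1:ℝ) + 1 = 2 by norm_num] at this

lemma Th_le_p {p x : ℝ} (h2 : 2 ≤ p) (h3 : p ≤ 3) (h0 : 0 < x) (h1 : x < 1) :
    Th p x ≤ p := by
  have hp : 0 < p := by linarith
  have h : ∀ y ∈ Set.Ioc 0 x, Th p x ≤ p * (1 + y) ^ (p - 1) := by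
    intro y hy
    have hy1 : y < 1 := lt_of_le_of_lt hy.2 h1
    refine le_trans (Th_anti h2 h3 hy.1 hy.2 h1) ?_
    unfold Th
    have b2 := gg_pos hp hy.1.le hy1
    rw [div_le_iff₀ (mul_pos hy.1 b2)]
    have c1 : 1 - y ≤ gg p y := by
      unfold gg
      have := Real.rpow_le_rpow_of_exponent_ge hy.1 hy1.le (by linarith : 1 ≤ p)
      simp at this; linarith
    have c2 : ff p y ≤ p * (1 + y) ^ (p - 1) * y := by
      have hz : (0:ℝ) < 1 + y := by linarith [hy.1]
      have := one_add_mul_self_le_rpow_one_add (s := - y / (1 + y)) (by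
        rw [le_div_iff₀ hz]; linarith) (by linarith : 1 ≤ p)
      rw [show 1 + -y / (1 + y) = (1 + y)⁻¹ by field_simp; ring, Real.inv_rpow hz.le] at this
      have hpos := Real.rpow_pos_of_pos hz p
      have h6 := mul_le_mul_of_nonneg_right this hpos.le
      rw [inv_mul_cancel₀ hpos.ne'] at h6
      rw [Real.rpow_sub_one hz.ne']
      unfold ff
      have : (1 + p * (-y / (1 + y))) * (1 + y) ^ p = (1+y)^p - p * ((1+y)^p/(1+y)) * y := by
        field_simp; ring
      linarith
    have hQ : 0 ≤ p * (1 + y) ^ (p - 1) * y := (ff_nonneg hp hy.1.le).trans c2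
    calc ff p y * (1 - y) ≤ (p * (1 + y) ^ (p - 1) * y) * gg p y :=
          mul_le_mul c2 c1 (by linarith) hQ
      _ = _ := by ring
  have hc : Filter.Tendsto (fun y : ℝ => p * (1 + y) ^ (p - 1)) (nhdsWithin 0 (Set.Ioi 0))
      (nhds (p * (1 + 0) ^ (p - 1))) := by
    have : ContinuousAt (fun y : ℝ => p * (1 + y) ^ (p - 1)) 0 := by
      apply ContinuousAt.mul continuousAt_const
      exact ContinuousAt.rpow_const (by fun_prop) (Or.inl (by norm_num))
    exact this.tendsto.mono_left nhdsWithin_le_nhds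
  have := ge_of_tendsto hc (by
    filter_upwards [Ioc_mem_nhdsGT h0] with y hy using h y hy)
  simpa using this

lemma kappa_eq {p a b : ℝ} (hp : 0 < p) (ha : 0 < a) (ha1 : a < 1) (hb : 0 < b) (hb1 : b < 1)
    (h : OnC p a b) : (1 - a - b) / (a * b) + 1 = Th p a * Th p b := by
  unfold Th
  have b1 := (gg_pos hp ha.le ha1).ne'
  have b2 := (gg_pos hp hb.le hb1).ne'
  unfold OnC at h
  field_simp
  linear_combination (-(1-a)*(1-b)) * h

/-- third divided difference -/
noncomputable def dd3 (F : ℝ → ℝ) (x y z w : ℝ) : ℝ :=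
  F x / ((x - y) * (x - z) * (x - w)) + F y / ((y - x) * (y - z) * (y - w))
  + F z / ((z - x) * (z - y) * (z - w)) + F w / ((w - x) * (w - y) * (w - z))

/-- pairwise distinct nodes -/
def Dist4 (x y z w : ℝ) : Prop := x ≠ y ∧ x ≠ z ∧ x ≠ w ∧ y ≠ z ∧ y ≠ w ∧ z ≠ w

open MeasureTheory in
lemma lin_rpow_integral {m : ℝ} (hm : m ∈ Set.Ioo (0:ℝ) 1) :
    ∃ C : ℝ, 0 < C ∧ ∀ x y z w c1 c2 c3 c4 : ℝ, 0 ≤ x → 0 ≤ y → 0 ≤ z → 0 ≤ w →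
      IntegrableOn (fun t => c1 * (Real.rpowIntegrand₀₁ m t x) + c2 * (Real.rpowIntegrand₀₁ m t y)
        + c3 * (Real.rpowIntegrand₀₁ m t z) + c4 * (Real.rpowIntegrand₀₁ m t w)) (Set.Ioi 0) ∧
      c1 * x ^ m + c2 * y ^ m + c3 * z ^ m + c4 * w ^ m =
        C * ∫ t in Set.Ioi (0:ℝ), (c1 * (Real.rpowIntegrand₀₁ m t x) + c2 * (Real.rpowIntegrand₀₁ m t y)
        + c3 * (Real.rpowIntegrand₀₁ m t z) + c4 * (Real.rpowIntegrand₀₁ m t w)) := by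
  refine ⟨(∫ t in Set.Ioi (0:ℝ), Real.rpowIntegrand₀₁ m t 1)⁻¹,
    inv_pos.2 (Real.integral_rpowIntegrand₀₁_one_pos hm), ?_⟩
  intro x y z w c1 c2 c3 c4 hx hy hz hw
  have i1 := (Real.integrableOn_rpowIntegrand₀₁_Ioi hm hx).const_mul c1
  have i2 := (Real.integrableOn_rpowIntegrand₀₁_Ioi hm hy).const_mul c2
  have i3 := (Real.integrableOn_rpowIntegrand₀₁_Ioi hm hz).const_mul c3
  have i4 := (Real.integrableOn_rpowIntegrand₀₁_Ioi hm hw).const_mul c4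
  refine ⟨((i1.add i2).add i3).add i4, ?_⟩
  have i12 : Integrable (fun t => c1 * (Real.rpowIntegrand₀₁ m t x) + c2 * (Real.rpowIntegrand₀₁ m t y))
    (volume.restrict (Set.Ioi 0)) := i1.add i2
  have i123 : Integrable (fun t => c1 * (Real.rpowIntegrand₀₁ m t x) + c2 * (Real.rpowIntegrand₀₁ m t y)
    + c3 * (Real.rpowIntegrand₀₁ m t z)) (volume.restrict (Set.Ioi 0)) := i12.add i3
  rw [integral_add i123 i4, integral_add i12 i3, integral_add i1 i2,
    integral_const_mul, integral_const_mul, integral_const_mul, integral_const_mul,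
    Real.rpow_eq_const_mul_integral hm hx, Real.rpow_eq_const_mul_integral hm hy,
    Real.rpow_eq_const_mul_integral hm hz, Real.rpow_eq_const_mul_integral hm hw]
  ring

open MeasureTheory in
lemma dd3_integral {m : ℝ} (hm : m ∈ Set.Ioo (0:ℝ) 1) :
    ∃ C : ℝ, 0 < C ∧ ∀ x y z w : ℝ, 0 ≤ x → 0 ≤ y → 0 ≤ z → 0 ≤ w → Dist4 x y z w →
      (IntegrableOn (fun t : ℝ => t ^ m * (1 / ((t + x) * (t + y) * (t + z) * (t + w)))) (Set.Ioi 0) ∧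
       IntegrableOn (fun t : ℝ => t ^ m * (t / ((t + x) * (t + y) * (t + z) * (t + w)))) (Set.Ioi 0) ∧
       IntegrableOn (fun t : ℝ => t ^ m * (t ^ 2 / ((t + x) * (t + y) * (t + z) * (t + w)))) (Set.Ioi 0)) ∧
      dd3 (fun t => t ^ m) x y z w = C * ∫ t in Set.Ioi (0:ℝ), t ^ m * (1 / ((t + x) * (t + y) * (t + z) * (t + w))) ∧
      - dd3 (fun t => t * t ^ m) x y z w = C * ∫ t in Set.Ioi (0:ℝ), t ^ m * (t / ((t + x) * (t + y) * (t + z) * (t + w))) ∧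
      dd3 (fun t => t ^ 2 * t ^ m) x y z w = C * ∫ t in Set.Ioi (0:ℝ), t ^ m * (t ^ 2 / ((t + x) * (t + y) * (t + z) * (t + w))) := by
  obtain ⟨C, hC, H⟩ := lin_rpow_integral hm
  refine ⟨C, hC, ?_⟩
  intro x y z w hx hy hz hw ⟨h1, h2, h3, h4, h5, h6⟩
  have n1 := sub_ne_zero.2 h1
  have n2 := sub_ne_zero.2 h2
  have n3 := sub_ne_zero.2 h3
  have n4 := sub_ne_zero.2 h4
  have n5 := sub_ne_zero.2 h5
  have n6 := sub_ne_zero.2 h6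
  have r1 : y - x = -(x - y) := by ring
  have r2 : z - x = -(x - z) := by ring
  have r3 : w - x = -(x - w) := by ring
  have r4 : z - y = -(y - z) := by ring
  have r5 : w - y = -(y - w) := by ring
  have r6 : w - z = -(z - w) := by ring
  have key0 := H x y z w (1/((x - y) * (x - z) * (x - w))) (1/((y - x) * (y - z) * (y - w)))
    (1/((z - x) * (z - y) * (z - w))) (1/((w - x) * (w - y) * (w - z))) hx hy hz hw
  have key1 := H x y z w (-x/((x - y) * (x - z) * (x - w))) (-y/((y - x) * (y - z) * (y - w)))
    (-z/((z - x) * (z - y) * (z - w))) (-w/((w - x) * (w - y) * (w - z))) hx hy hz hw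
  have key2 := H x y z w (x^2/((x - y) * (x - z) * (x - w))) (y^2/((y - x) * (y - z) * (y - w)))
    (z^2/((z - x) * (z - y) * (z - w))) (w^2/((w - x) * (w - y) * (w - z))) hx hy hz hw
  have e0 : Set.EqOn (fun t => 1/((x - y) * (x - z) * (x - w)) * (Real.rpowIntegrand₀₁ m t x) + 1/((y - x) * (y - z) * (y - w)) * (Real.rpowIntegrand₀₁ m t y)
        + 1/((z - x) * (z - y) * (z - w)) * (Real.rpowIntegrand₀₁ m t z) + 1/((w - x) * (w - y) * (w - z)) * (Real.rpowIntegrand₀₁ m t w))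
      (fun t : ℝ => t ^ m * (1 / ((t + x) * (t + y) * (t + z) * (t + w)))) (Set.Ioi 0) := by
    intro t ht
    have ht : 0 < t := ht
    simp only [Real.rpowIntegrand₀₁, r1, r2, r3, r4, r5, r6]
    generalize t ^ m = T
    have p1 : t + x ≠ 0 := by positivity
    have p2 : t + y ≠ 0 := by positivity
    have p3 : t + z ≠ 0 := by positivity
    have p4 : t + w ≠ 0 := by positivity
    field_simp
    ring
  have e1 : Set.EqOn (fun t => -x/((x - y) * (x - z) * (x - w)) * (Real.rpowIntegrand₀₁ m t x) + -y/((y - x) * (y - z) * (y - w)) * (Real.rpowIntegrand₀₁ m t y)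
        + -z/((z - x) * (z - y) * (z - w)) * (Real.rpowIntegrand₀₁ m t z) + -w/((w - x) * (w - y) * (w - z)) * (Real.rpowIntegrand₀₁ m t w))
      (fun t : ℝ => t ^ m * (t / ((t + x) * (t + y) * (t + z) * (t + w)))) (Set.Ioi 0) := by
    intro t ht
    have ht : 0 < t := ht
    simp only [Real.rpowIntegrand₀₁, r1, r2, r3, r4, r5, r6]
    generalize t ^ m = T
    have p1 : t + x ≠ 0 := by positivity
    have p2 : t + y ≠ 0 := by positivity
    have p3 : t + z ≠ 0 := by positivity
    have p4 : t + w ≠ 0 := by positivity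
    field_simp
    ring
  have e2 : Set.EqOn (fun t => x^2/((x - y) * (x - z) * (x - w)) * (Real.rpowIntegrand₀₁ m t x) + y^2/((y - x) * (y - z) * (y - w)) * (Real.rpowIntegrand₀₁ m t y)
        + z^2/((z - x) * (z - y) * (z - w)) * (Real.rpowIntegrand₀₁ m t z) + w^2/((w - x) * (w - y) * (w - z)) * (Real.rpowIntegrand₀₁ m t w))
      (fun t : ℝ => t ^ m * (t ^ 2 / ((t + x) * (t + y) * (t + z) * (t + w)))) (Set.Ioi 0) := by
    intro t ht
    have ht : 0 < t := ht
    simp only [Real.rpowIntegrand₀₁, r1, r2, r3, r4, r5, r6]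
    generalize t ^ m = T
    have p1 : t + x ≠ 0 := by positivity
    have p2 : t + y ≠ 0 := by positivity
    have p3 : t + z ≠ 0 := by positivity
    have p4 : t + w ≠ 0 := by positivity
    field_simp
    ring
  refine ⟨⟨key0.1.congr_fun e0 measurableSet_Ioi, key1.1.congr_fun e1 measurableSet_Ioi,
    key2.1.congr_fun e2 measurableSet_Ioi⟩, ?_, ?_, ?_⟩
  · rw [← setIntegral_congr_fun measurableSet_Ioi e0, ← key0.2]; unfold dd3; ring
  · rw [← setIntegral_congr_fun measurableSet_Ioi e1, ← key1.2]; unfold dd3; ring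
  · rw [← setIntegral_congr_fun measurableSet_Ioi e2, ← key2.2]; unfold dd3; ring

open MeasureTheory in
/-- monotonicity of the divided differences in the nodes -/
lemma dd3_mono {m : ℝ} (hm : m ∈ Set.Ioo (0:ℝ) 1) {x y z w x' y' z' w' : ℝ}
    (hx : 0 ≤ x) (hy : 0 ≤ y) (hz : 0 ≤ z) (hw : 0 ≤ w) (hd : Dist4 x y z w)
    (hxx : x ≤ x') (hyy : y ≤ y') (hzz : z ≤ z') (hww : w ≤ w') (hd' : Dist4 x' y' z' w') :
    dd3 (fun t => t ^ m) x' y' z' w' ≤ dd3 (fun t => t ^ m) x y z w ∧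
    - dd3 (fun t => t * t ^ m) x' y' z' w' ≤ - dd3 (fun t => t * t ^ m) x y z w ∧
    dd3 (fun t => t ^ 2 * t ^ m) x' y' z' w' ≤ dd3 (fun t => t ^ 2 * t ^ m) x y z w ∧
    0 ≤ dd3 (fun t => t ^ m) x y z w ∧
    0 ≤ - dd3 (fun t => t * t ^ m) x y z w ∧
    0 ≤ dd3 (fun t => t ^ 2 * t ^ m) x y z w := by
  obtain ⟨C, hC, H⟩ := dd3_integral hm
  obtain ⟨⟨i0, i1, i2⟩, a0, a1, a2⟩ := H x y z w hx hy hz hw hd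
  obtain ⟨⟨j0, j1, j2⟩, b0, b1, b2⟩ := H x' y' z' w' (hx.trans hxx) (hy.trans hyy) (hz.trans hzz) (hw.trans hww) hd'
  rw [a0, a1, a2, b0, b1, b2]
  have key : ∀ t ∈ Set.Ioi (0:ℝ), (t + x) * (t + y) * (t + z) * (t + w) ≤ (t + x') * (t + y') * (t + z') * (t + w')
      ∧ 0 < (t + x) * (t + y) * (t + z) * (t + w) := by
    intro t ht
    have ht : 0 < t := ht
    constructor
    · have := hx.trans hxx
      have := hy.trans hyy
      have := hz.trans hzz
      have := hw.trans hww
      gcongr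
    · positivity
  refine ⟨?_, ?_, ?_, ?_, ?_, ?_⟩
  · refine mul_le_mul_of_nonneg_left (setIntegral_mono_on j0 i0 measurableSet_Ioi ?_) hC.le
    intro t ht
    obtain ⟨k1, k2⟩ := key t ht
    have ht : 0 < t := ht
    gcongr
  · refine mul_le_mul_of_nonneg_left (setIntegral_mono_on j1 i1 measurableSet_Ioi ?_) hC.le
    intro t ht
    obtain ⟨k1, k2⟩ := key t ht
    have ht : 0 < t := ht
    gcongr
  · refine mul_le_mul_of_nonneg_left (setIntegral_mono_on j2 i2 measurableSet_Ioi ?_) hC.le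
    intro t ht
    obtain ⟨k1, k2⟩ := key t ht
    have ht : 0 < t := ht
    gcongr
  all_goals
    refine mul_nonneg hC.le (setIntegral_nonneg measurableSet_Ioi ?_)
    intro t ht
    obtain ⟨k1, k2⟩ := key t ht
    have ht : 0 < t := ht
    positivity

/-- mean value theorem for third divided differences -/
lemma dd3_mvt {F F1 F2 F3 : ℝ → ℝ} {x y z w : ℝ} (hxy : x < y) (hyz : y < z) (hzw : z < w)
    (hc : ContinuousOn F (Set.Icc x w))
    (h1 : ∀ t ∈ Set.Ioo x w, HasDerivAt F (F1 t) t)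
    (h2 : ∀ t ∈ Set.Ioo x w, HasDerivAt F1 (F2 t) t)
    (h3 : ∀ t ∈ Set.Ioo x w, HasDerivAt F2 (F3 t) t) :
    ∃ ξ ∈ Set.Ioo x w, dd3 F x y z w = F3 ξ / 6 := by
  set D := dd3 F x y z w with hD
  obtain ⟨A, B, C, e1, e2, e3, e4⟩ : ∃ A B C : ℝ, F x = A + B * x + C * x ^ 2 + D * x ^ 3 ∧
      F y = A + B * y + C * y ^ 2 + D * y ^ 3 ∧ F z = A + B * z + C * z ^ 2 + D * z ^ 3 ∧
      F w = A + B * w + C * w ^ 2 + D * w ^ 3 := by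
    set c1 := (F y - F x) / (y - x) with hc1
    set c2 := ((F z - F y) / (z - y) - (F y - F x) / (y - x)) / (z - x) with hc2
    have n1 : y - x ≠ 0 := by intro h; linarith
    have n2 : z - x ≠ 0 := by intro h; linarith
    have n3 : w - x ≠ 0 := by intro h; linarith
    have n4 : z - y ≠ 0 := by intro h; linarith
    have n5 : w - y ≠ 0 := by intro h; linarith
    have n6 : w - z ≠ 0 := by intro h; linarith
    have m1 : x - y ≠ 0 := by intro h; linarith
    have m2 : x - z ≠ 0 := by intro h; linarith
    have m3 : x - w ≠ 0 := by intro h; linarith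
    have m4 : y - z ≠ 0 := by intro h; linarith
    have m5 : y - w ≠ 0 := by intro h; linarith
    have m6 : z - w ≠ 0 := by intro h; linarith
    have f2 : F y = F x + c1 * (y - x) := by rw [hc1]; field_simp; ring
    have f3 : F z = F x + c1 * (z - x) + c2 * (z - x) * (z - y) := by
      rw [hc1, hc2]; field_simp; ring
    have f4 : F w = F x + c1 * (w - x) + c2 * (w - x) * (w - y) + D * (w - x) * (w - y) * (w - z) := by
      have : D = F x / ((x - y) * (x - z) * (x - w)) + F y / ((y - x) * (y - z) * (y - w))
          + F z / ((z - x) * (z - y) * (z - w)) + F w / ((w - x) * (w - y) * (w - z)) := rfl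
      rw [this, f3, f2]
      field_simp; ring
    refine ⟨F x - c1 * x + c2 * (x * y) - D * (x * y * z), c1 - c2 * (x + y) + D * (x * y + y * z + z * x),
      c2 - D * (x + y + z), ?_, ?_, ?_, ?_⟩
    · ring
    · rw [f2]; ring
    · rw [f3]; ring
    · rw [f4]; ring
  set G : ℝ → ℝ := fun t => F t - (A + B * t + C * t ^ 2 + D * t ^ 3) with hG
  set G1 : ℝ → ℝ := fun t => F1 t - (B + 2 * C * t + 3 * D * t ^ 2) with hG1
  set G2 : ℝ → ℝ := fun t => F2 t - (2 * C + 6 * D * t) with hG2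
  set G3 : ℝ → ℝ := fun t => F3 t - 6 * D with hG3
  have d1 : ∀ t ∈ Set.Ioo x w, HasDerivAt G (G1 t) t := by
    intro t ht
    have hpoly : HasDerivAt (fun t : ℝ => A + B * t + C * t ^ 2 + D * t ^ 3) (B + 2 * C * t + 3 * D * t ^ 2) t := by
      have := (((hasDerivAt_id t).const_mul B).const_add A).add (((hasDerivAt_id t).pow 2).const_mul C) |>.add
        (((hasDerivAt_id t).pow 3).const_mul D)
      refine this.congr_deriv ?_
      simp; ring
    exact (h1 t ht).sub hpoly
  have d2 : ∀ t ∈ Set.Ioo x w, HasDerivAt G1 (G2 t) t := by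
    intro t ht
    have hpoly : HasDerivAt (fun t : ℝ => B + 2 * C * t + 3 * D * t ^ 2) (2 * C + 6 * D * t) t := by
      have := (((hasDerivAt_id t).const_mul (2*C)).const_add B).add (((hasDerivAt_id t).pow 2).const_mul (3*D))
      refine this.congr_deriv ?_
      simp; ring
    exact (h2 t ht).sub hpoly
  have d3 : ∀ t ∈ Set.Ioo x w, HasDerivAt G2 (G3 t) t := by
    intro t ht
    have hpoly : HasDerivAt (fun t : ℝ => 2 * C + 6 * D * t) (6 * D) t := by
      have := (((hasDerivAt_id t).const_mul (6*D)).const_add (2*C))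
      refine this.congr_deriv ?_
      simp
    exact (h3 t ht).sub hpoly
  have cG : ContinuousOn G (Set.Icc x w) := hc.sub (by fun_prop)
  have rolle0 : ∀ u v, x ≤ u → u < v → v ≤ w → G u = 0 → G v = 0 → ∃ c ∈ Set.Ioo u v, G1 c = 0 := by
    intro u v hu huv hv gu gv
    exact exists_hasDerivAt_eq_zero huv (cG.mono (Set.Icc_subset_Icc hu hv)) (by rw [gu, gv])
      (fun t ht => d1 t ⟨by linarith [ht.1], by linarith [ht.2]⟩)
  obtain ⟨a1, ha1, ga1⟩ := rolle0 x y le_rfl hxy (by linarith) (by simp only [hG]; linarith) (by simp only [hG]; linarith)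
  obtain ⟨a2, ha2, ga2⟩ := rolle0 y z (by linarith) hyz (by linarith) (by simp only [hG]; linarith) (by simp only [hG]; linarith)
  obtain ⟨a3, ha3, ga3⟩ := rolle0 z w (by linarith) hzw le_rfl (by simp only [hG]; linarith) (by simp only [hG]; linarith)
  have rolle1 : ∀ u v, x < u → u < v → v < w → G1 u = 0 → G1 v = 0 → ∃ c ∈ Set.Ioo u v, G2 c = 0 := by
    intro u v hu huv hv gu gv
    exact exists_hasDerivAt_eq_zero huv (fun t ht => (d2 t ⟨by linarith [ht.1], by linarith [ht.2]⟩).continuousAt.continuousWithinAt) (by rw [gu, gv])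
      (fun t ht => d2 t ⟨by linarith [ht.1], by linarith [ht.2]⟩)
  obtain ⟨b1, hb1, gb1⟩ := rolle1 a1 a2 ha1.1 (by linarith [ha1.2, ha2.1]) (by linarith [ha2.2]) ga1 ga2
  obtain ⟨b2, hb2, gb2⟩ := rolle1 a2 a3 (by linarith [ha2.1]) (by linarith [ha2.2, ha3.1]) ha3.2 ga2 ga3
  have hxb : x < b1 := by linarith [ha1.1, hb1.1]
  have hbw : b2 < w := by linarith [ha3.2, hb2.2]
  obtain ⟨ξ, hξ, gξ⟩ := exists_hasDerivAt_eq_zero (f := G2) (f' := G3) (by linarith [hb1.2, hb2.1] : b1 < b2)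
    (fun t ht => (d3 t ⟨by linarith [ht.1], by linarith [ht.2]⟩).continuousAt.continuousWithinAt) (by rw [gb1, gb2])
    (fun t ht => d3 t ⟨by linarith [ht.1], by linarith [ht.2]⟩)
  refine ⟨ξ, ⟨by linarith [hξ.1], by linarith [hξ.2]⟩, ?_⟩
  simp only [hG3] at gξ
  linarith

/-- normalisation constant -/
noncomputable def cf (e : ℝ) : ℝ := e * (e - 1) * (e - 2)

lemma dd3_rpow_scale {e r l x y z w : ℝ} (he : 0 < e) (hr : e ≤ r) (hce : cf e ≠ 0) (hcr : cf r ≠ 0)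
    (hx : 0 ≤ x) (hxy : x < y) (hyz : y < z) (hzw : z < w) :
    ∃ ξ ∈ Set.Ioo x w, dd3 (fun t => t ^ r) x y z w / cf r - l * (dd3 (fun t => t ^ e) x y z w / cf e)
      = ξ ^ (e - 3) * (ξ ^ (r - e) - l) / 6 := by
  have hd : ∀ (s c t : ℝ), 0 < t → HasDerivAt (fun t : ℝ => c * t ^ s) (c * s * t ^ (s - 1)) t := by
    intro s c t ht
    refine ((Real.hasDerivAt_rpow_const (p := s) (Or.inl ht.ne')).const_mul c).congr_deriv ?_
    ring
  obtain ⟨ξ, hξ, h⟩ := dd3_mvt (F := fun t => (cf r)⁻¹ * t ^ r - (l * (cf e)⁻¹) * t ^ e)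
    (F1 := fun t => (cf r)⁻¹ * r * t ^ (r - 1) - (l * (cf e)⁻¹) * e * t ^ (e - 1))
    (F2 := fun t => (cf r)⁻¹ * r * (r - 1) * t ^ (r - 1 - 1) - (l * (cf e)⁻¹) * e * (e - 1) * t ^ (e - 1 - 1))
    (F3 := fun t => (cf r)⁻¹ * r * (r - 1) * (r - 1 - 1) * t ^ (r - 1 - 1 - 1) -
       (l * (cf e)⁻¹) * e * (e - 1) * (e - 1 - 1) * t ^ (e - 1 - 1 - 1)) hxy hyz hzw
    (by
      apply ContinuousOn.sub
      · exact ContinuousOn.mul continuousOn_const (ContinuousOn.rpow_const continuousOn_id (fun t _ => Or.inr (by linarith)))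
      · exact ContinuousOn.mul continuousOn_const (ContinuousOn.rpow_const continuousOn_id (fun t _ => Or.inr (by linarith))))
    (fun t ht => (hd _ _ t (lt_of_le_of_lt hx ht.1)).sub (hd _ _ t (lt_of_le_of_lt hx ht.1)))
    (fun t ht => (hd _ _ t (lt_of_le_of_lt hx ht.1)).sub (hd _ _ t (lt_of_le_of_lt hx ht.1)))
    (fun t ht => (hd _ _ t (lt_of_le_of_lt hx ht.1)).sub (hd _ _ t (lt_of_le_of_lt hx ht.1)))
  refine ⟨ξ, hξ, ?_⟩
  have hξ0 : 0 < ξ := lt_of_le_of_lt hx hξ.1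
  have e1 : dd3 (fun t => (cf r)⁻¹ * t ^ r - (l * (cf e)⁻¹) * t ^ e) x y z w =
    dd3 (fun t => t ^ r) x y z w / cf r - l * (dd3 (fun t => t ^ e) x y z w / cf e) := by
    unfold dd3; ring
  rw [e1] at h
  rw [h]
  have e2 : ξ ^ (e - 3) * (ξ ^ (r - e) - l) = ξ ^ (r - 3) - l * ξ ^ (e - 3) := by
    rw [mul_sub, ← Real.rpow_add hξ0]
    ring_nf
  rw [e2]
  have e3 : r - 1 - 1 - 1 = r - 3 := by ring
  have e4 : e - 1 - 1 - 1 = e - 3 := by ring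
  rw [e3, e4]
  have e5 : (cf r)⁻¹ * r * (r - 1) * (r - 1 - 1) = 1 := by
    rw [show (cf r)⁻¹ * r * (r - 1) * (r - 1 - 1) = (cf r)⁻¹ * cf r by unfold cf; ring]
    exact inv_mul_cancel₀ hcr
  have e6 : l * (cf e)⁻¹ * e * (e - 1) * (e - 1 - 1) = l := by
    rw [show l * (cf e)⁻¹ * e * (e - 1) * (e - 1 - 1) = l * ((cf e)⁻¹ * cf e) by unfold cf; ring,
      inv_mul_cancel₀ hce, mul_one]
  rw [e5, e6]
  ring

lemma dd3_scale_up {e r x y z w : ℝ} (he : 0 < e) (hr : e ≤ r) (hce : cf e ≠ 0) (hcr : cf r ≠ 0)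
    (hx : 0 ≤ x) (hxy : x < y) (hyz : y < z) (hzw : z < w) :
    dd3 (fun t => t ^ r) x y z w / cf r ≤ w ^ (r - e) * (dd3 (fun t => t ^ e) x y z w / cf e) := by
  obtain ⟨ξ, hξ, h⟩ := dd3_rpow_scale (l := w ^ (r - e)) he hr hce hcr hx hxy hyz hzw
  have hξ0 : 0 < ξ := lt_of_le_of_lt hx hξ.1
  have h1 : ξ ^ (r - e) ≤ w ^ (r - e) := Real.rpow_le_rpow hξ0.le hξ.2.le (by linarith)
  have h2 : 0 < ξ ^ (e - 3) := Real.rpow_pos_of_pos hξ0 _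
  have : ξ ^ (e - 3) * (ξ ^ (r - e) - w ^ (r - e)) ≤ 0 := mul_nonpos_of_nonneg_of_nonpos h2.le (by linarith)
  linarith

lemma dd3_scale_low {e r x y z w : ℝ} (he : 0 < e) (hr : e ≤ r) (hce : cf e ≠ 0) (hcr : cf r ≠ 0)
    (hx : 0 ≤ x) (hxy : x < y) (hyz : y < z) (hzw : z < w) :
    x ^ (r - e) * (dd3 (fun t => t ^ e) x y z w / cf e) ≤ dd3 (fun t => t ^ r) x y z w / cf r := by
  obtain ⟨ξ, hξ, h⟩ := dd3_rpow_scale (l := x ^ (r - e)) he hr hce hcr hx hxy hyz hzw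
  have hξ0 : 0 < ξ := lt_of_le_of_lt hx hξ.1
  have h1 : x ^ (r - e) ≤ ξ ^ (r - e) := Real.rpow_le_rpow hx hξ.1.le (by linarith)
  have h2 : 0 < ξ ^ (e - 3) := Real.rpow_pos_of_pos hξ0 _
  have : 0 ≤ ξ ^ (e - 3) * (ξ ^ (r - e) - x ^ (r - e)) := mul_nonneg h2.le (by linarith)
  linarith

lemma OnC.anti {p a b a' b' : ℝ} (hp : 0 < p) (ha : a ∈ Set.Icc (0:ℝ) 1) (hb : b ∈ Set.Icc (0:ℝ) 1)
    (ha' : a' ∈ Set.Icc (0:ℝ) 1) (hb' : b' ∈ Set.Icc (0:ℝ) 1) (h : OnC p a b) (h' : OnC p a' b')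
    (hlt : b < b') : a' < a := by
  by_contra hn
  push Not at hn
  unfold OnC at h h'
  have f1 := ff_le hp ha.1 hn
  have f2 := ff_lt hp hb.1 hlt
  have g1 := gg_le hp ha.1 hn
  have g2 := gg_lt hp hb.1 hlt
  have a0 := ff_nonneg hp ha.1
  have b0 := ff_nonneg hp hb.1
  have c0 := gg_nonneg hp ha'.1 ha'.2
  have d0 := gg_nonneg hp hb'.1 hb'.2
  have e1 : ff p a * ff p b ≤ ff p a' * ff p b := mul_le_mul_of_nonneg_right f1 b0
  have e2 : ff p a' * ff p b ≤ ff p a' * ff p b' := mul_le_mul_of_nonneg_left f2.le (a0.trans f1)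
  have e3 : gg p a' * gg p b' ≤ gg p a' * gg p b := mul_le_mul_of_nonneg_left g2.le c0
  have e4 : gg p a' * gg p b ≤ gg p a * gg p b := mul_le_mul_of_nonneg_right g1 (d0.trans g2.le)
  have e5 : ff p a' * (ff p b' - ff p b) = 0 := by nlinarith
  have e6 : ff p a' = 0 := by
    rcases mul_eq_zero.1 e5 with h | h
    · exact h
    · linarith
  have e7 : a' = 0 := by
    by_contra hne
    have := ff_pos hp (lt_of_le_of_ne ha'.1 (Ne.symm hne))
    linarith
  have e8 : a = 0 := le_antisymm (by linarith) ha.1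
  rw [e8, ff_zero, gg_zero hp] at h
  have : 0 < gg p b := gg_pos hp hb.1 (lt_of_lt_of_le hlt hb'.2)
  linarith

lemma OnC.unique {p a a' b : ℝ} (hp : 0 < p) (ha : a ∈ Set.Icc (0:ℝ) 1) (hb : b ∈ Set.Icc (0:ℝ) 1)
    (ha' : a' ∈ Set.Icc (0:ℝ) 1) (h : OnC p a b) (h' : OnC p a' b) : a = a' := by
  rcases lt_trichotomy a a' with hl | hl | hl
  · exact absurd (OnC.anti hp hb ha hb ha' h.symm h'.symm hl) (lt_irrefl _)
  · exact hl
  · exact absurd (OnC.anti hp hb ha' hb ha h'.symm h.symm hl) (lt_irrefl _)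

lemma ff_cont {p : ℝ} (hp : 0 < p) : Continuous (ff p) := by
  unfold ff
  exact ((continuous_const.add continuous_id).rpow_const (fun _ => Or.inr hp.le)).sub continuous_const

lemma gg_cont {p : ℝ} (hp : 0 < p) : Continuous (gg p) := by
  unfold gg
  exact continuous_const.sub (continuous_id.rpow_const (fun _ => Or.inr hp.le))

lemma kk_cont {p : ℝ} (hp : 0 < p) : Continuous (kk p) := by
  unfold kk
  exact ((continuous_const.add continuous_id).rpow_const (fun _ => Or.inr hp.le)).sub
    (continuous_id.rpow_const (fun _ => Or.inr hp.le))

lemma OnC.exists {p b : ℝ} (hp : 0 < p) (hb : b ∈ Set.Icc (0:ℝ) 1) :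
    ∃ a ∈ Set.Icc (0:ℝ) 1, OnC p a b := by
  have hc : ContinuousOn (fun a => ff p a * ff p b - gg p a * gg p b) (Set.Icc 0 1) :=
    (((ff_cont hp).mul continuous_const).sub ((gg_cont hp).mul continuous_const)).continuousOn
  have h0 : ff p 0 * ff p b - gg p 0 * gg p b ≤ 0 := by
    rw [ff_zero, gg_zero hp]; have := gg_nonneg hp hb.1 hb.2; linarith
  have h1 : 0 ≤ ff p 1 * ff p b - gg p 1 * gg p b := by
    rw [gg_one]; have := mul_nonneg (ff_nonneg hp zero_le_one) (ff_nonneg hp hb.1); linarith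
  obtain ⟨a, ha, h⟩ := intermediate_value_Icc zero_le_one hc (Set.mem_Icc.2 ⟨h0, h1⟩)
  exact ⟨a, ha, sub_eq_zero.1 h⟩

/-- the path -/
lemma path_exists {p : ℝ} (hp : 0 < p) : ∃ α : ℝ → ℝ, ContinuousOn α (Set.Icc 0 1) ∧
    ∀ b ∈ Set.Icc (0:ℝ) 1, α b ∈ Set.Icc (0:ℝ) 1 ∧ OnC p (α b) b := by
  choose! α hα using fun b (hb : b ∈ Set.Icc (0:ℝ) 1) => OnC.exists hp hb
  refine ⟨α, ?_, hα⟩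
  let A : Set.Icc (0:ℝ) 1 → (Set.Icc (0:ℝ) 1)ᵒᵈ := fun b => OrderDual.toDual ⟨α b, (hα b b.2).1⟩
  have hm : StrictMono A := by
    intro x y hxy
    change (⟨α y, (hα y y.2).1⟩ : Set.Icc (0:ℝ) 1) < ⟨α x, (hα x x.2).1⟩
    exact OnC.anti hp (hα x x.2).1 x.2 (hα y y.2).1 y.2 (hα x x.2).2 (hα y y.2).2 hxy
  have hs : Function.Surjective A := by
    intro y
    let y' := OrderDual.ofDual y
    refine ⟨⟨α y', (hα y' y'.2).1⟩, ?_⟩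
    change (⟨α (α y'), _⟩ : Set.Icc (0:ℝ) 1) = y'
    apply Subtype.ext
    have h1 := hα y' y'.2
    have h2 := hα _ h1.1
    exact OnC.unique hp h2.1 h1.1 y'.2 h2.2 h1.2.symm
  have hc : Continuous A := (hm.orderIsoOfSurjective A hs).continuous
  rw [continuousOn_iff_continuous_domRestrict]
  exact continuous_subtype_val.comp (continuous_ofDual.comp hc)

lemma implicit_deriv {h φ α : ℝ → ℝ} {b h' φ' : ℝ} (hα : ContinuousAt α b)
    (hh : HasStrictDerivAt h h' (α b)) (h0 : h' ≠ 0) (hφ : HasDerivAt φ φ' b)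
    (he : ∀ᶠ y in nhds b, h (α y) = φ y) : HasDerivAt α (h'⁻¹ * φ') b := by
  have e1 : ∀ᶠ y in nhds b, hh.localInverse h h' (α b) h0 (φ y) = α y := by
    have : ∀ᶠ x in nhds (α b), hh.localInverse h h' (α b) h0 (h x) = x :=
      HasStrictFDerivAt.eventually_left_inverse _
    filter_upwards [hα.eventually this, he] with y h1 h2
    rw [← h2]; exact h1
  have hb : h (α b) = φ b := he.self_of_nhds
  have h2 : HasDerivAt (hh.localInverse h h' (α b) h0) h'⁻¹ (φ b) := by
    rw [← hb]; exact (hh.to_localInverse h0).hasDerivAt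
  have h3 := h2.comp b hφ
  exact h3.congr_of_eventuallyEq (by filter_upwards [e1] with y hy; exact hy.symm)

/-- log of the normalized determinant -/
noncomputable def GG (p a b : ℝ) : ℝ :=
  Real.log (1 + a + b) + 1 / p * (Real.log (kk p a) + Real.log (kk p b) - 2 * Real.log (kk p a + kk p b))

noncomputable def NN (p a b : ℝ) : ℝ :=
  a ^ (p - 1) * (1 + a) ^ (p - 1) + (1 + a) * a ^ (p - 1) * b ^ (p - 1)
    - a * (1 + a) ^ (p - 1) * (1 + b) ^ (p - 1)

noncomputable def TT (p a b : ℝ) : ℝ := kk p a * NN p b a - kk p b * NN p a b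

noncomputable def cc (p a : ℝ) : ℝ :=
  (1 + a) ^ (p - 1) - a ^ (p - 1) + (1 + a) ^ (p - 1) * a ^ (p - 1)

lemma kk_pos {p x : ℝ} (hp : 0 < p) (hx : 0 ≤ x) : 0 < kk p x := by
  unfold kk
  have := Real.rpow_lt_rpow hx (by linarith : x < 1 + x) hp
  linarith

lemma cc_pos {p x : ℝ} (hp : 1 < p) (hx : 0 ≤ x) : 0 < cc p x := by
  unfold cc
  have := Real.rpow_lt_rpow hx (by linarith : x < 1 + x) (by linarith : 0 < p - 1)
  have : 0 ≤ (1 + x) ^ (p - 1) * x ^ (p - 1) := by positivity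
  linarith

lemma rpow_pred {x p : ℝ} (hx : 0 < x) : x ^ p = x * x ^ (p - 1) := by
  have := Real.rpow_add hx 1 (p - 1)
  rw [Real.rpow_one] at this
  rw [← this]; congr 1; ring

lemma alg_curve {a b P Q U V : ℝ}
    (h : ((1 + a) * P - 1) * ((1 + b) * Q - 1) = (1 - a * U) * (1 - b * V)) :
    (((1 + b) * Q - b * V) * (((1 + a) * P - a * U) + ((1 + b) * Q - b * V)) +
      (1 + a + b) * (Q - V) * (((1 + a) * P - a * U) - ((1 + b) * Q - b * V))) * (P - U + P * U) * ((1 + b) * Q - b * V)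
    - (((1 + a) * P - a * U) * (((1 + a) * P - a * U) + ((1 + b) * Q - b * V)) -
      (1 + a + b) * (P - U) * (((1 + a) * P - a * U) - ((1 + b) * Q - b * V))) * (Q - V + Q * V) * ((1 + a) * P - a * U)
    = - ((1 + a) * P - a * U) * ((1 + b) * Q - b * V) *
      (((1 + a) * P - a * U) * (V * Q + (1 + b) * V * U - b * Q * P) -
       ((1 + b) * Q - b * V) * (U * P + (1 + a) * U * V - a * P * Q)) := by
  linear_combination ((-1)*a*b*P^2*Q + (1)*a*b*P^2*V + (1)*a*b*P*Q^2 + (2)*a*b*P*Q*U + (-2)*a*b*P*Q*V + (-2)*a*b*P*U*V + (1)*a*b*P*V^2 + (-1)*a*b*Q^2*U + (-1)*a*b*Q*U^2 + (2)*a*b*Q*U*V + (1)*a*b*U^2*V + (-1)*a*b*U*V^2 + (1)*a*P*Q^2 + (1)*a*P*Q*U + (-1)*a*P*Q*V + (-1)*a*P*U*V + (-1)*a*Q^2*U + (-1)*a*Q*U^2 + (1)*a*Q*U*V + (1)*a*U^2*V + (-1)*b*P^2*Q + (1)*b*P^2*V + (1)*b*P*Q*U + (-1)*b*P*Q*V +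 (-1)*b*P*U*V + (1)*b*P*V^2 + (1)*b*Q*U*V + (-1)*b*U*V^2 + (1)*P*Q*U + (-1)*P*Q*V + (-1)*P*U*V + (1)*Q*U*V) * h

lemma logh_strict {p x : ℝ} (hp : 1 < p) (h0 : 0 < x) (h1 : x < 1) :
    HasStrictDerivAt (fun x => Real.log (ff p x) - Real.log (gg p x)) (p * cc p x / (ff p x * gg p x)) x := by
  have hf := ff_pos (by linarith : 0 < p) h0
  have hg := gg_pos (by linarith : 0 < p) h0.le h1
  have d1 : HasStrictDerivAt (ff p) (p * (1 + x) ^ (p - 1)) x := by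
    have := ((hasStrictDerivAt_id x).const_add 1)
    have h2 := (Real.hasStrictDerivAt_rpow_const (x := 1 + x) (p := p) (Or.inr hp.le)).comp x this
    have h3 : HasStrictDerivAt (ff p) (p * (1 + x) ^ (p - 1) * 1) x := h2.sub_const 1
    rwa [mul_one] at h3
  have d2 : HasStrictDerivAt (gg p) (- (p * x ^ (p - 1))) x := by
    have h2 := (Real.hasStrictDerivAt_rpow_const (x := x) (p := p) (Or.inr hp.le))
    exact (h2.const_sub 1)
  refine ((d1.log hf.ne').sub (d2.log hg.ne')).congr_deriv ?_
  have e1 : ff p x = (1 + x) * (1 + x) ^ (p - 1) - 1 := by unfold ff; rw [rpow_pred (by linarith)]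
  have e2 : gg p x = 1 - x * x ^ (p - 1) := by unfold gg; rw [rpow_pred h0]
  field_simp
  rw [e1, e2]; unfold cc; ring

lemma kk_deriv {p x : ℝ} (hp : 1 < p) :
    HasDerivAt (kk p) (p * ((1 + x) ^ (p - 1) - x ^ (p - 1))) x := by
  have := ((hasDerivAt_id x).const_add 1)
  have h2 := (Real.hasDerivAt_rpow_const (x := 1 + x) (p := p) (Or.inr hp.le)).comp x this
  have h3 := (Real.hasDerivAt_rpow_const (x := x) (p := p) (Or.inr hp.le))
  exact (h2.sub h3).congr_deriv (by ring)

/-- the derivative of `GG` along the path -/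
lemma path_deriv {p : ℝ} (hp : 1 < p) {α : ℝ → ℝ} (hc : ContinuousOn α (Set.Icc 0 1))
    (hα : ∀ b ∈ Set.Icc (0:ℝ) 1, α b ∈ Set.Icc (0:ℝ) 1 ∧ OnC p (α b) b) {b : ℝ} (h0 : 0 < b) (h1 : b < 1) :
    HasDerivAt (fun b => GG p (α b) b)
      (- (kk p (α b) * TT p (α b) b / (kk p b * cc p (α b) * (1 + α b + b) * (kk p (α b) + kk p b)))) b := by
  have hp0 : 0 < p := by linarith
  have hpos : ∀ y ∈ Set.Ioo (0:ℝ) 1, 0 < α y ∧ α y < 1 := by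
    intro y hy
    have := hα y ⟨hy.1.le, hy.2.le⟩
    exact ⟨this.2.a_pos hp0 this.1.1 hy.1.le hy.2, this.2.a_lt_one hp0 this.1.1 hy.1 this.1.2⟩
  obtain ⟨a0, a1⟩ := hpos b ⟨h0, h1⟩
  have hcb : ContinuousAt α b := hc.continuousAt (Icc_mem_nhds h0 h1)
  have hcur := (hα b ⟨h0.le, h1.le⟩).2
  have fa := ff_pos hp0 a0
  have fb := ff_pos hp0 h0
  have ga := gg_pos hp0 a0.le a1
  have gb := gg_pos hp0 h0.le h1
  have ka := kk_pos hp0 a0.le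
  have kb := kk_pos hp0 h0.le
  have ca := cc_pos hp a0.le
  have hda := implicit_deriv (φ := fun x => - (Real.log (ff p x) - Real.log (gg p x))) hcb (logh_strict hp a0 a1)
    (by positivity) (logh_strict hp h0 h1).hasDerivAt.neg (by
      filter_upwards [Ioo_mem_nhds h0 h1] with y hy
      obtain ⟨y0, y1⟩ := hpos y hy
      have hcy := (hα y ⟨hy.1.le, hy.2.le⟩).2
      have := congrArg Real.log hcy
      rw [Real.log_mul (ff_pos hp0 y0).ne' (ff_pos hp0 hy.1).ne',
        Real.log_mul (gg_pos hp0 y0.le y1).ne' (gg_pos hp0 hy.1.le hy.2).ne'] at this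
      linarith)
  generalize hA : α b = a at *
  have hda' : HasDerivAt α (- (cc p b * kk p a ^ 2 / (cc p a * kk p b ^ 2))) b := by
    refine hda.congr_deriv ?_
    have e1 : kk p a = ff p a + gg p a := by unfold kk ff gg; ring
    have e2 : kk p b = ff p b + gg p b := by unfold kk ff gg; ring
    have e3 : ff p a * gg p a * kk p b ^ 2 = ff p b * gg p b * kk p a ^ 2 := by
      have hcur' : ff p a * ff p b = gg p a * gg p b := hcur
      rw [e1, e2]
      linear_combination (ff p b * gg p a - ff p a * gg p b) * hcur'
    field_simp
    linear_combination (- cc p b) * e3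
  have hka : HasDerivAt (fun b => kk p (α b)) (p * ((1 + a) ^ (p - 1) - a ^ (p - 1)) * (- (cc p b * kk p a ^ 2 / (cc p a * kk p b ^ 2)))) b := by
    have := kk_deriv (x := α b) hp
    have h := this.comp b hda'
    rw [hA] at h
    exact h
  have hkb := kk_deriv (x := b) hp
  have hsum : HasDerivAt (fun b => 1 + α b + b) (- (cc p b * kk p a ^ 2 / (cc p a * kk p b ^ 2)) + 1) b :=
    (hda'.const_add 1).add (hasDerivAt_id b)
  have main := (hsum.log (by rw [hA]; positivity)).add
    ((((hka.log (by rw [hA]; positivity)).add (hkb.log kb.ne')).sub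
      (((hka.add hkb).log (by simp only [Pi.add_apply, hA]; positivity)).const_mul 2)).const_mul (1 / p))
  refine main.congr_deriv ?_
  simp only [Pi.add_apply, hA]
  have hcur2 : ((1 + a) * (1 + a) ^ (p - 1) - 1) * ((1 + b) * (1 + b) ^ (p - 1) - 1)
    = (1 - a * a ^ (p - 1)) * (1 - b * b ^ (p - 1)) := by
    rw [← rpow_pred (by linarith), ← rpow_pred (by linarith), ← rpow_pred a0, ← rpow_pred h0]
    exact hcur
  have key := alg_curve hcur2
  have k1 : kk p a = (1 + a) * (1 + a) ^ (p - 1) - a * a ^ (p - 1) := by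
    unfold kk; rw [rpow_pred (by linarith), rpow_pred a0]
  have k2 : kk p b = (1 + b) * (1 + b) ^ (p - 1) - b * b ^ (p - 1) := by
    unfold kk; rw [rpow_pred (by linarith), rpow_pred h0]
  rw [← k1, ← k2] at key
  have hl : 0 < 1 + a + b := by positivity
  unfold TT NN
  generalize kk p a = k at *
  generalize kk p b = k' at *
  have c1 : cc p a = (1 + a) ^ (p - 1) - a ^ (p - 1) + (1 + a) ^ (p - 1) * a ^ (p - 1) := rfl
  have c2 : cc p b = (1 + b) ^ (p - 1) - b ^ (p - 1) + (1 + b) ^ (p - 1) * b ^ (p - 1) := rfl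
  rw [← c1, ← c2] at key
  generalize cc p a = C1 at *
  generalize cc p b = C2 at *
  have hs : k + k' ≠ 0 := by positivity
  field_simp
  generalize (1 + a) ^ (p - 1) = P at *
  generalize (1 + b) ^ (p - 1) = Q at *
  generalize a ^ (p - 1) = U at *
  generalize b ^ (p - 1) = V at *
  linear_combination key

noncomputable def eps (m a b : ℝ) : ℝ := (a ^ m * b ^ m) / ((1 + a) * (1 + a) ^ m * ((1 + b) * (1 + b) ^ m))

noncomputable def RR (m a b : ℝ) : ℝ :=
  dd3 (fun t => t ^ 2 * t ^ m) b a (1 + b) (1 + a) * (((1 - a - b) / (a * b) - 4) + eps m a b * (1 + 3 * (a + b) + 4 * (a * b)))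
  + (- dd3 (fun t => t * t ^ m) b a (1 + b) (1 + a)) * (1 + a + b) * (((1 - a - b) / (a * b) - 3) + eps m a b * (2 * (a + b) + 3 * (a * b)))
  - 2 * ((1 + a) * (1 + b)) * dd3 (fun t => t ^ m) b a (1 + b) (1 + a) * (1 - eps m a b * (a * b))

set_option maxHeartbeats 1600000 in
lemma TT_eq {p a b : ℝ} (hb : 0 < b) (hab : b < a) (ha : a < 1) :
    TT p a b = (a - b) * (a * b) * ((1 + a) ^ (p - 1) * (1 + b) ^ (p - 1)) * RR (p - 2) a b := by
  have ha0 : 0 < a := hb.trans hab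
  unfold TT NN kk
  have q : ∀ x : ℝ, 0 < x → x ^ p = x * (x * x ^ (p - 2)) ∧ x ^ (p - 1) = x * x ^ (p - 2) := by
    intro x hx
    have h1 : x ^ (p - 1) = x * x ^ (p - 2) := by
      rw [rpow_pred hx]; congr 2; ring
    exact ⟨by rw [rpow_pred hx, h1], h1⟩
  rw [(q a ha0).1, (q a ha0).2, (q b hb).1, (q b hb).2, (q (1 + a) (by linarith)).1, (q (1 + a) (by linarith)).2,
    (q (1 + b) (by linarith)).1, (q (1 + b) (by linarith)).2]
  unfold RR eps dd3
  have hP : (1 + a) ^ (p - 2) ≠ 0 := by positivity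
  have hQ : (1 + b) ^ (p - 2) ≠ 0 := by positivity
  simp only []
  generalize (1 + a) ^ (p - 2) = P at *
  generalize (1 + b) ^ (p - 2) = Q at *
  generalize a ^ (p - 2) = U at *
  generalize b ^ (p - 2) = V at *
  have n1 : a - b ≠ 0 := by intro h; linarith
  have n2 : 1 + a - b ≠ 0 := by intro h; linarith
  have n3 : 1 + b - a ≠ 0 := by intro h; linarith
  rw [show b - a = -(a - b) by ring, show b - (1 + b) = -1 by ring, show b - (1 + a) = -(1 + a - b) by ring,
    show a - (1 + b) = -(1 + b - a) by ring, show a - (1 + a) = -1 by ring, show 1 + b - b = 1 by ring,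
    show 1 + b - (1 + a) = -(a - b) by ring, show 1 + a - a = 1 by ring, show 1 + a - (1 + b) = a - b by ring]
  have n4 : 1 + a ≠ 0 := by positivity
  have n5 : 1 + b ≠ 0 := by positivity
  field_simp
  ring

/-- weight -/
noncomputable def om (p a b : ℝ) : ℝ :=
  (a - b) * (a * b) * kk p a * ((1 + a) ^ (p - 1) * (1 + b) ^ (p - 1)) /
    (kk p b * cc p a * (1 + a + b) * (kk p a + kk p b))

lemma GGp_cont {p : ℝ} (hp : 1 < p) {α : ℝ → ℝ} (hc : ContinuousOn α (Set.Icc 0 1))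
    (hα : ∀ b ∈ Set.Icc (0:ℝ) 1, α b ∈ Set.Icc (0:ℝ) 1 ∧ OnC p (α b) b) :
    ContinuousOn (fun b => GG p (α b) b) (Set.Icc 0 1) := by
  have hp0 : 0 < p := by linarith
  have hk : ContinuousOn (fun b => kk p (α b)) (Set.Icc 0 1) := (kk_cont hp0).comp_continuousOn hc
  have hk2 : ContinuousOn (fun b => kk p b) (Set.Icc 0 1) := (kk_cont hp0).continuousOn
  unfold GG
  refine ContinuousOn.add (ContinuousOn.log ((continuousOn_const.add hc).add continuousOn_id) ?_)
    (continuousOn_const.mul (((hk.log ?_).add (hk2.log ?_)).sub (continuousOn_const.mul ((hk.add hk2).log ?_))))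
  · intro b hb
    have := (hα b hb).1.1
    have := hb.1
    show 1 + α b + b ≠ 0
    positivity
  · intro b hb; exact (kk_pos hp0 (hα b hb).1.1).ne'
  · intro b hb; exact (kk_pos hp0 hb.1).ne'
  · intro b hb; exact (add_pos (kk_pos hp0 (hα b hb).1.1) (kk_pos hp0 hb.1)).ne'

/-- derivative value -/
noncomputable def VV (p a b : ℝ) : ℝ := 
  - (kk p a * TT p a b / (kk p b * cc p a * (1 + a + b) * (kk p a + kk p b)))

lemma VV_eq {p a b : ℝ} (hb : 0 < b) (hab : b < a) (ha : a < 1) :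
    VV p a b = - (om p a b * RR (p - 2) a b) := by
  unfold VV om; rw [TT_eq hb hab ha]; ring

lemma cell_lower {p : ℝ} (hp : 1 < p) {α : ℝ → ℝ} (hc : ContinuousOn α (Set.Icc 0 1))
    (hα : ∀ b ∈ Set.Icc (0:ℝ) 1, α b ∈ Set.Icc (0:ℝ) 1 ∧ OnC p (α b) b) {x y c : ℝ}
    (h0 : 0 ≤ x) (hxy : x ≤ y) (h1 : y ≤ 1) (h : ∀ b ∈ Set.Ioo x y, c ≤ VV p (α b) b) :
    c * (y - x) ≤ GG p (α y) y - GG p (α x) x := by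
  have hcont := (GGp_cont hp hc hα).mono (Set.Icc_subset_Icc h0 h1)
  have hd : ∀ b ∈ Set.Ioo x y, HasDerivAt (fun b => GG p (α b) b) (VV p (α b) b) b :=
    fun b hb => path_deriv hp hc hα (by linarith [hb.1]) (by linarith [hb.2])
  refine (convex_Icc x y).mul_sub_le_image_sub_of_le_deriv hcont ?_ ?_ x (Set.left_mem_Icc.2 hxy) y
    (Set.right_mem_Icc.2 hxy) hxy
  · rw [interior_Icc]; intro b hb; exact (hd b hb).differentiableAt.differentiableWithinAt
  · rw [interior_Icc]; intro b hb; rw [(hd b hb).deriv]; exact h b hb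

lemma cell_upper {p : ℝ} (hp : 1 < p) {α : ℝ → ℝ} (hc : ContinuousOn α (Set.Icc 0 1))
    (hα : ∀ b ∈ Set.Icc (0:ℝ) 1, α b ∈ Set.Icc (0:ℝ) 1 ∧ OnC p (α b) b) {x y c : ℝ}
    (h0 : 0 ≤ x) (hxy : x ≤ y) (h1 : y ≤ 1) (h : ∀ b ∈ Set.Ioo x y, VV p (α b) b ≤ c) :
    GG p (α y) y - GG p (α x) x ≤ c * (y - x) := by
  have hcont := (GGp_cont hp hc hα).mono (Set.Icc_subset_Icc h0 h1)
  have hd : ∀ b ∈ Set.Ioo x y, HasDerivAt (fun b => GG p (α b) b) (VV p (α b) b) b :=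
    fun b hb => path_deriv hp hc hα (by linarith [hb.1]) (by linarith [hb.2])
  refine (convex_Icc x y).image_sub_le_mul_sub_of_deriv_le hcont ?_ ?_ x (Set.left_mem_Icc.2 hxy) y
    (Set.right_mem_Icc.2 hxy) hxy
  · rw [interior_Icc]; intro b hb; exact (hd b hb).differentiableAt.differentiableWithinAt
  · rw [interior_Icc]; intro b hb; rw [(hd b hb).deriv]; exact h b hb

/-- fixed point intervals, scale `2^40` -/
structure Iv where
  lo : Int
  hi : Int

def SC : Nat := 1099511627776

def Iv.Mem (x : ℝ) (X : Iv) : Prop := (X.lo : ℝ) ≤ x * SC ∧ x * SC ≤ (X.hi : ℝ)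

def cdiv (a b : Int) : Int := -((-a) / b)

def Iv.add (X Y : Iv) : Iv := ⟨X.lo + Y.lo, X.hi + Y.hi⟩
def Iv.neg (X : Iv) : Iv := ⟨-X.hi, -X.lo⟩
def Iv.sub (X Y : Iv) : Iv := ⟨X.lo - Y.hi, X.hi - Y.lo⟩
def Iv.mul (X Y : Iv) : Iv :=
  ⟨min (min (X.lo * Y.lo) (X.lo * Y.hi)) (min (X.hi * Y.lo) (X.hi * Y.hi)) / SC,
   cdiv (max (max (X.lo * Y.lo) (X.lo * Y.hi)) (max (X.hi * Y.lo) (X.hi * Y.hi))) SC⟩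
def Iv.inv (X : Iv) : Iv := ⟨(SC * SC : Int) / X.hi, cdiv (SC * SC) X.lo⟩
/-- rational constant `n/d` -/
def Iv.rat (n : Int) (d : Nat) : Iv := ⟨n * SC / d, cdiv (n * SC) d⟩

lemma SC_pos : (0 : ℝ) < (SC : ℝ) := by norm_num [SC]
lemma SC_posZ : (0 : ℤ) < (SC : ℤ) := by norm_num [SC]

lemma ediv_le_real (a : ℤ) {b : ℤ} (hb : 0 < b) : ((a / b : ℤ) : ℝ) ≤ (a : ℝ) / b := by
  rw [le_div_iff₀ (by exact_mod_cast hb)]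
  exact_mod_cast Int.ediv_mul_le a hb.ne'

lemma le_cdiv_real (a : ℤ) {b : ℤ} (hb : 0 < b) : (a : ℝ) / b ≤ ((cdiv a b : ℤ) : ℝ) := by
  have := ediv_le_real (-a) hb
  unfold cdiv
  push_cast at this ⊢
  rw [neg_div] at this
  linarith

lemma Iv.mem_add {x y : ℝ} {X Y : Iv} (hx : X.Mem x) (hy : Y.Mem y) : (X.add Y).Mem (x + y) := by
  unfold Iv.Mem Iv.add at *
  push_cast
  constructor <;> linarith [hx.1, hx.2, hy.1, hy.2]

lemma Iv.mem_neg {x : ℝ} {X : Iv} (hx : X.Mem x) : (X.neg).Mem (-x) := by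
  unfold Iv.Mem Iv.neg at *
  push_cast
  constructor <;> linarith [hx.1, hx.2]

lemma Iv.mem_sub {x y : ℝ} {X Y : Iv} (hx : X.Mem x) (hy : Y.Mem y) : (X.sub Y).Mem (x - y) := by
  unfold Iv.Mem Iv.sub at *
  push_cast
  constructor <;> linarith [hx.1, hx.2, hy.1, hy.2]

lemma mul_bounds {x y a b c d : ℝ} (h1 : a ≤ x) (h2 : x ≤ b) (h3 : c ≤ y) (h4 : y ≤ d) :
    min (min (a * c) (a * d)) (min (b * c) (b * d)) ≤ x * y ∧
    x * y ≤ max (max (a * c) (a * d)) (max (b * c) (b * d)) := by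
  constructor
  · simp only [min_le_iff]
    rcases le_total 0 y with hy | hy
    · rcases le_total 0 a with ha | ha
      · left; left; nlinarith
      · left; right; nlinarith
    · rcases le_total 0 b with hb | hb
      · right; left; nlinarith
      · right; right; nlinarith
  · simp only [le_max_iff]
    rcases le_total 0 y with hy | hy
    · rcases le_total 0 b with ha | ha
      · right; right; nlinarith
      · right; left; nlinarith
    · rcases le_total 0 a with hb | hb
      · left; right; nlinarith
      · left; left; nlinarith

lemma Iv.mem_mul {x y : ℝ} {X Y : Iv} (hx : X.Mem x) (hy : Y.Mem y) : (X.mul Y).Mem (x * y) := by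
  unfold Iv.Mem at *
  have h := mul_bounds hx.1 hx.2 hy.1 hy.2
  have hS := SC_pos
  constructor
  · refine (ediv_le_real _ SC_posZ).trans ?_
    rw [Int.cast_natCast, div_le_iff₀ hS]
    push_cast
    nlinarith [h.1]
  · refine le_trans ?_ (le_cdiv_real _ SC_posZ)
    rw [Int.cast_natCast, le_div_iff₀ hS]
    push_cast
    nlinarith [h.2]

lemma Iv.pos_of_lo {x : ℝ} {X : Iv} (hx : X.Mem x) (h : 0 < X.lo) : 0 < x := by
  have h1 : (0:ℝ) < X.lo := by exact_mod_cast h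
  have := hx.1
  have hS := SC_pos
  by_contra hn
  push Not at hn
  nlinarith

lemma Iv.nonneg_of_lo {x : ℝ} {X : Iv} (hx : X.Mem x) (h : 0 ≤ X.lo) : 0 ≤ x := by
  have h1 : (0:ℝ) ≤ X.lo := by exact_mod_cast h
  have := hx.1
  have hS := SC_pos
  by_contra hn
  push Not at hn
  nlinarith

lemma Iv.nonpos_of_hi {x : ℝ} {X : Iv} (hx : X.Mem x) (h : X.hi ≤ 0) : x ≤ 0 := by
  have h1 : (X.hi:ℝ) ≤ 0 := by exact_mod_cast h
  have := hx.2
  have hS := SC_pos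
  by_contra hn
  push Not at hn
  nlinarith

lemma Iv.mem_inv {x : ℝ} {X : Iv} (hx : X.Mem x) (h : 0 < X.lo) : (X.inv).Mem (x⁻¹) := by
  have hx0 := Iv.pos_of_lo hx h
  unfold Iv.Mem at *
  have hS := SC_pos
  have h1 : (0:ℝ) < X.lo := by exact_mod_cast h
  have h2 : (0:ℝ) < X.hi := lt_of_lt_of_le h1 (hx.1.trans hx.2)
  have h3 : 0 < X.hi := by exact_mod_cast h2
  have e : x⁻¹ * (SC:ℝ) = (SC:ℝ) * SC / (x * SC) := by field_simp
  rw [e]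
  constructor
  · refine (ediv_le_real _ h3).trans ?_
    push_cast
    exact div_le_div_of_nonneg_left (by positivity) (by positivity) hx.2
  · refine le_trans ?_ (le_cdiv_real _ h)
    push_cast
    exact div_le_div_of_nonneg_left (by positivity) (by positivity) hx.1

lemma Iv.mem_rat (n : ℤ) {d : ℕ} (hd : 0 < d) : (Iv.rat n d).Mem ((n : ℝ) / d) := by
  unfold Iv.Mem Iv.rat
  have hd' : (0:ℤ) < d := by exact_mod_cast hd
  constructor
  · refine (ediv_le_real _ hd').trans (le_of_eq ?_)
    push_cast; ring
  · refine le_trans (le_of_eq ?_) (le_cdiv_real _ hd')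
    push_cast; ring

/-- hull from a lower and an upper enclosure -/
def Iv.hull (X Y : Iv) : Iv := ⟨X.lo, Y.hi⟩

lemma Iv.mem_hull {x y z : ℝ} {X Y : Iv} (hx : X.Mem x) (hy : Y.Mem y) (h1 : x ≤ z) (h2 : z ≤ y) :
    (X.hull Y).Mem z := by
  have hS := SC_pos
  exact ⟨hx.1.trans (by show x * SC ≤ z * SC; nlinarith), le_trans (by show z * SC ≤ y * SC; nlinarith) hy.2⟩

/-- strict evaluation helper -/
def strictN {α : Sort*} (n : Nat) (f : Nat → α) : α :=
  match n with
  | 0 => f 0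
  | k + 1 => f (k + 1)

lemma strictN_eq {α : Sort*} (n : Nat) (f : Nat → α) : strictN n f = f n := by
  cases n <;> rfl

def strictI {α : Sort*} (n : Int) (f : Int → α) : α :=
  match n with
  | Int.ofNat k => strictN k (fun k => f (Int.ofNat k))
  | Int.negSucc k => strictN k (fun k => f (Int.negSucc k))

lemma strictI_eq {α : Sort*} (n : Int) (f : Int → α) : strictI n f = f n := by
  cases n <;> simp [strictI, strictN_eq]

def strictV {α : Sort*} (X : Iv) (f : Iv → α) : α :=
  strictI X.lo (fun a => strictI X.hi (fun b => f ⟨a, b⟩))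

lemma strictV_eq {α : Sort*} (n : Iv) (f : Iv → α) : strictV n f = f n := by
  cases n; simp [strictV, strictI_eq]

/-- bisection for `y^200 * E ≤ C` -/
def bis (C E : Nat) : Nat → Nat → Nat → Iv
  | 0, lo, hi => ⟨lo, hi⟩
  | f + 1, lo, hi => strictN ((lo + hi) / 2) (fun mid =>
      if Nat.ble (mid ^ 200 * E) C then bis C E f mid hi else bis C E f lo mid)

/-- scale of the nodes -/
def NB : Nat := 100000

/-- enclosure of `(X/NB)^(k/200)` -/
def pw (X k : Nat) : Iv :=
  strictN (X ^ k * SC ^ 200) (fun C => strictN (NB ^ k) (fun E => bis C E 41 0 (2 * SC)))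

lemma bis_spec (C E : Nat) : ∀ (f lo hi : Nat), lo ^ 200 * E ≤ C → C ≤ hi ^ 200 * E →
    ∃ l h : Nat, bis C E f lo hi = ⟨l, h⟩ ∧ l ^ 200 * E ≤ C ∧ C ≤ h ^ 200 * E := by
  intro f
  induction f with
  | zero => intro lo hi h1 h2; exact ⟨lo, hi, rfl, h1, h2⟩
  | succ f ih =>
    intro lo hi h1 h2
    unfold bis
    rw [strictN_eq]
    split_ifs with h
    · exact ih _ _ (Nat.le_of_ble_eq_true h) h2
    · refine ih _ _ h1 ?_
      have : ¬ (((lo + hi) / 2) ^ 200 * E ≤ C) := fun hh => h (Nat.ble_eq_true_of_le hh)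
      omega

lemma pw_mem {X k : ℕ} (hX : X ≤ 2 * NB) (hk : k ≤ 200) :
    (pw X k).Mem (((X : ℝ) / NB) ^ ((k : ℝ) / 200)) := by
  have hNB : (0:ℝ) < (NB : ℝ) := by norm_num [NB]
  unfold pw
  rw [strictN_eq, strictN_eq]
  obtain ⟨l, h, e, h1, h2⟩ := bis_spec (X ^ k * SC ^ 200) (NB ^ k) 41 0 (2 * SC) (by simp) (by
    rw [mul_pow]
    calc X ^ k * SC ^ 200 ≤ (2 * NB) ^ k * SC ^ 200 := by gcongr
      _ = 2 ^ k * (NB ^ k * SC ^ 200) := by rw [mul_pow]; ring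
      _ ≤ 2 ^ 200 * (NB ^ k * SC ^ 200) := by gcongr; norm_num
      _ = _ := by ring)
  rw [e]
  set x : ℝ := (X : ℝ) / NB with hx
  have hx0 : 0 ≤ x := by positivity
  have hS := SC_pos
  set z := x ^ ((k : ℝ) / 200) with hz
  have hz0 : 0 ≤ z := by positivity
  have hzp : z ^ 200 = x ^ k := by
    rw [hz, ← Real.rpow_natCast, ← Real.rpow_mul hx0]
    norm_num
  have hXk : (X : ℝ) ^ k = x ^ k * (NB : ℝ) ^ k := by rw [hx, div_pow]; field_simp
  have h1' : (l : ℝ) ^ 200 * (NB : ℝ) ^ k ≤ (X : ℝ) ^ k * (SC : ℝ) ^ 200 := by exact_mod_cast h1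
  have h2' : (X : ℝ) ^ k * (SC : ℝ) ^ 200 ≤ (h : ℝ) ^ 200 * (NB : ℝ) ^ k := by exact_mod_cast h2
  have hE : (0:ℝ) < (NB : ℝ) ^ k := by positivity
  constructor
  · show (((l : ℕ) : ℤ) : ℝ) ≤ z * SC
    rw [Int.cast_natCast]
    refine le_of_pow_le_pow_left₀ (n := 200) (by norm_num) (by positivity) ?_
    rw [mul_pow, hzp]
    rw [hXk] at h1'
    refine le_of_mul_le_mul_right (a := (NB : ℝ) ^ k) ?_ hE
    linarith
  · show z * SC ≤ (((h : ℕ) : ℤ) : ℝ)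
    rw [Int.cast_natCast]
    refine le_of_pow_le_pow_left₀ (n := 200) (by norm_num) (by positivity) ?_
    rw [mul_pow, hzp]
    rw [hXk] at h2'
    refine le_of_mul_le_mul_right (a := (NB : ℝ) ^ k) ?_ hE
    linarith

def I1 : Iv := Iv.rat 1 1
def nd (X : Nat) : Iv := Iv.rat X NB
def ffI (X : Nat) (Z : Iv) : Iv := ((Iv.rat ((NB + X) * (NB + X) : Nat) (NB * NB)).mul Z).sub I1
def ggI (X : Nat) (Z : Iv) : Iv := I1.sub ((Iv.rat (X * X : Nat) (NB * NB)).mul Z)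
def kkI (X : Nat) (W Z : Iv) : Iv :=
  ((Iv.rat ((NB + X) * (NB + X) : Nat) (NB * NB)).mul W).sub ((Iv.rat (X * X : Nat) (NB * NB)).mul Z)
def thD (X : Nat) (g : Iv) : Iv := (nd X).mul g
def thI (X : Nat) (f g : Iv) : Iv := (f.mul (nd (NB - X))).mul (thD X g).inv
/-- divided difference with nodes `b, a, 1+b, 1+a`, `D = a - b` -/
def JI (Fb Fa Fc Fd : Iv) (D : Nat) : Iv :=
  (((Fd.sub Fb).mul (Iv.rat NB (NB + D))).sub ((Fc.sub Fa).mul (Iv.rat NB (NB - D)))).mul (Iv.rat NB D)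
def sqI (X : Nat) (Z : Iv) : Iv := (Iv.rat (X * X : Nat) (NB * NB)).mul Z
def liI (X : Nat) (Z : Iv) : Iv := (nd X).mul Z
def J2I (B A : Nat) (Zb Za Zc Zd : Iv) : Iv :=
  JI (sqI B Zb) (sqI A Za) (sqI (NB + B) Zc) (sqI (NB + A) Zd) (A - B)
def J1I (B A : Nat) (Zb Za Zc Zd : Iv) : Iv :=
  (JI (liI B Zb) (liI A Za) (liI (NB + B) Zc) (liI (NB + A) Zd) (A - B)).neg
def J0I (B A : Nat) (Zb Za Zc Zd : Iv) : Iv := JI Zb Za Zc Zd (A - B)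

/-- `kappa` enclosure, together with a success flag -/
def kapI (k0 k1 B0 B1 AL AH : Nat) (fh gh f1 g1 fl gl f0 g0 : Iv) : Bool × Iv :=
  let ta := if AH = NB then (fh.mul (Iv.rat 200 (400 + k0))) else thI AH fh gh
  let tb := thI B1 f1 g1
  let sa := thI AL fl gl
  let sb := if B0 = 0 then Iv.rat (400 + k1 : Nat) 200 else thI B0 f0 g0
  ((decide (AH = NB) || decide (0 < (thD AH gh).lo)) && decide (0 < (thD B1 g1).lo) && decide (0 < (thD AL gl).lo)
    && (decide (B0 = 0) || decide (0 < (thD B0 g0).lo)),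
   ((ta.mul tb).sub I1).hull ((sa.mul sb).sub I1))

/-- enclosure of `RR/m` -/
def rI (j2 j1 j0 kap e A B : Iv) : Iv :=
  let s := A.add B
  let q := A.mul B
  let g := (I1.add A).mul (I1.add B)
  ((j2.mul ((kap.sub (Iv.rat 4 1)).add (e.mul ((I1.add ((Iv.rat 3 1).mul s)).add ((Iv.rat 4 1).mul q))))).add
   ((j1.mul (I1.add s)).mul ((kap.sub (Iv.rat 3 1)).add (e.mul (((Iv.rat 2 1).mul s).add ((Iv.rat 3 1).mul q)))))).sub
   ((((Iv.rat 2 1).mul g).mul j0).mul (I1.sub (e.mul q)))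

/-- The derivative enclosure on a cell. -/
def cellV (k0 k1 B0 B1 AL AH : Nat) : Bool × Iv :=
  strictV (pw B0 k0) fun b00 => strictV (pw B0 k1) fun b01 =>
  strictV (pw B1 k0) fun b10 => strictV (pw B1 k1) fun b11 =>
  strictV (pw AL k0) fun l0 => strictV (pw AL k1) fun l1 =>
  strictV (pw AH k0) fun h0 => strictV (pw AH k1) fun h1 =>
  strictV (pw (NB + B0) k0) fun c00 => strictV (pw (NB + B0) k1) fun c01 =>
  strictV (pw (NB + B1) k0) fun c10 => strictV (pw (NB + B1) k1) fun c11 =>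
  strictV (pw (NB + AL) k0) fun m0 => strictV (pw (NB + AL) k1) fun m1 =>
  strictV (pw (NB + AH) k0) fun n0 => strictV (pw (NB + AH) k1) fun n1 =>
  strictV (ffI AL m1) fun fl1 => strictV (ggI AL l1) fun gl1 =>
  strictV (ffI B1 c11) fun f11 => strictV (ggI B1 b11) fun g11 =>
  strictV (ffI AH n0) fun fh0 => strictV (ggI AH h0) fun gh0 =>
  strictV (ffI B0 c00) fun f00 => strictV (ggI B0 b00) fun g00 =>
  strictV (ffI B1 c10) fun f10 => strictV (ggI B1 b10) fun g10 =>
  strictV (ffI B0 c01) fun f01 => strictV (ggI B0 b01) fun g01 =>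
  let K := kapI k0 k1 B0 B1 AL AH fh0 gh0 f10 g10 fl1 gl1 f01 g01
  strictV K.2 fun kap =>
  strictV (m1.mul m0.inv) fun up =>
  strictV (b11.mul b10.inv) fun dn =>
  strictV (((((J2I B1 AH b10 h0 c10 n0).mul dn).mul (Iv.rat 200 k0))).hull
    (((J2I B0 AL b00 l0 c00 m0).mul up).mul (Iv.rat ((400 + k1) * (200 + k1) * 200 : Nat) ((400 + k0) * (200 + k0) * k0)))) fun j2 =>
  strictV (((((J1I B1 AH b10 h0 c10 n0).mul dn).mul
      (Iv.rat ((200 + k1) * (200 - k1) * 200 : Nat) ((200 + k0) * (200 - k0) * k0)))).hull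
    (((J1I B0 AL b00 l0 c00 m0).mul up).mul (Iv.rat 200 k0))) fun j1 =>
  strictV (((((J0I B1 AH b10 h0 c10 n0).mul dn).mul
      (Iv.rat ((200 - k1) * (400 - k1) * 200 : Nat) ((200 - k0) * (400 - k0) * k0)))).hull
    (((J0I B0 AL b00 l0 c00 m0).mul up).mul (Iv.rat 200 k0))) fun j0 =>
  strictV ((nd AL).hull (nd AH)) fun A => strictV ((nd B0).hull (nd B1)) fun B =>
  strictV (m0.hull n1) fun Pm => strictV (c00.hull c11) fun Qm =>
  strictV (l1.hull h0) fun Um => strictV (b01.hull b10) fun Vm =>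
  strictV ((I1.add A).mul Pm) fun P => strictV ((I1.add B).mul Qm) fun Q =>
  strictV ((Um.mul Vm).mul (P.mul Q).inv) fun e =>
  strictV (rI j2 j1 j0 kap e A B) fun R =>
  strictV ((kkI AL m0 l0).hull (kkI AH n1 h1)) fun ka =>
  strictV ((kkI B0 c00 b00).hull (kkI B1 c11 b11)) fun kb =>
  strictV (A.mul Um) fun U =>
  strictV ((P.sub U).add (P.mul U)) fun cI =>
  strictV ((kb.mul cI).mul (((I1.add A).add B).mul (ka.add kb))) fun den =>
  strictV ((((((nd (AL - B1)).hull (nd (AH - B0))).mul (A.mul B)).mul ka).mul (P.mul Q)).mul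
     ((Iv.rat k0 200).hull (Iv.rat k1 200))) fun num =>
  strictV ((((num).mul den.inv).mul R).neg) fun V =>
  (K.1 && decide (0 < m0.lo) && decide (0 < b10.lo) && decide (0 < (P.mul Q).lo) && decide (0 < den.lo)
    && decide (0 ≤ ((gl1.mul g11).sub (fl1.mul f11)).lo)
    && (decide (AH = NB) || decide (0 ≤ ((fh0.mul f00).sub (gh0.mul g00)).lo))
    && decide (B0 < B1) && decide (B0 < AL) && decide (AL < NB) && decide (B1 < AH) && decide (AH ≤ NB) && decide (B1 < NB)
    && decide (AL ≤ AH)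
    && decide (0 < k0) && decide (k0 ≤ k1) && decide (k1 ≤ 200) && decide (k0 < 200), V)

/-- location of the diagonal point -/
def lasE (k0 k1 B0 B1 : Nat) : Bool :=
  decide (0 ≤ ((ggI B0 (pw B0 k1)).sub (ffI B0 (pw (NB + B0) k1))).lo) &&
        decide (0 ≤ ((ffI B1 (pw (NB + B1) k0)).sub (ggI B1 (pw B1 k0))).lo)

def endOK (k0 B : Nat) : Bool := decide (0 ≤ ((ffI B (pw (NB + B) k0)).sub (ggI B (pw B k0))).lo) && decide (B < NB)

lemma dd3_nodes (F : ℝ → ℝ) {a b : ℝ} (h1 : b < a) (h2 : a < 1 + b) :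
    dd3 F b a (1 + b) (1 + a) = ((F (1 + a) - F b) * (1 / (1 + (a - b))) - (F (1 + b) - F a) * (1 / (1 - (a - b)))) * (1 / (a - b)) := by
  unfold dd3
  have n1 : a - b ≠ 0 := by intro h; linarith
  have n2 : 1 + (a - b) ≠ 0 := by intro h; linarith
  have n3 : 1 - (a - b) ≠ 0 := by intro h; linarith
  rw [show b - a = -(a - b) by ring, show b - (1 + b) = -1 by ring, show b - (1 + a) = -(1 + (a - b)) by ring,
    show a - (1 + b) = -(1 - (a - b)) by ring, show a - (1 + a) = -1 by ring, show 1 + b - b = 1 by ring,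
    show 1 + b - (1 + a) = -(a - b) by ring, show 1 + a - a = 1 by ring, show 1 + a - (1 + b) = a - b by ring,
    show 1 + b - a = 1 - (a - b) by ring, show 1 + a - b = 1 + (a - b) by ring]
  generalize a - b = d at *
  field_simp
  ring

lemma nodes_dist {a b : ℝ} (h1 : b < a) (h2 : a < 1 + b) : Dist4 b a (1 + b) (1 + a) := by
  refine ⟨?_, ?_, ?_, ?_, ?_, ?_⟩ <;> intro h <;> linarith

lemma dd3_one {m a b : ℝ} (hm : 0 < m) (hb : 0 ≤ b) (hab : b < a) :
    dd3 (fun t => t * t ^ m) b a (1 + b) (1 + a) = dd3 (fun t => t ^ (m + 1)) b a (1 + b) (1 + a) := by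
  have h : ∀ t : ℝ, 0 ≤ t → t * t ^ m = t ^ (m + 1) := by
    intro t ht; rw [Real.rpow_add_one' ht (by linarith)]; ring
  unfold dd3
  simp only []
  rw [h b hb, h a (by linarith), h (1 + b) (by linarith), h (1 + a) (by linarith)]

lemma dd3_two {m a b : ℝ} (hm : 0 < m) (hb : 0 ≤ b) (hab : b < a) :
    dd3 (fun t => t ^ 2 * t ^ m) b a (1 + b) (1 + a) = dd3 (fun t => t ^ (m + 2)) b a (1 + b) (1 + a) := by
  have h : ∀ t : ℝ, 0 ≤ t → t ^ 2 * t ^ m = t ^ (m + 2) := by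
    intro t ht
    rw [show m + 2 = (m + 1) + 1 by ring, Real.rpow_add_one' ht (by linarith), Real.rpow_add_one' ht (by linarith)]; ring
  unfold dd3
  simp only []
  rw [h b hb, h a (by linarith), h (1 + b) (by linarith), h (1 + a) (by linarith)]

/-- normalised scaling -/
lemma dd3_norm {e r b a : ℝ} (he : 0 < e) (hr : e ≤ r) (hce : cf e ≠ 0) (hcr : cf r ≠ 0)
    (hb : 0 ≤ b) (hab : b < a) (h2 : a < 1 + b) :
    dd3 (fun t => t ^ r) b a (1 + b) (1 + a) / cf r ≤ (1 + a) ^ (r - e) * (dd3 (fun t => t ^ e) b a (1 + b) (1 + a) / cf e) ∧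
    b ^ (r - e) * (dd3 (fun t => t ^ e) b a (1 + b) (1 + a) / cf e) ≤ dd3 (fun t => t ^ r) b a (1 + b) (1 + a) / cf r :=
  ⟨dd3_scale_up he hr hce hcr hb hab h2 (by linarith), dd3_scale_low he hr hce hcr hb hab h2 (by linarith)⟩

noncomputable def J2 (m b a : ℝ) : ℝ := dd3 (fun t => t ^ 2 * t ^ m) b a (1 + b) (1 + a)
noncomputable def J1 (m b a : ℝ) : ℝ := - dd3 (fun t => t * t ^ m) b a (1 + b) (1 + a)
noncomputable def J0 (m b a : ℝ) : ℝ := dd3 (fun t => t ^ m) b a (1 + b) (1 + a)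

lemma up_mul {x J c c' w w' : ℝ} (h : x ≤ c * (w * J)) (hJ : 0 ≤ J) (hc : 0 ≤ c) (hcc : c ≤ c') (hw : 0 ≤ w) (hww : w ≤ w') :
    x ≤ J * w' * c' := by
  have h1 : c * (w * J) ≤ c' * (w' * J) := by
    have := hc.trans hcc
    have := hw.trans hww
    gcongr
  calc x ≤ _ := h
    _ ≤ _ := h1
    _ = _ := by ring

set_option maxHeartbeats 1000000 in
lemma J_bounds {m m0 m1 b a : ℝ} (h0 : 0 < m0) (hm : m0 ≤ m) (hm1 : m ≤ m1) (h1 : m < 1) (h11 : m1 ≤ 1)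
    (hb : 0 ≤ b) (hb1 : b ≤ 1) (hab : b < a) (h2 : a < 1 + b) :
    J2 m b a / m ≤ J2 m0 b a * (1 + a) ^ (m1 - m0) * ((2 + m1) * (1 + m1) / ((2 + m0) * (1 + m0) * m0)) ∧
    J1 m b a / m ≤ J1 m0 b a * (1 + a) ^ (m1 - m0) * (1 / m0) ∧
    J0 m b a / m ≤ J0 m0 b a * (1 + a) ^ (m1 - m0) * (1 / m0) ∧
    J2 m0 b a * b ^ (m1 - m0) * (1 / m0) ≤ J2 m b a / m ∧
    J1 m0 b a * b ^ (m1 - m0) * ((1 + m1) * (1 - m1) / ((1 + m0) * (1 - m0) * m0)) ≤ J1 m b a / m ∧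
    J0 m0 b a * b ^ (m1 - m0) * ((1 - m1) * (2 - m1) / ((1 - m0) * (2 - m0) * m0)) ≤ J0 m b a / m := by
  have hmpos : 0 < m := by linarith
  have hm01 : m0 < 1 := by linarith
  have ha0 : 0 ≤ a := by linarith
  obtain ⟨-, -, -, p0, p1, p2⟩ := dd3_mono (m := m0) ⟨h0, hm01⟩ hb (by linarith) (by linarith : (0:ℝ) ≤ 1 + b) (by linarith : (0:ℝ) ≤ 1 + a)
    (nodes_dist hab h2) le_rfl le_rfl le_rfl le_rfl (nodes_dist hab h2)
  have f0 : ∀ x : ℝ, cf x = x * (x - 1) * (x - 2) := fun _ => rfl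
  have c1 : 0 < 1 - m := by linarith
  have c2 : 0 < 1 - m0 := by linarith
  have c3 : 0 < 2 - m := by linarith
  have c4 : 0 < 2 - m0 := by linarith
  have c5 : 0 ≤ 1 - m1 := by linarith
  have c6 : 0 < 2 - m1 := by linarith
  have z0 : cf m = m * ((1 - m) * (2 - m)) := by rw [f0]; ring
  have z0' : cf m0 = m0 * ((1 - m0) * (2 - m0)) := by rw [f0]; ring
  have z1 : cf (m + 1) = -(m * ((1 + m) * (1 - m))) := by rw [f0]; ring
  have z1' : cf (m0 + 1) = -(m0 * ((1 + m0) * (1 - m0))) := by rw [f0]; ring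
  have z2 : cf (m + 2) = m * ((2 + m) * (1 + m)) := by rw [f0]; ring
  have z2' : cf (m0 + 2) = m0 * ((2 + m0) * (1 + m0)) := by rw [f0]; ring
  have n0 := dd3_norm (e := m0) (r := m) h0 hm (by rw [z0']; positivity) (by rw [z0]; positivity) hb hab h2
  have n1 := dd3_norm (e := m0 + 1) (r := m + 1) (by linarith) (by linarith) (by rw [z1', neg_ne_zero]; positivity) (by rw [z1, neg_ne_zero]; positivity) hb hab h2
  have n2 := dd3_norm (e := m0 + 2) (r := m + 2) (by linarith) (by linarith) (by rw [z2']; positivity) (by rw [z2]; positivity) hb hab h2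
  rw [z0, z0'] at n0
  rw [z1, z1', ← dd3_one hmpos hb hab, ← dd3_one h0 hb hab, ← neg_div_neg_eq, neg_neg, ← neg_div_neg_eq (b := -(m0 * ((1 + m0) * (1 - m0)))), neg_neg] at n1
  rw [z2, z2', ← dd3_two hmpos hb hab, ← dd3_two h0 hb hab] at n2
  rw [show m + 1 - (m0 + 1) = m - m0 by ring] at n1
  rw [show m + 2 - (m0 + 2) = m - m0 by ring] at n2
  change J0 m b a / _ ≤ _ * (J0 m0 b a / _) ∧ _ * (J0 m0 b a / _) ≤ J0 m b a / _ at n0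
  change J1 m b a / _ ≤ _ * (J1 m0 b a / _) ∧ _ * (J1 m0 b a / _) ≤ J1 m b a / _ at n1
  change J2 m b a / _ ≤ _ * (J2 m0 b a / _) ∧ _ * (J2 m0 b a / _) ≤ J2 m b a / _ at n2
  change 0 ≤ J0 m0 b a at p0
  change 0 ≤ J1 m0 b a at p1
  change 0 ≤ J2 m0 b a at p2
  have wU : (1 + a) ^ (m - m0) ≤ (1 + a) ^ (m1 - m0) := Real.rpow_le_rpow_of_exponent_le (by linarith) (by linarith)
  have wU0 : 0 ≤ (1 + a) ^ (m - m0) := by positivity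
  have wL : b ^ (m1 - m0) * 1 ≤ b ^ (m - m0) * 1 := by
    rcases eq_or_lt_of_le hb with h | h
    · subst h
      rcases eq_or_lt_of_le hm with h' | h'
      · rw [h', sub_self, Real.rpow_zero]
        have := Real.rpow_le_one (x := 0) le_rfl zero_le_one (by linarith : 0 ≤ m1 - m)
        linarith
      · rw [Real.zero_rpow (by linarith), Real.zero_rpow (by linarith)]
    · have := Real.rpow_le_rpow_of_exponent_ge h hb1 (by linarith : m - m0 ≤ m1 - m0)
      linarith
  have wL0 : 0 ≤ b ^ (m1 - m0) := by positivity
  generalize (1 + a) ^ (m - m0) = u at *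
  generalize (1 + a) ^ (m1 - m0) = u1 at *
  generalize b ^ (m - m0) = v at *
  generalize b ^ (m1 - m0) = v1 at *
  generalize J0 m b a = A0 at *
  generalize J1 m b a = A1 at *
  generalize J2 m b a = A2 at *
  generalize J0 m0 b a = B0 at *
  generalize J1 m0 b a = B1 at *
  generalize J2 m0 b a = B2 at *
  have aux : ∀ A c : ℝ, 0 < c → A / m = c * (A / (m * c)) := by
    intro A c hc; field_simp
  have up : ∀ A B c c0 c' : ℝ, A / (m * c) ≤ u * (B / (m0 * c0)) → 0 ≤ B → 0 < c → 0 < c0 → c / (m0 * c0) ≤ c' → A / m ≤ B * u1 * c' := by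
    intro A B c c0 c' h hB hc hc0 hcc
    refine up_mul (J := B) (c := c / (m0 * c0)) (w := u) ?_ hB (by positivity) hcc wU0 wU
    rw [aux A c hc]
    calc c * (A / (m * c)) ≤ c * (u * (B / (m0 * c0))) := by gcongr
      _ = _ := by ring
  have dn : ∀ A B c c0 c' : ℝ, v * (B / (m0 * c0)) ≤ A / (m * c) → 0 ≤ B → 0 < c → 0 < c0 → 0 ≤ c' → c' ≤ c / (m0 * c0) → B * v1 * c' ≤ A / m := by
    intro A B c c0 c' h hB hc hc0 hc' hcc
    rw [aux A c hc]
    have : v1 ≤ v := by linarith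
    calc B * v1 * c' ≤ B * v * (c / (m0 * c0)) := by
          have := wL0.trans this
          gcongr
      _ = c * (v * (B / (m0 * c0))) := by ring
      _ ≤ _ := by gcongr
  refine ⟨up _ _ _ _ _ n2.1 p2 (by positivity) (by positivity) ?_, up _ _ _ _ _ n1.1 p1 (by positivity) (by positivity) ?_,
    up _ _ _ _ _ n0.1 p0 (by positivity) (by positivity) ?_, dn _ _ _ _ _ n2.2 p2 (by positivity) (by positivity) (by positivity) ?_,
    dn _ _ _ _ _ n1.2 p1 (by positivity) (by positivity) ?_ ?_, dn _ _ _ _ _ n0.2 p0 (by positivity) (by positivity) ?_ ?_⟩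
  · rw [mul_comm m0]; have : 0 ≤ 2 + m1 := by linarith
    gcongr
  · have t : (1 + m) * (1 - m) ≤ (1 + m0) * (1 - m0) := by nlinarith
    rw [div_le_div_iff₀ (by positivity) h0]; nlinarith [mul_le_mul_of_nonneg_left t h0.le]
  · have t : (1 - m) * (2 - m) ≤ (1 - m0) * (2 - m0) := by nlinarith
    rw [div_le_div_iff₀ (by positivity) h0]; nlinarith [mul_le_mul_of_nonneg_left t h0.le]
  · have t : (2 + m0) * (1 + m0) ≤ (2 + m) * (1 + m) := by nlinarith
    rw [div_le_div_iff₀ h0 (by positivity)]; nlinarith [mul_le_mul_of_nonneg_left t h0.le]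
  · have : 0 ≤ 1 + m1 := by linarith
    positivity
  · rw [mul_comm m0]; gcongr ?_ / _; nlinarith
  · positivity
  · rw [mul_comm m0]
    refine div_le_div_of_nonneg_right ?_ (by positivity)
    nlinarith

lemma NB_pos : (0:ℝ) < (NB:ℝ) := by norm_num [NB]
lemma NB_posN : 0 < NB := by norm_num [NB]

lemma strictV_ex {α : Type} {X : Iv} {f : Iv → α} {r : α} (h : strictV X f = r) : ∃ Y, Y = X ∧ f Y = r :=
  ⟨X, rfl, by rw [← h, strictV_eq]⟩

lemma Iv.mem_congr {x y : ℝ} {X : Iv} (h : X.Mem x) (e : x = y) : X.Mem y := e ▸ h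

lemma I1_mem : I1.Mem 1 := Iv.mem_congr (Iv.mem_rat 1 one_pos) (by norm_num)
lemma rat1_mem (n : ℤ) : (Iv.rat n 1).Mem (n : ℝ) := Iv.mem_congr (Iv.mem_rat n one_pos) (by norm_num)
lemma nd_mem (X : ℕ) : (nd X).Mem ((X : ℝ) / NB) := Iv.mem_congr (Iv.mem_rat X NB_posN) (by norm_num)

lemma pw1_mem {X k : ℕ} (hX : X ≤ NB) (hk : k ≤ 200) :
    (pw (NB + X) k).Mem ((1 + (X : ℝ) / NB) ^ ((k : ℝ) / 200)) := by
  refine Iv.mem_congr (pw_mem (by omega) hk) ?_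
  congr 1
  have := NB_pos
  push_cast
  field_simp

lemma sq1_mem (X : ℕ) : (Iv.rat ((NB + X) * (NB + X) : Nat) (NB * NB)).Mem ((1 + (X : ℝ) / NB) ^ 2) := by
  refine Iv.mem_congr (Iv.mem_rat _ (Nat.mul_pos NB_posN NB_posN)) ?_
  have := NB_pos
  push_cast
  field_simp

lemma sq0_mem (X : ℕ) : (Iv.rat (X * X : Nat) (NB * NB)).Mem (((X : ℝ) / NB) ^ 2) := by
  refine Iv.mem_congr (Iv.mem_rat _ (Nat.mul_pos NB_posN NB_posN)) ?_
  have := NB_pos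
  push_cast
  field_simp

lemma rpow_two_add {x m : ℝ} (hx : 0 ≤ x) (hm : 0 ≤ m) : x ^ (2 + m) = x ^ 2 * x ^ m := by
  rw [Real.rpow_add_of_nonneg hx (by norm_num) hm]; norm_num

lemma ffI_mem {X : ℕ} {Z : Iv} {m : ℝ} (hm : 0 ≤ m) (h : Z.Mem ((1 + (X : ℝ) / NB) ^ m)) :
    (ffI X Z).Mem (ff (2 + m) ((X : ℝ) / NB)) := by
  refine Iv.mem_congr (Iv.mem_sub (Iv.mem_mul (sq1_mem X) h) I1_mem) ?_
  unfold ff; rw [rpow_two_add (by positivity) hm]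

lemma ggI_mem {X : ℕ} {Z : Iv} {m : ℝ} (hm : 0 ≤ m) (h : Z.Mem (((X : ℝ) / NB) ^ m)) :
    (ggI X Z).Mem (gg (2 + m) ((X : ℝ) / NB)) := by
  refine Iv.mem_congr (Iv.mem_sub I1_mem (Iv.mem_mul (sq0_mem X) h)) ?_
  unfold gg; rw [rpow_two_add (by positivity) hm]

lemma kkI_mem {X : ℕ} {W Z : Iv} {m : ℝ} (hm : 0 ≤ m) (hW : W.Mem ((1 + (X : ℝ) / NB) ^ m)) (h : Z.Mem (((X : ℝ) / NB) ^ m)) :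
    (kkI X W Z).Mem (kk (2 + m) ((X : ℝ) / NB)) := by
  refine Iv.mem_congr (Iv.mem_sub (Iv.mem_mul (sq1_mem X) hW) (Iv.mem_mul (sq0_mem X) h)) ?_
  unfold kk; rw [rpow_two_add (by positivity) hm, rpow_two_add (by positivity) hm]

lemma nd_sub_mem {X Y : ℕ} (h : Y ≤ X) : (nd (X - Y)).Mem ((X : ℝ) / NB - (Y : ℝ) / NB) := by
  refine Iv.mem_congr (nd_mem _) ?_
  push_cast [h]
  ring

lemma thI_mem {X : ℕ} {f g : Iv} {r : ℝ} (hX : X ≤ NB) (hf : f.Mem (ff r ((X : ℝ) / NB))) (hg : g.Mem (gg r ((X : ℝ) / NB)))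
    (h0 : 0 < (thD X g).lo) : (thI X f g).Mem (Th r ((X : ℝ) / NB)) := by
  have h1 : (nd (NB - X)).Mem (1 - (X : ℝ) / NB) := by
    refine Iv.mem_congr (nd_sub_mem hX) ?_
    rw [div_self NB_pos.ne']
  refine Iv.mem_congr (Iv.mem_mul (Iv.mem_mul hf h1) (Iv.mem_inv (Iv.mem_mul (nd_mem X) hg) h0)) ?_
  unfold Th
  exact (div_eq_mul_inv _ _).symm

lemma JI_mem {F : ℝ → ℝ} {B A : ℕ} {Fb Fa Fc Fd : Iv} (hBA : B < A) (hA : A < NB + B)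
    (hb : Fb.Mem (F ((B : ℝ) / NB))) (ha : Fa.Mem (F ((A : ℝ) / NB)))
    (hc : Fc.Mem (F (1 + (B : ℝ) / NB))) (hd : Fd.Mem (F (1 + (A : ℝ) / NB))) :
    (JI Fb Fa Fc Fd (A - B)).Mem (dd3 F ((B : ℝ) / NB) ((A : ℝ) / NB) (1 + (B : ℝ) / NB) (1 + (A : ℝ) / NB)) := by
  have hN := NB_pos
  have h1 : (B:ℝ) < A := by exact_mod_cast hBA
  have h2 : (A:ℝ) < NB + B := by exact_mod_cast hA
  have g1 : (B:ℝ) / NB < A / NB := by gcongr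
  have g2 : (A:ℝ) / NB < 1 + B / NB := by
    rw [show (1:ℝ) + B / NB = (NB + B) / NB by field_simp]; gcongr
  have e1 : (Iv.rat NB (NB + (A - B))).Mem (1 / (1 + ((A:ℝ) / NB - B / NB))) := by
    refine Iv.mem_congr (Iv.mem_rat _ (by omega)) ?_
    push_cast [hBA.le]
    rw [show (1:ℝ) + (A / NB - B / NB) = (NB + (A - B)) / NB by field_simp, one_div_div]
  have e2 : (Iv.rat NB (NB - (A - B))).Mem (1 / (1 - ((A:ℝ) / NB - B / NB))) := by
    refine Iv.mem_congr (Iv.mem_rat _ (by omega)) ?_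
    rw [Nat.cast_sub (by omega), Nat.cast_sub hBA.le]
    push_cast
    rw [show (1:ℝ) - (A / NB - B / NB) = (NB - (A - B)) / NB by field_simp, one_div_div]
  have e3 : (Iv.rat NB (A - B)).Mem (1 / ((A:ℝ) / NB - B / NB)) := by
    refine Iv.mem_congr (Iv.mem_rat _ (by omega)) ?_
    rw [Nat.cast_sub hBA.le]
    push_cast
    rw [show ((A:ℝ) / NB - B / NB) = ((A - B)) / NB by field_simp, one_div_div]
  rw [dd3_nodes F g1 g2]
  exact Iv.mem_mul (Iv.mem_sub (Iv.mem_mul (Iv.mem_sub hd hb) e1) (Iv.mem_mul (Iv.mem_sub hc ha) e2)) e3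

lemma sqI1_mem {X : ℕ} {Z : Iv} {y : ℝ} (h : Z.Mem y) : (sqI (NB + X) Z).Mem ((1 + (X:ℝ) / NB) ^ 2 * y) :=
  Iv.mem_mul (sq1_mem X) h
lemma sqI0_mem {X : ℕ} {Z : Iv} {y : ℝ} (h : Z.Mem y) : (sqI X Z).Mem (((X:ℝ) / NB) ^ 2 * y) :=
  Iv.mem_mul (sq0_mem X) h
lemma liI0_mem {X : ℕ} {Z : Iv} {y : ℝ} (h : Z.Mem y) : (liI X Z).Mem (((X:ℝ) / NB) * y) :=
  Iv.mem_mul (nd_mem X) h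
lemma liI1_mem {X : ℕ} {Z : Iv} {y : ℝ} (h : Z.Mem y) : (liI (NB + X) Z).Mem ((1 + (X:ℝ) / NB) * y) := by
  refine Iv.mem_mul (Iv.mem_congr (nd_mem _) ?_) h
  have := NB_pos
  push_cast; field_simp

lemma J2I_mem {B A : ℕ} {Zb Za Zc Zd : Iv} {m : ℝ} (hBA : B < A) (hA : A < NB + B)
    (hb : Zb.Mem (((B : ℝ) / NB) ^ m)) (ha : Za.Mem (((A : ℝ) / NB) ^ m))
    (hc : Zc.Mem ((1 + (B : ℝ) / NB) ^ m)) (hd : Zd.Mem ((1 + (A : ℝ) / NB) ^ m)) :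
    (J2I B A Zb Za Zc Zd).Mem (J2 m ((B : ℝ) / NB) ((A : ℝ) / NB)) :=
  JI_mem (F := fun t => t ^ 2 * t ^ m) hBA hA (sqI0_mem hb) (sqI0_mem ha) (sqI1_mem hc) (sqI1_mem hd)

lemma J1I_mem {B A : ℕ} {Zb Za Zc Zd : Iv} {m : ℝ} (hBA : B < A) (hA : A < NB + B)
    (hb : Zb.Mem (((B : ℝ) / NB) ^ m)) (ha : Za.Mem (((A : ℝ) / NB) ^ m))
    (hc : Zc.Mem ((1 + (B : ℝ) / NB) ^ m)) (hd : Zd.Mem ((1 + (A : ℝ) / NB) ^ m)) :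
    (J1I B A Zb Za Zc Zd).Mem (J1 m ((B : ℝ) / NB) ((A : ℝ) / NB)) :=
  Iv.mem_neg (JI_mem (F := fun t => t * t ^ m) hBA hA (liI0_mem hb) (liI0_mem ha) (liI1_mem hc) (liI1_mem hd))

lemma J0I_mem {B A : ℕ} {Zb Za Zc Zd : Iv} {m : ℝ} (hBA : B < A) (hA : A < NB + B)
    (hb : Zb.Mem (((B : ℝ) / NB) ^ m)) (ha : Za.Mem (((A : ℝ) / NB) ^ m))
    (hc : Zc.Mem ((1 + (B : ℝ) / NB) ^ m)) (hd : Zd.Mem ((1 + (A : ℝ) / NB) ^ m)) :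
    (J0I B A Zb Za Zc Zd).Mem (J0 m ((B : ℝ) / NB) ((A : ℝ) / NB)) :=
  JI_mem (F := fun t => t ^ m) hBA hA hb ha hc hd

lemma kk_mono_x {p x y : ℝ} (hp : 1 < p) (hx : 0 ≤ x) (hxy : x ≤ y) : kk p x ≤ kk p y := by
  refine (monotoneOn_of_deriv_nonneg (D := Set.Ici 0) (convex_Ici 0) (kk_cont (by linarith)).continuousOn
    (fun z _ => (kk_deriv hp).differentiableAt.differentiableWithinAt) ?_) hx (hx.trans hxy) hxy
  intro z hz
  rw [interior_Ici] at hz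
  have hz : 0 < z := hz
  rw [(kk_deriv hp).deriv]
  have := Real.rpow_le_rpow hz.le (by linarith : z ≤ 1 + z) (by linarith : 0 ≤ p - 1)
  have : 0 ≤ (1 + z) ^ (p - 1) - z ^ (p - 1) := by linarith
  positivity

lemma rpow_anti_exp {x s r : ℝ} (hx : 0 ≤ x) (hx1 : x ≤ 1) (hs : 0 < s) (h : s ≤ r) : x ^ r ≤ x ^ s := by
  rcases eq_or_lt_of_le hx with h0 | h0
  · subst h0; rw [Real.zero_rpow hs.ne', Real.zero_rpow (by linarith)]
  · exact Real.rpow_le_rpow_of_exponent_ge h0 hx1 h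

lemma kk_mono_p {p r x : ℝ} (hp : 0 < p) (hr : p ≤ r) (hx : 0 ≤ x) (hx1 : x ≤ 1) : kk p x ≤ kk r x := by
  unfold kk
  have h1 := rpow_anti_exp hx hx1 hp hr
  have h2 := Real.rpow_le_rpow_of_exponent_le (by linarith : 1 ≤ 1 + x) hr
  linarith

/-- kappa enclosure -/
lemma kapI_mem {k0 k1 B0 B1 AL AH : ℕ} {fh gh f1 g1 fl gl f0 g0 : Iv} {p a b : ℝ}
    (hok : (kapI k0 k1 B0 B1 AL AH fh gh f1 g1 fl gl f0 g0).1 = true)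
    (hp0 : 2 + (k0:ℝ) / 200 ≤ p) (hp1 : p ≤ 2 + (k1:ℝ) / 200) (hk1 : k1 ≤ 200)
    (hb0 : (B0:ℝ) / NB < b) (hb1 : b < (B1:ℝ) / NB) (ha1 : a < 1) (hal : (AL:ℝ) / NB ≤ a) (hah : a ≤ (AH:ℝ) / NB)
    (hAL : 0 < AL) (hAL1 : AL < NB) (hB1 : B1 < NB) (hAH : AH ≤ NB)
    (hc : OnC p a b)
    (hfh : fh.Mem (ff (2 + (k0:ℝ) / 200) ((AH:ℝ) / NB))) (hgh : gh.Mem (gg (2 + (k0:ℝ) / 200) ((AH:ℝ) / NB)))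
    (hf1 : f1.Mem (ff (2 + (k0:ℝ) / 200) ((B1:ℝ) / NB))) (hg1 : g1.Mem (gg (2 + (k0:ℝ) / 200) ((B1:ℝ) / NB)))
    (hfl : fl.Mem (ff (2 + (k1:ℝ) / 200) ((AL:ℝ) / NB))) (hgl : gl.Mem (gg (2 + (k1:ℝ) / 200) ((AL:ℝ) / NB)))
    (hf0 : f0.Mem (ff (2 + (k1:ℝ) / 200) ((B0:ℝ) / NB))) (hg0 : g0.Mem (gg (2 + (k1:ℝ) / 200) ((B0:ℝ) / NB))) :
    (kapI k0 k1 B0 B1 AL AH fh gh f1 g1 fl gl f0 g0).2.Mem ((1 - a - b) / (a * b)) := by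
  have hN := NB_pos
  have ek0 : (0:ℝ) ≤ (k0:ℝ) / 200 := by positivity
  have ek1 : (k1:ℝ) / 200 ≤ 1 := by
    rw [div_le_one (by norm_num)]; exact_mod_cast hk1
  have hb : 0 < b := lt_of_le_of_lt (by positivity) hb0
  have hAL' : (0:ℝ) < (AL:ℝ) / NB := by have : (0:ℝ) < AL := by exact_mod_cast hAL
                                        positivity
  have ha : 0 < a := lt_of_lt_of_le hAL' hal
  have hB1' : (B1:ℝ) / NB < 1 := by rw [div_lt_one hN]; exact_mod_cast hB1
  have hAL1' : (AL:ℝ) / NB < 1 := by rw [div_lt_one hN]; exact_mod_cast hAL1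
  have hb1' : b < 1 := hb1.trans hB1'
  have hp2 : 2 ≤ p := by linarith
  have hp3 : p ≤ 3 := by linarith
  have hk := kappa_eq (by linarith : 0 < p) ha ha1 hb hb1' hc
  have hk' : (1 - a - b) / (a * b) = Th p a * Th p b - 1 := by linarith
  unfold kapI at hok ⊢
  simp only [Bool.and_eq_true, Bool.or_eq_true, decide_eq_true_eq] at hok ⊢
  obtain ⟨⟨⟨o1, o2⟩, o3⟩, o4⟩ := hok
  have tb := thI_mem hB1.le hf1 hg1 o2
  have sa := thI_mem hAL1.le hfl hgl o3
  have tb' : Th (2 + (k0:ℝ) / 200) ((B1:ℝ) / NB) ≤ Th p b :=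
    (Th_anti (by linarith) (by linarith) hb hb1.le hB1').trans (Th_mono_p (by linarith) hp0 hb hb1')
  have sa' : Th p a ≤ Th (2 + (k1:ℝ) / 200) ((AL:ℝ) / NB) :=
    (Th_mono_p (by linarith) hp1 ha ha1).trans (Th_anti (by linarith) (by linarith) hAL' hal ha1)
  have ta : ∃ t, 0 ≤ t ∧ t ≤ Th p a ∧ (if AH = NB then (fh.mul (Iv.rat 200 (400 + k0))) else thI AH fh gh).Mem t := by
    split_ifs with hif
    · refine ⟨_, ?_, ?_, Iv.mem_mul hfh (Iv.mem_rat _ (by omega))⟩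
      · have := ff_nonneg (p := 2 + (k0:ℝ) / 200) (by linarith) (by positivity : 0 ≤ (AH:ℝ) / NB)
        positivity
      · have h1 := Th_ge_one (p := 2 + (k0:ℝ) / 200) (by linarith) (by linarith) ha ha1
        refine le_trans (le_of_eq ?_) (h1.trans (Th_mono_p (by linarith) hp0 ha ha1))
        rw [hif, div_self hN.ne']
        unfold ff
        rw [show (1:ℝ) + 1 = 2 by norm_num, div_eq_mul_inv]
        congr 1
        rw [eq_comm, inv_eq_iff_eq_inv, inv_div]
        push_cast
        ring
    · have hAH' : AH < NB := lt_of_le_of_ne hAH hif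
      have hAH1 : (AH:ℝ) / NB < 1 := by rw [div_lt_one hN]; exact_mod_cast hAH'
      refine ⟨_, ?_, ?_, thI_mem hAH hfh hgh (o1.resolve_left hif)⟩
      · exact (Th_pos (by linarith) (ha.trans_le hah) hAH1).le
      · exact (Th_anti (by linarith) (by linarith) ha hah hAH1).trans (Th_mono_p (by linarith) hp0 ha ha1)
  have sb : ∃ t, Th p b ≤ t ∧ (if B0 = 0 then Iv.rat (400 + k1 : Nat) 200 else thI B0 f0 g0).Mem t := by
    split_ifs with hif
    · refine ⟨_, ?_, Iv.mem_rat _ (by omega)⟩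
      refine (Th_le_p hp2 hp3 hb hb1').trans (hp1.trans (le_of_eq ?_))
      push_cast; ring
    · have hB0 : (0:ℝ) < (B0:ℝ) / NB := by
        have : (0:ℝ) < B0 := by exact_mod_cast Nat.pos_of_ne_zero hif
        positivity
      refine ⟨_, ?_, thI_mem (r := 2 + (k1:ℝ) / 200) ?_ hf0 hg0 (o4.resolve_left hif)⟩
      · exact (Th_mono_p (by linarith) hp1 hb hb1').trans (Th_anti (by linarith) (by linarith) hB0 hb0.le hb1')
      · have : (B0:ℝ) < NB := by
          have := hb0.trans hb1'
          rwa [div_lt_one hN] at this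
        exact_mod_cast this.le
  obtain ⟨t, t0, t1, t2⟩ := ta
  obtain ⟨s, s1, s2⟩ := sb
  rw [hk']
  have P1 := Th_pos (by linarith : 0 < p) ha ha1
  have P2 := Th_pos (by linarith : 0 < p) hb hb1'
  have P3 := Th_pos (p := 2 + (k0:ℝ) / 200) (by linarith) (hb.trans hb1) hB1'
  have P4 := Th_pos (p := 2 + (k1:ℝ) / 200) (by linarith) hAL' hAL1'
  refine Iv.mem_hull (Iv.mem_sub (Iv.mem_mul t2 tb) I1_mem) (Iv.mem_sub (Iv.mem_mul sa s2) I1_mem) ?_ ?_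
  · gcongr
  · gcongr

lemma rI_mem {j2 j1 j0 kap e A B : Iv} {x2 x1 x0 k ee a b : ℝ} (h2 : j2.Mem x2) (h1 : j1.Mem x1) (h0 : j0.Mem x0)
    (hk : kap.Mem k) (he : e.Mem ee) (hA : A.Mem a) (hB : B.Mem b) :
    (rI j2 j1 j0 kap e A B).Mem (x2 * ((k - 4) + ee * (1 + 3 * (a + b) + 4 * (a * b))) + x1 * (1 + (a + b)) * ((k - 3) + ee * (2 * (a + b) + 3 * (a * b)))
      - 2 * ((1 + a) * (1 + b)) * x0 * (1 - ee * (a * b))) := by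
  have c4 : (Iv.rat 4 1).Mem 4 := by simpa using rat1_mem 4
  have c3 : (Iv.rat 3 1).Mem 3 := by simpa using rat1_mem 3
  have c2 : (Iv.rat 2 1).Mem 2 := by simpa using rat1_mem 2
  have hs := Iv.mem_add hA hB
  have hq := Iv.mem_mul hA hB
  have hg := Iv.mem_mul (Iv.mem_add I1_mem hA) (Iv.mem_add I1_mem hB)
  exact Iv.mem_sub (Iv.mem_add
    (Iv.mem_mul h2 (Iv.mem_add (Iv.mem_sub hk c4) (Iv.mem_mul he (Iv.mem_add (Iv.mem_add I1_mem (Iv.mem_mul c3 hs)) (Iv.mem_mul c4 hq)))))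
    (Iv.mem_mul (Iv.mem_mul h1 (Iv.mem_add I1_mem hs)) (Iv.mem_add (Iv.mem_sub hk c3) (Iv.mem_mul he (Iv.mem_add (Iv.mem_mul c2 hs) (Iv.mem_mul c3 hq))))))
    (Iv.mem_mul (Iv.mem_mul (Iv.mem_mul c2 hg) h0) (Iv.mem_sub I1_mem (Iv.mem_mul he hq)))

lemma ratio_aux (x y X Y Z : ℝ) : x * y * 200 / (X * Y * Z) = (x / 200) * (y / 200) / ((X / 200) * (Y / 200) * (Z / 200)) := by
  ring

set_option maxHeartbeats 2000000 in
theorem cellV_sound {k0 k1 B0 B1 AL AH : ℕ} {V : Iv} (h : cellV k0 k1 B0 B1 AL AH = (true, V)) {p a b : ℝ}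
    (hp0 : 2 + (k0:ℝ) / 200 ≤ p) (hp1 : p ≤ 2 + (k1:ℝ) / 200) (hp3 : p < 3)
    (hb0 : (B0:ℝ) / NB < b) (hb1 : b < (B1:ℝ) / NB) (hab : b < a) (ha1 : a < 1) (hc : OnC p a b) :
    V.Mem (VV p a b) := by
  unfold cellV at h
  obtain ⟨b00, eb00, h⟩ := strictV_ex h
  obtain ⟨b01, eb01, h⟩ := strictV_ex h
  obtain ⟨b10, eb10, h⟩ := strictV_ex h
  obtain ⟨b11, eb11, h⟩ := strictV_ex h
  obtain ⟨l0, el0, h⟩ := strictV_ex h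
  obtain ⟨l1, el1, h⟩ := strictV_ex h
  obtain ⟨h0, eh0, h⟩ := strictV_ex h
  obtain ⟨h1, eh1, h⟩ := strictV_ex h
  obtain ⟨c00, ec00, h⟩ := strictV_ex h
  obtain ⟨c01, ec01, h⟩ := strictV_ex h
  obtain ⟨c10, ec10, h⟩ := strictV_ex h
  obtain ⟨c11, ec11, h⟩ := strictV_ex h
  obtain ⟨m0, em0, h⟩ := strictV_ex h
  obtain ⟨m1, em1, h⟩ := strictV_ex h
  obtain ⟨n0, en0, h⟩ := strictV_ex h
  obtain ⟨n1, en1, h⟩ := strictV_ex h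
  obtain ⟨fl1, efl1, h⟩ := strictV_ex h
  obtain ⟨gl1, egl1, h⟩ := strictV_ex h
  obtain ⟨f11, ef11, h⟩ := strictV_ex h
  obtain ⟨g11, eg11, h⟩ := strictV_ex h
  obtain ⟨fh0, efh0, h⟩ := strictV_ex h
  obtain ⟨gh0, egh0, h⟩ := strictV_ex h
  obtain ⟨f00, ef00, h⟩ := strictV_ex h
  obtain ⟨g00, eg00, h⟩ := strictV_ex h
  obtain ⟨f10, ef10, h⟩ := strictV_ex h
  obtain ⟨g10, eg10, h⟩ := strictV_ex h
  obtain ⟨f01, ef01, h⟩ := strictV_ex h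
  obtain ⟨g01, eg01, h⟩ := strictV_ex h
  simp only [] at h
  obtain ⟨kap, ekap, h⟩ := strictV_ex h
  obtain ⟨up, eup, h⟩ := strictV_ex h
  obtain ⟨dn, edn, h⟩ := strictV_ex h
  obtain ⟨j2, ej2, h⟩ := strictV_ex h
  obtain ⟨j1, ej1, h⟩ := strictV_ex h
  obtain ⟨j0, ej0, h⟩ := strictV_ex h
  obtain ⟨A, eA, h⟩ := strictV_ex h
  obtain ⟨B, eB, h⟩ := strictV_ex h
  obtain ⟨Pm, ePm, h⟩ := strictV_ex h
  obtain ⟨Qm, eQm, h⟩ := strictV_ex h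
  obtain ⟨Um, eUm, h⟩ := strictV_ex h
  obtain ⟨Vm, eVm, h⟩ := strictV_ex h
  obtain ⟨P, eP, h⟩ := strictV_ex h
  obtain ⟨Q, eQ, h⟩ := strictV_ex h
  obtain ⟨e, ee, h⟩ := strictV_ex h
  obtain ⟨R, eR, h⟩ := strictV_ex h
  obtain ⟨ka, eka, h⟩ := strictV_ex h
  obtain ⟨kb, ekb, h⟩ := strictV_ex h
  obtain ⟨U, eU, h⟩ := strictV_ex h
  obtain ⟨cI, ecI, h⟩ := strictV_ex h
  obtain ⟨den, eden, h⟩ := strictV_ex h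
  obtain ⟨num, enum, h⟩ := strictV_ex h
  obtain ⟨V', eV, h⟩ := strictV_ex h
  rw [Prod.mk.injEq] at h
  obtain ⟨hok, hV⟩ := h
  subst hV
  simp only [Bool.and_eq_true, Bool.or_eq_true, decide_eq_true_eq] at hok
  obtain ⟨⟨⟨⟨⟨⟨⟨⟨⟨⟨⟨⟨⟨⟨⟨⟨⟨oK, om0⟩, ob10⟩, oPQ⟩, oden⟩, oal⟩, oah⟩, oB⟩, oBA⟩, oAL⟩, oBH⟩, oAH⟩, oB1⟩, oLH⟩, ok0⟩, ok01⟩, ok1⟩, ok00⟩ := hok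
  have hN := NB_pos
  have zk0 : (0:ℝ) < (k0:ℝ) / 200 := by have : (0:ℝ) < k0 := by exact_mod_cast ok0
                                        positivity
  have zk01 : (k0:ℝ) / 200 ≤ (k1:ℝ) / 200 := by gcongr
  have zk1 : (k1:ℝ) / 200 ≤ 1 := by rw [div_le_one (by norm_num)]; exact_mod_cast ok1
  have zk00 : (k0:ℝ) / 200 < 1 := by rw [div_lt_one (by norm_num)]; exact_mod_cast ok00
  have hk0 : k0 ≤ 200 := ok00.le
  have zk1p : (0:ℝ) < (k1:ℝ) / 200 := by linarith
  obtain ⟨m, hm⟩ : ∃ m, p = 2 + m := ⟨p - 2, by ring⟩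
  subst hm
  have hm0 : (k0:ℝ) / 200 ≤ m := by linarith
  have hm1 : m ≤ (k1:ℝ) / 200 := by linarith
  have hmp : 0 < m := by linarith
  have hmlt : m < 1 := by linarith
  have oBAL : B0 ≤ NB := by omega
  have M_b00 := pw_mem (X := B0) (k := k0) (by omega) hk0
  have M_b01 := pw_mem (X := B0) (k := k1) (by omega) ok1
  have M_b10 := pw_mem (X := B1) (k := k0) (by omega) hk0
  have M_b11 := pw_mem (X := B1) (k := k1) (by omega) ok1
  have M_l0 := pw_mem (X := AL) (k := k0) (by omega) hk0
  have M_l1 := pw_mem (X := AL) (k := k1) (by omega) ok1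
  have M_h0 := pw_mem (X := AH) (k := k0) (by omega) hk0
  have M_h1 := pw_mem (X := AH) (k := k1) (by omega) ok1
  have M_c00 := pw1_mem (X := B0) (k := k0) (by omega) hk0
  have M_c01 := pw1_mem (X := B0) (k := k1) (by omega) ok1
  have M_c10 := pw1_mem (X := B1) (k := k0) (by omega) hk0
  have M_c11 := pw1_mem (X := B1) (k := k1) (by omega) ok1
  have M_m0 := pw1_mem (X := AL) (k := k0) (by omega) hk0
  have M_m1 := pw1_mem (X := AL) (k := k1) (by omega) ok1
  have M_n0 := pw1_mem (X := AH) (k := k0) (by omega) hk0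
  have M_n1 := pw1_mem (X := AH) (k := k1) (by omega) ok1
  rw [← eb00] at M_b00
  rw [← eb01] at M_b01
  rw [← eb10] at M_b10
  rw [← eb11] at M_b11
  rw [← el0] at M_l0
  rw [← el1] at M_l1
  rw [← eh0] at M_h0
  rw [← eh1] at M_h1
  rw [← ec00] at M_c00
  rw [← ec01] at M_c01
  rw [← ec10] at M_c10
  rw [← ec11] at M_c11
  rw [← em0] at M_m0
  rw [← em1] at M_m1
  rw [← en0] at M_n0
  rw [← en1] at M_n1
  have M_fl1 := ffI_mem zk1p.le M_m1
  have M_gl1 := ggI_mem zk1p.le M_l1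
  have M_f11 := ffI_mem zk1p.le M_c11
  have M_g11 := ggI_mem zk1p.le M_b11
  have M_fh0 := ffI_mem zk0.le M_n0
  have M_gh0 := ggI_mem zk0.le M_h0
  have M_f00 := ffI_mem zk0.le M_c00
  have M_g00 := ggI_mem zk0.le M_b00
  have M_f10 := ffI_mem zk0.le M_c10
  have M_g10 := ggI_mem zk0.le M_b10
  have M_f01 := ffI_mem zk1p.le M_c01
  have M_g01 := ggI_mem zk1p.le M_b01
  rw [← efl1] at M_fl1
  rw [← egl1] at M_gl1
  rw [← ef11] at M_f11
  rw [← eg11] at M_g11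
  rw [← efh0] at M_fh0
  rw [← egh0] at M_gh0
  rw [← ef00] at M_f00
  rw [← eg00] at M_g00
  rw [← ef10] at M_f10
  rw [← eg10] at M_g10
  rw [← ef01] at M_f01
  rw [← eg01] at M_g01
  have M_B1 := nd_mem B1
  have M_B0 := nd_mem B0
  have M_AL := nd_mem AL
  have M_AH := nd_mem AH
  have rB : (B0:ℝ) / NB < (B1:ℝ) / NB := hb0.trans hb1
  have rBA : (B0:ℝ) / NB < (AL:ℝ) / NB := by gcongr
  have rAL : (AL:ℝ) / NB < 1 := by rw [div_lt_one hN]; exact_mod_cast oAL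
  have rBH : (B1:ℝ) / NB < (AH:ℝ) / NB := by gcongr
  have rAH : (AH:ℝ) / NB ≤ 1 := by rw [div_le_one hN]; exact_mod_cast oAH
  have rB1 : (B1:ℝ) / NB < 1 := by rw [div_lt_one hN]; exact_mod_cast oB1
  have rB0 : (0:ℝ) ≤ (B0:ℝ) / NB := by positivity
  have hb : 0 < b := by linarith
  have ha : 0 < a := by linarith
  -- bounds for a
  have hal : (AL:ℝ) / NB ≤ a := by
    refine OnC.lower (p := 2 + m) (by linarith) hp1 ha.le hb hb1.le rB1.le rAL.le hc ?_
    have := Iv.nonneg_of_lo (Iv.mem_sub (Iv.mem_mul M_gl1 M_g11) (Iv.mem_mul M_fl1 M_f11)) oal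
    linarith
  have hah : a ≤ (AH:ℝ) / NB := by
    rcases oah with o | o
    · rw [o, div_self hN.ne']; exact ha1.le
    · refine OnC.upper (p := 2 + m) (by linarith) hp0 (by positivity) ha1.le rB0 hb0.le hb (by linarith) hc ?_
      have := Iv.nonneg_of_lo (Iv.mem_sub (Iv.mem_mul M_fh0 M_f00) (Iv.mem_mul M_gh0 M_g00)) o
      linarith
  have M_kap := kapI_mem oK hp0 hp1 ok1 hb0 hb1 ha1 hal hah (by omega) oAL oB1 oAH hc M_fh0 M_gh0 M_f10 M_g10 M_fl1 M_gl1 M_f01 M_g01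
  rw [← ekap] at M_kap
  clear M_fh0 M_gh0 M_f10 M_g10 M_fl1 M_gl1 M_f01 M_g01 M_f11 M_g11 M_f00 M_g00 efl1 egl1 ef11 eg11 efh0 egh0 ef00 eg00 ef10 eg10 ef01 eg01 oal oah oK ekap
  clear eb00 eb01 eb10 eb11 el0 el1 eh0 eh1 ec00 ec01 ec10 ec11 em0 em1 en0 en1
  have M_up := Iv.mem_mul M_m1 (Iv.mem_inv M_m0 om0)
  have M_dn := Iv.mem_mul M_b11 (Iv.mem_inv M_b10 ob10)
  have rβ1 : (0:ℝ) < (B1:ℝ) / NB := by linarith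
  rw [← eup, ← div_eq_mul_inv, ← Real.rpow_sub (by positivity)] at M_up
  rw [← edn, ← div_eq_mul_inv, ← Real.rpow_sub rβ1] at M_dn
  have oHl : AH < NB + B1 := by omega
  have oLl : AL < NB + B0 := by omega
  have M_J2l := J2I_mem oBH oHl M_b10 M_h0 M_c10 M_n0
  have M_J1l := J1I_mem oBH oHl M_b10 M_h0 M_c10 M_n0
  have M_J0l := J0I_mem oBH oHl M_b10 M_h0 M_c10 M_n0
  have M_J2h := J2I_mem oBA oLl M_b00 M_l0 M_c00 M_m0
  have M_J1h := J1I_mem oBA oLl M_b00 M_l0 M_c00 M_m0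
  have M_J0h := J0I_mem oBA oLl M_b00 M_l0 M_c00 M_m0
  have M_r1 : (Iv.rat 200 k0).Mem (1 / ((k0:ℝ) / 200)) :=
    Iv.mem_congr (Iv.mem_rat _ ok0) (by rw [one_div_div]; norm_num)
  have cast2 : (((200 - k1 : ℕ)) : ℝ) = 200 - k1 := by rw [Nat.cast_sub ok1]; norm_num
  have cast3 : (((200 - k0 : ℕ)) : ℝ) = 200 - k0 := by rw [Nat.cast_sub hk0]; norm_num
  have cast4 : (((400 - k1 : ℕ)) : ℝ) = 400 - k1 := by rw [Nat.cast_sub (by omega)]; norm_num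
  have cast5 : (((400 - k0 : ℕ)) : ℝ) = 400 - k0 := by rw [Nat.cast_sub (by omega)]; norm_num
  have rk0 : (k0:ℝ) ≠ 0 := by exact_mod_cast ok0.ne'
  have rk0' : (200:ℝ) - k0 ≠ 0 := by
    have : (k0:ℝ) < 200 := by exact_mod_cast ok00
    linarith
  have rk0'' : (400:ℝ) - k0 ≠ 0 := by
    have : (k0:ℝ) < 200 := by exact_mod_cast ok00
    linarith
  have M_r2 : (Iv.rat ((400 + k1) * (200 + k1) * 200 : Nat) ((400 + k0) * (200 + k0) * k0)).Mem
      ((2 + (k1:ℝ) / 200) * (1 + (k1:ℝ) / 200) / ((2 + (k0:ℝ) / 200) * (1 + (k0:ℝ) / 200) * ((k0:ℝ) / 200))) := by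
    refine Iv.mem_congr (Iv.mem_rat _ (by positivity)) ?_
    push_cast
    rw [ratio_aux, show (400 + (k1:ℝ)) / 200 = 2 + k1 / 200 by ring, show (400 + (k0:ℝ)) / 200 = 2 + k0 / 200 by ring,
      show (200 + (k1:ℝ)) / 200 = 1 + k1 / 200 by ring, show (200 + (k0:ℝ)) / 200 = 1 + k0 / 200 by ring]
  have M_r3 : (Iv.rat ((200 + k1) * (200 - k1) * 200 : Nat) ((200 + k0) * (200 - k0) * k0)).Mem
      ((1 + (k1:ℝ) / 200) * (1 - (k1:ℝ) / 200) / ((1 + (k0:ℝ) / 200) * (1 - (k0:ℝ) / 200) * ((k0:ℝ) / 200))) := by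
    have : 0 < 200 - k0 := by omega
    refine Iv.mem_congr (Iv.mem_rat _ (by positivity)) ?_
    push_cast
    rw [cast2, cast3]
    rw [ratio_aux, show (200 - (k1:ℝ)) / 200 = 1 - k1 / 200 by ring, show (200 - (k0:ℝ)) / 200 = 1 - k0 / 200 by ring,
      show (200 + (k1:ℝ)) / 200 = 1 + k1 / 200 by ring, show (200 + (k0:ℝ)) / 200 = 1 + k0 / 200 by ring]
  have M_r4 : (Iv.rat ((200 - k1) * (400 - k1) * 200 : Nat) ((200 - k0) * (400 - k0) * k0)).Mem
      ((1 - (k1:ℝ) / 200) * (2 - (k1:ℝ) / 200) / ((1 - (k0:ℝ) / 200) * (2 - (k0:ℝ) / 200) * ((k0:ℝ) / 200))) := by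
    have : 0 < 200 - k0 := by omega
    have : 0 < 400 - k0 := by omega
    refine Iv.mem_congr (Iv.mem_rat _ (by positivity)) ?_
    push_cast
    rw [cast2, cast3, cast4, cast5]
    rw [ratio_aux, show (200 - (k1:ℝ)) / 200 = 1 - k1 / 200 by ring, show (200 - (k0:ℝ)) / 200 = 1 - k0 / 200 by ring,
      show (400 - (k1:ℝ)) / 200 = 2 - k1 / 200 by ring, show (400 - (k0:ℝ)) / 200 = 2 - k0 / 200 by ring]
  have M_K : ((Iv.rat k0 200).hull (Iv.rat k1 200)).Mem m := by
    refine Iv.mem_hull (Iv.mem_rat _ (by norm_num)) (Iv.mem_rat _ (by norm_num)) ?_ ?_ <;> push_cast <;> assumption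
  have M_D : ((nd (AL - B1)).hull (nd (AH - B0))).Mem (a - b) := by
    refine Iv.mem_hull (nd_mem _) (nd_sub_mem (by omega)) ?_ (by linarith)
    rcases le_total B1 AL with hh | hh
    · rw [Nat.cast_sub hh, sub_div]; linarith
    · rw [Nat.sub_eq_zero_of_le hh]; simp; linarith
  have M_ka : ((kkI AL m0 l0).hull (kkI AH n1 h1)).Mem (kk (2 + m) a) := by
    refine Iv.mem_hull (kkI_mem zk0.le M_m0 M_l0) (kkI_mem zk1p.le M_n1 M_h1) ?_ ?_
    · exact (kk_mono_p (by linarith) hp0 (by positivity) rAL.le).trans (kk_mono_x (by linarith) (by positivity) hal)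
    · exact (kk_mono_p (by linarith) hp1 ha.le ha1.le).trans (kk_mono_x (by linarith) ha.le hah)
  have M_kb : ((kkI B0 c00 b00).hull (kkI B1 c11 b11)).Mem (kk (2 + m) b) := by
    refine Iv.mem_hull (kkI_mem zk0.le M_c00 M_b00) (kkI_mem zk1p.le M_c11 M_b11) ?_ ?_
    · exact (kk_mono_p (by linarith) hp0 (by positivity) (by linarith)).trans (kk_mono_x (by linarith) (by positivity) hb0.le)
    · exact (kk_mono_p (by linarith) hp1 hb.le (by linarith)).trans (kk_mono_x (by linarith) hb.le hb1.le)
  rw [← eka] at M_ka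
  rw [← ekb] at M_kb
  generalize (B0:ℝ) / NB = β0 at *
  generalize (B1:ℝ) / NB = β1 at *
  generalize (AL:ℝ) / NB = α0 at *
  generalize (AH:ℝ) / NB = α1 at *
  generalize (k0:ℝ) / 200 = μ0 at *
  generalize (k1:ℝ) / 200 = μ1 at *
  have α1lt : α1 < 1 + β1 := by linarith
  have α0lt : α0 < 1 + β0 := by linarith
  have JL := J_bounds zk0 hm0 hm1 hmlt zk1 (by linarith : 0 ≤ β1) rB1.le rBH α1lt
  have JH := J_bounds zk0 hm0 hm1 hmlt zk1 rB0 (by linarith) rBA α0lt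
  have mono1 := dd3_mono (m := m) ⟨hmp, hmlt⟩ hb.le ha.le (by linarith : 0 ≤ 1 + b) (by linarith : 0 ≤ 1 + a) (nodes_dist hab (by linarith))
    hb1.le hah (by linarith : 1 + b ≤ 1 + β1) (by linarith : 1 + a ≤ 1 + α1) (nodes_dist rBH α1lt)
  have mono2 := dd3_mono (m := m) ⟨hmp, hmlt⟩ rB0 (by linarith : 0 ≤ α0) (by linarith : 0 ≤ 1 + β0) (by linarith : 0 ≤ 1 + α0) (nodes_dist rBA α0lt)
    hb0.le hal (by linarith : 1 + β0 ≤ 1 + b) (by linarith : 1 + α0 ≤ 1 + a) (nodes_dist hab (by linarith))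
  change J0 m β1 α1 ≤ J0 m b a ∧ J1 m β1 α1 ≤ J1 m b a ∧ J2 m β1 α1 ≤ J2 m b a ∧ _ at mono1
  change J0 m b a ≤ J0 m β0 α0 ∧ J1 m b a ≤ J1 m β0 α0 ∧ J2 m b a ≤ J2 m β0 α0 ∧ _ at mono2
  have dv : ∀ {x y : ℝ}, x ≤ y → x / m ≤ y / m := fun h => div_le_div_of_nonneg_right h hmp.le
  have M_j2 := Iv.mem_hull (Iv.mem_mul (Iv.mem_mul M_J2l M_dn) M_r1) (Iv.mem_mul (Iv.mem_mul M_J2h M_up) M_r2)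
    (JL.2.2.2.1.trans (dv mono1.2.2.1)) ((dv mono2.2.2.1).trans JH.1)
  have M_j1 := Iv.mem_hull (Iv.mem_mul (Iv.mem_mul M_J1l M_dn) M_r3) (Iv.mem_mul (Iv.mem_mul M_J1h M_up) M_r1)
    (JL.2.2.2.2.1.trans (dv mono1.2.1)) ((dv mono2.2.1).trans JH.2.1)
  have M_j0 := Iv.mem_hull (Iv.mem_mul (Iv.mem_mul M_J0l M_dn) M_r4) (Iv.mem_mul (Iv.mem_mul M_J0h M_up) M_r1)
    (JL.2.2.2.2.2.trans (dv mono1.1)) ((dv mono2.1).trans JH.2.2.1)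
  rw [← ej2] at M_j2
  rw [← ej1] at M_j1
  rw [← ej0] at M_j0
  have M_A := Iv.mem_hull M_AL M_AH hal hah
  have M_B := Iv.mem_hull M_B0 M_B1 hb0.le hb1.le
  rw [← eA] at M_A
  rw [← eB] at M_B
  have powU : ∀ {x y s t : ℝ}, 0 ≤ x → x ≤ y → 0 ≤ s → s ≤ t → (1 + x) ^ s ≤ (1 + y) ^ t := by
    intro x y s t h1 h2 h3 h4
    exact (Real.rpow_le_rpow (by linarith) (by linarith : 1 + x ≤ 1 + y) h3).trans (Real.rpow_le_rpow_of_exponent_le (by linarith) h4)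
  have powL : ∀ {x y s t : ℝ}, 0 ≤ x → x ≤ y → y ≤ 1 → 0 < s → s ≤ t → x ^ t ≤ y ^ s := by
    intro x y s t h1 h2 h3 h4 h5
    exact (rpow_anti_exp h1 (h2.trans h3) h4 h5).trans (Real.rpow_le_rpow h1 h2 h4.le)
  have M_Pm := Iv.mem_hull (z := (1 + a) ^ m) M_m0 M_n1 (powU (by linarith) hal zk0.le hm0) (powU ha.le hah hmp.le hm1)
  have M_Qm := Iv.mem_hull (z := (1 + b) ^ m) M_c00 M_c11 (powU rB0 hb0.le zk0.le hm0) (powU hb.le hb1.le hmp.le hm1)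
  have M_Um := Iv.mem_hull (z := a ^ m) M_l1 M_h0 (powL (by linarith) hal ha1.le hmp hm1) (powL ha.le hah rAH zk0 hm0)
  have M_Vm := Iv.mem_hull (z := b ^ m) M_b01 M_b10 (powL rB0 hb0.le (by linarith) hmp hm1) (powL hb.le hb1.le rB1.le zk0 hm0)
  rw [← ePm] at M_Pm
  rw [← eQm] at M_Qm
  rw [← eUm] at M_Um
  rw [← eVm] at M_Vm
  have M_P := Iv.mem_mul (Iv.mem_add I1_mem M_A) M_Pm
  have M_Q := Iv.mem_mul (Iv.mem_add I1_mem M_B) M_Qm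
  rw [← eP] at M_P
  rw [← eQ] at M_Q
  have M_e := Iv.mem_mul (Iv.mem_mul M_Um M_Vm) (Iv.mem_inv (Iv.mem_mul M_P M_Q) oPQ)
  rw [← ee, ← div_eq_mul_inv] at M_e
  change Iv.Mem (eps m a b) e at M_e
  have M_R := rI_mem M_j2 M_j1 M_j0 M_kap M_e M_A M_B
  rw [← eR] at M_R
  have M_U := Iv.mem_mul M_A M_Um
  rw [← eU] at M_U
  have M_c := Iv.mem_add (Iv.mem_sub M_P M_U) (Iv.mem_mul M_P M_U)
  rw [← ecI] at M_c
  have hP1 : (1 + a) * (1 + a) ^ m = (1 + a) ^ (2 + m - 1) := by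
    rw [rpow_pred (by linarith : 0 < 1 + a) (p := 2 + m - 1)]; congr 2; ring
  have hQ1 : (1 + b) * (1 + b) ^ m = (1 + b) ^ (2 + m - 1) := by
    rw [rpow_pred (by linarith : 0 < 1 + b) (p := 2 + m - 1)]; congr 2; ring
  have hU1 : a * a ^ m = a ^ (2 + m - 1) := by
    rw [rpow_pred ha (p := 2 + m - 1)]; congr 2; ring
  rw [hP1, hU1] at M_c
  rw [hP1] at M_P
  rw [hQ1] at M_Q
  change Iv.Mem (cc (2 + m) a) cI at M_c
  have M_den := Iv.mem_mul (Iv.mem_mul M_kb M_c) (Iv.mem_mul (Iv.mem_add (Iv.mem_add I1_mem M_A) M_B) (Iv.mem_add M_ka M_kb))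
  rw [← eden] at M_den
  have M_num := Iv.mem_mul (Iv.mem_mul (Iv.mem_mul (Iv.mem_mul M_D (Iv.mem_mul M_A M_B)) M_ka) (Iv.mem_mul M_P M_Q)) M_K
  rw [← enum] at M_num
  have M_V := Iv.mem_neg (Iv.mem_mul (Iv.mem_mul M_num (Iv.mem_inv M_den oden)) M_R)
  rw [← eV] at M_V
  refine Iv.mem_congr M_V ?_
  rw [VV_eq hb hab ha1]
  unfold om RR
  rw [show 2 + m - 2 = m by ring]
  change _ = - (_ * (J2 m b a * _ + J1 m b a * _ * _ - _ * J0 m b a * _))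
  have hm' : m ≠ 0 := hmp.ne'
  have q2 : J2 m b a = m * (J2 m b a / m) := by field_simp
  have q1 : J1 m b a = m * (J1 m b a / m) := by field_simp
  have q0 : J0 m b a = m * (J0 m b a / m) := by field_simp
  generalize J2 m b a / m = x2 at *
  generalize J1 m b a / m = x1 at *
  generalize J0 m b a / m = x0 at *
  rw [q2, q1, q0]
  generalize eps m a b = ε
  generalize (1 - a - b) / (a * b) = κ
  generalize kk (2 + m) a = K
  generalize kk (2 + m) b = K'
  generalize cc (2 + m) a = C
  generalize (1 + a) ^ (2 + m - 1) = P'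
  generalize (1 + b) ^ (2 + m - 1) = Q'
  rw [show K' * C * (1 + a + b) * (K + K') = K' * C * ((1 + a + b) * (K + K')) by ring, div_eq_mul_inv]
  generalize (K' * C * ((1 + a + b) * (K + K')))⁻¹ = W
  ring

lemma GG_symm (p a b : ℝ) : GG p a b = GG p b a := by
  unfold GG
  rw [add_comm (kk p a) (kk p b), add_comm (Real.log (kk p a)) (Real.log (kk p b)), add_right_comm]

lemma exists_star {p : ℝ} (hp : 0 < p) : ∃ s, 0 < s ∧ s < 1 ∧ ff p s = gg p s := by
  have hc : ContinuousOn (fun x => ff p x - gg p x) (Set.Icc 0 1) := ((ff_cont hp).sub (gg_cont hp)).continuousOn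
  have h1 : 0 < ff p 1 := ff_pos hp one_pos
  obtain ⟨s, hs, e⟩ := intermediate_value_Ioo (zero_le_one) hc (show (0:ℝ) ∈ Set.Ioo (ff p 0 - gg p 0) (ff p 1 - gg p 1) by
    rw [ff_zero, gg_zero hp, gg_one]; constructor <;> linarith)
  exact ⟨s, hs.1, hs.2, by simpa [sub_eq_zero] using e⟩

lemma above_diag {p a b s : ℝ} (hp : 0 < p) (hs : ff p s = gg p s) (hb : 0 ≤ b) (hbs : b < s)
    (ha : 0 ≤ a) (h : OnC p a b) : b < a := by
  by_contra hab
  push Not at hab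
  have e1 := ff_le hp ha hab
  have e2 := ff_lt hp hb hbs
  have e3 := gg_lt hp hb hbs
  have e4 := gg_le hp ha hab
  have e5 := ff_nonneg hp ha
  have e6 := ff_nonneg hp hb
  unfold OnC at h
  nlinarith

lemma le_star {p a b s : ℝ} (hp : 0 < p) (hs : ff p s = gg p s) (hs0 : 0 < s) (ha1 : a ≤ 1) (hb1 : b ≤ 1)
    (hab : b ≤ a) (h : OnC p a b) : b ≤ s := by
  by_contra hbs
  push Not at hbs
  have e1 := ff_lt hp hs0.le hbs
  have e2 := ff_lt hp hs0.le (hbs.trans_le hab)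
  have e3 := gg_lt hp hs0.le hbs
  have e4 := gg_lt hp hs0.le (hbs.trans_le hab)
  have e5 := ff_pos hp hs0
  have e6 := gg_nonneg hp (by linarith : 0 ≤ b) hb1
  have e7 := gg_nonneg hp (by linarith : 0 ≤ a) ha1
  unfold OnC at h
  nlinarith

/-- path data -/
structure PathD (p : ℝ) (α : ℝ → ℝ) (s : ℝ) : Prop where
  hp : 1 < p
  hc : ContinuousOn α (Set.Icc 0 1)
  hα : ∀ b ∈ Set.Icc (0:ℝ) 1, α b ∈ Set.Icc (0:ℝ) 1 ∧ OnC p (α b) b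
  s0 : 0 < s
  s1 : s < 1
  hs : ff p s = gg p s

lemma PathD.exists {p : ℝ} (hp : 1 < p) : ∃ α s, PathD p α s := by
  obtain ⟨α, h1, h2⟩ := path_exists (by linarith : 0 < p)
  obtain ⟨s, h3, h4, h5⟩ := exists_star (by linarith : 0 < p)
  exact ⟨α, s, hp, h1, h2, h3, h4, h5⟩

lemma PathD.mem {p s : ℝ} {α : ℝ → ℝ} (H : PathD p α s) {b : ℝ} (hb : 0 < b) (hbs : b < s) :
    b < α b ∧ α b < 1 ∧ OnC p (α b) b := by
  have := H.hp
  have h := H.hα b ⟨hb.le, by linarith [H.s1]⟩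
  exact ⟨above_diag (by linarith) H.hs hb.le hbs h.1.1 h.2, OnC.a_lt_one (by linarith) h.1.1 hb h.1.2 h.2, h.2⟩

lemma PathD.alpha_eq {p s : ℝ} {α : ℝ → ℝ} (H : PathD p α s) {a b : ℝ} (ha : a ∈ Set.Icc (0:ℝ) 1) (hb : b ∈ Set.Icc (0:ℝ) 1)
    (h : OnC p a b) : α b = a := by
  have := H.hp
  exact OnC.unique (by linarith) (H.hα b hb).1 hb ha (H.hα b hb).2 h

lemma PathD.alpha_zero {p s : ℝ} {α : ℝ → ℝ} (H : PathD p α s) : α 0 = 1 := by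
  have := H.hp
  refine H.alpha_eq (by simp) (by simp) ?_
  unfold OnC
  rw [ff_zero, gg_one]; ring

lemma PathD.alpha_s {p s : ℝ} {α : ℝ → ℝ} (H : PathD p α s) : α s = s := by
  refine H.alpha_eq ⟨H.s0.le, H.s1.le⟩ ⟨H.s0.le, H.s1.le⟩ ?_
  unfold OnC
  rw [H.hs]

lemma PathD.all {p s c : ℝ} {α : ℝ → ℝ} (H : PathD p α s) (h : ∀ b, 0 ≤ b → b ≤ s → c ≤ GG p (α b) b)
    {a b : ℝ} (ha : a ∈ Set.Icc (0:ℝ) 1) (hb : b ∈ Set.Icc (0:ℝ) 1) (hC : OnC p a b) : c ≤ GG p a b := by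
  have := H.hp
  have key : ∀ {a b : ℝ}, a ∈ Set.Icc (0:ℝ) 1 → b ∈ Set.Icc (0:ℝ) 1 → OnC p a b → b ≤ a → c ≤ GG p a b := by
    intro a b ha hb hC hab
    have := h b hb.1 (le_star (by linarith) H.hs H.s0 ha.2 hb.2 hab hC)
    rwa [H.alpha_eq ha hb hC] at this
  rcases le_total b a with hab | hab
  · exact key ha hb hC hab
  · rw [GG_symm]; exact key hb ha hC.symm hab

lemma PathD.star_unique {p s t : ℝ} {α : ℝ → ℝ} (H : PathD p α s) (t0 : 0 ≤ t) (ht : ff p t = gg p t) : t = s := by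
  have hp : 0 < p := by have := H.hp; linarith
  rcases lt_trichotomy t s with h | h | h
  · have e1 := ff_lt hp t0 h
    have e2 := gg_lt hp t0 h
    have := H.hs
    linarith
  · exact h
  · have e1 := ff_lt hp H.s0.le h
    have e2 := gg_lt hp H.s0.le h
    have := H.hs
    linarith

def Min0 (p : ℝ) : Prop := ∀ a b : ℝ, a ∈ Set.Icc (0:ℝ) 1 → b ∈ Set.Icc (0:ℝ) 1 → OnC p a b → GG p 1 0 ≤ GG p a b
def Min1 (p : ℝ) : Prop := ∀ s : ℝ, 0 ≤ s → ff p s = gg p s → ∀ a b : ℝ, a ∈ Set.Icc (0:ℝ) 1 → b ∈ Set.Icc (0:ℝ) 1 → OnC p a b → GG p s s ≤ GG p a b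
def MinM (p : ℝ) : Prop := ∀ s : ℝ, 0 ≤ s → ff p s = gg p s → ∀ a b : ℝ, a ∈ Set.Icc (0:ℝ) 1 → b ∈ Set.Icc (0:ℝ) 1 → OnC p a b →
  GG p 1 0 ≤ GG p a b ∨ GG p s s ≤ GG p a b

lemma VV_nonneg {p a b : ℝ} (hp : 1 < p) (hb : 0 < b) (ha : 0 < a) (h : TT p a b ≤ 0) : 0 ≤ VV p a b := by
  have k1 := kk_pos (by linarith : 0 < p) ha.le
  have k2 := kk_pos (by linarith : 0 < p) hb.le
  have k3 := cc_pos hp ha.le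
  unfold VV
  rw [← neg_div]
  apply div_nonneg
  · nlinarith
  · positivity

lemma VV_nonpos {p a b : ℝ} (hp : 1 < p) (hb : 0 < b) (ha : 0 < a) (h : 0 ≤ TT p a b) : VV p a b ≤ 0 := by
  have k1 := kk_pos (by linarith : 0 < p) ha.le
  have k2 := kk_pos (by linarith : 0 < p) hb.le
  have k3 := cc_pos hp ha.le
  unfold VV
  rw [neg_nonpos]
  positivity

theorem Min0_of_TT {p : ℝ} (hp : 1 < p) (h : ∀ a b : ℝ, 0 < b → b < a → a < 1 → OnC p a b → TT p a b ≤ 0) : Min0 p := by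
  obtain ⟨α, s, H⟩ := PathD.exists hp
  intro a b ha hb hC
  refine H.all ?_ ha hb hC
  intro b hb hbs
  have := cell_lower hp H.hc H.hα le_rfl hb (by linarith [H.s1]) (c := 0) (by
    intro x hx
    obtain ⟨h1, h2, h3⟩ := H.mem hx.1 (hx.2.trans_le hbs)
    exact VV_nonneg hp hx.1 (hx.1.trans h1) (h _ _ hx.1 h1 h2 h3))
  rw [H.alpha_zero] at this
  linarith

theorem Min1_of_TT {p : ℝ} (hp : 1 < p) (h : ∀ a b : ℝ, 0 < b → b < a → a < 1 → OnC p a b → 0 ≤ TT p a b) : Min1 p := by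
  obtain ⟨α, s, H⟩ := PathD.exists hp
  intro t t0 ht a b ha hb hC
  rw [H.star_unique t0 ht]
  refine H.all ?_ ha hb hC
  intro b hb hbs
  have := cell_upper hp H.hc H.hα hb hbs H.s1.le (c := 0) (by
    intro x hx
    have hx0 := lt_of_le_of_lt hb hx.1
    obtain ⟨h1, h2, h3⟩ := H.mem hx0 hx.2
    exact VV_nonpos hp hx0 (hx0.trans h1) (h _ _ hx0 h1 h2 h3))
  rw [H.alpha_s] at this
  linarith

lemma cellV_flags {k0 k1 B0 B1 AL AH : ℕ} {V : Iv} (h : cellV k0 k1 B0 B1 AL AH = (true, V)) :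
    B0 < B1 ∧ B1 < NB ∧ 0 < k0 ∧ k0 ≤ k1 ∧ k0 < 200 := by
  unfold cellV at h
  iterate 28 obtain ⟨_, -, h⟩ := strictV_ex h
  simp only [] at h
  iterate 23 obtain ⟨_, -, h⟩ := strictV_ex h
  rw [Prod.mk.injEq] at h
  obtain ⟨hok, -⟩ := h
  simp only [Bool.and_eq_true, decide_eq_true_eq] at hok
  tauto

section engine
variable {p s : ℝ} {α : ℝ → ℝ} {k0 k1 : ℕ}

lemma cell_lo (H : PathD p α s) (hp0 : 2 + (k0:ℝ) / 200 ≤ p) (hp1 : p ≤ 2 + (k1:ℝ) / 200) (hp3 : p < 3)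
    {B0 B1 AL AH : ℕ} {V : Iv} (hV : cellV k0 k1 B0 B1 AL AH = (true, V)) {x y : ℝ}
    (hx : (B0:ℝ) / NB ≤ x) (hxy : x ≤ y) (hy : y ≤ (B1:ℝ) / NB) (hys : y ≤ s) :
    (V.lo:ℝ) * ((y - x) * NB) ≤ (GG p (α y) y - GG p (α x) x) * SC * NB := by
  have hS := SC_pos
  have hN := NB_pos
  have hx0 : 0 ≤ x := le_trans (by positivity) hx
  have := cell_lower H.hp H.hc H.hα hx0 hxy (by linarith [H.s1]) (c := (V.lo:ℝ) / SC) (by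
    intro b hb
    obtain ⟨h1, h2, h3⟩ := H.mem (lt_of_le_of_lt hx0 hb.1) (hb.2.trans_le hys)
    have := cellV_sound hV hp0 hp1 hp3 (lt_of_le_of_lt hx hb.1) (hb.2.trans_le hy) h1 h2 h3
    rw [div_le_iff₀ hS]; exact this.1)
  have e : (V.lo:ℝ) * ((y - x) * NB) = (V.lo:ℝ) / SC * (y - x) * SC * NB := by field_simp
  rw [e]; gcongr

lemma cell_hi (H : PathD p α s) (hp0 : 2 + (k0:ℝ) / 200 ≤ p) (hp1 : p ≤ 2 + (k1:ℝ) / 200) (hp3 : p < 3)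
    {B0 B1 AL AH : ℕ} {V : Iv} (hV : cellV k0 k1 B0 B1 AL AH = (true, V)) {x y : ℝ}
    (hx : (B0:ℝ) / NB ≤ x) (hxy : x ≤ y) (hy : y ≤ (B1:ℝ) / NB) (hys : y ≤ s) :
    (GG p (α y) y - GG p (α x) x) * SC * NB ≤ (V.hi:ℝ) * ((y - x) * NB) := by
  have hS := SC_pos
  have hN := NB_pos
  have hx0 : 0 ≤ x := le_trans (by positivity) hx
  have := cell_upper H.hp H.hc H.hα hx0 hxy (by linarith [H.s1]) (c := (V.hi:ℝ) / SC) (by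
    intro b hb
    obtain ⟨h1, h2, h3⟩ := H.mem (lt_of_le_of_lt hx0 hb.1) (hb.2.trans_le hys)
    have := cellV_sound hV hp0 hp1 hp3 (lt_of_le_of_lt hx hb.1) (hb.2.trans_le hy) h1 h2 h3
    rw [le_div_iff₀ hS]; exact this.2)
  have e : (V.hi:ℝ) * ((y - x) * NB) = (V.hi:ℝ) / SC * (y - x) * SC * NB := by field_simp
  rw [e]; gcongr

lemma interp {A v t T : ℝ} (h0 : 0 ≤ A) (h1 : 0 ≤ A + v * T) (ht : 0 ≤ t) (htT : t ≤ T) : 0 ≤ A + v * t := by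
  rcases le_total 0 v with h | h
  · positivity
  · nlinarith

/-- abstract cell property -/
def CellProp (p s : ℝ) (α : ℝ → ℝ) (C : ℕ → ℕ → ℕ → ℕ → Bool × Iv) : Prop :=
  ∀ B0 B1 AL AH, (C B0 B1 AL AH).1 = true → B0 < B1 ∧ B1 < NB ∧ ∀ x y : ℝ, (B0:ℝ) / NB ≤ x → x ≤ y → y ≤ (B1:ℝ) / NB → y ≤ s →
    ((C B0 B1 AL AH).2.lo:ℝ) * ((y - x) * NB) ≤ (GG p (α y) y - GG p (α x) x) * SC * NB ∧
    (GG p (α y) y - GG p (α x) x) * SC * NB ≤ ((C B0 B1 AL AH).2.hi:ℝ) * ((y - x) * NB)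

lemma cellProp (H : PathD p α s) (hp0 : 2 + (k0:ℝ) / 200 ≤ p) (hp1 : p ≤ 2 + (k1:ℝ) / 200) (hp3 : p < 3) :
    CellProp p s α (cellV k0 k1) := by
  intro B0 B1 AL AH h
  rcases hV : cellV k0 k1 B0 B1 AL AH with ⟨ok, V⟩
  rw [hV] at h
  simp only at h
  subst h
  have hf := cellV_flags hV
  exact ⟨hf.1, hf.2.1, fun x y h1 h2 h3 h4 => ⟨cell_lo H hp0 hp1 hp3 hV h1 h2 h3 h4, cell_hi H hp0 hp1 hp3 hV h1 h2 h3 h4⟩⟩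

lemma star_le {r x : ℝ} (H : PathD p α s) (hr : 0 < r) (hrp : r ≤ p) (hx : 0 ≤ x) (h : gg r x ≤ ff r x) : s ≤ x := by
  by_contra hh
  push Not at hh
  have hp : 0 < p := by linarith
  have e1 := ff_lt hp hx hh
  have e2 := gg_lt hp hx hh
  have e3 := ff_scale hr hrp hx
  have e4 := gg_scale hr hrp hx
  have e5 : 0 < p / r := by positivity
  have e6 := mul_le_mul_of_nonneg_left h e5.le
  have := H.hs
  linarith

lemma star_ge {r x : ℝ} (H : PathD p α s) (hrp : p ≤ r) (hx : 0 ≤ x) (h : ff r x ≤ gg r x) : x ≤ s := by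
  by_contra hh
  push Not at hh
  have hp : 0 < p := by linarith [H.hp]
  have e1 := ff_lt hp H.s0.le hh
  have e2 := gg_lt hp H.s0.le hh
  have e3 := ff_scale hp hrp hx
  have e4 := gg_scale hp hrp hx
  have e5 : 0 < r / p := div_pos (by linarith) hp
  have := H.hs
  have e6 : r / p * gg p x < r / p * ff p x := mul_lt_mul_of_pos_left (by linarith) e5
  linarith

lemma end_hi (H : PathD p α s) (hp0 : 2 + (k0:ℝ) / 200 ≤ p) (hk : k0 ≤ 200) {B : ℕ} (hB : B < NB)
    (h : 0 ≤ ((ffI B (pw (NB + B) k0)).sub (ggI B (pw B k0))).lo) : s ≤ (B:ℝ) / NB := by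
  have hN := NB_pos
  have hm : (0:ℝ) ≤ (k0:ℝ) / 200 := by positivity
  have m1 := ffI_mem hm (pw1_mem (X := B) (k := k0) hB.le hk)
  have m2 := ggI_mem hm (pw_mem (X := B) (k := k0) (by omega) hk)
  have := Iv.nonneg_of_lo (Iv.mem_sub m1 m2) h
  exact star_le H (by positivity) hp0 (by positivity) (by linarith)

lemma end_lo (H : PathD p α s) (hp1 : p ≤ 2 + (k1:ℝ) / 200) (hk : k1 ≤ 200) {B : ℕ} (hB : B < NB)
    (h : 0 ≤ ((ggI B (pw B k1)).sub (ffI B (pw (NB + B) k1))).lo) : (B:ℝ) / NB ≤ s := by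
  have hN := NB_pos
  have hm : (0:ℝ) ≤ (k1:ℝ) / 200 := by positivity
  have m1 := ffI_mem hm (pw1_mem (X := B) (k := k1) hB.le hk)
  have m2 := ggI_mem hm (pw_mem (X := B) (k := k1) (by omega) hk)
  have := Iv.nonneg_of_lo (Iv.mem_sub m2 m1) h
  exact star_ge H hp1 (by positivity) (by linarith)

lemma lasE_sound (H : PathD p α s) (hp0 : 2 + (k0:ℝ) / 200 ≤ p) (hp1 : p ≤ 2 + (k1:ℝ) / 200) (hk : k0 ≤ 200) (hk1 : k1 ≤ 200) :
    ∀ B0 B1 : ℕ, lasE k0 k1 B0 B1 = true → B1 < NB → B0 < B1 → (B0:ℝ) / NB ≤ s ∧ s ≤ (B1:ℝ) / NB := by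
  intro B0 B1 h h1 h0
  unfold lasE at h
  simp only [Bool.and_eq_true, decide_eq_true_eq] at h
  exact ⟨end_lo H hp1 hk1 (h0.trans h1) h.1, end_hi H hp0 hk h1 h.2⟩

end engine

/-- chunked version of `preG` -/
def preC (C : Nat → Nat → Nat → Nat → Bool × Iv) (B' : Nat) (accE : Int) : List (Nat × Nat × Nat) → Nat → Int → Bool
  | [], B0, acc => decide (B0 = B') && decide (accE ≤ acc) && decide (0 ≤ accE)
  | (B1, AL, AH) :: t, B0, acc =>
    match C B0 B1 AL AH with
    | (ok, V) => ok && strictI (acc + V.lo * (B1 - B0 : Int)) (fun acc' => decide (0 ≤ acc') && preC C B' accE t B1 acc')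

/-- chunked suffix sums -/
def sufC (C : Nat → Nat → Nat → Nat → Bool × Iv) (B' : Nat) (S' : Int) : List (Nat × Nat × Nat) → Nat → Bool × Int
  | [], B0 => (decide (B0 = B') && decide (0 ≤ S'), S')
  | (B1, AL, AH) :: t, B0 =>
      match sufC C B' S' t B1, C B0 B1 AL AH with
      | (ok', s), (ok, V) => (ok' && ok && decide (0 ≤ s - V.hi * (B1 - B0 : Int)), s - V.hi * (B1 - B0 : Int))

/-- the last cell -/
def lasC (C : Nat → Nat → Nat → Nat → Bool × Iv) (E : Nat → Nat → Bool) (B0 B1 AL AH : Nat) : Bool :=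
   (C B0 B1 AL AH).1 && decide ((C B0 B1 AL AH).2.hi ≤ 0) && E B0 B1

def sufCk (C : Nat → Nat → Nat → Nat → Bool × Iv) (B' : Nat) (S' : Int) (L : List (Nat × Nat × Nat)) (B0 : Nat) (S : Int) : Bool :=
  (sufC C B' S' L B0).1 && decide (S ≤ (sufC C B' S' L B0).2) && decide (0 ≤ S)

lemma preC_cons (C : ℕ → ℕ → ℕ → ℕ → Bool × Iv) (B' : ℕ) (e : ℤ) (B1 AL AH : ℕ) (t : List (ℕ×ℕ×ℕ)) (B0 : ℕ) (acc : ℤ) : preC C B' e ((B1,AL,AH)::t) B0 acc =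
   ((C B0 B1 AL AH).1 && strictI (acc + (C B0 B1 AL AH).2.lo * (B1 - B0 : Int)) (fun acc' => decide (0 ≤ acc') && preC C B' e t B1 acc')) := rfl
lemma sufC_cons (C : ℕ → ℕ → ℕ → ℕ → Bool × Iv) (B' : ℕ) (S' : ℤ) (B1 AL AH : ℕ) (t : List (ℕ×ℕ×ℕ)) (B0 : ℕ) : sufC C B' S' ((B1,AL,AH)::t) B0 =
   ((sufC C B' S' t B1).1 && (C B0 B1 AL AH).1 && decide (0 ≤ (sufC C B' S' t B1).2 - (C B0 B1 AL AH).2.hi * (B1 - B0 : Int)),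
     (sufC C B' S' t B1).2 - (C B0 B1 AL AH).2.hi * (B1 - B0 : Int)) := rfl

section engine
variable {p s : ℝ} {α : ℝ → ℝ} {k0 k1 : ℕ}

lemma fin_aux {x : ℝ} (h : 0 ≤ x * SC * NB) : 0 ≤ x := by
  have hS := SC_pos
  have hN := NB_pos
  by_contra hh
  push Not at hh
  have : x * SC * NB < 0 := mul_neg_of_neg_of_pos (mul_neg_of_neg_of_pos hh hS) hN
  linarith

def PreSt (p s : ℝ) (α : ℝ → ℝ) (B : ℕ) (acc : ℤ) : Prop :=
  (∀ b : ℝ, 0 ≤ b → b ≤ s → b ≤ (B:ℝ) / NB → GG p 1 0 ≤ GG p (α b) b) ∧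
  ((B:ℝ) / NB ≤ s → (acc:ℝ) ≤ (GG p (α ((B:ℝ) / NB)) ((B:ℝ) / NB) - GG p 1 0) * SC * NB) ∧ 0 ≤ acc

lemma preSt_zero (H : PathD p α s) : PreSt p s α 0 0 := by
  refine ⟨?_, ?_, le_rfl⟩
  · intro b h1 h2 h3
    have : b = 0 := le_antisymm (by simpa using h3) h1
    rw [this, H.alpha_zero]
  · simp [H.alpha_zero]

lemma preC_sound {C : ℕ → ℕ → ℕ → ℕ → Bool × Iv} (hC : CellProp p s α C) {B' : ℕ} {e : ℤ} :
    ∀ (L : List (ℕ × ℕ × ℕ)) (B0 : ℕ) (acc : ℤ), preC C B' e L B0 acc = true → PreSt p s α B0 acc → PreSt p s α B' e := by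
  have hS := SC_pos
  have hN := NB_pos
  intro L
  induction L with
  | nil =>
    intro B0 acc h hst
    simp only [preC, Bool.and_eq_true, decide_eq_true_eq] at h
    obtain ⟨⟨rfl, h2⟩, h3⟩ := h
    exact ⟨hst.1, fun hb => le_trans (by exact_mod_cast h2) (hst.2.1 hb), h3⟩
  | cons hd t ih =>
    obtain ⟨B1, AL, AH⟩ := hd
    intro B0 acc hok hst
    obtain ⟨hst1, h1, h0⟩ := hst
    rw [preC_cons] at hok
    simp only [strictI_eq, Bool.and_eq_true, decide_eq_true_eq] at hok
    obtain ⟨o1, o2, o3⟩ := hok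
    obtain ⟨hB, -, hcell⟩ := hC B0 B1 AL AH o1
    generalize (C B0 B1 AL AH).2 = V at *
    have h0' : (0:ℝ) ≤ acc := by exact_mod_cast h0
    have o2' : (0:ℝ) ≤ acc + V.lo * ((B1:ℝ) - B0) := by exact_mod_cast o2
    have hB01 : (B0:ℝ) / NB ≤ (B1:ℝ) / NB := by gcongr
    refine ih B1 _ o3 ⟨?_, ?_, o2⟩
    · intro b hb0 hbs hle
      rcases le_total b ((B0:ℝ) / NB) with hb | hb
      · exact hst1 b hb0 hbs hb
      have k := (hcell _ _ le_rfl hb hle hbs).1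
      have k2 := h1 (hb.trans hbs)
      have hb' : b * NB ≤ B1 := by rwa [le_div_iff₀ hN] at hle
      have hb'' : (B0:ℝ) ≤ b * NB := by rwa [div_le_iff₀ hN] at hb
      have e : (b - (B0:ℝ) / NB) * NB = b * NB - B0 := by field_simp
      rw [e] at k
      have := interp h0' o2' (t := b * NB - B0) (by linarith) (by linarith)
      have := fin_aux (x := GG p (α b) b - GG p 1 0) (by linarith)
      linarith
    · intro hB1
      have k := (hcell _ _ le_rfl hB01 le_rfl hB1).1
      have k2 := h1 (hB01.trans hB1)
      have e : ((B1:ℝ) / NB - (B0:ℝ) / NB) * NB = B1 - B0 := by field_simp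
      rw [e] at k
      push_cast
      linarith

def SufSt (p s : ℝ) (α : ℝ → ℝ) (B : ℕ) (S : ℤ) : Prop :=
  (B:ℝ) / NB ≤ s ∧ 0 ≤ S ∧ (S : ℝ) ≤ (GG p (α ((B:ℝ) / NB)) ((B:ℝ) / NB) - GG p (α s) s) * SC * NB ∧
      ∀ b : ℝ, (B:ℝ) / NB ≤ b → b ≤ s → GG p (α s) s ≤ GG p (α b) b

lemma lasC_sound {C : ℕ → ℕ → ℕ → ℕ → Bool × Iv} (hC : CellProp p s α C) {E : ℕ → ℕ → Bool}
    (hE : ∀ B0 B1 : ℕ, E B0 B1 = true → B1 < NB → B0 < B1 → (B0:ℝ) / NB ≤ s ∧ s ≤ (B1:ℝ) / NB)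
    {B0 B1 AL AH : ℕ} (h : lasC C E B0 B1 AL AH = true) : SufSt p s α B0 0 := by
  have hN := NB_pos
  simp only [lasC, Bool.and_eq_true, decide_eq_true_eq] at h
  obtain ⟨⟨o1, o2⟩, o3⟩ := h
  obtain ⟨hB, hBN, hcell⟩ := hC B0 B1 AL AH o1
  obtain ⟨e1, e2⟩ := hE B0 B1 o3 hBN hB
  generalize (C B0 B1 AL AH).2 = V at *
  have o2' : (V.hi:ℝ) ≤ 0 := by exact_mod_cast o2
  have key : ∀ b : ℝ, (B0:ℝ) / NB ≤ b → b ≤ s → 0 ≤ (GG p (α b) b - GG p (α s) s) * SC * NB := by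
    intro b hb hbs
    have k := (hcell b s hb hbs e2 le_rfl).2
    have : (V.hi:ℝ) * ((s - b) * NB) ≤ 0 :=
      mul_nonpos_of_nonpos_of_nonneg o2' (mul_nonneg (by linarith) hN.le)
    have e : (GG p (α b) b - GG p (α s) s) * SC * NB = -((GG p (α s) s - GG p (α b) b) * SC * NB) := by ring
    rw [e]; linarith
  refine ⟨e1, le_rfl, ?_, fun b hb hbs => by linarith [fin_aux (key b hb hbs)]⟩
  simpa using key _ le_rfl e1

lemma sufC_sound {C : ℕ → ℕ → ℕ → ℕ → Bool × Iv} (hC : CellProp p s α C) {B' : ℕ} {S' : ℤ} (hst : SufSt p s α B' S') :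
    ∀ (L : List (ℕ × ℕ × ℕ)) (B0 : ℕ), (sufC C B' S' L B0).1 = true → SufSt p s α B0 (sufC C B' S' L B0).2 := by
  have hS := SC_pos
  have hN := NB_pos
  intro L
  induction L with
  | nil =>
    intro B0 h
    simp only [sufC, Bool.and_eq_true, decide_eq_true_eq] at h ⊢
    obtain ⟨rfl, -⟩ := h
    exact hst
  | cons hd t ih =>
    obtain ⟨B1, AL, AH⟩ := hd
    intro B0 hok
    rw [sufC_cons] at hok ⊢
    simp only [Bool.and_eq_true, decide_eq_true_eq] at hok
    obtain ⟨⟨o1, o2⟩, o3⟩ := hok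
    obtain ⟨i1, i2, i3, i4⟩ := ih B1 o1
    obtain ⟨hB, hBN, hcell⟩ := hC B0 B1 AL AH o2
    simp only
    generalize (C B0 B1 AL AH).2 = V at *
    generalize (sufC C B' S' t B1).2 = S at *
    have hB01 : (B0:ℝ) / NB ≤ (B1:ℝ) / NB := by gcongr
    have i2' : (0:ℝ) ≤ S := by exact_mod_cast i2
    have o3' : (0:ℝ) ≤ S - V.hi * ((B1:ℝ) - B0) := by exact_mod_cast o3
    have key : ∀ b : ℝ, (B0:ℝ) / NB ≤ b → b ≤ (B1:ℝ) / NB →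
        (S:ℝ) - V.hi * ((B1:ℝ) - b * NB) ≤ (GG p (α b) b - GG p (α s) s) * SC * NB := by
      intro b hb hb1
      have k := (hcell b _ hb hb1 le_rfl i1).2
      have e : ((B1:ℝ) / NB - b) * NB = B1 - b * NB := by field_simp
      rw [e] at k
      linarith
    refine ⟨hB01.trans i1, o3, ?_, ?_⟩
    · have := key _ le_rfl hB01
      have e : (B0:ℝ) / NB * NB = B0 := by field_simp
      rw [e] at this
      push_cast
      exact this
    · intro b hb hbs
      rcases le_total b ((B1:ℝ) / NB) with hle | hle
      · have hb' : b * NB ≤ B1 := by rwa [le_div_iff₀ hN] at hle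
        have hb'' : (B0:ℝ) ≤ b * NB := by rwa [div_le_iff₀ hN] at hb
        have := interp (v := -(V.hi:ℝ)) (T := (B1:ℝ) - B0) i2' (by linarith) (t := B1 - b * NB) (by linarith) (by linarith)
        have := fin_aux (x := GG p (α b) b - GG p (α s) s) (by linarith [key b hb hle])
        linarith
      · exact i4 b hle hbs

lemma sufCk_sound {C : ℕ → ℕ → ℕ → ℕ → Bool × Iv} (hC : CellProp p s α C) {B' B0 : ℕ} {S' S : ℤ} {L : List (ℕ × ℕ × ℕ)}
    (h : sufCk C B' S' L B0 S = true) (hst : SufSt p s α B' S') : SufSt p s α B0 S := by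
  simp only [sufCk, Bool.and_eq_true, decide_eq_true_eq] at h
  obtain ⟨⟨h1, h2⟩, h3⟩ := h
  obtain ⟨e1, e2, e3, e4⟩ := sufC_sound hC hst L B0 h1
  exact ⟨e1, h3, le_trans (by exact_mod_cast h2) e3, e4⟩

theorem cells0 {B : ℕ} {acc : ℤ} (hk : k0 ≤ 200) (hend : endOK k0 B = true)
    (hp0 : 2 + (k0:ℝ) / 200 ≤ p) (hp1 : p ≤ 2 + (k1:ℝ) / 200) (hp3 : p < 3)
    (h : ∀ α s, PathD p α s → CellProp p s α (cellV k0 k1) → PreSt p s α 0 0 → PreSt p s α B acc) : Min0 p := by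
  have hm : (0:ℝ) ≤ (k0:ℝ) / 200 := by positivity
  obtain ⟨α, s, H⟩ := PathD.exists (by linarith : 1 < p)
  intro a b ha hb hC
  refine H.all ?_ ha hb hC
  intro b hb hbs
  unfold endOK at hend
  simp only [Bool.and_eq_true, decide_eq_true_eq] at hend
  exact (h α s H (cellProp H hp0 hp1 hp3) (preSt_zero H)).1 b hb hbs (hbs.trans (end_hi H hp0 hk hend.2 hend.1))

theorem cellsM {B : ℕ} {acc acc' : ℤ} (hk : k0 ≤ 200) (hk1 : k1 ≤ 200)
    (hp0 : 2 + (k0:ℝ) / 200 ≤ p) (hp1 : p ≤ 2 + (k1:ℝ) / 200) (hp3 : p < 3)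
    (h : ∀ α s, PathD p α s → CellProp p s α (cellV k0 k1) → PreSt p s α 0 0 → PreSt p s α B acc)
    (h' : ∀ α s, PathD p α s → CellProp p s α (cellV k0 k1) →
      (∀ B0 B1 : ℕ, lasE k0 k1 B0 B1 = true → B1 < NB → B0 < B1 → (B0:ℝ) / NB ≤ s ∧ s ≤ (B1:ℝ) / NB) → SufSt p s α B acc') : MinM p := by
  have hm : (0:ℝ) ≤ (k0:ℝ) / 200 := by positivity
  obtain ⟨α, s, H⟩ := PathD.exists (by linarith : 1 < p)
  intro t t0 ht a b ha hb hC
  rw [H.star_unique t0 ht]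
  rw [← min_le_iff]
  refine H.all ?_ ha hb hC
  intro b hb hbs
  rw [min_le_iff]
  have hcp := cellProp H hp0 hp1 hp3
  rcases le_total b ((B : ℝ) / NB) with hle | hle
  · left; exact (h α s H hcp (preSt_zero H)).1 b hb hbs hle
  · right
    have := (h' α s H hcp (lasE_sound H hp0 hp1 hk hk1)).2.2.2 b hle hbs
    rwa [H.alpha_s] at this

theorem cells1 {acc' : ℤ} (hk : k0 ≤ 200) (hk1 : k1 ≤ 200)
    (hp0 : 2 + (k0:ℝ) / 200 ≤ p) (hp1 : p ≤ 2 + (k1:ℝ) / 200) (hp3 : p < 3)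
    (h' : ∀ α s, PathD p α s → CellProp p s α (cellV k0 k1) →
      (∀ B0 B1 : ℕ, lasE k0 k1 B0 B1 = true → B1 < NB → B0 < B1 → (B0:ℝ) / NB ≤ s ∧ s ≤ (B1:ℝ) / NB) → SufSt p s α 0 acc') : Min1 p := by
  have hm : (0:ℝ) ≤ (k0:ℝ) / 200 := by positivity
  obtain ⟨α, s, H⟩ := PathD.exists (by linarith : 1 < p)
  intro t t0 ht a b ha hb hC
  rw [H.star_unique t0 ht]
  refine H.all ?_ ha hb hC
  intro b hb hbs
  have := (h' α s H (cellProp H hp0 hp1 hp3) (lasE_sound H hp0 hp1 hk hk1)).2.2.2 b (by simpa using hb) hbs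
  rwa [H.alpha_s] at this
end engine

set_option maxRecDepth 100000

lemma engP_2_0 : preC (cellV 2 14) 36475 77346098298
  [(12158, 69128, 100000), (24317, 49000, 70444), (36475, 34943, 50645)] 0 0 = true := by decide +kernel

lemma engE_2 : endOK 2 36475 = true := by decide +kernel

theorem cell_2 {p : ℝ} (hp0 : 2 + ((2:ℕ):ℝ) / 200 ≤ p) (hp1 : p ≤ 2 + ((14:ℕ):ℝ) / 200) (hp3 : p < 3) : Min0 p := by
  refine cells0 (acc := 77346098298) (by norm_num) engE_2 hp0 hp1 hp3 fun α s H hC h => ?_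
  have h := preC_sound hC _ _ _ engP_2_0 h
  exact h

lemma engP_14_0 : preC (cellV 14 26) 35707 362281636286
  [(11902, 68319, 100000), (23805, 48066, 69646), (35707, 34197, 49704)] 0 0 = true := by decide +kernel

lemma engE_14 : endOK 14 35707 = true := by decide +kernel

theorem cell_14 {p : ℝ} (hp0 : 2 + ((14:ℕ):ℝ) / 200 ≤ p) (hp1 : p ≤ 2 + ((26:ℕ):ℝ) / 200) (hp3 : p < 3) : Min0 p := by
  refine cells0 (acc := 362281636286) (by norm_num) engE_14 hp0 hp1 hp3 fun α s H hC h => ?_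
  have h := preC_sound hC _ _ _ engP_14_0 h
  exact h

lemma engP_26_0 : preC (cellV 26 36) 34950 577531671100
  [(11650, 67734, 100000), (23300, 47415, 68848), (34950, 33708, 48772)] 0 0 = true := by decide +kernel

lemma engE_26 : endOK 26 34950 = true := by decide +kernel

theorem cell_26 {p : ℝ} (hp0 : 2 + ((26:ℕ):ℝ) / 200 ≤ p) (hp1 : p ≤ 2 + ((36:ℕ):ℝ) / 200) (hp3 : p < 3) : Min0 p := by
  refine cells0 (acc := 577531671100) (by norm_num) engE_26 hp0 hp1 hp3 fun α s H hC h => ?_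
  have h := preC_sound hC _ _ _ engP_26_0 h
  exact h

lemma engP_36_0 : preC (cellV 36 48) 34328 2703515662988
  [(8582, 73618, 100000), (17164, 55475, 74763), (25746, 42505, 57040), (34328, 32864, 44108)] 0 0 = true := by decide +kernel

lemma engE_36 : endOK 36 34328 = true := by decide +kernel

theorem cell_36 {p : ℝ} (hp0 : 2 + ((36:ℕ):ℝ) / 200 ≤ p) (hp1 : p ≤ 2 + ((48:ℕ):ℝ) / 200) (hp3 : p < 3) : Min0 p := by
  refine cells0 (acc := 2703515662988) (by norm_num) engE_36 hp0 hp1 hp3 fun α s H hC h => ?_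
  have h := preC_sound hC _ _ _ engP_36_0 h
  exact h

lemma engP_48_0 : preC (cellV 48 60) 33594 1453844533463
  [(8398, 72929, 100000), (16797, 54567, 74085), (25196, 41638, 56129), (33594, 32156, 43222)] 0 0 = true := by decide +kernel

lemma engE_48 : endOK 48 33594 = true := by decide +kernel

theorem cell_48 {p : ℝ} (hp0 : 2 + ((48:ℕ):ℝ) / 200 ≤ p) (hp1 : p ≤ 2 + ((60:ℕ):ℝ) / 200) (hp3 : p < 3) : Min0 p := by
  refine cells0 (acc := 1453844533463) (by norm_num) engE_48 hp0 hp1 hp3 fun α s H hC h => ?_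
  have h := preC_sound hC _ _ _ engP_48_0 h
  exact h

lemma engP_60_0 : preC (cellV 60 70) 32873 278844215223
  [(8218, 72434, 100000), (16436, 53929, 73404), (24655, 41047, 55227), (32873, 31695, 42352)] 0 0 = true := by decide +kernel

lemma engE_60 : endOK 60 32873 = true := by decide +kernel

theorem cell_60 {p : ℝ} (hp0 : 2 + ((60:ℕ):ℝ) / 200 ≤ p) (hp1 : p ≤ 2 + ((70:ℕ):ℝ) / 200) (hp3 : p < 3) : Min0 p := by
  refine cells0 (acc := 278844215223) (by norm_num) engE_60 hp0 hp1 hp3 fun α s H hC h => ?_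
  have h := preC_sound hC _ _ _ engP_60_0 h
  exact h

lemma engP_70_0 : preC (cellV 70 82) 21522 848679022659
  [(5380, 79808, 100000), (10761, 64568, 80705), (16142, 52926, 65933), (21522, 43879, 54479)] 0 0 = true := by decide +kernel

lemma engP_70_4 : preC (cellV 70 82) 32283 883778078099
  [(26902, 36706, 45451), (32283, 30900, 38205)] 21522 848679022659 = true := by decide +kernel

lemma engE_70 : endOK 70 32283 = true := by decide +kernel

theorem cell_70 {p : ℝ} (hp0 : 2 + ((70:ℕ):ℝ) / 200 ≤ p) (hp1 : p ≤ 2 + ((82:ℕ):ℝ) / 200) (hp3 : p < 3) : Min0 p := by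
  refine cells0 (acc := 883778078099) (by norm_num) engE_70 hp0 hp1 hp3 fun α s H hC h => ?_
  have h := preC_sound hC _ _ _ engP_70_0 h
  have h := preC_sound hC _ _ _ engP_70_4 h
  exact h

lemma engP_82_0 : preC (cellV 82 92) 12636 3665133937530
  [(3159, 86947, 100000), (6318, 75981, 87454), (9477, 66747, 76838), (12636, 58940, 67834)] 0 0 = true := by decide +kernel

lemma engP_82_4 : preC (cellV 82 92) 25271 3807877980255
  [(15794, 52305, 60162), (18953, 46624, 53593), (22112, 41726, 47928), (25271, 37471, 43013)] 12636 3665133937530 = true := by decide +kernel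

lemma engP_82_8 : preC (cellV 82 92) 31589 3753006121824
  [(28430, 33745, 38717), (31589, 30459, 34937)] 25271 3807877980255 = true := by decide +kernel

lemma engE_82 : endOK 82 31589 = true := by decide +kernel

theorem cell_82 {p : ℝ} (hp0 : 2 + ((82:ℕ):ℝ) / 200 ≤ p) (hp1 : p ≤ 2 + ((92:ℕ):ℝ) / 200) (hp3 : p < 3) : Min0 p := by
  refine cells0 (acc := 3753006121824) (by norm_num) engE_82 hp0 hp1 hp3 fun α s H hC h => ?_
  have h := preC_sound hC _ _ _ engP_82_0 h
  have h := preC_sound hC _ _ _ engP_82_4 h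
  have h := preC_sound hC _ _ _ engP_82_8 h
  exact h

lemma engP_92_0 : preC (cellV 92 98) 10341 4274392949809
  [(2585, 88891, 100000), (5170, 79293, 89154), (7756, 70989, 79749), (10341, 63798, 71583)] 0 0 = true := by decide +kernel

lemma engP_92_4 : preC (cellV 92 98) 20682 4290881956680
  [(12926, 57546, 64483), (15512, 52088, 58287), (18097, 47303, 52857), (20682, 43086, 48081)] 10341 4274392949809 = true := by decide +kernel

lemma engP_92_8 : preC (cellV 92 98) 31023 2823175026721
  [(23267, 39349, 43857), (25852, 36020, 40103), (28438, 33037, 36750), (31023, 30352, 33737)] 20682 4290881956680 = true := by decide +kernel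

lemma engE_92 : endOK 92 31023 = true := by decide +kernel

theorem cell_92 {p : ℝ} (hp0 : 2 + ((92:ℕ):ℝ) / 200 ≤ p) (hp1 : p ≤ 2 + ((98:ℕ):ℝ) / 200) (hp3 : p < 3) : Min0 p := by
  refine cells0 (acc := 2823175026721) (by norm_num) engE_92 hp0 hp1 hp3 fun α s H hC h => ?_
  have h := preC_sound hC _ _ _ engP_92_0 h
  have h := preC_sound hC _ _ _ engP_92_4 h
  have h := preC_sound hC _ _ _ engP_92_8 h
  exact h

lemma engP_98_0 : preC (cellV 98 102) 8768 4152523081472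
  [(2192, 90324, 100000), (4384, 81793, 90479), (6576, 74269, 82066), (8768, 67626, 74631)] 0 0 = true := by decide +kernel

lemma engP_98_4 : preC (cellV 98 102) 17536 4126473064128
  [(10960, 61752, 68053), (13152, 56543, 62222), (15344, 51910, 57040), (17536, 47775, 52422)] 8768 4152523081472 = true := by decide +kernel

lemma engP_98_8 : preC (cellV 98 102) 26304 688755632512
  [(19728, 44070, 48291), (21920, 40737, 44583), (24112, 37728, 41243), (26304, 34999, 38221)] 17536 4126473064128 = true := by decide +kernel

lemma engP_98_12 : preC (cellV 98 102) 30688 135109286016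
  [(28496, 32514, 35476), (30688, 30244, 32975)] 26304 688755632512 = true := by decide +kernel

lemma engE_98 : endOK 98 30688 = true := by decide +kernel

theorem cell_98 {p : ℝ} (hp0 : 2 + ((98:ℕ):ℝ) / 200 ≤ p) (hp1 : p ≤ 2 + ((102:ℕ):ℝ) / 200) (hp3 : p < 3) : Min0 p := by
  refine cells0 (acc := 135109286016) (by norm_num) engE_98 hp0 hp1 hp3 fun α s H hC h => ?_
  have h := preC_sound hC _ _ _ engP_98_0 h
  have h := preC_sound hC _ _ _ engP_98_4 h
  have h := preC_sound hC _ _ _ engP_98_8 h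
  have h := preC_sound hC _ _ _ engP_98_12 h
  exact h

lemma engP_102_0 : preC (cellV 102 104) 7617 4534547863322
  [(1904, 91459, 100000), (3808, 83809, 91528), (5713, 76953, 83933), (7617, 70813, 77120)] 0 0 = true := by decide +kernel

lemma engP_102_4 : preC (cellV 102 104) 15234 6546565929819
  [(9521, 65305, 71013), (11425, 60356, 65528), (13329, 55900, 60595), (15234, 51875, 56150)] 7617 4534547863322 = true := by decide +kernel

lemma engP_102_8 : preC (cellV 102 104) 22850 3823451015467
  [(17138, 48235, 52131), (19042, 44931, 48493), (20946, 41922, 45188), (22850, 39175, 42177)] 15234 6546565929819 = true := by decide +kernel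

lemma engP_102_12 : preC (cellV 102 104) 30467 2364079548710
  [(24754, 36659, 39425), (26659, 34346, 36902), (28563, 32215, 34582), (30467, 30245, 32443)] 22850 3823451015467 = true := by decide +kernel

lemma engE_102 : endOK 102 30467 = true := by decide +kernel

theorem cell_102 {p : ℝ} (hp0 : 2 + ((102:ℕ):ℝ) / 200 ≤ p) (hp1 : p ≤ 2 + ((104:ℕ):ℝ) / 200) (hp3 : p < 3) : Min0 p := by
  refine cells0 (acc := 2364079548710) (by norm_num) engE_102 hp0 hp1 hp3 fun α s H hC h => ?_
  have h := preC_sound hC _ _ _ engP_102_0 h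
  have h := preC_sound hC _ _ _ engP_102_4 h
  have h := preC_sound hC _ _ _ engP_102_8 h
  have h := preC_sound hC _ _ _ engP_102_12 h
  exact h

lemma engP_104_0 : preC (cellV 104 106) 6071 3944281707339
  [(1518, 93060, 100000), (3036, 86706, 93116), (4554, 80892, 86810), (6071, 75574, 81035)] 0 0 = true := by decide +kernel

lemma engP_104_4 : preC (cellV 104 106) 12143 6964986307461
  [(7589, 70701, 75748), (9107, 66235, 70900), (10625, 62139, 66454), (12143, 58378, 62373)] 6071 3944281707339 = true := by decide +kernel

lemma engP_104_8 : preC (cellV 104 106) 18214 5236808536592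
  [(13661, 54918, 58622), (15178, 51733, 55169), (16696, 48792, 51989), (18214, 46073, 49049)] 12143 6964986307461 = true := by decide +kernel

lemma engP_104_12 : preC (cellV 104 106) 24286 2303686906208
  [(19732, 43554, 46330), (21250, 41216, 43809), (22768, 39041, 41468), (24286, 37015, 39290)] 18214 5236808536592 = true := by decide +kernel

lemma engP_104_16 : preC (cellV 104 106) 30357 1122631979259
  [(25803, 35124, 37259), (27321, 33354, 35363), (28839, 31695, 33586), (30357, 30136, 31921)] 24286 2303686906208 = true := by decide +kernel

lemma engE_104 : endOK 104 30357 = true := by decide +kernel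

theorem cell_104 {p : ℝ} (hp0 : 2 + ((104:ℕ):ℝ) / 200 ≤ p) (hp1 : p ≤ 2 + ((106:ℕ):ℝ) / 200) (hp3 : p < 3) : Min0 p := by
  refine cells0 (acc := 1122631979259) (by norm_num) engE_104 hp0 hp1 hp3 fun α s H hC h => ?_
  have h := preC_sound hC _ _ _ engP_104_0 h
  have h := preC_sound hC _ _ _ engP_104_4 h
  have h := preC_sound hC _ _ _ engP_104_8 h
  have h := preC_sound hC _ _ _ engP_104_12 h
  have h := preC_sound hC _ _ _ engP_104_16 h
  exact h

lemma engP_106_0 : preC (cellV 106 108) 4321 2953826766202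
  [(1080, 94959, 100000), (2161, 90222, 95001), (3241, 85782, 90301), (4321, 81615, 85892)] 0 0 = true := by decide +kernel

lemma engP_106_4 : preC (cellV 106 108) 8642 6855119990120
  [(5401, 77704, 81752), (6482, 74031, 77866), (7562, 70585, 74213), (8642, 67349, 70785)] 4321 2953826766202 = true := by decide +kernel

lemma engP_106_8 : preC (cellV 106 108) 12963 7774610310930
  [(9723, 64306, 67563), (10803, 61447, 64532), (11883, 58758, 61683), (12963, 56226, 59001)] 8642 6855119990120 = true := by decide +kernel

lemma engP_106_12 : preC (cellV 106 108) 17285 5921329121752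
  [(14044, 53838, 56474), (15124, 51588, 54090), (16204, 49464, 51843), (17285, 47456, 49721)] 12963 7774610310930 = true := by decide +kernel

lemma engP_106_16 : preC (cellV 106 108) 21606 3286276625703
  [(18365, 45558, 47713), (19445, 43761, 45814), (20525, 42059, 44017), (21606, 40442, 42312)] 17285 5921329121752 = true := by decide +kernel

lemma engP_106_20 : preC (cellV 106 108) 25927 1393645350255
  [(22686, 38908, 40693), (23766, 37450, 39156), (24847, 36062, 37695), (25927, 34740, 36302)] 21606 3286276625703 = true := by decide +kernel

lemma engP_106_24 : preC (cellV 106 108) 30248 697416874916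
  [(27007, 33480, 34976), (28087, 32277, 33712), (29168, 31127, 32505), (30248, 30027, 31350)] 25927 1393645350255 = true := by decide +kernel

lemma engE_106 : endOK 106 30248 = true := by decide +kernel

theorem cell_106 {p : ℝ} (hp0 : 2 + ((106:ℕ):ℝ) / 200 ≤ p) (hp1 : p ≤ 2 + ((108:ℕ):ℝ) / 200) (hp3 : p < 3) : Min0 p := by
  refine cells0 (acc := 697416874916) (by norm_num) engE_106 hp0 hp1 hp3 fun α s H hC h => ?_
  have h := preC_sound hC _ _ _ engP_106_0 h
  have h := preC_sound hC _ _ _ engP_106_4 h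
  have h := preC_sound hC _ _ _ engP_106_8 h
  have h := preC_sound hC _ _ _ engP_106_12 h
  have h := preC_sound hC _ _ _ engP_106_16 h
  have h := preC_sound hC _ _ _ engP_106_20 h
  have h := preC_sound hC _ _ _ engP_106_24 h
  exact h

lemma engP_108_0 : preC (cellV 108 110) 2512 1528838489204
  [(628, 97005, 100000), (1256, 94119, 97031), (1884, 91339, 94168), (2512, 88660, 91409)] 0 0 = true := by decide +kernel

lemma engP_108_4 : preC (cellV 108 110) 5023 4707303064612
  [(3139, 86082, 88749), (3767, 83595, 86190), (4395, 81199, 83720), (5023, 78891, 81340)] 2512 1528838489204 = true := by decide +kernel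

lemma engP_108_8 : preC (cellV 108 110) 7535 7321832444016
  [(5651, 76667, 79046), (6279, 74524, 76835), (6907, 72460, 74704), (7535, 70470, 72650)] 5023 4707303064612 = true := by decide +kernel

lemma engP_108_12 : preC (cellV 108 110) 10046 8683492155218
  [(8163, 68552, 70670), (8791, 66703, 68760), (9418, 64923, 66919), (10046, 63204, 65146)] 7535 7321832444016 = true := by decide +kernel

lemma engP_108_16 : preC (cellV 108 110) 12558 8804960894270
  [(10674, 61546, 63433), (11302, 59946, 61781), (11930, 58402, 60185), (12558, 56912, 58646)] 10046 8683492155218 = true := by decide +kernel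

lemma engP_108_20 : preC (cellV 108 110) 15070 7809588908178
  [(13186, 55473, 57159), (13814, 54083, 55723), (14442, 52741, 54335), (15070, 51443, 52994)] 12558 8804960894270 = true := by decide +kernel

lemma engP_108_24 : preC (cellV 108 110) 17581 6194988273333
  [(15697, 50191, 51698), (16325, 48978, 50447), (16953, 47805, 49235), (17581, 46670, 48062)] 15070 7809588908178 = true := by decide +kernel

lemma engP_108_28 : preC (cellV 108 110) 20093 4437122440713
  [(18209, 45571, 46926), (18837, 44506, 45827), (19465, 43475, 44762), (20093, 42477, 43730)] 17581 6194988273333 = true := by decide +kernel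

lemma engP_108_32 : preC (cellV 108 110) 22604 2871021356763
  [(20721, 41508, 42730), (21348, 40571, 41760), (21976, 39660, 40821), (22604, 38776, 39909)] 20093 4437122440713 = true := by decide +kernel

lemma engP_108_36 : preC (cellV 108 110) 25116 1687440319723
  [(23232, 37918, 39023), (23860, 37085, 38163), (24488, 36276, 37328), (25116, 35489, 36516)] 22604 2871021356763 = true := by decide +kernel

lemma engP_108_40 : preC (cellV 108 110) 27627 966145650065
  [(25744, 34725, 35727), (26372, 33981, 34961), (27000, 33258, 34215), (27627, 32555, 33489)] 25116 1687440319723 = true := by decide +kernel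

lemma engP_108_44 : preC (cellV 108 110) 30139 702915538253
  [(28255, 31870, 32784), (28883, 31203, 32096), (29511, 30553, 31426), (30139, 29920, 30773)] 27627 966145650065 = true := by decide +kernel

lemma engE_108 : endOK 108 30139 = true := by decide +kernel

theorem cell_108 {p : ℝ} (hp0 : 2 + ((108:ℕ):ℝ) / 200 ≤ p) (hp1 : p ≤ 2 + ((110:ℕ):ℝ) / 200) (hp3 : p < 3) : Min0 p := by
  refine cells0 (acc := 702915538253) (by norm_num) engE_108 hp0 hp1 hp3 fun α s H hC h => ?_
  have h := preC_sound hC _ _ _ engP_108_0 h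
  have h := preC_sound hC _ _ _ engP_108_4 h
  have h := preC_sound hC _ _ _ engP_108_8 h
  have h := preC_sound hC _ _ _ engP_108_12 h
  have h := preC_sound hC _ _ _ engP_108_16 h
  have h := preC_sound hC _ _ _ engP_108_20 h
  have h := preC_sound hC _ _ _ engP_108_24 h
  have h := preC_sound hC _ _ _ engP_108_28 h
  have h := preC_sound hC _ _ _ engP_108_32 h
  have h := preC_sound hC _ _ _ engP_108_36 h
  have h := preC_sound hC _ _ _ engP_108_40 h
  have h := preC_sound hC _ _ _ engP_108_44 h
  exact h

lemma engP_110_0 : preC (cellV 110 112) 2310 1233898904469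
  [(578, 97217, 100000), (1155, 94532, 97241), (1733, 91934, 94577), (2310, 89428, 91999)] 0 0 = true := by decide +kernel

lemma engP_110_4 : preC (cellV 110 112) 4620 3791255294201
  [(2888, 87002, 89512), (3465, 84663, 87104), (4043, 82400, 84781), (4620, 80217, 82532)] 2310 1233898904469 = true := by decide +kernel

lemma engP_110_8 : preC (cellV 110 112) 6930 5828293017519
  [(5198, 78105, 80364), (5775, 76068, 78264), (6353, 74097, 76239), (6930, 72195, 74278)] 4620 3791255294201 = true := by decide +kernel

lemma engP_110_12 : preC (cellV 110 112) 9240 6727769115560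
  [(7508, 70355, 72386), (8085, 68579, 70555), (8663, 66860, 68787), (9240, 65201, 67075)] 6930 5828293017519 = true := by decide +kernel

lemma engP_110_16 : preC (cellV 110 112) 11550 6382974297468
  [(9818, 63594, 65423), (10395, 62043, 63822), (10973, 60541, 62276), (11550, 59090, 60778)] 9240 6727769115560 = true := by decide +kernel

lemma engP_110_20 : preC (cellV 110 112) 13860 4893694423877
  [(12128, 57683, 59331), (12705, 56324, 57928), (13283, 55006, 56572), (13860, 53733, 55256)] 11550 6382974297468 = true := by decide +kernel

lemma engP_110_24 : preC (cellV 110 112) 16171 2753460036693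
  [(14438, 52497, 53985), (15016, 51300, 52750), (15593, 50142, 51554), (16171, 49017, 50397)] 13860 4893694423877 = true := by decide +kernel

lemma engP_110_28 : preC (cellV 110 112) 18481 418213170129
  [(16748, 47929, 49273), (17326, 46871, 48185), (17903, 45847, 47127), (18481, 44851, 46103)] 16171 2753460036693 = true := by decide +kernel

lemma engL_110 : lasC (cellV 110 112) (lasE 110 112) 29453 30031 29812 30613 = true := by decide +kernel

lemma engS_110_15 : sufCk (cellV 110 112) 29453 0
  [(27721, 32226, 33097), (28298, 31601, 32453), (28876, 30990, 31825), (29453, 30394, 31211)] 27143 44120689518 = true := by decide +kernel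

lemma engS_110_11 : sufCk (cellV 110 112) 27143 44120689518
  [(25411, 34892, 35842), (25988, 34201, 35128), (26566, 33525, 34434), (27143, 32868, 33757)] 24833 148873038537 = true := by decide +kernel

lemma engS_110_7 : sufCk (cellV 110 112) 24833 148873038537
  [(23101, 37852, 38890), (23678, 37083, 38096), (24256, 36333, 37325), (24833, 35604, 36573)] 22523 263152636291 = true := by decide +kernel

lemma engS_110_3 : sufCk (cellV 110 112) 22523 263152636291
  [(20791, 41152, 42290), (21368, 40293, 41403), (21946, 39456, 40542), (22523, 38644, 39704)] 20213 286503120039 = true := by decide +kernel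

lemma engS_110_0 : sufCk (cellV 110 112) 20213 286503120039
  [(19058, 43886, 45106), (19636, 42948, 44141), (20213, 42038, 43201)] 18481 117758433160 = true := by decide +kernel

theorem cell_110 {p : ℝ} (hp0 : 2 + ((110:ℕ):ℝ) / 200 ≤ p) (hp1 : p ≤ 2 + ((112:ℕ):ℝ) / 200) (hp3 : p < 3) : MinM p := by
  refine cellsM (B := 18481) (acc := 418213170129) (acc' := 117758433160) (by norm_num) (by norm_num) hp0 hp1 hp3 (fun α s H hC h => ?_) (fun α s H hC hE => ?_)
  · have h := preC_sound hC _ _ _ engP_110_0 h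
    have h := preC_sound hC _ _ _ engP_110_4 h
    have h := preC_sound hC _ _ _ engP_110_8 h
    have h := preC_sound hC _ _ _ engP_110_12 h
    have h := preC_sound hC _ _ _ engP_110_16 h
    have h := preC_sound hC _ _ _ engP_110_20 h
    have h := preC_sound hC _ _ _ engP_110_24 h
    have h := preC_sound hC _ _ _ engP_110_28 h
    exact h
  · have h := lasC_sound hC hE engL_110
    have h := sufCk_sound hC engS_110_15 h
    have h := sufCk_sound hC engS_110_11 h
    have h := sufCk_sound hC engS_110_7 h
    have h := sufCk_sound hC engS_110_3 h
    have h := sufCk_sound hC engS_110_0 h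
    exact h

lemma engP_112_0 : preC (cellV 112 114) 2494 1189421421039
  [(623, 96979, 100000), (1247, 94065, 97005), (1870, 91262, 94114), (2494, 88557, 91332)] 0 0 = true := by decide +kernel

lemma engP_112_4 : preC (cellV 112 114) 4987 3322172774560
  [(3117, 85957, 88647), (3740, 83452, 86065), (4364, 81036, 83578), (4987, 78714, 81177)] 2494 1189421421039 = true := by decide +kernel

lemma engP_112_8 : preC (cellV 112 114) 7481 4447764968292
  [(5611, 76473, 78869), (6234, 74318, 76641), (6857, 72243, 74498), (7481, 70240, 72433)] 4987 3322172774560 = true := by decide +kernel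

lemma engP_112_12 : preC (cellV 112 114) 9974 3937250249585
  [(8104, 68314, 70440), (8728, 66455, 68523), (9351, 64666, 66671), (9974, 62941, 64889)] 7481 4447764968292 = true := by decide +kernel

lemma engP_112_16 : preC (cellV 112 114) 12468 1723410138981
  [(10598, 61276, 63171), (11221, 59673, 61511), (11845, 58124, 59912), (12468, 56632, 58367)] 9974 3937250249585 = true := by decide +kernel

lemma engP_112_20 : preC (cellV 112 114) 13715 191464543836
  [(13091, 55191, 56878), (13715, 53799, 55440)] 12468 1723410138981 = true := by decide +kernel

lemma engL_112 : lasC (cellV 112 114) (lasE 112 114) 29300 29923 29705 30552 = true := by decide +kernel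

lemma engS_112_21 : sufCk (cellV 112 114) 29300 0
  [(27429, 32323, 33251), (28053, 31641, 32549), (28676, 30979, 31865), (29300, 30333, 31200)] 26806 115087826706 = true := by decide +kernel

lemma engS_112_17 : sufCk (cellV 112 114) 26806 115087826706
  [(24936, 35240, 36262), (25559, 34480, 35477), (26183, 33740, 34714), (26806, 33022, 33972)] 24312 415260833108 = true := by decide +kernel

lemma engS_112_13 : sufCk (cellV 112 114) 24312 415260833108
  [(22442, 38512, 39639), (23066, 37657, 38757), (23689, 36828, 37900), (24312, 36023, 37069)] 21819 838209716863 = true := by decide +kernel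

lemma engS_112_9 : sufCk (cellV 112 114) 21819 838209716863
  [(19949, 42200, 43451), (20572, 41235, 42452), (21195, 40300, 41486), (21819, 39392, 40549)] 19325 1250223404837 = true := by decide +kernel

lemma engS_112_5 : sufCk (cellV 112 114) 19325 1250223404837
  [(17455, 46385, 47774), (18078, 45288, 46640), (18702, 44225, 45543), (19325, 43197, 44479)] 16832 1431872010768 = true := by decide +kernel

lemma engS_112_1 : sufCk (cellV 112 114) 16832 1431872010768
  [(14962, 51157, 52709), (15585, 49903, 51411), (16208, 48692, 50158), (16832, 47518, 48947)] 14338 950466353121 = true := by decide +kernel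

lemma engS_112_0 : sufCk (cellV 112 114) 14338 950466353121
  [(14338, 52456, 54050)] 13715 658239416329 = true := by decide +kernel

theorem cell_112 {p : ℝ} (hp0 : 2 + ((112:ℕ):ℝ) / 200 ≤ p) (hp1 : p ≤ 2 + ((114:ℕ):ℝ) / 200) (hp3 : p < 3) : MinM p := by
  refine cellsM (B := 13715) (acc := 191464543836) (acc' := 658239416329) (by norm_num) (by norm_num) hp0 hp1 hp3 (fun α s H hC h => ?_) (fun α s H hC hE => ?_)
  · have h := preC_sound hC _ _ _ engP_112_0 h
    have h := preC_sound hC _ _ _ engP_112_4 h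
    have h := preC_sound hC _ _ _ engP_112_8 h
    have h := preC_sound hC _ _ _ engP_112_12 h
    have h := preC_sound hC _ _ _ engP_112_16 h
    have h := preC_sound hC _ _ _ engP_112_20 h
    exact h
  · have h := lasC_sound hC hE engL_112
    have h := sufCk_sound hC engS_112_21 h
    have h := sufCk_sound hC engS_112_17 h
    have h := sufCk_sound hC engS_112_13 h
    have h := sufCk_sound hC engS_112_9 h
    have h := sufCk_sound hC engS_112_5 h
    have h := sufCk_sound hC engS_112_1 h
    have h := sufCk_sound hC engS_112_0 h
    exact h

lemma engP_114_0 : preC (cellV 114 116) 2982 1191642155358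
  [(745, 96371, 100000), (1491, 92898, 96402), (2236, 89582, 92956), (2982, 86408, 89664)] 0 0 = true := by decide +kernel

lemma engP_114_4 : preC (cellV 114 116) 5963 2516926471609
  [(3727, 83379, 86513), (4472, 80484, 83505), (5218, 77714, 80629), (5963, 75071, 77875)] 2982 1191642155358 = true := by decide +kernel

lemma engP_114_8 : preC (cellV 114 116) 8945 1383032833896
  [(6709, 72541, 75247), (7454, 70126, 72730), (8199, 67817, 70326), (8945, 65606, 68027)] 5963 2516926471609 = true := by decide +kernel

lemma engP_114_12 : preC (cellV 114 116) 9690 602403847361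
  [(9690, 63493, 65825)] 8945 1383032833896 = true := by decide +kernel

lemma engL_114 : lasC (cellV 114 116) (lasE 114 116) 29071 29816 29598 30569 = true := by decide +kernel

lemma engS_114_22 : sufCk (cellV 114 116) 29071 0
  [(26834, 32763, 33851), (27580, 31933, 32991), (28325, 31130, 32157), (29071, 30351, 31351)] 26089 251693082223 = true := by decide +kernel

lemma engS_114_18 : sufCk (cellV 114 116) 26089 251693082223
  [(23853, 36376, 37603), (24598, 35426, 36615), (25344, 34507, 35662), (26089, 33621, 34741)] 23107 909878372377 = true := by decide +kernel

lemma engS_114_14 : sufCk (cellV 114 116) 23107 909878372377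
  [(20871, 40535, 41924), (21617, 39437, 40784), (22362, 38380, 39684), (23107, 37361, 38625)] 20126 1838661860329 = true := by decide +kernel

lemma engS_114_10 : sufCk (cellV 114 116) 20126 1838661860329
  [(17890, 45362, 46947), (18635, 44085, 45617), (19380, 42857, 44339), (20126, 41673, 43109)] 17144 2729438618384 = true := by decide +kernel

lemma engS_114_6 : sufCk (cellV 114 116) 17144 2729438618384
  [(14908, 51015, 52829), (15653, 49515, 51268), (16399, 48074, 49770), (17144, 46692, 48329)] 14163 3076413942288 = true := by decide +kernel

lemma engS_114_2 : sufCk (cellV 114 116) 14163 3076413942288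
  [(11926, 57684, 59775), (12672, 55908, 57928), (13417, 54208, 56155), (14163, 52577, 54459)] 11181 1842397975176 = true := by decide +kernel

lemma engS_114_0 : sufCk (cellV 114 116) 11181 1842397975176
  [(10436, 61470, 63721), (11181, 59536, 61704)] 9690 256455276009 = true := by decide +kernel

theorem cell_114 {p : ℝ} (hp0 : 2 + ((114:ℕ):ℝ) / 200 ≤ p) (hp1 : p ≤ 2 + ((116:ℕ):ℝ) / 200) (hp3 : p < 3) : MinM p := by
  refine cellsM (B := 9690) (acc := 602403847361) (acc' := 256455276009) (by norm_num) (by norm_num) hp0 hp1 hp3 (fun α s H hC h => ?_) (fun α s H hC hE => ?_)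
  · have h := preC_sound hC _ _ _ engP_114_0 h
    have h := preC_sound hC _ _ _ engP_114_4 h
    have h := preC_sound hC _ _ _ engP_114_8 h
    have h := preC_sound hC _ _ _ engP_114_12 h
    exact h
  · have h := lasC_sound hC hE engL_114
    have h := sufCk_sound hC engS_114_22 h
    have h := sufCk_sound hC engS_114_18 h
    have h := sufCk_sound hC engS_114_14 h
    have h := sufCk_sound hC engS_114_10 h
    have h := sufCk_sound hC engS_114_6 h
    have h := sufCk_sound hC engS_114_2 h
    have h := sufCk_sound hC engS_114_0 h
    exact h

lemma engP_116_0 : preC (cellV 116 118) 3495 991416235645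
  [(874, 95725, 100000), (1748, 91671, 95761), (2621, 87832, 91738), (3495, 84189, 87927)] 0 0 = true := by decide +kernel

lemma engP_116_4 : preC (cellV 116 118) 6990 460173822430
  [(4369, 80735, 84309), (5243, 77463, 80878), (6117, 74361, 77625), (6990, 71424, 74540)] 3495 991416235645 = true := by decide +kernel

lemma engL_116 : lasC (cellV 116 118) (lasE 116 118) 28835 29709 29492 30596 = true := by decide +kernel

lemma engS_116_21 : sufCk (cellV 116 118) 28835 0
  [(26214, 33247, 34513), (27088, 32253, 33476), (27961, 31298, 32478), (28835, 30378, 31520)] 25340 468386109253 = true := by decide +kernel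

lemma engS_116_17 : sufCk (cellV 116 118) 25340 468386109253
  [(22719, 37646, 39110), (23592, 36478, 37888), (24466, 35357, 36717), (25340, 34281, 35593)] 21845 1686488857758 = true := by decide +kernel

lemma engS_116_13 : sufCk (cellV 116 118) 21845 1686488857758
  [(19223, 42861, 44569), (20097, 41470, 43113), (20971, 40139, 41719), (21845, 38865, 40387)] 18350 3366012513269 = true := by decide +kernel

lemma engS_116_9 : sufCk (cellV 116 118) 18350 3366012513269
  [(15728, 49114, 51127), (16602, 47438, 49369), (17476, 45840, 47693), (18350, 44316, 46095)] 14854 4839448467025 = true := by decide +kernel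

lemma engS_116_5 : sufCk (cellV 116 118) 14854 4839448467025
  [(12233, 56699, 59087), (13107, 54659, 56945), (13981, 52718, 54908), (14854, 50873, 52970)] 11359 4998226508430 = true := by decide +kernel

lemma engS_116_1 : sufCk (cellV 116 118) 11359 4998226508430
  [(8738, 65992, 68843), (9612, 63484, 66210), (10486, 61104, 63711), (11359, 58847, 61339)] 7864 1638552629326 = true := by decide +kernel

lemma engS_116_0 : sufCk (cellV 116 118) 7864 1638552629326
  [(7864, 68636, 71618)] 6990 62588914596 = true := by decide +kernel

theorem cell_116 {p : ℝ} (hp0 : 2 + ((116:ℕ):ℝ) / 200 ≤ p) (hp1 : p ≤ 2 + ((118:ℕ):ℝ) / 200) (hp3 : p < 3) : MinM p := by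
  refine cellsM (B := 6990) (acc := 460173822430) (acc' := 62588914596) (by norm_num) (by norm_num) hp0 hp1 hp3 (fun α s H hC h => ?_) (fun α s H hC hE => ?_)
  · have h := preC_sound hC _ _ _ engP_116_0 h
    have h := preC_sound hC _ _ _ engP_116_4 h
    exact h
  · have h := lasC_sound hC hE engL_116
    have h := sufCk_sound hC engS_116_21 h
    have h := sufCk_sound hC engS_116_17 h
    have h := sufCk_sound hC engS_116_13 h
    have h := sufCk_sound hC engS_116_9 h
    have h := sufCk_sound hC engS_116_5 h
    have h := sufCk_sound hC engS_116_1 h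
    have h := sufCk_sound hC engS_116_0 h
    exact h

lemma engP_118_0 : preC (cellV 118 120) 3947 560107633015
  [(987, 95149, 100000), (1973, 90588, 95190), (2960, 86291, 90663), (3947, 82248, 86397)] 0 0 = true := by decide +kernel

lemma engP_118_4 : preC (cellV 118 120) 4934 293177440885
  [(4934, 78445, 82381)] 3947 560107633015 = true := by decide +kernel

lemma engL_118 : lasC (cellV 118 120) (lasE 118 120) 28615 29602 29387 30608 = true := by decide +kernel

lemma engS_118_20 : sufCk (cellV 118 120) 28615 0
  [(25655, 33674, 35105), (26642, 32530, 33904), (27629, 31437, 32756), (28615, 30390, 31658)] 24668 760596577172 = true := by decide +kernel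

lemma engS_118_16 : sufCk (cellV 118 120) 24668 760596577172
  [(21708, 38818, 40515), (22695, 37438, 39062), (23682, 36124, 37679), (24668, 34871, 36361)] 20721 2729362578932 = true := by decide +kernel

lemma engS_118_12 : sufCk (cellV 118 120) 20721 2729362578932
  [(17761, 45083, 47119), (18748, 43393, 45336), (19735, 41789, 43645), (20721, 40267, 42039)] 16774 5378978947217 = true := by decide +kernel

lemma engS_118_8 : sufCk (cellV 118 120) 16774 5378978947217
  [(13814, 52831, 55300), (14801, 50730, 53082), (15788, 48744, 50984), (16774, 46865, 48998)] 12828 7490832366232 = true := by decide +kernel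

lemma engS_118_4 : sufCk (cellV 118 120) 12828 7490832366232
  [(9867, 62548, 65574), (10854, 59902, 62778), (11841, 57406, 60139), (12828, 55052, 57650)] 8881 7010402939010 = true := by decide +kernel

lemma engS_118_0 : sufCk (cellV 118 120) 8881 7010402939010
  [(5920, 74870, 78601), (6907, 71504, 75047), (7894, 68336, 71698), (8881, 65354, 68544)] 4934 629293088158 = true := by decide +kernel

theorem cell_118 {p : ℝ} (hp0 : 2 + ((118:ℕ):ℝ) / 200 ≤ p) (hp1 : p ≤ 2 + ((120:ℕ):ℝ) / 200) (hp3 : p < 3) : MinM p := by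
  refine cellsM (B := 4934) (acc := 293177440885) (acc' := 629293088158) (by norm_num) (by norm_num) hp0 hp1 hp3 (fun α s H hC h => ?_) (fun α s H hC hE => ?_)
  · have h := preC_sound hC _ _ _ engP_118_0 h
    have h := preC_sound hC _ _ _ engP_118_4 h
    exact h
  · have h := lasC_sound hC hE engL_118
    have h := sufCk_sound hC engS_118_20 h
    have h := sufCk_sound hC engS_118_16 h
    have h := sufCk_sound hC engS_118_12 h
    have h := sufCk_sound hC engS_118_8 h
    have h := sufCk_sound hC engS_118_4 h
    have h := sufCk_sound hC engS_118_0 h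
    exact h

lemma engL_120 : lasC (cellV 120 122) (lasE 120 122) 28677 29496 29282 30327 = true := by decide +kernel

lemma engS_120_31 : sufCk (cellV 120 122) 28677 0
  [(26219, 32789, 33980), (27038, 31864, 33015), (27857, 30972, 32087), (28677, 30111, 31192)] 25399 678686395367 = true := by decide +kernel

lemma engS_120_27 : sufCk (cellV 120 122) 25399 678686395367
  [(22941, 36866, 38232), (23761, 35786, 37106), (24580, 34749, 36022), (25399, 33751, 34982)] 22122 2529783589411 = true := by decide +kernel

lemma engS_120_23 : sufCk (cellV 120 122) 22122 2529783589411
  [(19664, 41654, 43233), (20483, 40381, 41903), (21303, 39160, 40629), (22122, 37990, 39405)] 18845 5384818315421 = true := by decide +kernel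

lemma engS_120_19 : sufCk (cellV 120 122) 18845 5384818315421
  [(16387, 47337, 49180), (17206, 45821, 47591), (18025, 44371, 46074), (18845, 42982, 44623)] 15567 8725491422343 = true := by decide +kernel

lemma engS_120_15 : sufCk (cellV 120 122) 15567 8725491422343
  [(13109, 54158, 56319), (13929, 52330, 54407), (14748, 50588, 52581), (15567, 48926, 50841)] 12290 11622721623431 = true := by decide +kernel

lemma engS_120_11 : sufCk (cellV 120 122) 12290 11622721623431
  [(9832, 62416, 64970), (10651, 60198, 62646), (11471, 58084, 60434), (12290, 56074, 58326)] 9013 12870135994215 = true := by decide +kernel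

lemma engS_120_7 : sufCk (cellV 120 122) 9013 12870135994215
  [(6555, 72494, 75526), (7374, 69781, 72682), (8193, 67203, 69982), (9013, 64748, 67415)] 5735 10674903804378 = true := by decide +kernel

lemma engS_120_3 : sufCk (cellV 120 122) 5735 10674903804378
  [(3277, 84851, 88445), (4097, 81519, 84966), (4916, 78357, 81656), (5735, 75352, 78513)] 2458 4539036714528 = true := by decide +kernel

lemma engS_120_0 : sufCk (cellV 120 122) 2458 4539036714528
  [(819, 95922, 100000), (1639, 92039, 95956), (2458, 88354, 92103)] 0 279251667832 = true := by decide +kernel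

theorem cell_120 {p : ℝ} (hp0 : 2 + ((120:ℕ):ℝ) / 200 ≤ p) (hp1 : p ≤ 2 + ((122:ℕ):ℝ) / 200) (hp3 : p < 3) : Min1 p := by
  refine cells1 (acc' := 279251667832) (by norm_num) (by norm_num) hp0 hp1 hp3 (fun α s H hC hE => ?_)
  have h := lasC_sound hC hE engL_120
  have h := sufCk_sound hC engS_120_31 h
  have h := sufCk_sound hC engS_120_27 h
  have h := sufCk_sound hC engS_120_23 h
  have h := sufCk_sound hC engS_120_19 h
  have h := sufCk_sound hC engS_120_15 h
  have h := sufCk_sound hC engS_120_11 h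
  have h := sufCk_sound hC engS_120_7 h
  have h := sufCk_sound hC engS_120_3 h
  have h := sufCk_sound hC engS_120_0 h
  exact h

lemma engL_122 : lasC (cellV 122 124) (lasE 122 124) 28260 29390 29177 30546 = true := by decide +kernel

lemma engS_122_21 : sufCk (cellV 122 124) 28260 0
  [(24868, 34164, 35817), (25999, 32819, 34394), (27129, 31543, 33045), (28260, 30330, 31764)] 23738 1465443026657 = true := by decide +kernel

lemma engS_122_17 : sufCk (cellV 122 124) 23738 1465443026657
  [(20347, 40343, 42373), (21477, 38665, 40590), (22608, 37079, 38908), (23738, 35582, 37319)] 19217 5273600700519 = true := by decide +kernel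

lemma engS_122_13 : sufCk (cellV 122 124) 19217 5273600700519
  [(15825, 48166, 50700), (16956, 46025, 48420), (18086, 44015, 46278), (19217, 42123, 44267)] 14695 10345715415395 = true := by decide +kernel

lemma engS_122_9 : sufCk (cellV 122 124) 14695 10345715415395
  [(11304, 58267, 61480), (12434, 55485, 58507), (13565, 52881, 55731), (14695, 50447, 53132)] 10173 14173423396569 = true := by decide +kernel

lemma engS_122_5 : sufCk (cellV 122 124) 10173 14173423396569
  [(6782, 71537, 75651), (7913, 67861, 71729), (9043, 64439, 68071), (10173, 61248, 64662)] 5652 13016324774927 = true := by decide +kernel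

lemma engS_122_1 : sufCk (cellV 122 124) 5652 13016324774927
  [(2261, 89139, 94427), (3391, 84259, 89224), (4522, 79711, 84379), (5652, 75478, 79859)] 1130 3983660574566 = true := by decide +kernel

lemma engS_122_0 : sufCk (cellV 122 124) 1130 3983660574566
  [(1130, 94381, 100000)] 0 1910119352406 = true := by decide +kernel

theorem cell_122 {p : ℝ} (hp0 : 2 + ((122:ℕ):ℝ) / 200 ≤ p) (hp1 : p ≤ 2 + ((124:ℕ):ℝ) / 200) (hp3 : p < 3) : Min1 p := by
  refine cells1 (acc' := 1910119352406) (by norm_num) (by norm_num) hp0 hp1 hp3 (fun α s H hC hE => ?_)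
  have h := lasC_sound hC hE engL_122
  have h := sufCk_sound hC engS_122_21 h
  have h := sufCk_sound hC engS_122_17 h
  have h := sufCk_sound hC engS_122_13 h
  have h := sufCk_sound hC engS_122_9 h
  have h := sufCk_sound hC engS_122_5 h
  have h := sufCk_sound hC engS_122_1 h
  have h := sufCk_sound hC engS_122_0 h
  exact h

lemma engL_124 : lasC (cellV 124 126) (lasE 124 126) 27821 29285 29073 30795 = true := by decide +kernel

lemma engS_124_15 : sufCk (cellV 124 126) 27821 0
  [(23428, 35750, 37972), (24892, 33906, 35985), (26356, 32186, 34135), (27821, 30578, 32409)] 21964 2699954563237 = true := by decide +kernel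

lemma engS_124_11 : sufCk (cellV 124 126) 21964 2699954563237
  [(17571, 44665, 47621), (19035, 42172, 44917), (20500, 39866, 42421), (21964, 37732, 40112)] 16107 9130299417059 = true := by decide +kernel

lemma engS_124_7 : sufCk (cellV 124 126) 16107 9130299417059
  [(11714, 56993, 61039), (13178, 53505, 57236), (14642, 50307, 53754), (16107, 47368, 50559)] 10250 15238093813863 = true := by decide +kernel

lemma engS_124_3 : sufCk (cellV 124 126) 10250 15238093813863
  [(5857, 74566, 80214), (7321, 69552, 74743), (8786, 64977, 69754), (10250, 60805, 65197)] 4393 13148983367549 = true := by decide +kernel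

lemma engS_124_0 : sufCk (cellV 124 126) 4393 13148983367549
  [(1464, 92737, 100000), (2928, 86111, 92795), (4393, 80069, 86218)] 0 2856060766326 = true := by decide +kernel

theorem cell_124 {p : ℝ} (hp0 : 2 + ((124:ℕ):ℝ) / 200 ≤ p) (hp1 : p ≤ 2 + ((126:ℕ):ℝ) / 200) (hp3 : p < 3) : Min1 p := by
  refine cells1 (acc' := 2856060766326) (by norm_num) (by norm_num) hp0 hp1 hp3 (fun α s H hC hE => ?_)
  have h := lasC_sound hC hE engL_124
  have h := sufCk_sound hC engS_124_15 h
  have h := sufCk_sound hC engS_124_11 h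
  have h := sufCk_sound hC engS_124_7 h
  have h := sufCk_sound hC engS_124_3 h
  have h := sufCk_sound hC engS_124_0 h
  exact h

lemma engL_126 : lasC (cellV 126 128) (lasE 126 128) 27357 29181 28969 31077 = true := by decide +kernel

lemma engS_126_11 : sufCk (cellV 126 128) 27357 0
  [(21886, 37603, 40538), (23710, 35153, 37843), (25533, 32914, 35386), (27357, 30860, 33140)] 20062 4462205644721 = true := by decide +kernel

lemma engS_126_7 : sufCk (cellV 126 128) 20062 4462205644721
  [(14590, 50165, 54454), (16414, 46532, 50417), (18238, 43256, 46784), (20062, 40293, 43506)] 12767 13535905079093 = true := by decide +kernel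

lemma engS_126_3 : sufCk (cellV 126 128) 12767 13535905079093
  [(7295, 69436, 75969), (9119, 63772, 69638), (10943, 58720, 63996), (12767, 54207, 58959)] 5471 16341105645461 = true := by decide +kernel

lemma engS_126_0 : sufCk (cellV 126 128) 5471 16341105645461
  [(1824, 90980, 100000), (3648, 82945, 91052), (5471, 75799, 83072)] 0 2983356205397 = true := by decide +kernel

theorem cell_126 {p : ℝ} (hp0 : 2 + ((126:ℕ):ℝ) / 200 ≤ p) (hp1 : p ≤ 2 + ((128:ℕ):ℝ) / 200) (hp3 : p < 3) : Min1 p := by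
  refine cells1 (acc' := 2983356205397) (by norm_num) (by norm_num) hp0 hp1 hp3 (fun α s H hC hE => ?_)
  have h := lasC_sound hC hE engL_126
  have h := sufCk_sound hC engS_126_11 h
  have h := sufCk_sound hC engS_126_7 h
  have h := sufCk_sound hC engS_126_3 h
  have h := sufCk_sound hC engS_126_0 h
  exact h

lemma engL_128 : lasC (cellV 128 131) (lasE 128 131) 26999 29076 28763 31250 = true := by decide +kernel

lemma engS_128_9 : sufCk (cellV 128 131) 26999 0
  [(20769, 38858, 42492), (22845, 35936, 39221), (24922, 33305, 36288), (26999, 30925, 33644)] 18692 5855529488551 = true := by decide +kernel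

lemma engS_128_5 : sufCk (cellV 128 131) 18692 5855529488551
  [(12461, 54561, 60209), (14538, 49899, 54930), (16615, 45779, 50276), (18692, 42121, 46155)] 10384 15959476690189 = true := by decide +kernel

lemma engS_128_1 : sufCk (cellV 128 131) 10384 15959476690189
  [(4154, 80666, 89810), (6231, 72781, 80878), (8307, 65891, 73058), (10384, 59856, 66214)] 2077 9676144462111 = true := by decide +kernel

lemma engS_128_0 : sufCk (cellV 128 131) 2077 9676144462111
  [(2077, 89689, 100000)] 0 2497231803535 = true := by decide +kernel

theorem cell_128 {p : ℝ} (hp0 : 2 + ((128:ℕ):ℝ) / 200 ≤ p) (hp1 : p ≤ 2 + ((131:ℕ):ℝ) / 200) (hp3 : p < 3) : Min1 p := by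
  refine cells1 (acc' := 2497231803535) (by norm_num) (by norm_num) hp0 hp1 hp3 (fun α s H hC hE => ?_)
  have h := lasC_sound hC hE engL_128
  have h := sufCk_sound hC engS_128_9 h
  have h := sufCk_sound hC engS_128_5 h
  have h := sufCk_sound hC engS_128_1 h
  have h := sufCk_sound hC engS_128_0 h
  exact h

lemma engL_131 : lasC (cellV 131 139) (lasE 131 139) 26855 28921 28103 31084 = true := by decide +kernel

lemma engS_131_9 : sufCk (cellV 131 139) 26855 0
  [(20658, 38069, 42288), (22724, 35175, 39024), (24789, 32576, 36099), (26855, 30230, 33466)] 18592 5302798220404 = true := by decide +kernel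

lemma engS_131_5 : sufCk (cellV 131 139) 18592 5302798220404
  [(12395, 53740, 60007), (14460, 49068, 54720), (16526, 44951, 50065), (18592, 41309, 45946)] 10329 14727723783120 = true := by decide +kernel

lemma engS_131_1 : sufCk (cellV 131 139) 10329 14727723783120
  [(4132, 80189, 89741), (6197, 72159, 80757), (8263, 65165, 72902), (10329, 59068, 66028)] 2066 8171809156514 = true := by decide +kernel

lemma engS_131_0 : sufCk (cellV 131 139) 2066 8171809156514
  [(2066, 89417, 100000)] 0 869588132718 = true := by decide +kernel

theorem cell_131 {p : ℝ} (hp0 : 2 + ((131:ℕ):ℝ) / 200 ≤ p) (hp1 : p ≤ 2 + ((139:ℕ):ℝ) / 200) (hp3 : p < 3) : Min1 p := by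
  refine cells1 (acc' := 869588132718) (by norm_num) (by norm_num) hp0 hp1 hp3 (fun α s H hC hE => ?_)
  have h := lasC_sound hC hE engL_131
  have h := sufCk_sound hC engS_131_9 h
  have h := sufCk_sound hC engS_131_5 h
  have h := sufCk_sound hC engS_131_1 h
  have h := sufCk_sound hC engS_131_0 h
  exact h

lemma engL_139 : lasC (cellV 139 151) (lasE 139 151) 25661 28512 27317 31558 = true := by decide +kernel

lemma engS_139_5 : sufCk (cellV 139 151) 25661 0
  [(17107, 42420, 49504), (19958, 37712, 43883), (22810, 33715, 39127), (25661, 30287, 35062)] 14256 10570958056277 = true := by decide +kernel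

lemma engS_139_1 : sufCk (cellV 139 151) 14256 10570958056277
  [(5702, 72906, 85761), (8554, 62930, 73985), (11405, 54760, 64256), (14256, 48023, 56206)] 2851 16255387460538 = true := by decide +kernel

lemma engS_139_0 : sufCk (cellV 139 151) 2851 16255387460538
  [(2851, 85107, 100000)] 0 3827483329044 = true := by decide +kernel

theorem cell_139 {p : ℝ} (hp0 : 2 + ((139:ℕ):ℝ) / 200 ≤ p) (hp1 : p ≤ 2 + ((151:ℕ):ℝ) / 200) (hp3 : p < 3) : Min1 p := by
  refine cells1 (acc' := 3827483329044) (by norm_num) (by norm_num) hp0 hp1 hp3 (fun α s H hC hE => ?_)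
  have h := lasC_sound hC hE engL_139
  have h := sufCk_sound hC engS_139_5 h
  have h := sufCk_sound hC engS_139_1 h
  have h := sufCk_sound hC engS_139_0 h
  exact h

lemma engL_151 : lasC (cellV 151 163) (lasE 151 163) 23260 27912 26752 33140 = true := by decide +kernel

lemma engS_151_1 : sufCk (cellV 151 163) 23260 0
  [(9304, 59248, 77117), (13956, 47211, 60624), (18608, 38439, 48675), (23260, 31851, 39843)] 4652 19937840914332 = true := by decide +kernel

lemma engS_151_0 : sufCk (cellV 151 163) 4652 19937840914332
  [(4652, 76146, 100000)] 0 14335155770640 = true := by decide +kernel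

theorem cell_151 {p : ℝ} (hp0 : 2 + ((151:ℕ):ℝ) / 200 ≤ p) (hp1 : p ≤ 2 + ((163:ℕ):ℝ) / 200) (hp3 : p < 3) : Min1 p := by
  refine cells1 (acc' := 14335155770640) (by norm_num) (by norm_num) hp0 hp1 hp3 (fun α s H hC hE => ?_)
  have h := lasC_sound hC hE engL_151
  have h := sufCk_sound hC engS_151_1 h
  have h := sufCk_sound hC engS_151_0 h
  exact h

lemma engL_163 : lasC (cellV 163 175) (lasE 163 175) 18219 27329 26203 39078 = true := by decide +kernel

lemma engS_163_0 : sufCk (cellV 163 175) 18219 0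
  [(9110, 58470, 100000), (18219, 37703, 59843)] 0 5622641607525 = true := by decide +kernel

theorem cell_163 {p : ℝ} (hp0 : 2 + ((163:ℕ):ℝ) / 200 ≤ p) (hp1 : p ≤ 2 + ((175:ℕ):ℝ) / 200) (hp3 : p < 3) : Min1 p := by
  refine cells1 (acc' := 5622641607525) (by norm_num) (by norm_num) hp0 hp1 hp3 (fun α s H hC hE => ?_)
  have h := lasC_sound hC hE engL_163
  have h := sufCk_sound hC engS_163_0 h
  exact h

lemma engL_175 : lasC (cellV 175 187) (lasE 175 187) 17843 26764 25670 38327 = true := by decide +kernel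

lemma engS_175_0 : sufCk (cellV 175 187) 17843 0
  [(8921, 57698, 100000), (17843, 36982, 59067)] 0 8303607079560 = true := by decide +kernel

theorem cell_175 {p : ℝ} (hp0 : 2 + ((175:ℕ):ℝ) / 200 ≤ p) (hp1 : p ≤ 2 + ((187:ℕ):ℝ) / 200) (hp3 : p < 3) : Min1 p := by
  refine cells1 (acc' := 8303607079560) (by norm_num) (by norm_num) hp0 hp1 hp3 (fun α s H hC hE => ?_)
  have h := lasC_sound hC hE engL_175
  have h := sufCk_sound hC engS_175_0 h
  exact h

lemma engL_187 : lasC (cellV 187 199) (lasE 187 199) 17477 26215 25154 37596 = true := by decide +kernel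

lemma engS_187_0 : sufCk (cellV 187 199) 17477 0
  [(8738, 56928, 100000), (17477, 36282, 58292)] 0 10870745194737 = true := by decide +kernel

theorem cell_187 {p : ℝ} (hp0 : 2 + ((187:ℕ):ℝ) / 200 ≤ p) (hp1 : p ≤ 2 + ((199:ℕ):ℝ) / 200) (hp3 : p < 3) : Min1 p := by
  refine cells1 (acc' := 10870745194737) (by norm_num) (by norm_num) hp0 hp1 hp3 (fun α s H hC hE => ?_)
  have h := lasC_sound hC hE engL_187
  have h := sufCk_sound hC engS_187_0 h
  exact h

lemma engL_199 : lasC (cellV 199 200) (lasE 199 200) 17121 25682 25592 36884 = true := by decide +kernel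

lemma engS_199_0 : sufCk (cellV 199 200) 17121 0
  [(8561, 57403, 100000), (17121, 36775, 57517)] 0 18790737187680 = true := by decide +kernel

theorem cell_199 {p : ℝ} (hp0 : 2 + ((199:ℕ):ℝ) / 200 ≤ p) (hp1 : p ≤ 2 + ((200:ℕ):ℝ) / 200) (hp3 : p < 3) : Min1 p := by
  refine cells1 (acc' := 18790737187680) (by norm_num) (by norm_num) hp0 hp1 hp3 (fun α s H hC hE => ?_)
  have h := lasC_sound hC hE engL_199
  have h := sufCk_sound hC engS_199_0 h
  exact h

theorem engine0 {p : ℝ} (h0 : 2.01 ≤ p) (h1 : p ≤ 2.55) : Min0 p := by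
  have h3 : p < 3 := by linarith
  rcases le_total p (2 + ((14:ℕ):ℝ) / 200) with h | h
  · exact cell_2 (by push_cast at *; linarith) h h3
  rcases le_total p (2 + ((26:ℕ):ℝ) / 200) with h | h
  · exact cell_14 (by push_cast at *; linarith) h h3
  rcases le_total p (2 + ((36:ℕ):ℝ) / 200) with h | h
  · exact cell_26 (by push_cast at *; linarith) h h3
  rcases le_total p (2 + ((48:ℕ):ℝ) / 200) with h | h
  · exact cell_36 (by push_cast at *; linarith) h h3
  rcases le_total p (2 + ((60:ℕ):ℝ) / 200) with h | h
  · exact cell_48 (by push_cast at *; linarith) h h3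
  rcases le_total p (2 + ((70:ℕ):ℝ) / 200) with h | h
  · exact cell_60 (by push_cast at *; linarith) h h3
  rcases le_total p (2 + ((82:ℕ):ℝ) / 200) with h | h
  · exact cell_70 (by push_cast at *; linarith) h h3
  rcases le_total p (2 + ((92:ℕ):ℝ) / 200) with h | h
  · exact cell_82 (by push_cast at *; linarith) h h3
  rcases le_total p (2 + ((98:ℕ):ℝ) / 200) with h | h
  · exact cell_92 (by push_cast at *; linarith) h h3
  rcases le_total p (2 + ((102:ℕ):ℝ) / 200) with h | h
  · exact cell_98 (by push_cast at *; linarith) h h3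
  rcases le_total p (2 + ((104:ℕ):ℝ) / 200) with h | h
  · exact cell_102 (by push_cast at *; linarith) h h3
  rcases le_total p (2 + ((106:ℕ):ℝ) / 200) with h | h
  · exact cell_104 (by push_cast at *; linarith) h h3
  rcases le_total p (2 + ((108:ℕ):ℝ) / 200) with h | h
  · exact cell_106 (by push_cast at *; linarith) h h3
  exact cell_108 (by push_cast at *; linarith) (by push_cast; linarith) h3

theorem engineM {p : ℝ} (h0 : 2.55 ≤ p) (h1 : p ≤ 2.6) : MinM p := by
  have h3 : p < 3 := by linarith
  rcases le_total p (2 + ((112:ℕ):ℝ) / 200) with h | h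
  · exact cell_110 (by push_cast at *; linarith) h h3
  rcases le_total p (2 + ((114:ℕ):ℝ) / 200) with h | h
  · exact cell_112 (by push_cast at *; linarith) h h3
  rcases le_total p (2 + ((116:ℕ):ℝ) / 200) with h | h
  · exact cell_114 (by push_cast at *; linarith) h h3
  rcases le_total p (2 + ((118:ℕ):ℝ) / 200) with h | h
  · exact cell_116 (by push_cast at *; linarith) h h3
  exact cell_118 (by push_cast at *; linarith) (by push_cast; linarith) h3

theorem engine1 {p : ℝ} (h0 : 2.6 ≤ p) (h3 : p < 3) : Min1 p := by
  rcases le_total p (2 + ((122:ℕ):ℝ) / 200) with h | h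
  · exact cell_120 (by push_cast at *; linarith) h h3
  rcases le_total p (2 + ((124:ℕ):ℝ) / 200) with h | h
  · exact cell_122 (by push_cast at *; linarith) h h3
  rcases le_total p (2 + ((126:ℕ):ℝ) / 200) with h | h
  · exact cell_124 (by push_cast at *; linarith) h h3
  rcases le_total p (2 + ((128:ℕ):ℝ) / 200) with h | h
  · exact cell_126 (by push_cast at *; linarith) h h3
  rcases le_total p (2 + ((131:ℕ):ℝ) / 200) with h | h
  · exact cell_128 (by push_cast at *; linarith) h h3
  rcases le_total p (2 + ((139:ℕ):ℝ) / 200) with h | h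
  · exact cell_131 (by push_cast at *; linarith) h h3
  rcases le_total p (2 + ((151:ℕ):ℝ) / 200) with h | h
  · exact cell_139 (by push_cast at *; linarith) h h3
  rcases le_total p (2 + ((163:ℕ):ℝ) / 200) with h | h
  · exact cell_151 (by push_cast at *; linarith) h h3
  rcases le_total p (2 + ((175:ℕ):ℝ) / 200) with h | h
  · exact cell_163 (by push_cast at *; linarith) h h3
  rcases le_total p (2 + ((187:ℕ):ℝ) / 200) with h | h
  · exact cell_175 (by push_cast at *; linarith) h h3
  rcases le_total p (2 + ((199:ℕ):ℝ) / 200) with h | h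
  · exact cell_187 (by push_cast at *; linarith) h h3
  exact cell_199 (by push_cast at *; linarith) (by push_cast; linarith) h3

/-- exponential sum -/
noncomputable def ES {N : ℕ} (c l : Fin N → ℝ) (x : ℝ) : ℝ := ∑ i, c i * Real.exp (l i * x)

/-- `F` alternates in sign at `k` points beyond `t`, starting with sign `e` -/
def Alt (F : ℝ → ℝ) : ℕ → ℝ → ℝ → Prop
  | 0, _, _ => True
  | k + 1, e, t => ∃ x, t < x ∧ 0 < e * F x ∧ Alt F k (-e) x

lemma Alt.mono {F : ℝ → ℝ} {k : ℕ} {e t t' : ℝ} (h : Alt F k e t) (ht : t' ≤ t) : Alt F k e t' := by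
  cases k with
  | zero => trivial
  | succ k =>
    obtain ⟨x, hx, h1, h2⟩ := h
    exact ⟨x, lt_of_le_of_lt ht hx, h1, h2⟩

lemma ES_kill_pt {N : ℕ} (c l : Fin N → ℝ) (m : ℝ) {e x y : ℝ} (hxy : x < y) (h1 : 0 < e * ES c l x)
    (h2 : 0 < -e * ES c l y) : ∃ z, x < z ∧ z < y ∧ 0 < -e * ES (fun i => c i * (l i - m)) l z := by
  have hd : ∀ z, HasDerivAt (fun z => Real.exp (-m * z) * ES c l z)
      (Real.exp (-m * z) * ES (fun i => c i * (l i - m)) l z) z := by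
    intro z
    have h3 : HasDerivAt (fun z => ES c l z) (∑ i, c i * (Real.exp (l i * z) * l i)) z := by
      unfold ES
      exact HasDerivAt.fun_sum (u := Finset.univ) (x := z) (A := fun i => fun z => c i * Real.exp (l i * z))
        (A' := fun i => c i * (Real.exp (l i * z) * l i)) (fun i _ => by
          have := ((hasDerivAt_id z).const_mul (l i)).exp.const_mul (c i)
          simpa using this)
    have h4 : HasDerivAt (fun z : ℝ => Real.exp (-m * z)) (Real.exp (-m * z) * -m) z := by
      have := ((hasDerivAt_id z).const_mul (-m)).exp
      simpa using this
    refine (h4.mul h3).congr_deriv ?_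
    unfold ES
    rw [Finset.mul_sum, Finset.mul_sum, Finset.mul_sum, ← Finset.sum_add_distrib]
    refine Finset.sum_congr rfl fun i _ => ?_
    ring
  obtain ⟨z, hz, hz2⟩ := exists_hasDerivAt_eq_slope _ _ hxy
    (HasDerivAt.continuousOn fun z _ => hd z) (fun z _ => hd z)
  refine ⟨z, hz.1, hz.2, ?_⟩
  have hm := Real.exp_pos (-m * z)
  have hx := Real.exp_pos (-m * x)
  have hy := Real.exp_pos (-m * y)
  rw [eq_div_iff (by linarith)] at hz2
  have hyx : 0 < y - x := by linarith
  have : 0 < (Real.exp (-m * z) * (y - x)) * (-e * ES (fun i => c i * (l i - m)) l z) := by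
    have e1 : (Real.exp (-m * z) * (y - x)) * (-e * ES (fun i => c i * (l i - m)) l z)
      = Real.exp (-m * y) * (-e * ES c l y) + Real.exp (-m * x) * (e * ES c l x) := by
      linear_combination (-e) * hz2
    rw [e1]; positivity
  exact pos_of_mul_pos_right this (by positivity)

lemma ES_kill' {N : ℕ} (c l : Fin N → ℝ) (m : ℝ) : ∀ (k : ℕ) (e t x : ℝ), 0 < e * ES c l x → t ≤ x →
    Alt (ES c l) k (-e) x → Alt (ES (fun i => c i * (l i - m)) l) k (-e) t := by
  intro k
  induction k with
  | zero => intros; trivial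
  | succ k ih =>
    intro e t x hx ht h
    obtain ⟨y, hy, h1, h2⟩ := h
    obtain ⟨z, hz1, hz2, hz3⟩ := ES_kill_pt c l m hy hx h1
    exact ⟨z, by linarith, hz3, ih (-e) z y h1 hz2.le h2⟩

lemma ES_kill {N : ℕ} (c l : Fin N → ℝ) (m : ℝ) {k : ℕ} {e t : ℝ}
    (h : Alt (ES c l) (k + 1) e t) : Alt (ES (fun i => c i * (l i - m)) l) k (-e) t := by
  obtain ⟨x, hx, h1, h2⟩ := h
  exact ES_kill' c l m k e t x h1 hx.le h2

lemma ES_nonpos {N : ℕ} {c l : Fin N → ℝ} {t : ℝ} (hc : ∀ i, c i ≤ 0) (h : Alt (ES c l) 1 1 t) : False := by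
  obtain ⟨x, -, h1, -⟩ := h
  have : ES c l x ≤ 0 := Finset.sum_nonpos fun i _ => mul_nonpos_of_nonpos_of_nonneg (hc i) (Real.exp_pos _).le
  linarith

lemma descartes8 {c l : Fin 8 → ℝ} {t : ℝ} (h01 : l 1 < l 0) (h12 : l 2 < l 1) (h23 : l 3 < l 2) (h34 : l 4 < l 3)
    (h45 : l 5 < l 4) (h56 : l 6 < l 5) (h67 : l 7 < l 6) (c3 : 0 ≤ c 3) (c5 : c 5 ≤ 0) (c6 : c 6 ≤ 0)
    (h : Alt (ES c l) 6 (-1) t) : False := by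
  have h1 := ES_kill _ _ (l 7) (ES_kill _ _ (l 4) (ES_kill _ _ (l 2) (ES_kill _ _ (l 1) (ES_kill _ _ (l 0) h))))
  simp only [neg_neg] at h1
  refine ES_nonpos ?_ h1
  intro i
  fin_cases i
  · simp
  · simp
  · simp
  · show c 3 * (l 3 - l 0) * (l 3 - l 1) * (l 3 - l 2) * (l 3 - l 4) * (l 3 - l 7) ≤ 0
    have : 0 ≤ c 3 * (l 0 - l 3) * (l 1 - l 3) * (l 2 - l 3) * (l 3 - l 4) * (l 3 - l 7) := by
      have := sub_nonneg.2 (show l 3 ≤ l 0 by linarith)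
      have := sub_nonneg.2 (show l 3 ≤ l 1 by linarith)
      have := sub_nonneg.2 (show l 3 ≤ l 2 by linarith)
      have := sub_nonneg.2 (show l 4 ≤ l 3 by linarith)
      have := sub_nonneg.2 (show l 7 ≤ l 3 by linarith)
      positivity
    linarith
  · simp
  · show c 5 * (l 5 - l 0) * (l 5 - l 1) * (l 5 - l 2) * (l 5 - l 4) * (l 5 - l 7) ≤ 0
    have : 0 ≤ (-c 5) * (l 0 - l 5) * (l 1 - l 5) * (l 2 - l 5) * (l 4 - l 5) * (l 5 - l 7) := by
      have := sub_nonneg.2 (show l 5 ≤ l 0 by linarith)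
      have := sub_nonneg.2 (show l 5 ≤ l 1 by linarith)
      have := sub_nonneg.2 (show l 5 ≤ l 2 by linarith)
      have := sub_nonneg.2 (show l 5 ≤ l 4 by linarith)
      have := sub_nonneg.2 (show l 7 ≤ l 5 by linarith)
      have := neg_nonneg.2 c5
      positivity
    linarith
  · show c 6 * (l 6 - l 0) * (l 6 - l 1) * (l 6 - l 2) * (l 6 - l 4) * (l 6 - l 7) ≤ 0
    have : 0 ≤ (-c 6) * (l 0 - l 6) * (l 1 - l 6) * (l 2 - l 6) * (l 4 - l 6) * (l 6 - l 7) := by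
      have := sub_nonneg.2 (show l 6 ≤ l 0 by linarith)
      have := sub_nonneg.2 (show l 6 ≤ l 1 by linarith)
      have := sub_nonneg.2 (show l 6 ≤ l 2 by linarith)
      have := sub_nonneg.2 (show l 6 ≤ l 4 by linarith)
      have := sub_nonneg.2 (show l 7 ≤ l 6 by linarith)
      have := neg_nonneg.2 c6
      positivity
    linarith
  · simp

open Filter Topology in
lemma ev_pos {f : ℝ → ℝ} (hf : Continuous f) (h0 : 0 < f 0) : ∀ᶠ e in 𝓝[>] (0:ℝ), 0 < f e := by
  have := hf.continuousAt.eventually (lt_mem_nhds h0)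
  exact this.filter_mono nhdsWithin_le_nhds

open Filter Topology in
/-- the perturbation argument, first case -/
lemma perturb_a {T S D0 D1 : ℝ → ℝ} {x : ℝ} (hx0 : 0 < x) (hx1 : x < 1) (t0 : T (-1) = 0) (t1 : T 0 = 0) (t2 : T 1 = 0)
    (s0 : S (-1) = 0) (s1 : S 0 = 0) (s2 : S 1 = 0) (s3 : S 2 = 1) (d0 : D0 (-1) = 1)
    (e0 : D1 (-1) = 0) (e1 : D1 0 = 1) (e2 : 0 < D1 1)
    (hx : T x < 0) (hS : S x ≤ 0) (hT2 : T 2 ≤ 0) (h3 : 0 < T 3 - T 2 * S 3) :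
    ∃ u v w : ℝ, Alt (fun n => T n + u * S n + v * D1 n + w * D0 n) 6 (-1) (-2) := by
  have hneg : 0 < -(T x - T 2 * S x) := by nlinarith
  have E1 := ev_pos (f := fun e => 1 - e * D0 0) (by fun_prop) (by norm_num)
  have E2 := ev_pos (f := fun e => -(T x - T 2 * S x) + e * S x - e ^ 2 * D1 x + e ^ 3 * D0 x) (by fun_prop) (by simpa using hneg)
  have E3 := ev_pos (f := fun e => D1 1 - e * D0 1) (by fun_prop) (by simpa using e2)
  have E4 := ev_pos (f := fun e => 1 - e * D1 2 + e ^ 2 * D0 2) (by fun_prop) (by norm_num)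
  have E5 := ev_pos (f := fun e => (T 3 - T 2 * S 3) - e * S 3 + e ^ 2 * D1 3 - e ^ 3 * D0 3) (by fun_prop) (by simpa using h3)
  have E6 : ∀ᶠ e in 𝓝[>] (0:ℝ), 0 < e := self_mem_nhdsWithin
  obtain ⟨e, ⟨⟨⟨⟨⟨h1, h2⟩, h3⟩, h4⟩, h5⟩, h6⟩⟩ := ((((E1.and E2).and E3).and E4).and E5 |>.and E6).exists
  refine ⟨-T 2 - e, e ^ 2, - e ^ 3, -1, by norm_num, ?_, 0, by norm_num, ?_, x, hx0, ?_, 1, hx1, ?_, 2, by norm_num, ?_, 3, by norm_num, ?_, trivial⟩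
  · simp only [t0, s0, e0, d0]
    have := pow_pos h6 3
    nlinarith
  · simp only [t1, s1, e1]
    have := mul_pos (pow_pos h6 2) h1
    nlinarith
  · nlinarith
  · simp only [t2, s2]
    have := mul_pos (pow_pos h6 2) h3
    nlinarith
  · simp only [s3]
    have := mul_pos h6 h4
    nlinarith
  · nlinarith

open Filter Topology in
/-- the perturbation argument, second case -/
lemma perturb_b {T S D0 D1 D2 : ℝ → ℝ} {x : ℝ} (hx0 : 1 < x) (hx1 : x < 2) (t0 : T (-1) = 0) (t1 : T 0 = 0) (t2 : T 1 = 0)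
    (s0 : S (-1) = 0) (s1 : S 0 = 0) (s2 : S 1 = 0) (s3 : S 2 = 1) (d0 : D0 (-1) = 1)
    (e0 : D1 (-1) = 0) (e1 : D1 0 = 1) (f0 : D2 (-1) = 0) (f1 : D2 0 = 0) (f2 : D2 1 = 1)
    (hx : 0 < T x) (hS : 0 ≤ S x) (hT2 : T 2 ≤ 0) (h3 : 0 < T 3 - T 2 * S 3) :
    ∃ u v w z : ℝ, Alt (fun n => T n + u * S n + z * D2 n + v * D1 n + w * D0 n) 6 (-1) (-2) := by
  have hneg : 0 < (T x - T 2 * S x) := by nlinarith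
  have E1 := ev_pos (f := fun e => 1 - e * D0 0) (by fun_prop) (by norm_num)
  have E2 := ev_pos (f := fun e => (T x - T 2 * S x) - e * S x - e ^ 2 * D2 x + e ^ 3 * D1 x - e ^ 4 * D0 x) (by fun_prop) (by simpa using hneg)
  have E3 := ev_pos (f := fun e => 1 - e * D1 1 + e ^ 2 * D0 1) (by fun_prop) (by norm_num)
  have E4 := ev_pos (f := fun e => 1 + e * D2 2 - e ^ 2 * D1 2 + e ^ 3 * D0 2) (by fun_prop) (by norm_num)
  have E5 := ev_pos (f := fun e => (T 3 - T 2 * S 3) - e * S 3 - e ^ 2 * D2 3 + e ^ 3 * D1 3 - e ^ 4 * D0 3) (by fun_prop) (by simpa using h3)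
  have E6 : ∀ᶠ e in 𝓝[>] (0:ℝ), 0 < e := self_mem_nhdsWithin
  obtain ⟨e, ⟨⟨⟨⟨⟨h1, h2⟩, h3⟩, h4⟩, h5⟩, h6⟩⟩ := ((((E1.and E2).and E3).and E4).and E5 |>.and E6).exists
  refine ⟨-T 2 - e, e ^ 3, - e ^ 4, - e ^ 2, -1, by norm_num, ?_, 0, by norm_num, ?_, 1, by norm_num, ?_, x, hx0, ?_, 2, hx1, ?_, 3, by norm_num, ?_, trivial⟩
  · simp only [t0, s0, e0, d0, f0]
    have := pow_pos h6 4
    nlinarith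
  · simp only [t1, s1, e1, f1]
    have := mul_pos (pow_pos h6 3) h1
    nlinarith
  · simp only [t2, s2, f2]
    have := mul_pos (pow_pos h6 2) h3
    nlinarith
  · nlinarith
  · simp only [s3]
    have := mul_pos h6 h4
    nlinarith
  · nlinarith

lemma ES8 (c y : Fin 8 → ℝ) (hy : ∀ i, 0 < y i) (n : ℝ) :
    ES c (fun i => Real.log (y i)) n = c 0 * y 0 ^ n + c 1 * y 1 ^ n + c 2 * y 2 ^ n + c 3 * y 3 ^ n
      + c 4 * y 4 ^ n + c 5 * y 5 ^ n + c 6 * y 6 ^ n + c 7 * y 7 ^ n := by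
  unfold ES
  rw [Fin.sum_univ_eight]
  simp only [Real.rpow_def_of_pos (hy _)]

lemma dd3_rpow_sign {x y z w n : ℝ} (hx : 0 < x) (hxy : x < y) (hyz : y < z) (hzw : z < w) :
    ∃ ξ : ℝ, 0 < ξ ∧ dd3 (fun t => t ^ n) x y z w = n * (n - 1) * (n - 2) * ξ := by
  obtain ⟨ξ, h1, h2⟩ := dd3_mvt (F := fun t => t ^ n) (F1 := fun t => n * t ^ (n - 1))
    (F2 := fun t => n * ((n - 1) * t ^ (n - 1 - 1))) (F3 := fun t => n * ((n - 1) * ((n - 1 - 1) * t ^ (n - 1 - 1 - 1)))) hxy hyz hzw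
    (fun t ht => (Real.continuousAt_rpow_const t n (Or.inl (by linarith [ht.1] : (0:ℝ) < t).ne')).continuousWithinAt)
    (fun t ht => Real.hasDerivAt_rpow_const (Or.inl (by linarith [ht.1] : (0:ℝ) < t).ne'))
    (fun t ht => (Real.hasDerivAt_rpow_const (Or.inl (by linarith [ht.1] : (0:ℝ) < t).ne')).const_mul n)
    (fun t ht => ((Real.hasDerivAt_rpow_const (Or.inl (by linarith [ht.1] : (0:ℝ) < t).ne')).const_mul (n - 1)).const_mul n)
  refine ⟨ξ ^ (n - 1 - 1 - 1) / 6, ?_, ?_⟩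
  · have : 0 < ξ := by linarith [h1.1]
    positivity
  · rw [h2]; ring

lemma ES_add {N : ℕ} (c c' l : Fin N → ℝ) (u x : ℝ) :
    ES c l x + u * ES c' l x = ES (fun i => c i + u * c' i) l x := by
  unfold ES
  rw [Finset.mul_sum, ← Finset.sum_add_distrib]
  exact Finset.sum_congr rfl fun i _ => by ring

/-- sign of an eight term exponential sum vanishing at -1, 0, 1 -/
lemma eight_core {c y : Fin 8 → ℝ} (h01 : y 1 < y 0) (h12 : y 2 < y 1) (h23 : y 3 < y 2) (h34 : y 4 < y 3)
    (h45 : y 5 < y 4) (h56 : y 6 < y 5) (h67 : y 7 < y 6) (h7 : 0 < y 7) (c3 : 0 ≤ c 3) (c5 : c 5 ≤ 0) (c6 : c 6 ≤ 0)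
    {T : ℝ → ℝ} (hT : ∀ n, T n = ES c (fun i => Real.log (y i)) n)
    (t0 : T (-1) = 0) (t1 : T 0 = 0) (t2 : T 1 = 0) (hT2 : T 2 ≤ 0)
    (hT3 : 0 < T 3 - T 2 * (y 0 + y 1 + y 2 + y 4)) :
    (∀ n, 0 < n → n < 1 → 0 ≤ T n) ∧ (∀ n, 1 < n → n < 2 → T n ≤ 0) := by
  have p6 : 0 < y 6 := by linarith
  have p5 : 0 < y 5 := by linarith
  have p4 : 0 < y 4 := by linarith
  have p3 : 0 < y 3 := by linarith
  have p2 : 0 < y 2 := by linarith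
  have p1 : 0 < y 1 := by linarith
  have p0 : 0 < y 0 := by linarith
  have hy : ∀ i, 0 < y i := by
    intro i; fin_cases i <;> assumption
  set l : Fin 8 → ℝ := fun i => Real.log (y i) with hl
  have n01 : y 0 - y 1 ≠ 0 := by intro h; linarith
  have n02 : y 0 - y 2 ≠ 0 := by intro h; linarith
  have n04 : y 0 - y 4 ≠ 0 := by intro h; linarith
  have n12 : y 1 - y 2 ≠ 0 := by intro h; linarith
  have n14 : y 1 - y 4 ≠ 0 := by intro h; linarith
  have n24 : y 2 - y 4 ≠ 0 := by intro h; linarith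
  have r1 : y 1 - y 0 = -(y 0 - y 1) := by ring
  have r2 : y 2 - y 0 = -(y 0 - y 2) := by ring
  have r3 : y 4 - y 0 = -(y 0 - y 4) := by ring
  have r4 : y 2 - y 1 = -(y 1 - y 2) := by ring
  have r5 : y 4 - y 1 = -(y 1 - y 4) := by ring
  have r6 : y 4 - y 2 = -(y 2 - y 4) := by ring
  -- the comparison sums
  set cS : Fin 8 → ℝ := ![y 0 / ((y 0 - y 1) * (y 0 - y 2) * (y 0 - y 4)),
    y 1 / ((y 1 - y 0) * (y 1 - y 2) * (y 1 - y 4)), y 2 / ((y 2 - y 0) * (y 2 - y 1) * (y 2 - y 4)), 0,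
    y 4 / ((y 4 - y 0) * (y 4 - y 1) * (y 4 - y 2)), 0, 0, 0] with hcS
  set cD0 : Fin 8 → ℝ := ![y 0, 0, 0, 0, 0, 0, 0, 0] with hcD0
  set cD1 : Fin 8 → ℝ := ![y 0 / (y 0 - y 1), y 1 / (y 1 - y 0), 0, 0, 0, 0, 0, 0] with hcD1
  set cD2 : Fin 8 → ℝ := ![y 0 / ((y 0 - y 1) * (y 0 - y 2)), y 1 / ((y 1 - y 0) * (y 1 - y 2)),
    y 2 / ((y 2 - y 0) * (y 2 - y 1)), 0, 0, 0, 0, 0] with hcD2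
  have eS : ∀ n, ES cS l n = y 0 / ((y 0 - y 1) * (y 0 - y 2) * (y 0 - y 4)) * y 0 ^ n +
    y 1 / ((y 1 - y 0) * (y 1 - y 2) * (y 1 - y 4)) * y 1 ^ n + y 2 / ((y 2 - y 0) * (y 2 - y 1) * (y 2 - y 4)) * y 2 ^ n +
    y 4 / ((y 4 - y 0) * (y 4 - y 1) * (y 4 - y 2)) * y 4 ^ n := by
    intro n; rw [hl, ES8 _ _ hy]; simp [hcS]
  have eD0 : ∀ n, ES cD0 l n = y 0 * y 0 ^ n := by
    intro n; rw [hl, ES8 _ _ hy]; simp [hcD0]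
  have eD1 : ∀ n, ES cD1 l n = y 0 / (y 0 - y 1) * y 0 ^ n + y 1 / (y 1 - y 0) * y 1 ^ n := by
    intro n; rw [hl, ES8 _ _ hy]; simp [hcD1]
  have eD2 : ∀ n, ES cD2 l n = y 0 / ((y 0 - y 1) * (y 0 - y 2)) * y 0 ^ n + y 1 / ((y 1 - y 0) * (y 1 - y 2)) * y 1 ^ n
     + y 2 / ((y 2 - y 0) * (y 2 - y 1)) * y 2 ^ n := by
    intro n; rw [hl, ES8 _ _ hy]; simp [hcD2]
  have q2 : ∀ x : ℝ, x ^ (2:ℝ) = x ^ 2 := fun x => Real.rpow_natCast x 2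
  have q3 : ∀ x : ℝ, x ^ (3:ℝ) = x ^ 3 := fun x => Real.rpow_natCast x 3
  have s0 : ES cS l (-1) = 0 := by
    rw [eS]; simp only [Real.rpow_neg_one, r1, r2, r3, r4, r5, r6]; field_simp; ring
  have s1 : ES cS l 0 = 0 := by
    rw [eS]; simp only [Real.rpow_zero, r1, r2, r3, r4, r5, r6]; field_simp; ring
  have s2 : ES cS l 1 = 0 := by
    rw [eS]; simp only [Real.rpow_one, r1, r2, r3, r4, r5, r6]; field_simp; ring
  have s3 : ES cS l 2 = 1 := by
    rw [eS]; simp only [q2, r1, r2, r3, r4, r5, r6]; field_simp; ring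
  have s4 : ES cS l 3 = y 0 + y 1 + y 2 + y 4 := by
    rw [eS]; simp only [q3, r1, r2, r3, r4, r5, r6]; field_simp; ring
  have d0 : ES cD0 l (-1) = 1 := by
    rw [eD0, Real.rpow_neg_one]; field_simp
  have e0 : ES cD1 l (-1) = 0 := by
    rw [eD1]; simp only [Real.rpow_neg_one, r1]; field_simp; ring
  have e1 : ES cD1 l 0 = 1 := by
    rw [eD1]; simp only [Real.rpow_zero, r1]; field_simp; ring
  have e2 : ES cD1 l 1 = y 0 + y 1 := by
    rw [eD1]; simp only [Real.rpow_one, r1]; field_simp; ring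
  have f0 : ES cD2 l (-1) = 0 := by
    rw [eD2]; simp only [Real.rpow_neg_one, r1, r2, r4]; field_simp; ring
  have f1 : ES cD2 l 0 = 0 := by
    rw [eD2]; simp only [Real.rpow_zero, r1, r2, r4]; field_simp; ring
  have f2 : ES cD2 l 1 = 1 := by
    rw [eD2]; simp only [Real.rpow_one, r1, r2, r4]; field_simp; ring
  have hSd : ∀ n, ∃ ξ : ℝ, 0 < ξ ∧ ES cS l n = (n + 1) * n * (n - 1) * ξ := by
    intro n
    obtain ⟨ξ, h1, h2⟩ := dd3_rpow_sign (n := n + 1) p4 (h34.trans h23) h12 h01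
    refine ⟨ξ, h1, ?_⟩
    rw [eS]
    have : dd3 (fun t => t ^ (n + 1)) (y 4) (y 2) (y 1) (y 0) = y 0 / ((y 0 - y 1) * (y 0 - y 2) * (y 0 - y 4)) * y 0 ^ n +
    y 1 / ((y 1 - y 0) * (y 1 - y 2) * (y 1 - y 4)) * y 1 ^ n + y 2 / ((y 2 - y 0) * (y 2 - y 1) * (y 2 - y 4)) * y 2 ^ n +
    y 4 / ((y 4 - y 0) * (y 4 - y 1) * (y 4 - y 2)) * y 4 ^ n := by
      unfold dd3
      simp only [Real.rpow_add p0, Real.rpow_add p1, Real.rpow_add p2, Real.rpow_add p4, Real.rpow_one]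
      ring
    rw [← this, h2]; ring
  have m01 : l 1 < l 0 := Real.log_lt_log p1 h01
  have m12 : l 2 < l 1 := Real.log_lt_log p2 h12
  have m23 : l 3 < l 2 := Real.log_lt_log p3 h23
  have m34 : l 4 < l 3 := Real.log_lt_log p4 h34
  have m45 : l 5 < l 4 := Real.log_lt_log p5 h45
  have m56 : l 6 < l 5 := Real.log_lt_log p6 h56
  have m67 : l 7 < l 6 := Real.log_lt_log h7 h67
  constructor
  · intro n hn0 hn1
    by_contra hneg
    push Not at hneg
    obtain ⟨ξ, hξ, hS⟩ := hSd n
    obtain ⟨u, v, w, H⟩ := perturb_a (T := T) (S := ES cS l) (D0 := ES cD0 l) (D1 := ES cD1 l) hn0 hn1 t0 t1 t2 s0 s1 s2 s3 d0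
      e0 e1 (by rw [e2]; linarith) hneg (by
        rw [hS]
        have : 0 ≤ (n + 1) * n * (1 - n) * ξ := by
          have : 0 < 1 - n := by linarith
          positivity
        linarith) hT2 (by rwa [s4])
    simp only [hT, ES_add] at H
    refine descartes8 m01 m12 m23 m34 m45 m56 m67 ?_ ?_ ?_ H
    · simpa [hcS, hcD0, hcD1] using c3
    · simpa [hcS, hcD0, hcD1] using c5
    · simpa [hcS, hcD0, hcD1] using c6
  · intro n hn0 hn1
    by_contra hneg
    push Not at hneg
    obtain ⟨ξ, hξ, hS⟩ := hSd n
    obtain ⟨u, v, w, z, H⟩ := perturb_b (T := T) (S := ES cS l) (D0 := ES cD0 l) (D1 := ES cD1 l) (D2 := ES cD2 l) hn0 hn1 t0 t1 t2 s0 s1 s2 s3 d0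
      e0 e1 f0 f1 f2 hneg (by
        rw [hS]
        have : 0 < n - 1 := by linarith
        positivity) hT2 (by rwa [s4])
    simp only [hT, ES_add] at H
    refine descartes8 m01 m12 m23 m34 m45 m56 m67 ?_ ?_ ?_ H
    · simpa [hcS, hcD0, hcD1, hcD2] using c3
    · simpa [hcS, hcD0, hcD1, hcD2] using c5
    · simpa [hcS, hcD0, hcD1, hcD2] using c6

lemma final_poly {s q : ℝ} (hs1 : s ≤ 1) (h : 1 - s ≤ 2.11 * q) (hq : 4 * q ≤ s ^ 2) (hq0 : 0 < q) (hs0 : 0 < s) :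
    0 < ((1 + s + q) * (2 + 3 * s / 2) + (1 + s / 2) * q) * (1.89 * (1 + s + q) ^ 2 - q * (1 + 3 * s + 4 * q))
      - (1 + s) * (2.89 * (1 + s + q) ^ 3 - q ^ 2 * (2 + 4 * s + 5 * q)) := by
  have hs : 7/10 ≤ s := by nlinarith
  have hq4 : q ≤ 1/4 := by nlinarith
  nlinarith [mul_pos hq0 hq0, mul_nonneg (sub_nonneg.2 hs1) (sub_nonneg.2 hs), mul_nonneg hq0.le (sub_nonneg.2 hs), mul_nonneg hq0.le (sub_nonneg.2 hq4), mul_nonneg (mul_nonneg hq0.le (sub_nonneg.2 hq4)) (sub_nonneg.2 hs), mul_nonneg (sub_nonneg.2 hq4) (sub_nonneg.2 hs)]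

lemma TT_expand {p a b : ℝ} (hb : 0 < b) (ha : 0 < a) : TT p a b =
    ES ![-(b + a * b), a + a * b, -(1 + b - a * b), 1 + a - a * b, (1 + a) * (1 + b) + b, -((1 + a) * (1 + b) + a),
      -(a + a * b), b + a * b] (fun i => Real.log ((![(1 + a) ^ 2 * (1 + b), (1 + a) * (1 + b) ^ 2, (1 + a) * (1 + b) * a,
      (1 + a) * (1 + b) * b, (1 + a) * (a * b), (1 + b) * (a * b), a ^ 2 * b, a * b ^ 2] : Fin 8 → ℝ) i)) (p - 1) := by
  rw [ES8]
  · simp only [Matrix.cons_val]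
    have pa : 0 < 1 + a := by linarith
    have pb : 0 < 1 + b := by linarith
    simp only [pow_two]
    rw [Real.mul_rpow (by positivity) pb.le, Real.mul_rpow pa.le pa.le, Real.mul_rpow pa.le (by positivity), Real.mul_rpow pb.le pb.le,
      Real.mul_rpow (by positivity) ha.le, Real.mul_rpow pa.le pb.le, Real.mul_rpow (by positivity) hb.le, Real.mul_rpow pa.le pb.le,
      Real.mul_rpow pa.le (by positivity), Real.mul_rpow ha.le hb.le, Real.mul_rpow pb.le (by positivity), Real.mul_rpow ha.le hb.le,
      Real.mul_rpow (by positivity) hb.le, Real.mul_rpow ha.le ha.le, Real.mul_rpow ha.le (by positivity), Real.mul_rpow hb.le hb.le]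
    unfold TT NN kk
    rw [rpow_pred (p := p) pa, rpow_pred (p := p) pb, rpow_pred (p := p) ha, rpow_pred (p := p) hb]
    ring
  · intro i
    fin_cases i <;> simp <;> positivity

set_option maxHeartbeats 1000000 in
lemma TT_sign {a b : ℝ} (hb : 0 < b) (hab : b < a) (ha1 : a < 1) (hs1 : a + b ≤ 1) (h : 1 - (a + b) ≤ 2.11 * (a * b)) :
    (∀ p, 1 < p → p < 2 → 0 ≤ TT p a b) ∧ (∀ p, 2 < p → p < 3 → TT p a b ≤ 0) := by
  have ha : 0 < a := by linarith
  have hq : 0 < a * b := by positivity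
  have hd : 0 < a - b := by linarith
  have q2 : ∀ x : ℝ, x ^ (2:ℝ) = x ^ 2 := fun x => Real.rpow_natCast x 2
  have q3 : ∀ x : ℝ, x ^ (3:ℝ) = x ^ 3 := fun x => Real.rpow_natCast x 3
  have q4 : ∀ x : ℝ, x ^ (4:ℝ) = x ^ 4 := fun x => Real.rpow_natCast x 4
  have T2 : TT (2 + 1) a b = (a - b) * (((1 + a) * (1 + b)) ^ 2 * (1 - (a + b) - 4 * (a * b)) + (a * b) ^ 2 * (1 + 3 * (a + b) + 4 * (a * b))) := by
    norm_num [TT, kk, NN, q2, q3]; ring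
  have T3 : TT (3 + 1) a b = (a - b) * ((1 + (a + b)) * (((1 + a) * (1 + b)) ^ 3 * (1 - (a + b) - 5 * (a * b)) + (a * b) ^ 3 * (2 + 4 * (a + b) + 5 * (a * b)))) := by
    norm_num [TT, kk, NN, q3, q4]; ring
  have hs0 : 0 < a + b := by linarith
  have h4 : 4 * (a * b) ≤ (a + b) ^ 2 := by nlinarith [sq_nonneg (a - b)]
  have hF := final_poly hs1 h h4 hq hs0
  have hγ : (1 + a) * (1 + b) = 1 + (a + b) + a * b := by ring
  set q := a * b with hqd
  set s := a + b with hsd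
  have hq4 : q ≤ 1/4 := by nlinarith
  have hs : 7/10 ≤ s := by nlinarith
  have hBr : 0 < 1.89 * (1 + s + q) ^ 2 - q * (1 + 3 * s + 4 * q) := by nlinarith
  have key := eight_core (c := ![-(b + q), a + q, -(1 + b - q), 1 + a - q, (1 + a) * (1 + b) + b, -((1 + a) * (1 + b) + a),
      -(a + q), b + q]) (y := ![(1 + a) ^ 2 * (1 + b), (1 + a) * (1 + b) ^ 2, (1 + a) * (1 + b) * a,
      (1 + a) * (1 + b) * b, (1 + a) * q, (1 + b) * q, a ^ 2 * b, a * b ^ 2]) (T := fun n => TT (n + 1) a b)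
      (show (1 + a) * (1 + b) ^ 2 < (1 + a) ^ 2 * (1 + b) by linarith [mul_pos (mul_pos (by linarith : 0 < 1 + a) (by linarith : 0 < 1 + b)) hd])
      (show (1 + a) * (1 + b) * a < (1 + a) * (1 + b) ^ 2 by linarith [mul_pos (mul_pos (by linarith : 0 < 1 + a) (by linarith : 0 < 1 + b)) (by linarith : 0 < 1 + b - a)])
      (show (1 + a) * (1 + b) * b < (1 + a) * (1 + b) * a by linarith [mul_pos (mul_pos (by linarith : 0 < 1 + a) (by linarith : 0 < 1 + b)) hd])
      (show (1 + a) * q < (1 + a) * (1 + b) * b by rw [hqd]; linarith [mul_pos (mul_pos (by linarith : 0 < 1 + a) hb) (by linarith : 0 < 1 + b - a)])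
      (show (1 + b) * q < (1 + a) * q by linarith [mul_pos hq hd])
      (show a ^ 2 * b < (1 + b) * q by rw [hqd]; linarith [mul_pos (mul_pos ha hb) (by linarith : 0 < 1 + b - a)])
      (show a * b ^ 2 < a ^ 2 * b by linarith [mul_pos (mul_pos ha hb) hd])
      (show 0 < a * b ^ 2 by positivity)
      (show 0 ≤ 1 + a - q by linarith) (show -((1 + a) * (1 + b) + a) ≤ 0 by have : 0 < (1 + a) * (1 + b) := by positivity
                                                                             linarith)
      (show -(a + q) ≤ 0 by linarith)
      (fun n => by have := TT_expand (p := n + 1) hb ha; rw [add_sub_cancel_right] at this; exact this)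
      (by norm_num [TT, kk])
      (by norm_num [TT, kk, NN]; try ring) (by norm_num [TT, kk, NN, q2]; try ring)
      (by
        show TT (2 + 1) a b ≤ 0
        rw [T2, hγ]
        have : (1 + s + q) ^ 2 * (1 - s - 4 * q) + q ^ 2 * (1 + 3 * s + 4 * q) ≤ 0 := by
          have h5 : 0 < q * (1.89 * (1 + s + q) ^ 2 - q * (1 + 3 * s + 4 * q)) := mul_pos hq hBr
          have h6 := mul_nonneg (sq_nonneg (1 + s + q)) (by linarith : 0 ≤ 2.11 * q - (1 - s))
          linarith
        exact mul_nonpos_of_nonneg_of_nonpos hd.le this)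
      (by
        show 0 < TT (3 + 1) a b - TT (2 + 1) a b * ((1 + a) ^ 2 * (1 + b) + (1 + a) * (1 + b) ^ 2 + (1 + a) * (1 + b) * a + (1 + a) * q)
        have e1 : (1 + a) ^ 2 * (1 + b) + (1 + a) * (1 + b) ^ 2 + (1 + a) * (1 + b) * a + (1 + a) * q =
          (1 + s + q) * (2 + 3 * s / 2) + (1 + s / 2) * q + ((1 + s + q) + q) * ((a - b) / 2) := by rw [hqd, hsd]; ring
        rw [e1, T2, T3, hγ]
        set E := (1 + s + q) * (2 + 3 * s / 2) + (1 + s / 2) * q with hE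
        set E' := E + ((1 + s + q) + q) * ((a - b) / 2) with hE'
        have hEE : E ≤ E' := by
          have : 0 ≤ ((1 + s + q) + q) * ((a - b) / 2) := by positivity
          linarith
        have g1 : 0 < E' * (1.89 * (1 + s + q) ^ 2 - q * (1 + 3 * s + 4 * q))
            - (1 + s) * (2.89 * (1 + s + q) ^ 3 - q ^ 2 * (2 + 4 * s + 5 * q)) := by
          have := mul_le_mul_of_nonneg_right hEE hBr.le
          linarith
        have g2 : (1 + s) * (1 + s + q) ≤ E' := by
          have : (1 + s) * (1 + s + q) ≤ E := by
            have : 0 ≤ (1 + s + q) * (1 + s / 2) + (1 + s / 2) * q := by positivity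
            rw [hE]; linarith
          linarith
        have g3 := mul_nonneg (mul_nonneg (sub_nonneg.2 g2) (sq_nonneg (1 + s + q))) (by linarith : 0 ≤ 2.11 * q - (1 - s))
        have g4 := mul_pos hq g1
        have : 0 < ((1 + s) * ((1 + s + q) ^ 3 * (1 - s - 5 * q) + q ^ 3 * (2 + 4 * s + 5 * q)))
           - ((1 + s + q) ^ 2 * (1 - s - 4 * q) + q ^ 2 * (1 + 3 * s + 4 * q)) * E' := by
          have : ((1 + s) * ((1 + s + q) ^ 3 * (1 - s - 5 * q) + q ^ 3 * (2 + 4 * s + 5 * q)))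
           - ((1 + s + q) ^ 2 * (1 - s - 4 * q) + q ^ 2 * (1 + 3 * s + 4 * q)) * E' =
           q * (E' * (1.89 * (1 + s + q) ^ 2 - q * (1 + 3 * s + 4 * q))
            - (1 + s) * (2.89 * (1 + s + q) ^ 3 - q ^ 2 * (2 + 4 * s + 5 * q))) +
            (E' - (1 + s) * (1 + s + q)) * (1 + s + q) ^ 2 * (2.11 * q - (1 - s)) := by ring
          rw [this]; linarith
        have := mul_pos hd this
        linarith)
  refine ⟨fun p h1 h2 => ?_, fun p h1 h2 => ?_⟩
  · have := key.1 (p - 1) (by linarith) (by linarith)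
    simpa using this
  · have := key.2 (p - 1) (by linarith) (by linarith)
    simpa using this

lemma Th_201 {x : ℝ} (h0 : 0 < x) (h1 : x < 1) : Th 2.01 x ≤ (1 + 1/75) * ((2 + x) / (1 + x)) := by
  have hf : ff 2.01 x ≤ (1 + 1/75) * (x * (2 + x)) := by
    unfold ff
    have e : (1 + x) ^ (2.01:ℝ) = (1 + x) ^ 2 * (1 + x) ^ (0.01:ℝ) := by
      rw [show (2.01:ℝ) = 2 + 0.01 by norm_num, Real.rpow_add (by linarith)]
      congr 1
      exact Real.rpow_natCast (1 + x) 2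
    have h := rpow_one_add_le_one_add_mul_self (s := x) (by linarith) (p := 0.01) (by norm_num) (by norm_num)
    rw [e]
    have := mul_le_mul_of_nonneg_left h (sq_nonneg (1 + x))
    nlinarith [mul_pos h0 h0, mul_pos h0 (by linarith : 0 < 1 - x), mul_pos (mul_pos h0 h0) (by linarith : 0 < 1 - x)]
  have hg : 1 - x ^ 2 ≤ gg 2.01 x := by
    unfold gg
    have := Real.rpow_le_rpow_of_exponent_ge h0 h1.le (show (2:ℝ) ≤ 2.01 by norm_num)
    have e : x ^ (2:ℝ) = x ^ 2 := Real.rpow_natCast x 2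
    exact sub_le_sub_left (this.trans_eq e) 1
  have hg0 : 0 < 1 - x ^ 2 := by nlinarith
  unfold Th
  calc ff 2.01 x * (1 - x) / (x * gg 2.01 x) ≤ ((1 + 1/75) * (x * (2 + x))) * (1 - x) / (x * (1 - x ^ 2)) := by
        gcongr
    _ = _ := by
        have : 1 - x ^ 2 ≠ 0 := hg0.ne'
        have : 1 - x ≠ 0 := by linarith
        have : 1 + x ≠ 0 := by linarith
        have e : 1 - x ^ 2 = (1 - x) * (1 + x) := by ring
        rw [e]
        field_simp

lemma kappa_small {p a b : ℝ} (hp : 1 ≤ p) (hp2 : p ≤ 2.01) (hb : 0 < b) (hab : b < a) (ha1 : a < 1) (h : OnC p a b) :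
    a + b ≤ 1 ∧ 1 - (a + b) ≤ 2.11 * (a * b) := by
  have ha : 0 < a := by linarith
  have hq : 0 < a * b := by positivity
  have hk := kappa_eq (by linarith) ha ha1 hb (by linarith) h
  have t1 : ∀ x, 0 < x → x < 1 → 1 ≤ Th p x := by
    intro x h0 h1
    have := Th_mono_p (p := 1) (r := p) (by norm_num) hp h0 h1
    have e : Th 1 x = 1 := by
      unfold Th ff gg
      have : 1 - x ≠ 0 := by linarith
      simp only [Real.rpow_one]
      field_simp
      ring
    linarith
  have t2 : ∀ x, 0 < x → x < 1 → Th p x ≤ (1 + 1/75) * ((2 + x) / (1 + x)) := by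
    intro x h0 h1
    exact (Th_mono_p (by linarith) hp2 h0 h1).trans (Th_201 h0 h1)
  have a1 := t1 a ha ha1
  have b1 := t1 b hb (by linarith)
  have a2 := t2 a ha ha1
  have b2 := t2 b hb (by linarith)
  have lo : 1 ≤ Th p a * Th p b := by nlinarith
  have hi : Th p a * Th p b ≤ ((1 + 1/75) * ((2 + a) / (1 + a))) * ((1 + 1/75) * ((2 + b) / (1 + b))) := by
    gcongr
  rw [← hk] at lo hi
  constructor
  · have : 0 ≤ (1 - a - b) / (a * b) := by linarith
    have := (div_nonneg_iff.1 this)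
    rcases this with h | h
    · linarith
    · linarith
  · have e : ((1 + 1/75) * ((2 + a) / (1 + a))) * ((1 + 1/75) * ((2 + b) / (1 + b))) = (1 + 1/75)^2 * ((2 + a) * (2 + b)) / ((1 + a) * (1 + b)) := by
      field_simp
    rw [e, div_add_one hq.ne', div_le_div_iff₀ hq (by positivity)] at hi
    have h2 : (1 - (a + b) - 2.11 * (a * b)) * (1 + (a + b)) ≤ 0 := by
      have : 0 < a * b * (a + b - a * b) := mul_pos hq (by nlinarith)
      have : 0 < a * b * (a + b) := by positivity
      nlinarith
    nlinarith

theorem low_Min1 {p : ℝ} (hp : 1 < p) (hp2 : p ≤ 2) : Min1 p := by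
  refine Min1_of_TT hp fun a b hb hab ha h => ?_
  obtain ⟨h1, h2⟩ := kappa_small hp.le (by linarith) hb hab ha h
  rcases hp2.lt_or_eq with h3 | h3
  · exact (TT_sign hb hab ha h1 h2).1 p hp h3
  · subst h3
    apply le_of_eq
    have q2 : ∀ x : ℝ, x ^ (2:ℝ) = x ^ 2 := fun x => Real.rpow_natCast x 2
    norm_num [TT, kk, NN, q2]; ring

theorem low_Min0 {p : ℝ} (hp : 2 ≤ p) (hp2 : p ≤ 2.01) : Min0 p := by
  refine Min0_of_TT (by linarith) fun a b hb hab ha h => ?_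
  obtain ⟨h1, h2⟩ := kappa_small (by linarith) hp2 hb hab ha h
  rcases hp.lt_or_eq with h3 | h3
  · exact (TT_sign hb hab ha h1 h2).2 p h3 (by linarith)
  · subst h3
    apply le_of_eq
    have q2 : ∀ x : ℝ, x ^ (2:ℝ) = x ^ 2 := fun x => Real.rpow_natCast x 2
    norm_num [TT, kk, NN, q2]; ring

noncomputable def LL (a b P Q U V : ℝ) : ℝ := -(b * (1 + a)) * P + (a * (1 + b)) * Q - (1 + b - a * b) * U + (1 + a - a * b) * V

lemma TT_split {p a b : ℝ} (hb : 0 < b) (ha : 0 < a) : TT p a b =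
    (1 + a) ^ (p - 1) * (1 + b) ^ (p - 1) * LL a b ((1 + a) ^ (p - 1)) ((1 + b) ^ (p - 1)) (a ^ (p - 1)) (b ^ (p - 1)) +
    a ^ (p - 1) * b ^ (p - 1) * (((1 + a) * (1 + b) + b) * (1 + a) ^ (p - 1) - ((1 + a) * (1 + b) + a) * (1 + b) ^ (p - 1)
      - (a + a * b) * a ^ (p - 1) + (b + a * b) * b ^ (p - 1)) := by
  have pa : 0 < 1 + a := by linarith
  have pb : 0 < 1 + b := by linarith
  unfold TT NN kk LL
  rw [rpow_pred (p := p) pa, rpow_pred (p := p) pb, rpow_pred (p := p) ha, rpow_pred (p := p) hb]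
  ring

/-- Bernoulli: tangent line bound for powers -/
lemma rpow_tangent {x y n : ℝ} (hx : 0 < x) (hy : 0 < y) (hn : 1 ≤ n) : x ^ n + n * x ^ (n - 1) * (y - x) ≤ y ^ n := by
  have h := one_add_mul_self_le_rpow_one_add (s := (y - x) / x) (by rw [le_div_iff₀ hx]; linarith) hn
  have e : 1 + (y - x) / x = y / x := by field_simp; ring
  rw [e, Real.div_rpow hy.le hx.le, le_div_iff₀ (by positivity)] at h
  have e2 := rpow_pred (p := n) hx
  have : (1 + n * ((y - x) / x)) * x ^ n = x ^ n + n * x ^ (n - 1) * (y - x) := by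
    rw [e2]; field_simp
  linarith

lemma Lbar_nonneg {a b n : ℝ} (hb : 0 < b) (hab : b < a) (ha1 : a < 1) (hn : 2 ≤ n) :
    0 ≤ ((1 + a) * (1 + b) + b) * (1 + a) ^ n - ((1 + a) * (1 + b) + a) * (1 + b) ^ n
      - (a + a * b) * a ^ n + (b + a * b) * b ^ n := by
  have ha : 0 < a := by linarith
  have h1 := rpow_tangent (x := 1 + b) (y := 1 + a) (n := n) (by linarith) (by linarith) (by linarith)
  have e1 := rpow_pred (p := n) (by linarith : 0 < 1 + b)
  -- U - V ≤ P - Q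
  have h2 : a ^ n - b ^ n ≤ (1 + a) ^ n - (1 + b) ^ n := by
    have hm : MonotoneOn (fun x : ℝ => (1 + x) ^ n - x ^ n) (Set.Ici 0) := by
      refine monotoneOn_of_hasDerivWithinAt_nonneg (f' := fun x => n * (1 + x) ^ (n - 1) - n * x ^ (n - 1)) (convex_Ici 0) ?_ ?_ ?_
      · apply ContinuousOn.sub
        · exact ContinuousOn.rpow_const (by fun_prop) (fun t _ => Or.inr (by linarith))
        · exact ContinuousOn.rpow_const (by fun_prop) (fun t _ => Or.inr (by linarith))
      · intro x hx
        rw [interior_Ici] at hx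
        have hx : 0 < x := hx
        have d1 := ((hasDerivAt_id x).const_add 1).rpow_const (p := n) (Or.inr (by linarith))
        have d2 := (Real.hasDerivAt_rpow_const (x := x) (p := n) (Or.inr (by linarith)))
        have := d1.sub d2
        simp only [id, one_mul] at this
        exact this.hasDerivWithinAt
      · intro x hx
        rw [interior_Ici] at hx
        have hx : 0 < x := hx
        have := Real.rpow_le_rpow hx.le (by linarith : x ≤ 1 + x) (by linarith : 0 ≤ n - 1)
        nlinarith
    have := hm (show b ∈ Set.Ici (0:ℝ) from hb.le) (show a ∈ Set.Ici (0:ℝ) from ha.le) hab.le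
    simp only at this
    linarith
  have hQ : 1 ≤ (1 + b) ^ (n - 1) := Real.one_le_rpow (by linarith) (by linarith)
  have hQ2 : 1 ≤ (1 + b) ^ n := Real.one_le_rpow (by linarith) (by linarith)
  have hV : b ^ n ≤ 1 := Real.rpow_le_one hb.le (by linarith) (by linarith)
  set P := (1 + a) ^ n
  set Q := (1 + b) ^ n
  set U := a ^ n
  set V := b ^ n
  set Q1 := (1 + b) ^ (n - 1)
  have hd : 0 < a - b := by linarith
  have g0 : 0 < a + a * b := by positivity
  have g1 : 0 ≤ (a + a * b) * ((P - Q) - (U - V)) := mul_nonneg g0.le (by linarith)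
  have g3 : 0 ≤ (1 + 2 * b) * ((P - Q) - n * Q1 * (a - b)) := mul_nonneg (by linarith) (by linarith)
  have g4 : 0 ≤ (a - b) * (((1 + 2 * b) * (n * Q1) - Q) - V) := by
    apply mul_nonneg hd.le
    have : (1 + 2 * b) * (n * Q1) ≥ 2 * Q := by
      rw [e1]
      have : 0 ≤ (n - 2) * Q1 := mul_nonneg (by linarith) (by linarith)
      nlinarith
    linarith
  nlinarith

lemma descartes4 {c l : Fin 4 → ℝ} {t : ℝ} (h : Alt (ES c l) 5 1 t) : False := by
  have h1 := ES_kill _ _ (l 3) (ES_kill _ _ (l 2) (ES_kill _ _ (l 1) (ES_kill _ _ (l 0) h)))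
  simp only [neg_neg] at h1
  refine ES_nonpos ?_ h1
  intro i
  fin_cases i <;> simp

open Filter Topology in
lemma LL_34 {a b n : ℝ} (hb : 0 < b) (hab : b < a) (h5 : 5 * (a * b) ≤ 1 - (a + b)) (hn : 2 ≤ n) (hn3 : n ≤ 3) :
    0 ≤ LL a b ((1 + a) ^ n) ((1 + b) ^ n) (a ^ n) (b ^ n) := by
  have ha : 0 < a := by linarith
  have hq : 0 < a * b := by positivity
  have hd : 0 < a - b := by linarith
  have q2 : ∀ x : ℝ, x ^ (2:ℝ) = x ^ 2 := fun x => Real.rpow_natCast x 2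
  have q3 : ∀ x : ℝ, x ^ (3:ℝ) = x ^ 3 := fun x => Real.rpow_natCast x 3
  set F : ℝ → ℝ := fun n => LL a b ((1 + a) ^ n) ((1 + b) ^ n) (a ^ n) (b ^ n) with hF
  set G : ℝ → ℝ := fun n => ((1 + b) / (1 + a)) ^ 2 * (1 + a) ^ n - (1 + b) ^ n with hG
  have F0 : F 0 = 2 * (a - b) := by simp only [hF, LL, Real.rpow_zero]; ring
  have F1 : F 1 = 0 := by simp only [hF, LL, Real.rpow_one]; ring
  have F2 : F 2 = (a - b) * (1 - (a + b) - 4 * (a * b)) := by simp only [hF, LL, q2]; ring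
  have F3 : F 3 = (a - b) * (1 + (a + b)) * (1 - (a + b) - 5 * (a * b)) := by simp only [hF, LL, q3]; ring
  have F2p : 0 < F 2 := by rw [F2]; exact mul_pos hd (by linarith)
  have F3p : 0 ≤ F 3 := by rw [F3]; exact mul_nonneg (by positivity) (by linarith)
  have G1 : G 1 < 0 := by
    have : G 1 = - ((1 + b) * (a - b) / (1 + a)) := by simp only [hG, Real.rpow_one]; field_simp; ring
    rw [this]
    have : 0 < (1 + b) * (a - b) / (1 + a) := by positivity
    linarith
  have G3 : 0 < G 3 := by
    have : G 3 = (1 + b) ^ 2 * (a - b) := by simp only [hG, q3]; field_simp; ring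
    rw [this]; positivity
  show 0 ≤ F n
  rcases hn.lt_or_eq with h2 | h2
  swap
  · rw [← h2]; exact F2p.le
  rcases hn3.lt_or_eq with h3 | h3
  swap
  · rw [h3]; exact F3p
  by_contra hneg
  push Not at hneg
  have E1 := ev_pos (f := fun e => F 0 + e * G 0) (by fun_prop) (by simp [F0]; linarith)
  have E2 := ev_pos (f := fun e => F 2 + e * G 2) (by fun_prop) (by simpa using F2p)
  have E3 := ev_pos (f := fun e => -(F n + e * G n)) (by fun_prop) (by simpa using hneg)
  have E6 : ∀ᶠ e in 𝓝[>] (0:ℝ), 0 < e := self_mem_nhdsWithin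
  obtain ⟨e, ⟨⟨⟨e1, e2⟩, e3⟩, e6⟩⟩ := ((E1.and E2).and E3 |>.and E6).exists
  have hA : Alt (fun n => F n + e * G n) 5 1 (-1) := by
    refine ⟨0, by norm_num, by simpa using e1, 1, by norm_num, ?_, 2, by norm_num, by simpa using e2, n, h2, ?_, 3, h3, ?_, trivial⟩
    · simp only [F1]; nlinarith
    · simp only [neg_neg]; linarith
    · simp only [neg_neg]; nlinarith
  have hE : (fun n => F n + e * G n) = ES ![-(b * (1 + a)) + e * ((1 + b) / (1 + a)) ^ 2, a * (1 + b) - e, -(1 + b - a * b), 1 + a - a * b]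
     ![Real.log (1 + a), Real.log (1 + b), Real.log a, Real.log b] := by
    ext m
    unfold ES
    simp only [Fin.sum_univ_four, Matrix.cons_val]
    simp only [hF, hG, LL, Real.rpow_def_of_pos ha, Real.rpow_def_of_pos hb, Real.rpow_def_of_pos (by linarith : 0 < 1 + a),
      Real.rpow_def_of_pos (by linarith : 0 < 1 + b)]
    ring
  rw [hE] at hA
  exact descartes4 hA

lemma kappa_five {p a b : ℝ} (hp : 3 ≤ p) (hb : 0 < b) (hab : b < a) (ha1 : a < 1) (h : OnC p a b) :
    5 * (a * b) ≤ 1 - (a + b) := by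
  have ha : 0 < a := by linarith
  have hb1 : b < 1 := by linarith
  have hq : 0 < a * b := by positivity
  have hk := kappa_eq (by linarith) ha ha1 hb hb1 h
  have q3 : ∀ x : ℝ, x ^ (3:ℝ) = x ^ 3 := fun x => Real.rpow_natCast x 3
  have e3 : ∀ x : ℝ, 0 < x → x < 1 → Th 3 x = (3 + 3 * x + x ^ 2) / (1 + x + x ^ 2) := by
    intro x h0 h1
    unfold Th ff gg
    rw [q3, q3]
    have h2 : 1 - x ≠ 0 := by linarith
    have h3 : 1 + x + x ^ 2 ≠ 0 := by positivity
    have h4 : 1 - x ^ 3 = (1 - x) * (1 + x + x ^ 2) := by ring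
    rw [h4]
    field_simp
    ring
  have m1 := Th_mono_p (by norm_num) hp ha ha1
  have m2 := Th_mono_p (by norm_num) hp hb hb1
  have p2 := Th_pos (p := 3) (by norm_num) hb hb1
  have p1 := Th_pos (p := p) (by linarith) ha ha1
  have : Th 3 a * Th 3 b ≤ Th p a * Th p b := mul_le_mul m1 m2 p2.le p1.le
  rw [← hk, e3 a ha ha1, e3 b hb hb1, div_mul_div_comm, div_add_one hq.ne', div_le_div_iff₀ (by positivity) hq] at this
  set s := a + b with hs
  set q := a * b with hqd
  have e1 : (3 + 3 * a + a ^ 2) * (3 + 3 * b + b ^ 2) * q = (9 + 9 * s + 3 * (s ^ 2 - 2 * q) + 9 * q + 3 * q * s + q ^ 2) * q := by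
    rw [hs, hqd]; ring
  have e2 : (1 - a - b + q) * ((1 + a + a ^ 2) * (1 + b + b ^ 2)) = (1 - s + q) * (1 + s + (s ^ 2 - 2 * q) + q + q * s + q ^ 2) := by
    rw [hs, hqd]; ring
  have h1s : s ≤ 1 := by
    by_contra hc
    push Not at hc
    nlinarith [mul_pos hq hq, mul_pos hq (by linarith : 0 < s - 1), mul_pos (by linarith : 0 < s - 1) (by linarith : 0 < s)]
  have hs0 : 0 < s := by linarith
  have key : (9 + 6 * s + 3 * s ^ 2 + 3 * q * (1 + s)) * q ≤ (1 - s) * (1 + s + s ^ 2) := by nlinarith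
  have : 5 * (1 + s + s ^ 2) ≤ 9 + 6 * s + 3 * s ^ 2 + 3 * q * (1 + s) := by nlinarith
  have h6 : (5 * q) * (1 + s + s ^ 2) ≤ (1 - s) * (1 + s + s ^ 2) := by nlinarith
  exact le_of_mul_le_mul_right h6 (by positivity)

lemma LL_alt {p a b : ℝ} (hb : 0 < b) (ha : 0 < a) :
    LL a b ((1 + a) ^ (p - 1)) ((1 + b) ^ (p - 1)) (a ^ (p - 1)) (b ^ (p - 1)) =
    (a - b) + a * ff p b - b * ff p a - (1 - a * b) * (a ^ (p - 1) - b ^ (p - 1)) - (a * b) * (a ^ (p - 2) - b ^ (p - 2)) := by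
  have pa : 0 < 1 + a := by linarith
  have pb : 0 < 1 + b := by linarith
  have e1 := rpow_pred (p := p - 1) ha
  have e2 := rpow_pred (p := p - 1) hb
  rw [show p - 1 - 1 = p - 2 by ring] at e1 e2
  unfold LL ff
  rw [rpow_pred (p := p) pa, rpow_pred (p := p) pb, e1, e2]
  ring

lemma ff_ge {p x : ℝ} (hp : 1 ≤ p) (hx : 0 ≤ x) : p * x ≤ ff p x := by
  have := one_add_mul_self_le_rpow_one_add (s := x) (by linarith) hp
  unfold ff; linarith

lemma big_a {p a b : ℝ} (hp : 4 ≤ p) (hb : 0 < b) (hab : b < a) (ha1 : a < 1) (h : OnC p a b) (hpa : 1.08 ≤ p * a) :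
    0 ≤ LL a b ((1 + a) ^ (p - 1)) ((1 + b) ^ (p - 1)) (a ^ (p - 1)) (b ^ (p - 1)) := by
  have ha : 0 < a := by linarith
  have hq : 0 < a * b := by positivity
  rw [LL_alt hb ha]
  have h1 : p * b ≤ ff p b := ff_ge (by linarith) hb.le
  have hfa := ff_pos (p := p) (by linarith) ha
  have hga := gg_pos (p := p) (by linarith) ha.le ha1
  have hgb1 : gg p b ≤ 1 := by
    unfold gg
    have : 0 ≤ b ^ p := by positivity
    linarith
  have h2 : p * (b * ff p a) ≤ 1 - a ^ p := by
    have : ff p a * (p * b) ≤ ff p a * ff p b := mul_le_mul_of_nonneg_left h1 hfa.le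
    unfold OnC at h
    have : gg p a * gg p b ≤ gg p a := by nlinarith
    have : gg p a = 1 - a ^ p := rfl
    nlinarith
  have e1 := rpow_pred (p := p - 1) ha
  have e0 := rpow_pred (p := p) ha
  rw [show p - 1 - 1 = p - 2 by ring] at e1
  have hk : a ^ (p - 2) ≤ a ^ 2 := by
    have := Real.rpow_le_rpow_of_exponent_ge ha ha1.le (show (2:ℝ) ≤ p - 2 by linarith)
    rwa [show a ^ (2:ℝ) = a ^ 2 from Real.rpow_natCast a 2] at this
  have hk0 : 0 < a ^ (p - 2) := by positivity
  have hb1 : 0 < b ^ (p - 1) := by positivity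
  have hb2 : 0 < b ^ (p - 2) := by positivity
  have h4 : a ^ 2 ≤ p * a - 1 := by
    by_cases hc : a ≤ 0.27
    · nlinarith
    · push Not at hc
      nlinarith
  set u := a ^ (p - 2)
  rw [e1] at e0
  rw [e0] at h2
  rw [e1]
  have hpp : 0 < p := by linarith
  -- e(a) ≥ 0
  have hE : 0 ≤ p * (a - a * u) - (1 - a * (a * u)) := by
    have : p * (a - a * u) - (1 - a * (a * u)) = (p * a - 1) * (1 - u) - u * (1 - a ^ 2) := by ring
    rw [this]
    have g1 : a ^ 2 * (1 - u) ≤ (p * a - 1) * (1 - u) := mul_le_mul_of_nonneg_right h4 (by nlinarith)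
    have g2 : a ^ 2 * (1 - u) - u * (1 - a ^ 2) = a ^ 2 - u := by ring
    linarith
  have h3 : a * (p * b) ≤ a * ff p b := mul_le_mul_of_nonneg_left h1 ha.le
  have hB : 0 ≤ b * (p * a - 1) - b * (a * u * (1 - a)) := by
    have g3 : a * u * (1 - a) ≤ a ^ 2 := by
      have : u ≤ 1 := by nlinarith
      have : a * u * (1 - a) ≤ u := by
        have : 0 ≤ u * (1 - a * (1 - a)) := mul_nonneg hk0.le (by nlinarith)
        nlinarith
      linarith
    have : 0 ≤ b * (p * a - 1 - a * u * (1 - a)) := mul_nonneg hb.le (by linarith)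
    linarith
  have hV : 0 ≤ (1 - a * b) * b ^ (p - 1) + a * b * b ^ (p - 2) := by
    have : 0 < 1 - a * b := by nlinarith
    positivity
  have hX : b * ff p a ≤ a - a * u := by
    have : p * (b * ff p a) ≤ p * (a - a * u) := by linarith
    exact le_of_mul_le_mul_left this hpp
  nlinarith

lemma xex {x : ℝ} (h0 : 0 ≤ x) (h1 : x ≤ 1.08) : x * Real.exp x - Real.exp x + 1 ≤ 0.7 * (Real.exp x - 1) * x := by
  have := Real.quadratic_le_exp_of_nonneg h0
  have h2 : (1 - 0.3 * x) * (1 + x + x ^ 2 / 2) ≤ (1 - 0.3 * x) * Real.exp x := mul_le_mul_of_nonneg_left this (by linarith)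
  have h3 : 0 ≤ x ^ 2 * (0.2 - 0.15 * x) := mul_nonneg (sq_nonneg x) (by linarith)
  nlinarith

theorem small_main {p a b : ℝ} (hp : 4 ≤ p) (hb : 0 < b) (hab : b < a) (ha1 : a < 1) (h : OnC p a b) (hpa : p * a ≤ 1.08) : b * ff p a - a * ff p b ≤ 0.7 * (a - b) := by
  have ha : 0 < a := by linarith
  have hd : 0 < a - b := by linarith
  have hfa := ff_pos (p := p) (by linarith) ha
  have hder : ∀ x ∈ Set.Icc b a, HasDerivAt (fun x => ff p x / x) ((p * (1 + x) ^ (p - 1) * x - ff p x * 1) / x ^ 2) x := by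
    intro x hx
    have hx0 : 0 < x := by linarith [hx.1]
    exact (ff_deriv hx0.le).div (hasDerivAt_id x) hx0.ne'
  obtain ⟨ξ, hξ, e⟩ := exists_hasDerivAt_eq_slope _ _ hab (HasDerivAt.continuousOn hder)
    (fun x hx => hder x ⟨hx.1.le, hx.2.le⟩)
  have hξ0 : 0 < ξ := by linarith [hξ.1]
  have hξ1 : 0 < 1 + ξ := by linarith
  -- logs
  set x := p * Real.log (1 + ξ) with hx
  have hlog1 : Real.log (1 + ξ) ≤ ξ := by have := Real.log_le_sub_one_of_pos hξ1; linarith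
  have hlog2 : ξ / (1 + ξ) ≤ Real.log (1 + ξ) := by
    have := Real.one_sub_inv_le_log_of_pos hξ1
    have e : ξ / (1 + ξ) = 1 - (1 + ξ)⁻¹ := by field_simp; ring
    linarith
  have hx0 : 0 ≤ x := by
    have : 0 < ξ / (1 + ξ) := by positivity
    have : 0 ≤ Real.log (1 + ξ) := by linarith
    positivity
  have hxp : x ≤ p * ξ := mul_le_mul_of_nonneg_left hlog1 (by linarith)
  have hx1 : x ≤ 1.08 := by
    have : p * ξ ≤ p * a := mul_le_mul_of_nonneg_left hξ.2.le (by linarith)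
    linarith
  have hE : (1 + ξ) ^ p = Real.exp x := by rw [Real.rpow_def_of_pos hξ1, hx]; ring_nf
  have hff : ff p ξ = Real.exp x - 1 := by unfold ff; rw [hE]
  have hfξ : 0 < ff p ξ := ff_pos (by linarith) hξ0
  have hnum : p * (1 + ξ) ^ (p - 1) * ξ ≤ x * Real.exp x := by
    have e2 := rpow_pred (p := p) hξ1
    have : p * (1 + ξ) ^ (p - 1) * ξ = p * (ξ / (1 + ξ)) * Real.exp x := by
      rw [← hE, e2]; field_simp
    rw [this]
    have : p * (ξ / (1 + ξ)) ≤ x := mul_le_mul_of_nonneg_left hlog2 (by linarith)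
    exact mul_le_mul_of_nonneg_right this (Real.exp_pos _).le
  have hnum2 : p * (1 + ξ) ^ (p - 1) * ξ - ff p ξ * 1 ≤ 0.7 * ff p ξ * (p * ξ) := by
    have g1 := xex hx0 hx1
    have g2 : 0.7 * ff p ξ * x ≤ 0.7 * ff p ξ * (p * ξ) := mul_le_mul_of_nonneg_left hxp (by positivity)
    rw [hff] at g2 ⊢
    linarith
  -- convexity
  have hconv : ff p ξ * a ≤ ξ * ff p a := by
    have hc := (convexOn_rpow (by linarith : 1 ≤ p)).2 (show (1:ℝ) ∈ Set.Ici (0:ℝ) by simp) (show 1 + a ∈ Set.Ici (0:ℝ) from by simp; linarith)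
      (show (0:ℝ) ≤ 1 - ξ / a by rw [sub_nonneg, div_le_one ha]; exact hξ.2.le) (show (0:ℝ) ≤ ξ / a by positivity) (by ring)
    simp only [smul_eq_mul, Real.one_rpow] at hc
    have e3 : (1 - ξ / a) * 1 + ξ / a * (1 + a) = 1 + ξ := by field_simp; ring
    rw [e3] at hc
    have : ff p ξ ≤ ξ / a * ff p a := by unfold ff; linarith
    calc ff p ξ * a ≤ (ξ / a * ff p a) * a := mul_le_mul_of_nonneg_right this ha.le
      _ = ξ * ff p a := by field_simp
  have hder2 : (p * (1 + ξ) ^ (p - 1) * ξ - ff p ξ * 1) / ξ ^ 2 ≤ 0.7 * p * ff p a / a := by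
    rw [div_le_div_iff₀ (by positivity) ha]
    have g1 := mul_le_mul_of_nonneg_right hnum2 ha.le
    have g2 := mul_le_mul_of_nonneg_left hconv (by positivity : 0 ≤ 0.7 * p * ξ)
    nlinarith
  rw [e, div_le_div_iff₀ hd ha] at hder2
  have e5 : b * ff p a - a * ff p b = (ff p a / a - ff p b / b) * a * b := by field_simp
  rw [e5]
  have hfb : p * b ≤ ff p b := ff_ge (by linarith) hb.le
  have g1 : ff p a * (p * b) ≤ 1 := by
    have g2 : ff p a * (p * b) ≤ ff p a * ff p b := mul_le_mul_of_nonneg_left hfb hfa.le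
    unfold OnC at h
    have g3 : gg p a ≤ 1 := by unfold gg; have : 0 ≤ a ^ p := by positivity
                               linarith
    have g4 : gg p b ≤ 1 := by unfold gg; have : 0 ≤ b ^ p := by positivity
                               linarith
    have g5 := gg_pos (p := p) (by linarith) hb.le (by linarith)
    have : gg p a * gg p b ≤ 1 := by nlinarith
    linarith
  have g2 := mul_le_mul_of_nonneg_right hder2 hb.le
  have g3 := mul_le_mul_of_nonneg_right g1 (by linarith : 0 ≤ 0.7 * (a - b))
  nlinarith

lemma small_a {p a b : ℝ} (hp : 4 ≤ p) (hb : 0 < b) (hab : b < a) (ha1 : a < 1) (h : OnC p a b) (hpa : p * a ≤ 1.08) :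
    0 ≤ LL a b ((1 + a) ^ (p - 1)) ((1 + b) ^ (p - 1)) (a ^ (p - 1)) (b ^ (p - 1)) := by
  have ha : 0 < a := by linarith
  have hq : 0 < a * b := by positivity
  have hd : 0 < a - b := by linarith
  rw [LL_alt hb ha]
  have hfa := ff_pos (p := p) (by linarith) ha
  -- main bound
  have main := small_main hp hb hab ha1 h hpa
  have t1 := rpow_tangent (x := a) (y := b) (n := p - 1) ha hb (by linarith)
  have t2 := rpow_tangent (x := a) (y := b) (n := p - 2) ha hb (by linarith)
  rw [show p - 1 - 1 = p - 2 by ring] at t1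
  rw [show p - 2 - 1 = p - 3 by ring] at t2
  have ha27 : a ≤ 0.27 := by nlinarith
  have q2 : a ^ (p - 2) ≤ a ^ 2 := by
    have := Real.rpow_le_rpow_of_exponent_ge ha ha1.le (show (2:ℝ) ≤ p - 2 by linarith)
    rwa [show a ^ (2:ℝ) = a ^ 2 from Real.rpow_natCast a 2] at this
  have q1 : a ^ (p - 3) ≤ a := by
    have := Real.rpow_le_rpow_of_exponent_ge ha ha1.le (show (1:ℝ) ≤ p - 3 by linarith)
    rwa [Real.rpow_one] at this
  have hpa2 : (p - 1) * a ^ 2 ≤ 0.2187 := by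
    have h1 : p ^ 2 * a ^ 2 ≤ 1.1664 := by
      have := pow_le_pow_left₀ (by positivity : 0 ≤ p * a) hpa 2
      rw [mul_pow] at this; norm_num at this ⊢; linarith
    have h2 : 16 * (p - 1) ≤ 3 * p ^ 2 := by nlinarith
    nlinarith [sq_nonneg a, mul_nonneg (sq_nonneg a) (sub_nonneg.2 h2)]
  have v1 : a ^ (p - 1) - b ^ (p - 1) ≤ 0.2187 * (a - b) := by
    have : (p - 1) * a ^ (p - 2) ≤ 0.2187 := by nlinarith
    nlinarith
  have v2 : a ^ (p - 2) - b ^ (p - 2) ≤ (p - 2) * a * (a - b) := by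
    have : (p - 2) * a ^ (p - 3) ≤ (p - 2) * a := mul_le_mul_of_nonneg_left q1 (by linarith)
    have := mul_le_mul_of_nonneg_right this hd.le
    linarith
  have v3 : (a * b) * (a ^ (p - 2) - b ^ (p - 2)) ≤ 0.06 * (a - b) := by
    have w1 := mul_le_mul_of_nonneg_left v2 hq.le
    have w2 : (a * b) * ((p - 2) * a) ≤ 0.06 := by
      have : b * ((p - 2) * a ^ 2) ≤ 0.27 * 0.2187 := by
        have x1 : (p - 2) * a ^ 2 ≤ 0.2187 := by nlinarith [sq_nonneg a]
        have x2 : 0 ≤ (p - 2) * a ^ 2 := mul_nonneg (by linarith) (sq_nonneg a)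
        have x3 : b ≤ 0.27 := by linarith
        exact mul_le_mul x3 x1 x2 (by norm_num)
      nlinarith
    have w3 := mul_le_mul_of_nonneg_right w2 hd.le
    nlinarith
  have v0 : 0 ≤ a ^ (p - 1) - b ^ (p - 1) := by
    have := Real.rpow_le_rpow hb.le hab.le (by linarith : 0 ≤ p - 1)
    linarith
  have v4 : (1 - a * b) * (a ^ (p - 1) - b ^ (p - 1)) ≤ a ^ (p - 1) - b ^ (p - 1) := by
    have := mul_nonneg hq.le v0
    linarith
  linarith

theorem high_Min1 {p : ℝ} (hp : 3 ≤ p) : Min1 p := by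
  refine Min1_of_TT (by linarith) fun a b hb hab ha h => ?_
  have ha0 : 0 < a := by linarith
  rw [TT_split hb ha0]
  have h1 := Lbar_nonneg hb hab ha (n := p - 1) (by linarith)
  have h2 : 0 ≤ LL a b ((1 + a) ^ (p - 1)) ((1 + b) ^ (p - 1)) (a ^ (p - 1)) (b ^ (p - 1)) := by
    rcases le_total p 4 with h4 | h4
    · exact LL_34 hb hab (kappa_five hp hb hab ha h) (by linarith) (by linarith)
    · rcases le_total 1.08 (p * a) with h5 | h5
      · exact big_a h4 hb hab ha h h5
      · exact small_a h4 hb hab ha h h5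
  have : 0 < 1 + a := by linarith
  have : 0 < 1 + b := by linarith
  positivity

lemma rle {x q e : ℝ} (n d : ℕ) (he : e = (n:ℝ) / d) (hd : 0 < d) (hx : 0 ≤ x) (hq : 0 ≤ q) (h : x ^ n ≤ q ^ d) : x ^ e ≤ q := by
  have hd' : (0:ℝ) < d := by exact_mod_cast hd
  have h1 : (x ^ e) ^ d = x ^ n := by
    rw [← Real.rpow_natCast, ← Real.rpow_mul hx, he, div_mul_cancel₀ _ hd'.ne', Real.rpow_natCast]
  exact le_of_pow_le_pow_left₀ hd.ne' hq (h1 ▸ h)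

lemma rge {x q e : ℝ} (n d : ℕ) (he : e = (n:ℝ) / d) (hd : 0 < d) (hx : 0 ≤ x) (h : q ^ d ≤ x ^ n) : q ≤ x ^ e := by
  have hd' : (0:ℝ) < d := by exact_mod_cast hd
  have h1 : (x ^ e) ^ d = x ^ n := by
    rw [← Real.rpow_natCast, ← Real.rpow_mul hx, he, div_mul_cancel₀ _ hd'.ne', Real.rpow_natCast]
  exact le_of_pow_le_pow_left₀ hd.ne' (by positivity) (h1 ▸ h)

lemma log_ge {x : ℝ} (a b : ℕ) (ha : 0 < a) (h : (2:ℝ) ^ b ≤ x ^ a) (hx : 0 < x) : (b:ℝ) / a * Real.log 2 ≤ Real.log x := by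
  have ha' : (0:ℝ) < a := by exact_mod_cast ha
  have := Real.log_le_log (by positivity) h
  rw [Real.log_pow, Real.log_pow] at this
  rw [div_mul_eq_mul_div, div_le_iff₀ ha']; linarith

lemma log_le {x : ℝ} (a b : ℕ) (ha : 0 < a) (h : x ^ a ≤ (2:ℝ) ^ b) (hx : 0 < x) : Real.log x ≤ (b:ℝ) / a * Real.log 2 := by
  have ha' : (0:ℝ) < a := by exact_mod_cast ha
  have := Real.log_le_log (by positivity) h
  rw [Real.log_pow, Real.log_pow] at this
  rw [div_mul_eq_mul_div, le_div_iff₀ ha']; linarith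

noncomputable def MM (p : ℝ) : ℝ := 4 - Real.exp ((2 - p) * Real.log 2)
noncomputable def cE (p : ℝ) : ℝ := Real.exp (Real.log (MM p) / p)
noncomputable def phi (p : ℝ) : ℝ :=
  Real.exp (p * Real.log ((cE p + 1) / 2)) + Real.exp (p * Real.log ((cE p - 1) / 2))

lemma ww_eq (p : ℝ) : Real.exp ((2 - p) * Real.log 2) = (1 / 2 : ℝ) ^ (p - 2) := by
  rw [Real.rpow_def_of_pos (by norm_num), one_div, Real.log_inv]; ring_nf

lemma ww_lt {p : ℝ} (hp : 2 < p) : Real.exp ((2 - p) * Real.log 2) < 1 := by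
  rw [Real.exp_lt_one_iff]
  exact mul_neg_of_neg_of_pos (by linarith) (Real.log_pos (by norm_num))

lemma MM_gt {p : ℝ} (hp : 2 < p) : 3 < MM p := by unfold MM; linarith [ww_lt hp]

lemma cE_gt {p : ℝ} (hp : 2 < p) : 1 < cE p := by
  unfold cE
  rw [Real.one_lt_exp_iff]
  have := Real.log_pos (by linarith [MM_gt hp] : 1 < MM p)
  positivity

lemma cE_rpow {p : ℝ} (hp : 2 < p) : cE p ^ p = MM p := by
  unfold cE
  rw [← Real.exp_mul, div_mul_cancel₀ _ (by linarith), Real.exp_log (by linarith [MM_gt hp])]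

lemma phi_hasDeriv {p : ℝ} (hp : 2 < p) :
    ∃ c', p * c' = cE p * ((Real.exp ((2 - p) * Real.log 2) * Real.log 2) / MM p - Real.log (cE p)) ∧
     HasDerivAt phi (((cE p + 1) / 2) ^ p * Real.log ((cE p + 1) / 2) + ((cE p - 1) / 2) ^ p * Real.log ((cE p - 1) / 2)
      + p * c' / 2 * (((cE p + 1) / 2) ^ (p - 1) + ((cE p - 1) / 2) ^ (p - 1))) p := by
  have hM := MM_gt hp
  have hc := cE_gt hp
  have hw : HasDerivAt MM (Real.exp ((2 - p) * Real.log 2) * Real.log 2) p := by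
    have h1 : HasDerivAt (fun p : ℝ => (2 - p) * Real.log 2) (- Real.log 2) p := by
      simpa using ((hasDerivAt_id p).const_sub 2).mul_const (Real.log 2)
    have := (h1.exp).const_sub 4
    exact this.congr_deriv (by ring)
  have hL : HasDerivAt (fun p => Real.log (MM p) / p) _ p := (hw.log (by linarith)).div (hasDerivAt_id p) (by simp; linarith)
  have hC : HasDerivAt cE _ p := hL.exp
  set c' := Real.exp (Real.log (MM p) / p) *
      ((Real.exp ((2 - p) * Real.log 2) * Real.log 2 / MM p * p - Real.log (MM p) * 1) / p ^ 2) with hc'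
  refine ⟨c', ?_, ?_⟩
  · have e1 : Real.log (cE p) = Real.log (MM p) / p := by unfold cE; rw [Real.log_exp]
    rw [e1, hc']
    show p * (cE p * _) = _
    field_simp
  · have x0 : 0 < (cE p + 1) / 2 := by linarith
    have y0 : 0 < (cE p - 1) / 2 := by linarith
    have hx := ((hC.add_const 1).div_const 2).log x0.ne'
    have hy := ((hC.sub_const 1).div_const 2).log y0.ne'
    have hxx := ((hasDerivAt_id p).mul hx).exp
    have hyy := ((hasDerivAt_id p).mul hy).exp
    have := hxx.add hyy
    refine this.congr_deriv ?_
    simp only [id, Pi.mul_apply]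
    rw [rpow_pred x0, rpow_pred y0]
    have ex : Real.exp (p * Real.log ((cE p + 1) / 2)) = (cE p + 1) / 2 * ((cE p + 1) / 2) ^ (p - 1) := by
      rw [← rpow_pred x0, Real.rpow_def_of_pos x0, mul_comm]
    have ey : Real.exp (p * Real.log ((cE p - 1) / 2)) = (cE p - 1) / 2 * ((cE p - 1) / 2) ^ (p - 1) := by
      rw [← rpow_pred y0, Real.rpow_def_of_pos y0, mul_comm]
    rw [ex, ey]
    have : cE p + 1 ≠ 0 := by linarith
    have : cE p - 1 ≠ 0 := by linarith
    field_simp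
    ring

lemma cE_lo {p r c1 w : ℝ} (hp : 2 < p) (hpr : p ≤ r) (h1 : 1 ≤ c1) (hw : Real.exp ((2 - p) * Real.log 2) ≤ w) (h : c1 ^ r ≤ 4 - w) : c1 ≤ cE p := by
  have h2 : c1 ^ p ≤ cE p ^ p := by
    rw [cE_rpow hp]; unfold MM
    have := Real.rpow_le_rpow_of_exponent_le h1 hpr
    linarith
  exact (Real.rpow_le_rpow_iff (by linarith) (by linarith [cE_gt hp]) (by linarith)).1 h2

lemma cE_hi {p l c2 w : ℝ} (hp : 2 < p) (hpr : l ≤ p) (h1 : 1 ≤ c2) (hw : w ≤ Real.exp ((2 - p) * Real.log 2)) (h : 4 - w ≤ c2 ^ l) : cE p ≤ c2 := by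
  have h2 : cE p ^ p ≤ c2 ^ p := by
    rw [cE_rpow hp]; unfold MM
    have := Real.rpow_le_rpow_of_exponent_le h1 hpr
    linarith
  exact (Real.rpow_le_rpow_iff (by linarith [cE_gt hp]) (by linarith) (by linarith)).1 h2

lemma phi_der_pos {l r c1 c2 w1 w2 A B S1 S2 la lb lc : ℝ} (hl : 2 < l)
    (hw2 : (1/2:ℝ) ^ (l - 2) ≤ w2) (hw1 : w1 ≤ (1/2:ℝ) ^ (r - 2)) (hw10 : 0 < w1)
    (hc1 : 1 < c1) (h1 : c1 ^ r ≤ 4 - w2) (h2 : 4 - w1 ≤ c2 ^ l) (hc2 : c2 < 3) (hw23 : w2 ≤ 1)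
    (hA : A ≤ ((c1 + 1) / 2) ^ l) (hA0 : 0 ≤ A) (hla : la * Real.log 2 ≤ Real.log ((c1 + 1) / 2)) (hla0 : 0 ≤ la)
    (hB : ((c2 - 1) / 2) ^ l ≤ B) (hlb : - lb * Real.log 2 ≤ Real.log ((c1 - 1) / 2)) (hlb0 : 0 ≤ lb)
    (hlc : Real.log c2 ≤ lc * Real.log 2) (hS1 : ((c2 + 1) / 2) ^ (r - 1) ≤ S1) (hS2 : ((c2 - 1) / 2) ^ (l - 1) ≤ S2)
    (hlk : w1 / (4 - w1) ≤ lc) (hc12 : c1 ≤ c2)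
    (fin : 0 < A * la - B * lb - c2 / 2 * (lc - w1 / (4 - w1)) * (S1 + S2)) :
    ∀ p, l ≤ p → p ≤ r → ∃ d, HasDerivAt phi d p ∧ 0 < d := by
  intro p hp1 hp2
  have hp : 2 < p := by linarith
  obtain ⟨c', hc', hd⟩ := phi_hasDeriv hp
  refine ⟨_, hd, ?_⟩
  set w := Real.exp ((2 - p) * Real.log 2) with hw
  set c := cE p with hcdef
  have hln : 0 < Real.log 2 := Real.log_pos (by norm_num)
  have hwl : w ≤ w2 := by
    refine le_trans ?_ hw2
    rw [hw, ww_eq]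
    exact Real.rpow_le_rpow_of_exponent_ge (by norm_num) (by norm_num) (by linarith)
  have hwr : w1 ≤ w := by
    refine hw1.trans ?_
    rw [hw, ww_eq]
    exact Real.rpow_le_rpow_of_exponent_ge (by norm_num) (by norm_num) (by linarith)
  have k1 : c1 ≤ c := cE_lo hp hp2 hc1.le hwl h1
  have k2 : c ≤ c2 := cE_hi hp hp1 (by linarith) hwr h2
  have hcpos : 0 < c := by linarith
  have hx0 : 0 < (c + 1) / 2 := by linarith
  have hy0 : 0 < (c - 1) / 2 := by linarith
  have p1 : A * (la * Real.log 2) ≤ ((c + 1) / 2) ^ p * Real.log ((c + 1) / 2) := by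
    have q1 : ((c1 + 1) / 2) ^ l ≤ ((c + 1) / 2) ^ p :=
      (Real.rpow_le_rpow (by linarith) (by linarith) (by linarith)).trans
        (Real.rpow_le_rpow_of_exponent_le (by linarith) hp1)
    have q2 : Real.log ((c1 + 1) / 2) ≤ Real.log ((c + 1) / 2) := Real.log_le_log (by linarith) (by linarith)
    exact mul_le_mul (by linarith) (by linarith) (by positivity) (by positivity)
  have p2 : - (B * (lb * Real.log 2)) ≤ ((c - 1) / 2) ^ p * Real.log ((c - 1) / 2) := by
    have q1 : ((c - 1) / 2) ^ p ≤ ((c2 - 1) / 2) ^ l :=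
      (Real.rpow_le_rpow_of_exponent_ge hy0 (by linarith) hp1).trans (Real.rpow_le_rpow hy0.le (by linarith) (by linarith))
    have q2 : Real.log ((c1 - 1) / 2) ≤ Real.log ((c - 1) / 2) := Real.log_le_log (by linarith) (by linarith)
    have q3 : - Real.log ((c - 1) / 2) ≤ lb * Real.log 2 := by linarith
    have q4 : Real.log ((c - 1) / 2) ≤ 0 := Real.log_nonpos hy0.le (by linarith)
    have q0 : 0 < ((c - 1) / 2) ^ p := by positivity
    have := mul_le_mul (by linarith : ((c - 1) / 2) ^ p ≤ B) q3 (by linarith) (by linarith)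
    linarith
  have p3 : c * (Real.log c - w * Real.log 2 / MM p) ≤ c2 * ((lc - w1 / (4 - w1)) * Real.log 2) := by
    have q1 : Real.log c ≤ lc * Real.log 2 := (Real.log_le_log hcpos k2).trans hlc
    have q2 : w1 / (4 - w1) ≤ w / MM p := by
      unfold MM
      rw [div_le_div_iff₀ (by linarith) (by linarith)]
      nlinarith
    have q3 := mul_le_mul_of_nonneg_right q2 hln.le
    have q4 : 0 ≤ (lc - w1 / (4 - w1)) * Real.log 2 := mul_nonneg (by linarith) hln.le
    have e : w * Real.log 2 / MM p = w / MM p * Real.log 2 := by ring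
    calc c * (Real.log c - w * Real.log 2 / MM p) ≤ c * ((lc - w1 / (4 - w1)) * Real.log 2) := by
          apply mul_le_mul_of_nonneg_left _ hcpos.le
          rw [e]; linarith
      _ ≤ _ := mul_le_mul_of_nonneg_right k2 q4
  have p4 : ((c + 1) / 2) ^ (p - 1) + ((c - 1) / 2) ^ (p - 1) ≤ S1 + S2 := by
    have q1 : ((c + 1) / 2) ^ (p - 1) ≤ ((c2 + 1) / 2) ^ (r - 1) :=
      (Real.rpow_le_rpow hx0.le (by linarith) (by linarith)).trans
        (Real.rpow_le_rpow_of_exponent_le (by linarith) (by linarith))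
    have q2 : ((c - 1) / 2) ^ (p - 1) ≤ ((c2 - 1) / 2) ^ (l - 1) :=
      (Real.rpow_le_rpow_of_exponent_ge hy0 (by linarith) (by linarith)).trans (Real.rpow_le_rpow hy0.le (by linarith) (by linarith))
    linarith
  have p5 : c * (Real.log c - w * Real.log 2 / MM p) * (((c + 1) / 2) ^ (p - 1) + ((c - 1) / 2) ^ (p - 1))
      ≤ c2 * ((lc - w1 / (4 - w1)) * Real.log 2) * (S1 + S2) := by
    refine mul_le_mul p3 p4 (by positivity) ?_
    exact mul_nonneg (by linarith) (mul_nonneg (by linarith) hln.le)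
  have p6 := mul_pos fin hln
  rw [hc']
  linarith

set_option exponentiation.threshold 2000

lemma phi_der_0 : ∀ p : ℝ, 2.55 ≤ p → p ≤ 2.57 → ∃ d, HasDerivAt phi d p ∧ 0 < d := by
  refine phi_der_pos (l := 2.55) (r := 2.57) (c1 := 1.5944) (c2 := 1.6022) (w1 := 0.67361) (w2 := 0.68303) (A := 1.94163) (B := 0.04686)
    (S1 := 1.51171) (S2 := 0.1556) (la := 3 / 8) (lb := 205 / 117) (lc := 66 / 97) (by norm_num)
    (rle 11 20 (by norm_num) (by norm_num) (by norm_num) (by norm_num) (by norm_num)) (rge 57 100 (by norm_num) (by norm_num) (by norm_num) (by norm_num)) (by norm_num) (by norm_num)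
    (rle 257 100 (by norm_num) (by norm_num) (by norm_num) (by norm_num) (by norm_num)) (rge 51 20 (by norm_num) (by norm_num) (by norm_num) (by norm_num)) (by norm_num) (by norm_num)
    (rge 51 20 (by norm_num) (by norm_num) (by norm_num) (by norm_num)) (by norm_num) ?_ (by norm_num)
    (rle 51 20 (by norm_num) (by norm_num) (by norm_num) (by norm_num) (by norm_num)) ?_ (by norm_num) ?_
    (rle 157 100 (by norm_num) (by norm_num) (by norm_num) (by norm_num) (by norm_num)) (rle 31 20 (by norm_num) (by norm_num) (by norm_num) (by norm_num) (by norm_num)) (by norm_num) (by norm_num) (by norm_num)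
  · exact_mod_cast log_ge (x := (1.5944 + 1) / 2) 8 3 (by norm_num) (by norm_num) (by norm_num)
  · have := log_le (x := 2 / (1.5944 - 1)) 117 205 (by norm_num) (by norm_num) (by norm_num)
    rw [show ((1.5944:ℝ) - 1) / 2 = (2 / (1.5944 - 1))⁻¹ by rw [inv_div], Real.log_inv]
    push_cast at this
    linarith
  · exact_mod_cast log_le (x := 1.6022) 97 66 (by norm_num) (by norm_num) (by norm_num)

lemma phi_der_1 : ∀ p : ℝ, 2.57 ≤ p → p ≤ 2.59 → ∃ d, HasDerivAt phi d p ∧ 0 < d := by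
  refine phi_der_pos (l := 2.57) (r := 2.59) (c1 := 1.5904) (c2 := 1.598) (w1 := 0.66434) (w2 := 0.67362) (A := 1.94404) (B := 0.04493)
    (S1 := 1.51579) (S2 := 0.15025) (la := 25 / 67) (lb := 169 / 96) (lc := 23 / 34) (by norm_num)
    (rle 57 100 (by norm_num) (by norm_num) (by norm_num) (by norm_num) (by norm_num)) (rge 59 100 (by norm_num) (by norm_num) (by norm_num) (by norm_num)) (by norm_num) (by norm_num)
    (rle 259 100 (by norm_num) (by norm_num) (by norm_num) (by norm_num) (by norm_num)) (rge 257 100 (by norm_num) (by norm_num) (by norm_num) (by norm_num)) (by norm_num) (by norm_num)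
    (rge 257 100 (by norm_num) (by norm_num) (by norm_num) (by norm_num)) (by norm_num) ?_ (by norm_num)
    (rle 257 100 (by norm_num) (by norm_num) (by norm_num) (by norm_num) (by norm_num)) ?_ (by norm_num) ?_
    (rle 159 100 (by norm_num) (by norm_num) (by norm_num) (by norm_num) (by norm_num)) (rle 157 100 (by norm_num) (by norm_num) (by norm_num) (by norm_num) (by norm_num)) (by norm_num) (by norm_num) (by norm_num)
  · exact_mod_cast log_ge (x := (1.5904 + 1) / 2) 67 25 (by norm_num) (by norm_num) (by norm_num)
  · have := log_le (x := 2 / (1.5904 - 1)) 96 169 (by norm_num) (by norm_num) (by norm_num)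
    rw [show ((1.5904:ℝ) - 1) / 2 = (2 / (1.5904 - 1))⁻¹ by rw [inv_div], Real.log_inv]
    push_cast at this
    linarith
  · exact_mod_cast log_le (x := 1.598) 34 23 (by norm_num) (by norm_num) (by norm_num)

lemma phi_der_2 : ∀ p : ℝ, 2.59 ≤ p → p ≤ 2.6 → ∃ d, HasDerivAt phi d p ∧ 0 < d := by
  refine phi_der_pos (l := 2.59) (r := 2.6) (c1 := 1.5893) (c2 := 1.5931) (w1 := 0.65975) (w2 := 0.66435) (A := 1.95197) (B := 0.04293)
    (S1 := 1.51518) (S2 := 0.14476) (la := 19 / 51) (lb := 67 / 38) (lc := 43 / 64) (by norm_num)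
    (rle 59 100 (by norm_num) (by norm_num) (by norm_num) (by norm_num) (by norm_num)) (rge 3 5 (by norm_num) (by norm_num) (by norm_num) (by norm_num)) (by norm_num) (by norm_num)
    (rle 13 5 (by norm_num) (by norm_num) (by norm_num) (by norm_num) (by norm_num)) (rge 259 100 (by norm_num) (by norm_num) (by norm_num) (by norm_num)) (by norm_num) (by norm_num)
    (rge 259 100 (by norm_num) (by norm_num) (by norm_num) (by norm_num)) (by norm_num) ?_ (by norm_num)
    (rle 259 100 (by norm_num) (by norm_num) (by norm_num) (by norm_num) (by norm_num)) ?_ (by norm_num) ?_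
    (rle 8 5 (by norm_num) (by norm_num) (by norm_num) (by norm_num) (by norm_num)) (rle 159 100 (by norm_num) (by norm_num) (by norm_num) (by norm_num) (by norm_num)) (by norm_num) (by norm_num) (by norm_num)
  · exact_mod_cast log_ge (x := (1.5893 + 1) / 2) 51 19 (by norm_num) (by norm_num) (by norm_num)
  · have := log_le (x := 2 / (1.5893 - 1)) 38 67 (by norm_num) (by norm_num) (by norm_num)
    rw [show ((1.5893:ℝ) - 1) / 2 = (2 / (1.5893 - 1))⁻¹ by rw [inv_div], Real.log_inv]
    push_cast at this
    linarith
  · exact_mod_cast log_le (x := 1.5931) 64 43 (by norm_num) (by norm_num) (by norm_num)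

lemma phi_eq {p : ℝ} (hp : 2 < p) : phi p = ((cE p + 1) / 2) ^ p + ((cE p - 1) / 2) ^ p := by
  have := cE_gt hp
  unfold phi
  rw [Real.rpow_def_of_pos (by linarith), Real.rpow_def_of_pos (by linarith), mul_comm p, mul_comm p]

lemma phi_lo : phi 2.57 < 2 := by
  have hw : 0.67361678 ≤ (1/2:ℝ) ^ ((2.57:ℝ) - 2) := rge 57 100 (by norm_num) (by norm_num) (by norm_num) (by norm_num)
  rw [← ww_eq] at hw
  have hc : cE 2.57 ≤ 1.59625430 := cE_hi (l := 2.57) (by norm_num) le_rfl (by norm_num) hw (rge 257 100 (by norm_num) (by norm_num) (by norm_num) (by norm_num))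
  have hc0 := cE_gt (p := 2.57) (by norm_num)
  have hX : ((1.59625430 + 1) / 2 : ℝ) ^ (2.57:ℝ) ≤ 1.95535360 := rle 257 100 (by norm_num) (by norm_num) (by norm_num) (by norm_num) (by norm_num)
  have hY : ((1.59625430 - 1) / 2 : ℝ) ^ (2.57:ℝ) ≤ 0.04458740 := rle 257 100 (by norm_num) (by norm_num) (by norm_num) (by norm_num) (by norm_num)
  have h1 := Real.rpow_le_rpow (z := 2.57) (by linarith) (by linarith : (cE 2.57 + 1) / 2 ≤ (1.59625430 + 1) / 2) (by norm_num)
  have h2 := Real.rpow_le_rpow (z := 2.57) (by linarith) (by linarith : (cE 2.57 - 1) / 2 ≤ (1.59625430 - 1) / 2) (by norm_num)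
  rw [phi_eq (by norm_num)]
  linarith

lemma phi_hi : 2 < phi 2.58 := by
  have hw : (1/2:ℝ) ^ ((2.58:ℝ) - 2) ≤ 0.66896378 := rle 29 50 (by norm_num) (by norm_num) (by norm_num) (by norm_num) (by norm_num)
  rw [← ww_eq] at hw
  have hc : 1.59422690 ≤ cE 2.58 := cE_lo (r := 2.58) (by norm_num) le_rfl (by norm_num) hw (rle 129 50 (by norm_num) (by norm_num) (by norm_num) (by norm_num) (by norm_num))
  have hX : 1.95651480 ≤ ((1.59422690 + 1) / 2 : ℝ) ^ (2.58:ℝ) := rge 129 50 (by norm_num) (by norm_num) (by norm_num) (by norm_num)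
  have hY : 0.04366560 ≤ ((1.59422690 - 1) / 2 : ℝ) ^ (2.58:ℝ) := rge 129 50 (by norm_num) (by norm_num) (by norm_num) (by norm_num)
  have h1 := Real.rpow_le_rpow (z := 2.58) (by norm_num) (by linarith : (1.59422690 + 1) / 2 ≤ (cE 2.58 + 1) / 2) (by norm_num)
  have h2 := Real.rpow_le_rpow (z := 2.58) (by norm_num) (by linarith : (1.59422690 - 1) / 2 ≤ (cE 2.58 - 1) / 2) (by norm_num)
  rw [phi_eq (by norm_num)]
  linarith

lemma phi_der_all {p : ℝ} (h0 : 2.55 ≤ p) (h1 : p ≤ 2.6) : ∃ d, HasDerivAt phi d p ∧ 0 < d := by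
  rcases le_total p 2.57 with h | h
  · exact phi_der_0 p h0 h
  · rcases le_total p 2.59 with h' | h'
    · exact phi_der_1 p h h'
    · exact phi_der_2 p h' h1

lemma phi_cont : ContinuousOn phi (Set.Icc 2.55 2.6) := by
  intro p hp
  obtain ⟨d, hd, -⟩ := phi_der_all hp.1 hp.2
  exact hd.continuousAt.continuousWithinAt

lemma phi_mono : StrictMonoOn phi (Set.Icc 2.55 2.6) := by
  refine strictMonoOn_of_deriv_pos (convex_Icc _ _) phi_cont ?_
  intro p hp
  have hp' := interior_subset hp
  obtain ⟨d, hd, h⟩ := phi_der_all hp'.1 hp'.2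
  rw [hd.deriv]; exact h

theorem p0_exists : ∃ p₀ : ℝ, 2.57 < p₀ ∧ p₀ < 2.58 ∧ ∀ p, 2.55 ≤ p → p ≤ 2.6 →
    (p ≤ p₀ → phi p ≤ 2) ∧ (p₀ ≤ p → 2 ≤ phi p) := by
  have hs : Set.Icc (2.57:ℝ) 2.58 ⊆ Set.Icc 2.55 2.6 := Set.Icc_subset_Icc (by norm_num) (by norm_num)
  obtain ⟨p₀, ⟨h1, h2⟩, h3⟩ := intermediate_value_Icc (by norm_num : (2.57:ℝ) ≤ 2.58) (phi_cont.mono hs)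
    (show (2:ℝ) ∈ Set.Icc (phi 2.57) (phi 2.58) from ⟨phi_lo.le, phi_hi.le⟩)
  have e1 : p₀ ≠ 2.57 := fun h => by rw [h] at h3; exact phi_lo.ne h3
  have e2 : p₀ ≠ 2.58 := fun h => by rw [h] at h3; exact phi_hi.ne h3.symm
  have h0 := hs ⟨h1, h2⟩
  refine ⟨p₀, lt_of_le_of_ne h1 e1.symm, lt_of_le_of_ne h2 e2, fun p a b => ⟨fun h => ?_, fun h => ?_⟩⟩
  · rw [← h3]; exact phi_mono.monotoneOn ⟨a, b⟩ h0 h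
  · rw [← h3]; exact phi_mono.monotoneOn h0 ⟨a, b⟩ h

/-- log form of the two candidate values -/
lemma GG_10 {p : ℝ} (hp : 0 < p) : GG p 1 0 = 1 / p * Real.log (2 ^ p - 1) - Real.log 2 := by
  have h1 : (1:ℝ) < 2 ^ p := Real.one_lt_rpow (by norm_num) hp
  have e1 : kk p 1 = 2 ^ p - 1 := by unfold kk; rw [Real.one_rpow]; norm_num
  have e0 : kk p 0 = 1 := by unfold kk; rw [Real.zero_rpow hp.ne']; norm_num
  unfold GG
  rw [e1, e0, show (1:ℝ) + 1 + 0 = 2 by norm_num, show (2:ℝ) ^ p - 1 + 1 = 2 ^ p by ring, Real.log_rpow (by norm_num), Real.log_one]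
  field_simp
  ring

lemma GG_ss {p s : ℝ} (hp : 0 < p) (hs : 0 ≤ s) : GG p s s = Real.log (1 + 2 * s) - 2 / p * Real.log 2 := by
  have hk := kk_pos hp hs
  unfold GG
  rw [show kk p s + kk p s = 2 * kk p s by ring, Real.log_mul (by norm_num) hk.ne', show 1 + s + s = 1 + 2 * s by ring]
  ring

lemma GG_diff {p s : ℝ} (hp : 2 < p) (hs : 0 ≤ s) : GG p s s - GG p 1 0 = Real.log (1 + 2 * s) - Real.log (cE p) := by
  rw [GG_10 (by linarith), GG_ss (by linarith) hs]
  have h1 : (1:ℝ) < 2 ^ p := Real.one_lt_rpow (by norm_num) (by linarith)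
  have e : MM p = (2 ^ p - 1) * (4 / 2 ^ p) := by
    unfold MM
    rw [ww_eq, one_div, Real.inv_rpow (by norm_num), Real.rpow_sub (by norm_num)]
    norm_num
    field_simp
  unfold cE
  rw [Real.log_exp, e, Real.log_mul (by linarith) (by positivity), Real.log_div (by norm_num) (by positivity), Real.log_rpow (by norm_num),
    show (4:ℝ) = 2 ^ 2 by norm_num, Real.log_pow]
  have : p ≠ 0 := by linarith
  field_simp
  push_cast
  ring

lemma star_cmp {p s : ℝ} (hp : 2 < p) (hs : 0 ≤ s) (h : ff p s = gg p s) :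
    (phi p ≤ 2 → GG p 1 0 ≤ GG p s s) ∧ (2 ≤ phi p → GG p s s ≤ GG p 1 0) := by
  have hc := cE_gt hp
  have hd := GG_diff hp hs
  set y := (cE p - 1) / 2 with hy
  have hy0 : 0 < y := by linarith
  have e : phi p = (1 + y) ^ p + y ^ p := by
    rw [phi_eq hp, ← hy, show (cE p + 1) / 2 = 1 + y by rw [hy]; ring]
  have hs2 : (1 + s) ^ p + s ^ p = 2 := by unfold ff gg at h; linarith
  have ec : cE p = 1 + 2 * y := by rw [hy]; ring
  constructor
  · intro h2
    have : y ≤ s := by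
      by_contra hlt
      push Not at hlt
      have g1 := Real.rpow_lt_rpow hs hlt (by linarith : 0 < p)
      have g2 := Real.rpow_lt_rpow (by linarith : 0 ≤ 1 + s) (by linarith : 1 + s < 1 + y) (by linarith : 0 < p)
      linarith
    have := Real.log_le_log (by linarith : 0 < cE p) (by linarith : cE p ≤ 1 + 2 * s)
    linarith
  · intro h2
    have : s ≤ y := by
      by_contra hlt
      push Not at hlt
      have g1 := Real.rpow_lt_rpow hy0.le hlt (by linarith : 0 < p)
      have g2 := Real.rpow_lt_rpow (by linarith : 0 ≤ 1 + y) (by linarith : 1 + y < 1 + s) (by linarith : 0 < p)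
      linarith
    have := Real.log_le_log (by linarith : 0 < 1 + 2 * s) (by linarith : 1 + 2 * s ≤ cE p)
    linarith

theorem analytic_main : ∃ p₀ : ℝ, 2.57 < p₀ ∧ p₀ < 2.58 ∧ ∀ p, 1 < p →
    ((p ≤ 2 ∨ p₀ ≤ p) → Min1 p) ∧ ((2 ≤ p ∧ p ≤ p₀) → Min0 p) := by
  obtain ⟨p₀, h1, h2, h⟩ := p0_exists
  refine ⟨p₀, h1, h2, fun p hp => ⟨?_, ?_⟩⟩
  · rintro (hp2 | hp2)
    · exact low_Min1 hp hp2
    · rcases le_total 3 p with h3 | h3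
      · exact high_Min1 h3
      rcases le_total 2.6 p with h4 | h4
      · rcases eq_or_lt_of_le h3 with h5 | h5
        · exact high_Min1 h5.ge
        · exact engine1 h4 h5
      · intro s hs hst a b ha hb hab
        have := (star_cmp (by linarith) hs hst).2 ((h p (by linarith) h4).2 hp2)
        rcases engineM (by linarith) h4 s hs hst a b ha hb hab with h6 | h6
        · linarith
        · linarith
  · rintro ⟨hp2, hp3⟩
    rcases le_total p 2.01 with h3 | h3
    · exact low_Min0 hp2 h3
    rcases le_total p 2.55 with h4 | h4
    · exact engine0 h3 h4
    · intro a b ha hb hab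
      obtain ⟨s, hs, -, hst⟩ := exists_star (p := p) (by linarith)
      have := (star_cmp (by linarith) hs.le hst).1 ((h p h4 (by linarith)).1 hp3)
      rcases engineM h4 (by linarith) s hs.le hst a b ha hb hab with h6 | h6
      · linarith
      · linarith

lemma crit_config {p X Y u v : ℝ} (hp : 1 < p) (hX : 0 < X) (hY : 0 < Y) (hu : 0 ≤ u) (hv : 0 ≤ v)
    (e0 : X ^ p + Y ^ p = 1) (e1 : (X + u) ^ p + v ^ p = 1) (e2 : u ^ p + (Y + v) ^ p = 1) :
    ∃ a b : ℝ, a ∈ Set.Icc (0:ℝ) 1 ∧ b ∈ Set.Icc (0:ℝ) 1 ∧ OnC p a b ∧ Real.log (X * Y + X * v + Y * u) = GG p a b := by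
  have hp0 : 0 < p := by linarith
  set a := u / X with ha
  set b := v / Y with hb
  have ea : u = X * a := by rw [ha]; field_simp
  have eb : v = Y * b := by rw [hb]; field_simp
  have ha0 : 0 ≤ a := by positivity
  have hb0 : 0 ≤ b := by positivity
  have hA : 0 < X ^ p := by positivity
  have hB : 0 < Y ^ p := by positivity
  have f1 : X ^ p * ff p a = Y ^ p * gg p b := by
    rw [ea, eb, show X + X * a = X * (1 + a) by ring, Real.mul_rpow hX.le (by linarith), Real.mul_rpow hY.le hb0] at e1
    unfold ff gg; linarith
  have f2 : Y ^ p * ff p b = X ^ p * gg p a := by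
    rw [ea, eb, show Y + Y * b = Y * (1 + b) by ring, Real.mul_rpow hY.le (by linarith), Real.mul_rpow hX.le ha0] at e2
    unfold ff gg; linarith
  have fa : 0 ≤ ff p a := ff_nonneg hp0 ha0
  have fb : 0 ≤ ff p b := ff_nonneg hp0 hb0
  have ga : 0 ≤ gg p a := by
    have : 0 ≤ X ^ p * gg p a := by rw [← f2]; positivity
    exact nonneg_of_mul_nonneg_right this hA
  have gb : 0 ≤ gg p b := by
    have : 0 ≤ Y ^ p * gg p b := by rw [← f1]; positivity
    exact nonneg_of_mul_nonneg_right this hB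
  have le1 : ∀ x : ℝ, 0 ≤ x → 0 ≤ gg p x → x ≤ 1 := by
    intro x hx h
    by_contra hlt
    push Not at hlt
    have := Real.one_lt_rpow hlt hp0
    unfold gg at h; linarith
  refine ⟨a, b, ⟨ha0, le1 a ha0 ga⟩, ⟨hb0, le1 b hb0 gb⟩, ?_, ?_⟩
  · unfold OnC
    have h : (X ^ p * Y ^ p) * (ff p a * ff p b) = (X ^ p * Y ^ p) * (gg p a * gg p b) := by
      calc _ = (X ^ p * ff p a) * (Y ^ p * ff p b) := by ring
        _ = (Y ^ p * gg p b) * (X ^ p * gg p a) := by rw [f1, f2]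
        _ = _ := by ring
    exact mul_left_cancel₀ (by positivity) h
  · have k1 := kk_pos hp0 ha0
    have k2 := kk_pos hp0 hb0
    have ek : ∀ x, kk p x = ff p x + gg p x := by intro x; unfold kk ff gg; ring
    have h : X ^ p * kk p a = Y ^ p * kk p b := by rw [ek, ek]; linarith
    have eA : X ^ p = kk p b / (kk p a + kk p b) := by
      rw [eq_div_iff (by positivity)]
      have : Y ^ p = 1 - X ^ p := by linarith
      rw [this] at h; linarith
    have eB : Y ^ p = kk p a / (kk p a + kk p b) := by
      rw [eq_div_iff (by positivity)]
      have : X ^ p = 1 - Y ^ p := by linarith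
      rw [this] at h; linarith
    have lA := congrArg Real.log eA
    have lB := congrArg Real.log eB
    rw [Real.log_rpow hX, Real.log_div k2.ne' (by positivity)] at lA
    rw [Real.log_rpow hY, Real.log_div k1.ne' (by positivity)] at lB
    rw [ea, eb, show X * Y + X * (Y * b) + Y * (X * a) = (1 + a + b) * (X * Y) by ring,
      Real.log_mul (by positivity) (by positivity), Real.log_mul hX.ne' hY.ne']
    unfold GG
    have lX : Real.log X = 1 / p * (Real.log (kk p b) - Real.log (kk p a + kk p b)) := by rw [← lA]; field_simp
    have lY : Real.log Y = 1 / p * (Real.log (kk p a) - Real.log (kk p a + kk p b)) := by rw [← lB]; field_simp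
    rw [lX, lY]; ring

/-- `Dl` is a lower bound for determinants of inscribed critical configurations. -/
def CfgBound (p Dl : ℝ) : Prop := ∀ X Y u v : ℝ, 0 ≤ X → 0 ≤ Y → 0 ≤ u → 0 ≤ v →
  X ^ p + Y ^ p = 1 → (X + u) ^ p + v ^ p = 1 → u ^ p + (Y + v) ^ p = 1 → Dl ≤ X * Y + X * v + Y * u

lemma cfg_of {p G : ℝ} (hp : 1 < p) (h : ∀ a b : ℝ, a ∈ Set.Icc (0:ℝ) 1 → b ∈ Set.Icc (0:ℝ) 1 → OnC p a b → G ≤ GG p a b) :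
    CfgBound p (Real.exp G) := by
  intro X Y u v hX hY hu hv e0 e1 e2
  have hp0 : p ≠ 0 := by linarith
  have key : ∀ {X Y u v : ℝ}, X = 0 → 0 ≤ Y → 0 ≤ u → 0 ≤ v →
     X ^ p + Y ^ p = 1 → (X + u) ^ p + v ^ p = 1 → u ^ p + (Y + v) ^ p = 1 → False := by
    intro X Y u v hX hY hu hv e0 e1 e2
    rw [hX, Real.zero_rpow hp0, zero_add] at e0
    have hY1 : Y = 1 := by
      have := congrArg (fun t => t ^ (1 / p)) e0
      simp only [Real.one_rpow] at this
      rwa [← Real.rpow_mul hY, mul_one_div_cancel hp0, Real.rpow_one] at this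
    rw [hX, zero_add] at e1
    rw [hY1] at e2
    have h1 : 0 ≤ u ^ p := by positivity
    have h2 : 1 ≤ (1 + v) ^ p := Real.one_le_rpow (by linarith) (by linarith)
    have h3 : u ^ p = 0 := by linarith
    have h4 : v ^ p = 1 := by linarith
    have h5 : v ^ p ≠ 0 := by rw [h4]; norm_num
    have h6 : 0 < v := by
      rcases eq_or_lt_of_le hv with h | h
      · rw [← h, Real.zero_rpow hp0] at h5; exact absurd rfl h5
      · exact h
    have := Real.one_lt_rpow (by linarith : 1 < 1 + v) (by linarith : 0 < p)
    linarith
  rcases eq_or_lt_of_le hX with h0 | hX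
  · exact (key h0.symm hY hu hv e0 e1 e2).elim
  rcases eq_or_lt_of_le hY with h0 | hY
  · exact (key h0.symm hX.le hv hu (by linarith) (by linarith) (by linarith)).elim
  obtain ⟨a, b, ha, hb, hab, e⟩ := crit_config hp hX hY hu hv e0 e1 e2
  have := h a b ha hb hab
  rw [← e] at this
  rwa [← Real.le_log_iff_exp_le (by positivity)]

lemma exp_GG10 {p : ℝ} (hp : 0 < p) : Real.exp (GG p 1 0) = (2 ^ p - 1) ^ (1 / p) / 2 := by
  have h1 : (1:ℝ) < 2 ^ p := Real.one_lt_rpow (by norm_num) hp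
  rw [GG_10 hp, Real.exp_sub, Real.exp_log (by norm_num), Real.rpow_def_of_pos (by linarith : (0:ℝ) < 2 ^ p - 1), mul_comm]

lemma exp_GGss {p s : ℝ} (hp : 0 < p) (hs : 0 ≤ s) : Real.exp (GG p s s) = (1 + 2 * s) * (4:ℝ) ^ (-1 / p) := by
  rw [GG_ss hp hs, Real.exp_sub, Real.exp_log (by linarith), Real.rpow_def_of_pos (by norm_num), div_eq_mul_inv, ← Real.exp_neg,
    show (4:ℝ) = 2 ^ 2 by norm_num, Real.log_pow]
  congr 2
  push_cast
  ring

noncomputable def Fp (p : ℝ) (v : ℝ × ℝ) : ℝ := |v.1| ^ p + |v.2| ^ p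

lemma Fp_nonneg (p : ℝ) (v : ℝ × ℝ) : 0 ≤ Fp p v := by unfold Fp; positivity

lemma Fp_neg (p : ℝ) (v : ℝ × ℝ) : Fp p (-v) = Fp p v := by unfold Fp; simp

lemma Fp_smul {p t : ℝ} (ht : 0 ≤ t) (v : ℝ × ℝ) : Fp p (t • v) = t ^ p * Fp p v := by
  unfold Fp
  simp only [Prod.smul_fst, Prod.smul_snd, smul_eq_mul, abs_mul, abs_of_nonneg ht]
  rw [Real.mul_rpow ht (abs_nonneg _), Real.mul_rpow ht (abs_nonneg _)]; ring

lemma abs_jensen {p α β x y : ℝ} (hp : 1 ≤ p) (hα : 0 ≤ α) (hβ : 0 ≤ β) (h : α + β ≤ 1) :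
    |α * x + β * y| ^ p ≤ α * |x| ^ p + β * |y| ^ p := by
  have h1 : |α * x + β * y| ≤ α * |x| + β * |y| := by
    have := abs_add_le (α * x) (β * y)
    rwa [abs_mul, abs_mul, abs_of_nonneg hα, abs_of_nonneg hβ] at this
  have h2 : (α * |x| + β * |y|) ^ p ≤ α * |x| ^ p + β * |y| ^ p := by
    have hc := (convexOn_rpow hp)
    rcases eq_or_lt_of_le (add_nonneg hα hβ) with h0 | h0
    · have e1 : α = 0 := by linarith
      have e2 : β = 0 := by linarith
      rw [e1, e2]; simp [Real.zero_rpow (by linarith : p ≠ 0)]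
    · set g := α + β with hg
      have := hc.2 (show |x| ∈ Set.Ici (0:ℝ) from abs_nonneg x) (show |y| ∈ Set.Ici (0:ℝ) from abs_nonneg y)
        (show 0 ≤ α / g by positivity) (show 0 ≤ β / g by positivity) (by rw [← add_div, ← hg, div_self h0.ne'])
      simp only [smul_eq_mul] at this
      have e : α * |x| + β * |y| = g * (α / g * |x| + β / g * |y|) := by field_simp
      rw [e, Real.mul_rpow h0.le (by positivity)]
      have g1 : g ^ p ≤ g := by
        have := Real.rpow_le_rpow_of_exponent_ge h0 h hp
        rwa [Real.rpow_one] at this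
      calc g ^ p * (α / g * |x| + β / g * |y|) ^ p ≤ g * (α / g * |x| ^ p + β / g * |y| ^ p) :=
            mul_le_mul g1 this (by positivity) h0.le
        _ = _ := by field_simp
  exact (Real.rpow_le_rpow (abs_nonneg _) h1 (by linarith)).trans h2

lemma Fp_jensen {p α β : ℝ} (hp : 1 ≤ p) (hα : 0 ≤ α) (hβ : 0 ≤ β) (h : α + β ≤ 1) (v w : ℝ × ℝ) :
    Fp p (α • v + β • w) ≤ α * Fp p v + β * Fp p w := by
  unfold Fp
  simp only [Prod.fst_add, Prod.snd_add, Prod.smul_fst, Prod.smul_snd, smul_eq_mul]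
  have h1 := abs_jensen (x := v.1) (y := w.1) hp hα hβ h
  have h2 := abs_jensen (x := v.2) (y := w.2) hp hα hβ h
  linarith

lemma Fp_combo {p α β : ℝ} (hp : 1 ≤ p) (hα : 0 ≤ α) (hβ : 0 ≤ β) (h : α + β < 1) {v w : ℝ × ℝ}
    (hv : Fp p v ≤ 1) (hw : Fp p w ≤ 1) : Fp p (α • v + β • w) < 1 := by
  have := Fp_jensen hp hα hβ h.le v w
  nlinarith [mul_le_mul_of_nonneg_left hv hα, mul_le_mul_of_nonneg_left hw hβ]

/-- chord argument -/
lemma chord {p : ℝ} (hp : 1 ≤ p) {m w b : ℝ × ℝ} (hm : Fp p m ≤ 1) (hb : Fp p b ≤ 1) (hbm : Fp p (b - m) ≤ 1)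
    (hw : det2 m w ≠ 0) (hlt : |det2 m w| < |det2 m b|) : ∃ k : ℤ, Fp p (w - (k:ℝ) • m) < 1 := by
  -- WLOG λ > 0
  have main : ∀ w : ℝ × ℝ, 0 < det2 m w / det2 m b → |det2 m w| < |det2 m b| → ∃ k : ℤ, Fp p (w - (k:ℝ) • m) < 1 := by
    intro w hpos hlt
    have hD : det2 m b ≠ 0 := fun h => by rw [h] at hlt; simp at hlt; linarith [abs_nonneg (det2 m w)]
    set l := det2 m w / det2 m b with hl
    have hl1 : l < 1 := by
      have : |l| < 1 := by rw [hl, abs_div, div_lt_one (abs_pos.2 hD)]; exact hlt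
      exact (abs_lt.1 this).2
    set t := det2 w b / det2 m b with ht
    have hwe : w = l • b + t • m := by
      have h1 : det2 m w = l * det2 m b := by rw [hl]; field_simp
      have h2 : det2 w b = t * det2 m b := by rw [ht]; field_simp
      ext
      · simp only [Prod.fst_add, Prod.smul_fst, smul_eq_mul]
        apply mul_right_cancel₀ hD
        have : w.1 * det2 m b = det2 m w * b.1 + det2 w b * m.1 := by unfold det2; ring
        rw [this, h1, h2]; ring
      · simp only [Prod.snd_add, Prod.smul_snd, smul_eq_mul]
        apply mul_right_cancel₀ hD
        have : w.2 * det2 m b = det2 m w * b.2 + det2 w b * m.2 := by unfold det2; ring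
        rw [this, h1, h2]; ring
    refine ⟨⌈t⌉, ?_⟩
    set s := (⌈t⌉:ℝ) - t with hs
    have hs0 : 0 ≤ s := by have := Int.le_ceil t; linarith
    have hs1 : s < 1 := by have := Int.ceil_lt_add_one t; linarith
    have e : w - (⌈t⌉:ℝ) • m = l • b - s • m := by
      rw [hwe, hs]; module
    rw [e]
    rcases le_total s l with h | h
    · have : l • b - s • m = s • (b - m) + (l - s) • b := by module
      rw [this]
      exact Fp_combo hp hs0 (by linarith) (by linarith) hbm hb
    · have : l • b - s • m = l • (b - m) + (s - l) • (-m) := by module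
      rw [this]
      exact Fp_combo hp hpos.le (by linarith) (by linarith) hbm (by rw [Fp_neg]; exact hm)
  have hD : det2 m b ≠ 0 := fun h => by rw [h] at hlt; simp at hlt; linarith [abs_nonneg (det2 m w)]
  rcases lt_or_gt_of_ne (div_ne_zero hw hD) with h | h
  · have e : det2 m (-w) = - det2 m w := by unfold det2; simp; ring
    obtain ⟨k, hk⟩ := main (-w) (by rw [e, neg_div]; linarith) (by rw [e, abs_neg]; exact hlt)
    refine ⟨-k, ?_⟩
    rw [← Fp_neg]
    convert hk using 2
    push_cast
    module
  · exact main w h hlt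

noncomputable def Wp (p t : ℝ) : ℝ := (1 - t ^ p) ^ (1 / p)

lemma Wp_cont {p : ℝ} (hp : 1 < p) : Continuous (Wp p) := by
  have h1 : Continuous (fun t : ℝ => t ^ p) := continuous_id.rpow_const (fun _ => Or.inr (by linarith))
  exact (continuous_const.sub h1).rpow_const (fun _ => Or.inr (by positivity))

lemma rpow_le_one' {p t : ℝ} (hp : 1 < p) (h0 : 0 ≤ t) (h1 : t ≤ 1) : t ^ p ≤ 1 :=
  Real.rpow_le_one h0 h1 (by linarith)

lemma Wp_nonneg {p t : ℝ} (hp : 1 < p) (h0 : 0 ≤ t) (h1 : t ≤ 1) : 0 ≤ Wp p t :=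
  Real.rpow_nonneg (by linarith [rpow_le_one' hp h0 h1]) _

lemma Wp_pow {p t : ℝ} (hp : 1 < p) (h0 : 0 ≤ t) (h1 : t ≤ 1) : t ^ p + Wp p t ^ p = 1 := by
  unfold Wp
  rw [← Real.rpow_mul (by linarith [rpow_le_one' hp h0 h1]), one_div_mul_cancel (by linarith), Real.rpow_one]; ring

lemma Wp_anti {p s t : ℝ} (hp : 1 < p) (h0 : 0 ≤ s) (hst : s ≤ t) (h1 : t ≤ 1) : Wp p t ≤ Wp p s := by
  unfold Wp
  have := Real.rpow_le_rpow h0 hst (by linarith : 0 ≤ p)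
  exact Real.rpow_le_rpow (by linarith [rpow_le_one' hp (h0.trans hst) h1]) (by linarith) (by positivity)

lemma Wp_zero {p : ℝ} (hp : 1 < p) : Wp p 0 = 1 := by
  unfold Wp; rw [Real.zero_rpow (by linarith)]; simp

lemma Wp_eq {p x y : ℝ} (hp : 1 < p) (hy : 0 ≤ y) (h : x ^ p + y ^ p = 1) : Wp p x = y := by
  unfold Wp
  rw [show 1 - x ^ p = y ^ p by linarith, ← Real.rpow_mul hy, mul_one_div_cancel (by linarith), Real.rpow_one]

lemma le_one_of {p x y : ℝ} (hp : 1 < p) (hy : 0 ≤ y) (h : x ^ p + y ^ p = 1) : x ≤ 1 := by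
  by_contra hlt
  push Not at hlt
  have := Real.one_lt_rpow hlt (by linarith : 0 < p)
  have : 0 ≤ y ^ p := by positivity
  linarith

def HasB (p Dl : ℝ) (m : ℝ × ℝ) : Prop := ∃ b, Fp p b ≤ 1 ∧ Fp p (b - m) ≤ 1 ∧ Dl ≤ |det2 m b|

lemma Fp_of_nonneg {p x y : ℝ} (hx : 0 ≤ x) (hy : 0 ≤ y) : Fp p (x, y) = x ^ p + y ^ p := by
  unfold Fp; simp only [abs_of_nonneg hx, abs_of_nonneg hy]

lemma bI {p Dl x y : ℝ} (hp : 1 < p) (hD : CfgBound p Dl) (hx : 0 ≤ x) (hy : 0 ≤ y) (h : x ^ p + y ^ p = 1) (hy2 : y ≤ 1 / 2) :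
    HasB p Dl (x, y) := by
  have hx1 := le_one_of hp hy h
  have hWx := Wp_eq hp hy h
  have hc : ContinuousOn (fun u => (x - u) ^ p + (Wp p u - y) ^ p) (Set.Icc 0 x) := by
    apply Continuous.continuousOn
    exact ((continuous_const.sub continuous_id).rpow_const (fun _ => Or.inr (by linarith))).add
      (((Wp_cont hp).sub continuous_const).rpow_const (fun _ => Or.inr (by linarith)))
  have hmem : (1:ℝ) ∈ Set.Icc ((fun u => (x - u) ^ p + (Wp p u - y) ^ p) x) ((fun u => (x - u) ^ p + (Wp p u - y) ^ p) 0) := by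
    constructor
    · simp only [hWx, sub_self, Real.zero_rpow (by linarith : p ≠ 0)]; norm_num
    · simp only [Wp_zero hp, sub_zero]
      have := Real.rpow_le_rpow hy (by linarith : y ≤ 1 - y) (by linarith : 0 ≤ p)
      linarith
  obtain ⟨u, ⟨hu0, hux⟩, hu⟩ := intermediate_value_Icc' hx hc hmem
  simp only at hu
  have hWu : y ≤ Wp p u := by rw [← hWx]; exact Wp_anti hp hu0 hux hx1
  have hpw := Wp_pow hp hu0 (by linarith : u ≤ 1)
  have key := hD (x - u) (Wp p u - y) u y (by linarith) (by linarith) hu0 hy hu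
    (by rw [sub_add_cancel]; exact h) (by rw [sub_add_cancel]; exact hpw)
  refine ⟨(u, Wp p u), ?_, ?_, ?_⟩
  · rw [Fp_of_nonneg hu0 (by linarith)]; exact hpw.le
  · rw [Prod.mk_sub_mk, show u - x = -(x - u) by ring]
    unfold Fp
    simp only [abs_neg, abs_of_nonneg (by linarith : 0 ≤ x - u), abs_of_nonneg (by linarith : 0 ≤ Wp p u - y)]
    exact hu.le
  · refine le_trans ?_ (le_abs_self _)
    unfold det2
    simp only
    linarith

lemma bII {p Dl X Y : ℝ} (hp : 1 < p) (hD : CfgBound p Dl) (hX : 1 / 2 ≤ X) (hY : 1 / 2 ≤ Y) (h : X ^ p + Y ^ p = 1) :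
    HasB p Dl (-X, Y) := by
  have hX1 := le_one_of hp (by linarith) h
  have hY1 := le_one_of hp (by linarith : 0 ≤ X) (by linarith : Y ^ p + X ^ p = 1)
  have hWX := Wp_eq hp (by linarith) h
  have hWY := Wp_eq hp (by linarith : 0 ≤ X) (by linarith : Y ^ p + X ^ p = 1)
  have hc : ContinuousOn (fun v => Wp p (Wp p v - X) - v) (Set.Icc 0 (1 - Y)) := by
    apply Continuous.continuousOn
    exact ((Wp_cont hp).comp ((Wp_cont hp).sub continuous_const)).sub continuous_id
  have hW1 : ∀ v, 0 ≤ v → v ≤ 1 → Wp p v ≤ 1 := by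
    intro v h0 h1
    rw [← Wp_zero hp]; exact Wp_anti hp le_rfl h0 h1
  have hu : ∀ v, 0 ≤ v → v ≤ 1 - Y → 0 ≤ Wp p v - X := by
    intro v h0 h1
    have : Wp p Y ≤ Wp p v := Wp_anti hp h0 (by linarith) hY1
    linarith
  have hmem : Y ∈ Set.Icc ((fun v => Wp p (Wp p v - X) - v) (1 - Y)) ((fun v => Wp p (Wp p v - X) - v) 0) := by
    constructor
    · have h1 := hu (1 - Y) (by linarith) le_rfl
      have h2 := hW1 (1 - Y) (by linarith) (by linarith)
      have := hW1 _ h1 (by linarith)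
      simp only
      linarith
    · simp only [Wp_zero hp, sub_zero]
      have := Wp_anti hp (by linarith : 0 ≤ 1 - X) (by linarith : 1 - X ≤ X) hX1
      linarith
  obtain ⟨v, ⟨hv0, hv1⟩, hv⟩ := intermediate_value_Icc' (by linarith : (0:ℝ) ≤ 1 - Y) hc hmem
  simp only at hv
  have hu0 := hu v hv0 hv1
  have hv2 := hW1 v hv0 (by linarith)
  have p1 := Wp_pow hp hv0 (by linarith)
  have p2 := Wp_pow hp hu0 (by linarith)
  set u := Wp p v - X with hudef
  have e1 : X + u = Wp p v := by rw [hudef]; ring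
  have e2 : Y + v = Wp p u := by linarith
  have key := hD X Y u v (by linarith) (by linarith) hu0 hv0 h (by rw [e1]; linarith) (by rw [e2]; exact p2)
  refine ⟨(u, Y + v), ?_, ?_, ?_⟩
  · rw [Fp_of_nonneg hu0 (by linarith), e2]; exact p2.le
  · rw [Prod.mk_sub_mk, show u - -X = X + u by ring, show Y + v - Y = v by ring, Fp_of_nonneg (by linarith) hv0, e1]; linarith
  · refine le_trans ?_ (neg_le_abs _)
    unfold det2
    simp only
    linarith

lemma HasB.swap {p Dl x y : ℝ} (h : HasB p Dl (x, y)) : HasB p Dl (y, x) := by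
  obtain ⟨⟨b1, b2⟩, h1, h2, h3⟩ := h
  refine ⟨(b2, b1), ?_, ?_, ?_⟩
  · unfold Fp at *; simp only at *; linarith
  · unfold Fp at *; simp only [Prod.mk_sub_mk] at *; linarith
  · refine h3.trans (le_of_eq ?_)
    rw [← abs_neg]; unfold det2; congr 1; simp only; ring

lemma HasB.neg1 {p Dl x y : ℝ} (h : HasB p Dl (x, y)) : HasB p Dl (-x, y) := by
  obtain ⟨⟨b1, b2⟩, h1, h2, h3⟩ := h
  refine ⟨(-b1, b2), ?_, ?_, ?_⟩
  · unfold Fp at *; simp only [abs_neg] at *; linarith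
  · unfold Fp at *; simp only [Prod.mk_sub_mk] at *
    rw [show -b1 - -x = -(b1 - x) by ring, abs_neg]; linarith
  · refine h3.trans (le_of_eq ?_)
    rw [← abs_neg]; unfold det2; congr 1; simp only; ring

lemma HasB.neg2 {p Dl x y : ℝ} (h : HasB p Dl (x, y)) : HasB p Dl (x, -y) := h.swap.neg1.swap

theorem hasB {p Dl : ℝ} (hp : 1 < p) (hD : CfgBound p Dl) (m : ℝ × ℝ) (hm : Fp p m = 1) : HasB p Dl m := by
  have pos : ∀ x y : ℝ, 0 ≤ x → 0 ≤ y → x ^ p + y ^ p = 1 → HasB p Dl (x, y) := by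
    intro x y hx hy h
    rcases le_total y (1/2) with h1 | h1
    · exact bI hp hD hx hy h h1
    rcases le_total x (1/2) with h2 | h2
    · exact (bI hp hD hy hx (by linarith) h2).swap
    · have := (bII hp hD h2 h1 h).neg1
      rwa [neg_neg] at this
  obtain ⟨x, y⟩ := m
  have h := pos |x| |y| (abs_nonneg x) (abs_nonneg y) (by unfold Fp at hm; exact hm)
  rcases abs_choice x with hx | hx <;> rcases abs_choice y with hy | hy <;> rw [hx, hy] at h
  · exact h
  · have := h.neg2; rwa [neg_neg] at this
  · have := h.neg1; rwa [neg_neg] at this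
  · have := h.neg2.neg1; rwa [neg_neg, neg_neg] at this

noncomputable def Vl (m n : ℝ × ℝ) (i j : ℤ) : ℝ × ℝ := (i:ℝ) • m + (j:ℝ) • n

lemma abs_le_of_rpow {p x R : ℝ} (hp : 1 < p) (hx : 0 ≤ x) (h : x ^ p ≤ R) : x ≤ 1 + R := by
  have h0 : 0 ≤ x ^ p := by positivity
  rcases le_total x 1 with h1 | h1
  · linarith
  · have := Real.rpow_le_rpow_of_exponent_le h1 hp.le
    rw [Real.rpow_one] at this
    linarith

lemma Vl_finite {p : ℝ} (hp : 1 < p) {m n : ℝ × ℝ} (hd : 0 < det2 m n) (R : ℝ) :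
    {ij : ℤ × ℤ | Fp p (Vl m n ij.1 ij.2) ≤ R}.Finite := by
  set K := (1 + R) * (|m.1| + |m.2| + |n.1| + |n.2|) with hK
  set N := ⌈K / det2 m n⌉ with hN
  refine Set.Finite.subset ((Set.finite_Icc (-N) N).prod (Set.finite_Icc (-N) N)) ?_
  rintro ⟨i, j⟩ h
  simp only [Set.mem_ofPred_eq] at h
  set q := Vl m n i j with hq
  have h1 : |q.1| ≤ 1 + R := by
    apply abs_le_of_rpow hp (abs_nonneg _)
    have : 0 ≤ |q.2| ^ p := by positivity
    unfold Fp at h; linarith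
  have h2 : |q.2| ≤ 1 + R := by
    apply abs_le_of_rpow hp (abs_nonneg _)
    have : 0 ≤ |q.1| ^ p := by positivity
    unfold Fp at h; linarith
  have hR : 0 ≤ 1 + R := (abs_nonneg _).trans h1
  have bd : ∀ r : ℝ × ℝ, |det2 q r| ≤ (1 + R) * (|r.1| + |r.2|) := by
    intro r
    have : |det2 q r| ≤ |q.1 * r.2| + |q.2 * r.1| := by unfold det2; exact abs_sub _ _
    rw [abs_mul, abs_mul] at this
    have g1 := mul_le_mul_of_nonneg_right h1 (abs_nonneg r.2)
    have g2 := mul_le_mul_of_nonneg_right h2 (abs_nonneg r.1)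
    linarith
  have key : ∀ (k : ℤ) (r : ℝ × ℝ), |r.1| + |r.2| ≤ |m.1| + |m.2| + |n.1| + |n.2| → |det2 q r| = |(k:ℝ)| * det2 m n → k ∈ Set.Icc (-N) N := by
    intro k r hr he
    have g1 := bd r
    rw [he] at g1
    have g2 := mul_le_mul_of_nonneg_left hr hR
    have g3 : |(k:ℝ)| ≤ K / det2 m n := by rw [le_div_iff₀ hd]; linarith
    have g4 : |(k:ℝ)| ≤ N := g3.trans (Int.le_ceil _)
    have g5 := abs_le.1 g4
    exact ⟨by exact_mod_cast g5.1, by exact_mod_cast g5.2⟩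
  refine ⟨key i n (by linarith [abs_nonneg m.1, abs_nonneg m.2]) ?_, key j m (by linarith [abs_nonneg n.1, abs_nonneg n.2]) ?_⟩
  · have : det2 q n = i * det2 m n := by
      rw [hq]; unfold Vl det2; simp; ring
    rw [this, abs_mul, abs_of_pos hd]
  · have : det2 q m = -(j * det2 m n) := by
      rw [hq]; unfold Vl det2; simp; ring
    rw [this, abs_neg, abs_mul, abs_of_pos hd]

theorem lattice_bound {p Dl : ℝ} (hp : 1 < p) (hD : CfgBound p Dl) {m1 m3 : ℝ × ℝ} (hd : 0 < det2 m1 m3)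
    (hadm : ∀ i j : ℤ, ¬ (i = 0 ∧ j = 0) → 1 ≤ Fp p (Vl m1 m3 i j)) : Dl ≤ det2 m1 m3 := by
  set S := {ij : ℤ × ℤ | Fp p (Vl m1 m3 ij.1 ij.2) ≤ Fp p (Vl m1 m3 1 0)} ∩ {ij : ℤ × ℤ | ¬ (ij.1 = 0 ∧ ij.2 = 0)} with hS
  have hSf : S.Finite := (Vl_finite hp hd _).inter_of_left _
  have hSn : S.Nonempty := ⟨(1, 0), by simp [hS]⟩
  obtain ⟨⟨i0, j0⟩, hij, hmin⟩ := Set.exists_min_image S (fun ij => Fp p (Vl m1 m3 ij.1 ij.2)) hSf hSn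
  have hmin' : ∀ i j : ℤ, ¬ (i = 0 ∧ j = 0) → Fp p (Vl m1 m3 i0 j0) ≤ Fp p (Vl m1 m3 i j) := by
    intro i j h
    rcases le_total (Fp p (Vl m1 m3 i j)) (Fp p (Vl m1 m3 1 0)) with h1 | h1
    · exact hmin (i, j) ⟨h1, h⟩
    · exact (hij.1).trans h1
  have hg : 0 < Int.gcd i0 j0 := by
    rw [Int.gcd_pos_iff]
    have := hij.2
    simp only [Set.mem_ofPred_eq] at this
    tauto
  obtain ⟨i, j, hgij, hi, hj⟩ := Int.exists_gcd_one hg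
  set g := Int.gcd i0 j0 with hgdef
  have hg1 : (1:ℝ) ≤ g := by exact_mod_cast hg
  have hnz : ¬ (i = 0 ∧ j = 0) := by
    rintro ⟨h1, h2⟩
    rw [h1, h2] at hgij; simp at hgij
  set m := Vl m1 m3 i j with hm
  have hmM : ∀ i' j' : ℤ, ¬ (i' = 0 ∧ j' = 0) → Fp p m ≤ Fp p (Vl m1 m3 i' j') := by
    intro i' j' h
    refine le_trans ?_ (hmin' i' j' h)
    have e : Vl m1 m3 i0 j0 = (g:ℝ) • m := by
      rw [hm]; unfold Vl; rw [hi, hj]; push_cast; module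
    rw [e, Fp_smul (by linarith)]
    have : 1 ≤ (g:ℝ) ^ p := Real.one_le_rpow hg1 (by linarith)
    nlinarith [Fp_nonneg p m]
  have hM := hadm i j hnz
  rw [← hm] at hM
  have hbez := Int.gcd_eq_gcd_ab i j
  rw [hgij] at hbez
  set x := Int.gcdA i j
  set y := Int.gcdB i j
  have hbezR : (1:ℝ) = i * x + j * y := by exact_mod_cast hbez
  set w := Vl m1 m3 (-y) x with hw
  have hdet : det2 m w = det2 m1 m3 := by
    have : det2 m w = (i * x + j * y) * det2 m1 m3 := by
      rw [hm, hw]; unfold Vl det2; simp; ring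
    rw [this, ← hbezR, one_mul]
  set t := (Fp p m) ^ (-(1 / p)) with ht
  have hFpos : 0 < Fp p m := by linarith
  have ht0 : 0 < t := by positivity
  have ht1 : t ≤ 1 := Real.rpow_le_one_of_one_le_of_nonpos hM (by rw [neg_nonpos]; positivity)
  have htp : t ^ p * Fp p m = 1 := by
    rw [ht, ← Real.rpow_mul hFpos.le, show -(1 / p) * p = -1 by field_simp, Real.rpow_neg_one]
    exact inv_mul_cancel₀ hFpos.ne'
  have hFt : Fp p (t • m) = 1 := by rw [Fp_smul ht0.le]; exact htp
  obtain ⟨b, hb1, hb2, hb3⟩ := hasB hp hD (t • m) hFt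
  by_contra hlt
  push Not at hlt
  have hdt : det2 (t • m) (t • w) = t ^ 2 * det2 m1 m3 := by
    rw [← hdet]; unfold det2; simp; ring
  have hts : t ^ 2 ≤ 1 := pow_le_one₀ ht0.le ht1
  obtain ⟨k, hk⟩ := chord hp.le hFt.le hb1 hb2 (w := t • w) (by rw [hdt]; positivity)
    (by rw [hdt, abs_of_pos (by positivity)]; nlinarith)
  have e : t • w - (k:ℝ) • t • m = t • Vl m1 m3 (-y - k * i) (x - k * j) := by
    rw [hw, hm]; unfold Vl; push_cast; module
  rw [e, Fp_smul ht0.le] at hk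
  have h3 := hmM (-y - k * i) (x - k * j) (by
    rintro ⟨h1, h2⟩
    have e1 : y = - (k * i) := by linarith
    have e2 : x = k * j := by linarith
    rw [e1, e2] at hbez
    ring_nf at hbez
    norm_num at hbez)
  have := mul_le_mul_of_nonneg_left h3 (by positivity : 0 ≤ t ^ p)
  linarith

lemma int_tri (d : ℝ) : ∫ x in (0:ℝ)..d, (d - x) = d ^ 2 / 2 := by
  rw [intervalIntegral.integral_sub (by simp) (by simp)]
  simp
  ring

open MeasureTheory in
lemma vol_open {d : ℝ} (hd : 0 ≤ d) : volume {q : ℝ × ℝ | 0 < q.1 ∧ 0 < q.2 ∧ q.1 + q.2 < d} = ENNReal.ofReal (d ^ 2 / 2) := by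
  have e : {q : ℝ × ℝ | 0 < q.1 ∧ 0 < q.2 ∧ q.1 + q.2 < d} = regionBetween (fun _ => (0:ℝ)) (fun x => d - x) (Set.Ioo 0 d) := by
    ext q
    simp only [regionBetween, Set.mem_ofPred_eq, Set.mem_Ioo]
    constructor
    · rintro ⟨h1, h2, h3⟩; exact ⟨⟨h1, by linarith⟩, h2, by linarith⟩
    · rintro ⟨⟨h1, h2⟩, h3, h4⟩; exact ⟨h1, h3, by linarith⟩
  rw [e, Measure.volume_eq_prod, volume_regionBetween_eq_integral]
  · congr 1
    rw [← integral_Ioc_eq_integral_Ioo, ← intervalIntegral.integral_of_le hd]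
    simp only [Pi.sub_apply, sub_zero]
    exact int_tri d
  · exact (integrableOn_const (by simp) (by simp))
  · exact (Continuous.integrableOn_Icc (by fun_prop)).mono_set Set.Ioo_subset_Icc_self
  · exact measurableSet_Ioo
  · intro x hx; simp at *; linarith

open MeasureTheory in
lemma vol_closed {d : ℝ} (hd : 0 ≤ d) : volume {q : ℝ × ℝ | 0 ≤ q.1 ∧ 0 ≤ q.2 ∧ q.1 + q.2 ≤ d} ≤ ENNReal.ofReal (d ^ 2 / 2) := by
  have hm : MeasurableSet {q : ℝ × ℝ | 0 ≤ q.1 ∧ 0 ≤ q.2 ∧ q.1 + q.2 ≤ d} := by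
    apply IsClosed.measurableSet
    exact (isClosed_le continuous_const continuous_fst).inter
      ((isClosed_le continuous_const continuous_snd).inter (isClosed_le (continuous_fst.add continuous_snd) continuous_const))
  rw [Measure.volume_eq_prod, Measure.prod_apply hm]
  calc _ ≤ ∫⁻ x, (Set.Icc 0 d).indicator (fun x => ENNReal.ofReal (d - x)) x := by
        apply lintegral_mono
        intro x
        by_cases hx : x ∈ Set.Icc 0 d
        · rw [Set.indicator_of_mem hx]
          calc _ ≤ volume (Set.Icc 0 (d - x)) := by
                apply measure_mono
                rintro y ⟨-, h2, h3⟩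
                exact ⟨h2, by simp at h3; linarith⟩
            _ = _ := by rw [Real.volume_Icc, sub_zero]
        · have : Prod.mk x ⁻¹' {q : ℝ × ℝ | 0 ≤ q.1 ∧ 0 ≤ q.2 ∧ q.1 + q.2 ≤ d} = ∅ := by
            ext y
            simp only [Set.mem_preimage, Set.mem_ofPred_eq, Set.mem_empty_iff_false, iff_false]
            rintro ⟨h1, h2, h3⟩
            exact hx ⟨h1, by linarith⟩
          show volume (Prod.mk x ⁻¹' {q : ℝ × ℝ | 0 ≤ q.1 ∧ 0 ≤ q.2 ∧ q.1 + q.2 ≤ d}) ≤ _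
          rw [this]; simp
    _ = ∫⁻ x in Set.Icc 0 d, ENNReal.ofReal (d - x) := by rw [lintegral_indicator measurableSet_Icc]
    _ = ENNReal.ofReal (∫ x in Set.Icc 0 d, (d - x)) := by
        rw [ofReal_integral_eq_lintegral_ofReal]
        · exact Continuous.integrableOn_Icc (by fun_prop)
        · refine (ae_restrict_iff' measurableSet_Icc).2 (Filter.Eventually.of_forall ?_)
          intro x hx; simp only [Pi.zero_apply]; linarith [hx.2]
    _ = ENNReal.ofReal (d ^ 2 / 2) := by
        congr 1
        rw [integral_Icc_eq_integral_Ioc, ← intervalIntegral.integral_of_le hd]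
        exact int_tri d
    _ ≤ _ := le_rfl

noncomputable def fT (v w : ℝ × ℝ) : (ℝ × ℝ) →ₗ[ℝ] (ℝ × ℝ) :=
  Matrix.toLin (Module.Basis.finTwoProd ℝ) (Module.Basis.finTwoProd ℝ) !![w.2, -w.1; -v.2, v.1]

lemma fT_apply (v w q : ℝ × ℝ) : fT v w q = (det2 q w, det2 v q) := by
  unfold fT det2
  rw [Matrix.toLin_finTwoProd_apply]
  ext <;> simp <;> ring

lemma fT_det (v w : ℝ × ℝ) : LinearMap.det (fT v w) = det2 v w := by
  unfold fT det2
  rw [LinearMap.det_toLin, Matrix.det_fin_two_of]; ring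

def To (v w : ℝ × ℝ) : Set (ℝ × ℝ) := {q | 0 < det2 q w ∧ 0 < det2 v q ∧ det2 q w + det2 v q < det2 v w}
def Tc (v w : ℝ × ℝ) : Set (ℝ × ℝ) := {q | 0 ≤ det2 q w ∧ 0 ≤ det2 v q ∧ det2 q w + det2 v q ≤ det2 v w}

lemma det2_cont (w : ℝ × ℝ) : Continuous (fun q => det2 q w) := by unfold det2; fun_prop
lemma det2_cont' (w : ℝ × ℝ) : Continuous (fun q => det2 w q) := by unfold det2; fun_prop

lemma To_open (v w : ℝ × ℝ) : IsOpen (To v w) :=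
  (isOpen_lt continuous_const (det2_cont w)).inter ((isOpen_lt continuous_const (det2_cont' v)).inter
    (isOpen_lt ((det2_cont w).add (det2_cont' v)) continuous_const))

open MeasureTheory in
lemma To_vol {v w : ℝ × ℝ} (hd : 0 ≤ det2 v w) : volume (To v w) = ENNReal.ofReal (det2 v w / 2) := by
  rcases eq_or_lt_of_le hd with h | h
  · have : To v w = ∅ := by
      ext q
      simp only [To, Set.mem_ofPred_eq, Set.mem_empty_iff_false, iff_false]
      rintro ⟨h1, h2, h3⟩; linarith
    rw [this, ← h]; simp
  · have e : To v w = fT v w ⁻¹' {q : ℝ × ℝ | 0 < q.1 ∧ 0 < q.2 ∧ q.1 + q.2 < det2 v w} := by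
      ext q; simp only [To, Set.mem_preimage, Set.mem_ofPred_eq, fT_apply]
    rw [e, Measure.addHaar_preimage_linearMap _ (by rw [fT_det]; exact h.ne'), fT_det, vol_open hd, ← ENNReal.ofReal_mul (abs_nonneg _),
      abs_of_pos (by positivity)]
    congr 1
    field_simp

open MeasureTheory in
lemma Tc_vol {v w : ℝ × ℝ} (h : 0 < det2 v w) : volume (Tc v w) ≤ ENNReal.ofReal (det2 v w / 2) := by
  have e : Tc v w = fT v w ⁻¹' {q : ℝ × ℝ | 0 ≤ q.1 ∧ 0 ≤ q.2 ∧ q.1 + q.2 ≤ det2 v w} := by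
    ext q; simp only [Tc, Set.mem_preimage, Set.mem_ofPred_eq, fT_apply]
  rw [e, Measure.addHaar_preimage_linearMap _ (by rw [fT_det]; exact h.ne'), fT_det]
  calc _ ≤ ENNReal.ofReal |(det2 v w)⁻¹| * ENNReal.ofReal (det2 v w ^ 2 / 2) := by gcongr; exact vol_closed h.le
    _ = _ := by
      rw [← ENNReal.ofReal_mul (abs_nonneg _), abs_of_pos (by positivity)]
      congr 1
      field_simp

lemma Tc_sub {K : Set (ℝ × ℝ)} (hK : Convex ℝ K) {v w : ℝ × ℝ} (h0 : (0 : ℝ × ℝ) ∈ K) (hv : v ∈ K) (hw : w ∈ K) (h : 0 < det2 v w) :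
    Tc v w ⊆ K := by
  rintro q ⟨h1, h2, h3⟩
  set d := det2 v w with hd
  have e : q = (det2 q w / d) • v + (det2 v q / d) • w := by
    ext
    · simp only [Prod.fst_add, Prod.smul_fst, smul_eq_mul]
      field_simp
      rw [hd]; unfold det2; ring
    · simp only [Prod.snd_add, Prod.smul_snd, smul_eq_mul]
      field_simp
      rw [hd]; unfold det2; ring
  rw [e]
  set s := det2 q w / d
  set t := det2 v q / d
  have hs : 0 ≤ s := by positivity
  have ht : 0 ≤ t := by positivity
  have hst : s + t ≤ 1 := by
    show det2 q w / d + det2 v q / d ≤ 1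
    rw [← add_div, div_le_one h]; exact h3
  rcases eq_or_lt_of_le (add_nonneg hs ht) with h5 | h5
  · have e1 : s = 0 := by linarith
    have e2 : t = 0 := by linarith
    rw [e1, e2]; simpa using h0
  · have := hK hv hw (show 0 ≤ s / (s + t) by positivity) (show 0 ≤ t / (s + t) by positivity) (by field_simp)
    have h6 := hK h0 this (show 0 ≤ 1 - (s + t) by linarith) h5.le (by ring)
    convert h6 using 1
    rw [smul_zero, zero_add, smul_add, smul_smul, smul_smul]
    congr 2 <;> field_simp

lemma To_sub {K : Set (ℝ × ℝ)} (hK : Convex ℝ K) {v w : ℝ × ℝ} (h0 : (0 : ℝ × ℝ) ∈ K) (hv : v ∈ K) (hw : w ∈ K) :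
    To v w ⊆ K := by
  rintro q ⟨h1, h2, h3⟩
  exact Tc_sub hK h0 hv hw (by linarith) ⟨h1.le, h2.le, h3.le⟩

lemma det2_add_left (a b c : ℝ × ℝ) : det2 (a + b) c = det2 a c + det2 b c := by
  unfold det2; simp; ring
lemma det2_smul_left (t : ℝ) (a c : ℝ × ℝ) : det2 (t • a) c = t * det2 a c := by
  unfold det2; simp; ring
lemma det2_neg_left (a c : ℝ × ℝ) : det2 (-a) c = - det2 a c := by
  unfold det2; simp; ring
lemma det2_neg_right (a c : ℝ × ℝ) : det2 a (-c) = - det2 a c := by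
  unfold det2; simp; ring
lemma det2_swap (a c : ℝ × ℝ) : det2 c a = - det2 a c := by
  unfold det2; ring

def Hs (v1 v2 v3 : ℝ × ℝ) : Set (ℝ × ℝ) := {v1, v2, v3, -v1, -v2, -v3}

lemma strip_convex (w : ℝ × ℝ) (d : ℝ) : Convex ℝ {q : ℝ × ℝ | |det2 q w| ≤ d} := by
  intro x hx y hy a b ha hb hab
  simp only [Set.mem_ofPred_eq] at *
  rw [det2_add_left, det2_smul_left, det2_smul_left]
  rw [abs_le] at *
  constructor <;> nlinarith [mul_le_mul_of_nonneg_left hx.1 ha, mul_le_mul_of_nonneg_left hx.2 ha,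
    mul_le_mul_of_nonneg_left hy.1 hb, mul_le_mul_of_nonneg_left hy.2 hb]

lemma hull_strip {v1 v2 v3 w : ℝ × ℝ} {d : ℝ} (h1 : |det2 v1 w| ≤ d) (h2 : |det2 v2 w| ≤ d) (h3 : |det2 v3 w| ≤ d) :
    ∀ q ∈ convexHull ℝ (Hs v1 v2 v3), |det2 q w| ≤ d := by
  intro q hq
  have : convexHull ℝ (Hs v1 v2 v3) ⊆ {q : ℝ × ℝ | |det2 q w| ≤ d} := by
    apply convexHull_min _ (strip_convex w d)
    intro x hx
    simp only [Hs, Set.mem_insert_iff, Set.mem_singleton_iff] at hx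
    simp only [Set.mem_ofPred_eq]
    rcases hx with h | h | h | h | h | h <;> subst h <;> (try rw [det2_neg_left, abs_neg]) <;> assumption
  exact this hq

open MeasureTheory in
lemma vol_lower {K : Set (ℝ × ℝ)} (hK : Convex ℝ K) (hs : ∀ q ∈ K, -q ∈ K) {v1 v2 v3 : ℝ × ℝ}
    (h1 : v1 ∈ K) (h2 : v2 ∈ K) (h3 : v3 ∈ K) (d12 : 0 ≤ det2 v1 v2) (d23 : 0 ≤ det2 v2 v3) (d13 : 0 < det2 v1 v3) :
    ENNReal.ofReal (det2 v1 v2 + det2 v2 v3 + det2 v1 v3) ≤ volume K := by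
  have h0 : (0 : ℝ × ℝ) ∈ K := by
    have := hK h1 (hs _ h1) (show (0:ℝ) ≤ 1/2 by norm_num) (show (0:ℝ) ≤ 1/2 by norm_num) (by norm_num)
    simpa using this
  have e31 : det2 v3 (-v1) = det2 v1 v3 := by rw [det2_neg_right, ← det2_swap]
  have hA := To_vol d12
  have hB := To_vol d23
  have hC := To_vol (v := v3) (w := -v1) (by rw [e31]; exact d13.le)
  rw [e31] at hC
  set A := To v1 v2
  set B := To v2 v3
  set C := To v3 (-v1)
  have pl : ∀ q : ℝ × ℝ, det2 v1 v2 * det2 q v3 = det2 q v2 * det2 v1 v3 + det2 v1 q * det2 v2 v3 := by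
    intro q; unfold det2; ring
  have pl2 : ∀ q : ℝ × ℝ, det2 v2 v3 * det2 v1 q = det2 q v3 * det2 v1 v2 + det2 v2 q * det2 v1 v3 := by
    intro q; unfold det2; ring
  have mA : ∀ q ∈ A, 0 < det2 v1 q ∧ 0 < det2 q v2 ∧ 0 ≤ det2 q v3 := by
    rintro q ⟨a, b, c⟩
    refine ⟨b, a, ?_⟩
    have := pl q
    by_contra hn
    push Not at hn
    nlinarith [mul_nonneg a.le d13.le, mul_nonneg b.le d23]
  have mB : ∀ q ∈ B, 0 < det2 v1 q ∧ det2 q v2 < 0 ∧ 0 < det2 q v3 := by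
    rintro q ⟨a, b, c⟩
    refine ⟨?_, by rw [det2_swap]; linarith, a⟩
    have := pl2 q
    by_contra hn
    push Not at hn
    nlinarith [mul_nonneg a.le d12, mul_pos b d13]
  have mC : ∀ q ∈ C, 0 < det2 v1 q ∧ det2 q v3 < 0 := by
    rintro q ⟨a, b, c⟩
    rw [det2_neg_right] at a
    rw [det2_swap] at b
    exact ⟨by rw [det2_swap]; exact a, by linarith⟩
  have hAB : Disjoint A B := Set.disjoint_left.2 fun q a b => by linarith [(mA q a).2.1, (mB q b).2.1]
  have hABC : Disjoint (A ∪ B) C := Set.disjoint_left.2 fun q a b => by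
    rcases a with a | a
    · linarith [(mA q a).2.2, (mC q b).2]
    · linarith [(mB q a).2.2, (mC q b).2]
  set P := A ∪ B ∪ C with hP
  have oP : IsOpen P := ((To_open _ _).union (To_open _ _)).union (To_open _ _)
  have vP : volume P = ENNReal.ofReal ((det2 v1 v2 + det2 v2 v3 + det2 v1 v3) / 2) := by
    rw [hP, measure_union hABC (To_open _ _).measurableSet, measure_union hAB (To_open _ _).measurableSet, hA, hB, hC,
      ← ENNReal.ofReal_add (by positivity) (by positivity), ← ENNReal.ofReal_add (by positivity) (by positivity)]
    congr 1; ring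
  have mP : ∀ q ∈ P, 0 < det2 v1 q := by
    rintro q ((h | h) | h)
    exacts [(mA q h).1, (mB q h).1, (mC q h).1]
  have sP : P ⊆ K := Set.union_subset (Set.union_subset (To_sub hK h0 h1 h2) (To_sub hK h0 h2 h3)) (To_sub hK h0 h3 (hs _ h1))
  have hd : Disjoint P (-P) := Set.disjoint_left.2 fun q a b => by
    have := mP q a
    have h' := mP (-q) (Set.mem_neg.1 b)
    rw [det2_neg_right] at h'
    linarith
  have hu : P ∪ -P ⊆ K := by
    apply Set.union_subset sP
    intro q hq
    have := hs _ (sP (Set.mem_neg.1 hq))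
    rwa [neg_neg] at this
  calc ENNReal.ofReal (det2 v1 v2 + det2 v2 v3 + det2 v1 v3) = volume P + volume (-P) := by
        rw [Measure.measure_neg, vP, ← ENNReal.ofReal_add (by positivity) (by positivity)]
        congr 1; ring
    _ = volume (P ∪ -P) := (measure_union hd oP.neg.measurableSet).symm
    _ ≤ _ := measure_mono hu

lemma scale_out {p : ℝ} (hp : 1 < p) {w q : ℝ × ℝ} {d : ℝ} (hd : 0 < d) (h : ∀ q ∈ ballD p, |det2 q w| ≤ d)
    (hq : d ≤ |det2 q w|) : 1 ≤ Fp p q := by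
  by_contra hn
  push Not at hn
  have hF := Fp_nonneg p q
  -- t with t^p * F < 1, t > 1
  set F := Fp p q
  obtain ⟨t, ht1, ht2⟩ : ∃ t : ℝ, 1 < t ∧ t ^ p * F < 1 := by
    refine ⟨(2 / (1 + F)) ^ (1 / p), ?_, ?_⟩
    · apply Real.one_lt_rpow
      · rw [lt_div_iff₀ (by linarith)]; linarith
      · positivity
    · rw [← Real.rpow_mul (by positivity), one_div_mul_cancel (by linarith), Real.rpow_one, div_mul_eq_mul_div, div_lt_one (by linarith)]
      linarith
  have hb : t • q ∈ ballD p := by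
    show Fp p (t • q) < 1
    rw [Fp_smul (by linarith)]; exact ht2
  have := h _ hb
  rw [det2_smul_left, abs_mul, abs_of_pos (by linarith)] at this
  nlinarith

lemma ball_det_zero {p : ℝ} (hp : 1 < p) {w : ℝ × ℝ} (h : ∀ q ∈ ballD p, det2 q w = 0) : w = 0 := by
  have hz : (0:ℝ) ^ p = 0 := Real.zero_rpow (by linarith)
  have hh : (1/2:ℝ) ^ p < 1 := Real.rpow_lt_one (by norm_num) (by norm_num) (by linarith)
  have a := h (1/2, 0) (by
    show |(1/2:ℝ)| ^ p + |(0:ℝ)| ^ p < 1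
    rw [abs_zero, hz, abs_of_pos (by norm_num)]; linarith)
  have b := h (0, 1/2) (by
    show |(0:ℝ)| ^ p + |(1/2:ℝ)| ^ p < 1
    rw [abs_zero, hz, abs_of_pos (by norm_num)]; linarith)
  unfold det2 at a b
  simp at a b
  ext <;> simp [a, b]

lemma hull_symm (v1 v2 v3 : ℝ × ℝ) : ∀ q ∈ convexHull ℝ (Hs v1 v2 v3), -q ∈ convexHull ℝ (Hs v1 v2 v3) := by
  intro q hq
  have : -q ∈ convexHull ℝ (-(Hs v1 v2 v3)) := by
    rw [convexHull_neg]; exact Set.neg_mem_neg.2 hq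
  have e : -(Hs v1 v2 v3) = Hs v1 v2 v3 := by
    ext x
    simp only [Hs, Set.mem_neg, Set.mem_insert_iff, Set.mem_singleton_iff, neg_inj]
    have : ∀ a b : ℝ × ℝ, -a = b ↔ a = -b := fun a b => neg_eq_iff_eq_neg
    simp only [this]
    tauto
  rwa [e] at this

open MeasureTheory in
lemma LBcore {p Dl : ℝ} (hp : 1 < p) (hD : CfgBound p Dl) {v1 v2 v3 : ℝ × ℝ} (h12 : 0 ≤ det2 v1 v2) (h23 : 0 ≤ det2 v2 v3)
    (h1 : det2 v1 v2 ≤ det2 v1 v3) (h2 : det2 v2 v3 ≤ det2 v1 v3) (hb : ballD p ⊆ convexHull ℝ (Hs v1 v2 v3)) :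
    ENNReal.ofReal (4 * Dl) ≤ volume (convexHull ℝ (Hs v1 v2 v3)) := by
  have hK := convex_convexHull ℝ (Hs v1 v2 v3)
  have hs := hull_symm v1 v2 v3
  have k1 : v1 ∈ convexHull ℝ (Hs v1 v2 v3) := subset_convexHull ℝ _ (by simp [Hs])
  have k2 : v2 ∈ convexHull ℝ (Hs v1 v2 v3) := subset_convexHull ℝ _ (by simp [Hs])
  have k3 : v3 ∈ convexHull ℝ (Hs v1 v2 v3) := subset_convexHull ℝ _ (by simp [Hs])
  have strip : ∀ {w : ℝ × ℝ} {d : ℝ}, |det2 v1 w| ≤ d → |det2 v2 w| ≤ d → |det2 v3 w| ≤ d → ∀ q ∈ ballD p, |det2 q w| ≤ d :=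
    fun a b c q hq => hull_strip a b c q (hb hq)
  have self : ∀ v : ℝ × ℝ, det2 v v = 0 := fun v => by unfold det2; ring
  rcases eq_or_lt_of_le (h12.trans h1) with h0 | h0
  · exfalso
    have e12 : det2 v1 v2 = 0 := by linarith
    have e23 : det2 v2 v3 = 0 := by linarith
    have z1 : v1 = 0 := ball_det_zero hp fun q hq => by
      have := strip (w := v1) (d := 0) (by rw [self]; simp) (by rw [det2_swap, e12]; simp) (by rw [det2_swap, ← h0]; simp) q hq
      exact abs_nonpos_iff.1 this
    have z2 : v2 = 0 := ball_det_zero hp fun q hq => by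
      have := strip (w := v2) (d := 0) (by rw [e12]; simp) (by rw [self]; simp) (by rw [det2_swap, e23]; simp) q hq
      exact abs_nonpos_iff.1 this
    have z3 : v3 = 0 := ball_det_zero hp fun q hq => by
      have := strip (w := v3) (d := 0) (by rw [← h0]; simp) (by rw [e23]; simp) (by rw [self]; simp) q hq
      exact abs_nonpos_iff.1 this
    have : ((1:ℝ), (0:ℝ)) = 0 := ball_det_zero hp fun q hq => by
      have := strip (w := ((1:ℝ), (0:ℝ))) (d := 0) (by rw [z1]; simp [det2]) (by rw [z2]; simp [det2]) (by rw [z3]; simp [det2]) q hq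
      exact abs_nonpos_iff.1 this
    simp at this
  have S3 : ∀ q ∈ ballD p, |det2 q (-v1 - v3)| ≤ det2 v1 v3 := by
    apply strip
    · have : det2 v1 (-v1 - v3) = - det2 v1 v3 := by unfold det2; simp; ring
      rw [this, abs_neg, abs_of_pos h0]
    · have : det2 v2 (-v1 - v3) = det2 v1 v2 - det2 v2 v3 := by unfold det2; simp; ring
      rw [this, abs_le]; constructor <;> linarith
    · have : det2 v3 (-v1 - v3) = det2 v1 v3 := by unfold det2; simp; ring
      rw [this, abs_of_pos h0]
  rcases le_or_gt (det2 v1 v2 + det2 v2 v3) (det2 v1 v3) with hc | hc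
  · have S1 : ∀ q ∈ ballD p, |det2 q (v3 - v1)| ≤ det2 v1 v3 := by
      apply strip
      · have : det2 v1 (v3 - v1) = det2 v1 v3 := by unfold det2; simp; ring
        rw [this, abs_of_pos h0]
      · have : det2 v2 (v3 - v1) = det2 v1 v2 + det2 v2 v3 := by unfold det2; simp; ring
        rw [this, abs_of_nonneg (by positivity)]; exact hc
      · have : det2 v3 (v3 - v1) = det2 v1 v3 := by unfold det2; simp; ring
        rw [this, abs_of_pos h0]
    have hv := vol_lower hK hs k1 k3 k3 h0.le (by rw [self]) h0
    rw [self] at hv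
    have hdet : det2 ((1/2:ℝ) • (v1 + v3)) ((1/2:ℝ) • (v3 - v1)) = det2 v1 v3 / 2 := by unfold det2; simp; ring
    have := lattice_bound hp hD (m1 := (1/2:ℝ) • (v1 + v3)) (m3 := (1/2:ℝ) • (v3 - v1)) (by rw [hdet]; linarith) (by
      intro i j hij
      by_cases hi : i = 0
      · have hj : j ≠ 0 := fun h => hij ⟨hi, h⟩
        apply scale_out hp h0 S3
        have : det2 (Vl ((1/2:ℝ) • (v1 + v3)) ((1/2:ℝ) • (v3 - v1)) i j) (-v1 - v3) = j * det2 v1 v3 := by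
          unfold Vl det2; simp; ring
        rw [this, abs_mul, abs_of_pos h0]
        have : (1:ℝ) ≤ |(j:ℝ)| := by exact_mod_cast Int.one_le_abs hj
        nlinarith
      · apply scale_out hp h0 S1
        have : det2 (Vl ((1/2:ℝ) • (v1 + v3)) ((1/2:ℝ) • (v3 - v1)) i j) (v3 - v1) = i * det2 v1 v3 := by
          unfold Vl det2; simp; ring
        rw [this, abs_mul, abs_of_pos h0]
        have : (1:ℝ) ≤ |(i:ℝ)| := by exact_mod_cast Int.one_le_abs hi
        nlinarith)
    rw [hdet] at this
    exact (ENNReal.ofReal_le_ofReal (by linarith)).trans hv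
  · have p12 : 0 < det2 v1 v2 := by linarith
    have p23 : 0 < det2 v2 v3 := by linarith
    have S1 : ∀ q ∈ ballD p, |det2 q (v2 - v1)| ≤ det2 v1 v2 := by
      apply strip
      · have : det2 v1 (v2 - v1) = det2 v1 v2 := by unfold det2; simp; ring
        rw [this, abs_of_pos p12]
      · have : det2 v2 (v2 - v1) = det2 v1 v2 := by unfold det2; simp; ring
        rw [this, abs_of_pos p12]
      · have : det2 v3 (v2 - v1) = det2 v1 v3 - det2 v2 v3 := by unfold det2; simp; ring
        rw [this, abs_le]; constructor <;> linarith
    have S2 : ∀ q ∈ ballD p, |det2 q (v3 - v2)| ≤ det2 v2 v3 := by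
      apply strip
      · have : det2 v1 (v3 - v2) = det2 v1 v3 - det2 v1 v2 := by unfold det2; simp; ring
        rw [this, abs_le]; constructor <;> linarith
      · have : det2 v2 (v3 - v2) = det2 v2 v3 := by unfold det2; simp; ring
        rw [this, abs_of_pos p23]
      · have : det2 v3 (v3 - v2) = det2 v2 v3 := by unfold det2; simp; ring
        rw [this, abs_of_pos p23]
    have hv := vol_lower hK hs k1 k2 k3 h12 h23 h0
    have hdet : det2 ((1/2:ℝ) • (v1 + v2)) ((1/2:ℝ) • (v3 - v1)) = (det2 v1 v2 + det2 v2 v3 + det2 v1 v3) / 4 := by unfold det2; simp; ring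
    have E1 : ∀ i j : ℤ, det2 (Vl ((1/2:ℝ) • (v1 + v2)) ((1/2:ℝ) • (v3 - v1)) i j) (v2 - v1) =
        i * det2 v1 v2 + j * ((det2 v1 v3 - det2 v2 v3 - det2 v1 v2) / 2) := by
      intro i j; unfold Vl det2; simp; ring
    have E2 : ∀ i j : ℤ, det2 (Vl ((1/2:ℝ) • (v1 + v2)) ((1/2:ℝ) • (v3 - v1)) i j) (v3 - v2) =
        i * ((det2 v1 v3 - det2 v1 v2 + det2 v2 v3) / 2) + j * ((det2 v2 v3 - det2 v1 v3 + det2 v1 v2) / 2) := by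
      intro i j; unfold Vl det2; simp; ring
    have E3 : ∀ i j : ℤ, det2 (Vl ((1/2:ℝ) • (v1 + v2)) ((1/2:ℝ) • (v3 - v1)) i j) (-v1 - v3) =
        i * ((det2 v1 v2 - det2 v2 v3 - det2 v1 v3) / 2) + j * det2 v1 v3 := by
      intro i j; unfold Vl det2; simp; ring
    set a := det2 v1 v2
    set b := det2 v2 v3
    set c := det2 v1 v3
    have key : ∀ i j : ℤ, ¬ (i = 0 ∧ j = 0) → (0 < i ∨ (i = 0 ∧ 0 < j)) →
        1 ≤ Fp p (Vl ((1/2:ℝ) • (v1 + v2)) ((1/2:ℝ) • (v3 - v1)) i j) := by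
      intro i j _ hij
      rcases hij with hi | ⟨hi, hj⟩
      · have hi' : (1:ℝ) ≤ (i:ℝ) := by exact_mod_cast hi
        rcases le_or_gt j 0 with hj | hj
        · have hj' : (j:ℝ) ≤ 0 := by exact_mod_cast hj
          apply scale_out hp p12 S1
          rw [E1]
          refine le_trans ?_ (le_abs_self _)
          nlinarith [mul_nonneg (neg_nonneg.2 hj') (show 0 ≤ a + b - c by linarith)]
        · have hj' : (1:ℝ) ≤ (j:ℝ) := by exact_mod_cast hj
          apply scale_out hp p23 S2
          rw [E2]
          refine le_trans ?_ (le_abs_self _)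
          nlinarith [mul_nonneg (sub_nonneg.2 hi') (show 0 ≤ c - a + b by linarith), mul_nonneg (sub_nonneg.2 hj') (show 0 ≤ b - c + a by linarith)]
      · have hj' : (1:ℝ) ≤ (j:ℝ) := by exact_mod_cast hj
        apply scale_out hp h0 S3
        rw [E3, hi]
        refine le_trans ?_ (le_abs_self _)
        push_cast
        nlinarith
    have key2 : ∀ i j : ℤ, i < 0 → 0 < j → 1 ≤ Fp p (Vl ((1/2:ℝ) • (v1 + v2)) ((1/2:ℝ) • (v3 - v1)) i j) := by
      intro i j hi hj
      have hi' : (i:ℝ) ≤ 0 := by exact_mod_cast hi.le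
      have hj' : (1:ℝ) ≤ (j:ℝ) := by exact_mod_cast hj
      apply scale_out hp h0 S3
      rw [E3]
      refine le_trans ?_ (le_abs_self _)
      nlinarith [mul_nonneg (neg_nonneg.2 hi') (show 0 ≤ b + c - a by linarith)]
    have := lattice_bound hp hD (m1 := (1/2:ℝ) • (v1 + v2)) (m3 := (1/2:ℝ) • (v3 - v1)) (by rw [hdet]; linarith) (by
      intro i j hij
      have hneg : Fp p (Vl ((1/2:ℝ) • (v1 + v2)) ((1/2:ℝ) • (v3 - v1)) i j) = Fp p (Vl ((1/2:ℝ) • (v1 + v2)) ((1/2:ℝ) • (v3 - v1)) (-i) (-j)) := by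
        rw [← Fp_neg]; congr 1
        unfold Vl; push_cast
        rw [neg_smul, neg_smul, neg_add]
      rcases lt_trichotomy i 0 with hi | hi | hi
      · rw [hneg]; exact key _ _ (by omega) (by omega)
      · rcases lt_trichotomy j 0 with hj | hj | hj
        · rw [hneg]; exact key _ _ (by omega) (by omega)
        · exact absurd ⟨hi, hj⟩ hij
        · exact key _ _ hij (by omega)
      · exact key _ _ hij (by omega))
    rw [hdet] at this
    exact (ENNReal.ofReal_le_ofReal (by linarith)).trans hv

lemma Hs_cyc (v1 v2 v3 : ℝ × ℝ) : Hs v2 v3 (-v1) = Hs v1 v2 v3 := by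
  ext x; simp only [Hs, Set.mem_insert_iff, Set.mem_singleton_iff, neg_neg]; tauto

lemma Hs_n2 (v1 v2 v3 : ℝ × ℝ) : Hs v1 (-v2) v3 = Hs v1 v2 v3 := by
  ext x; simp only [Hs, Set.mem_insert_iff, Set.mem_singleton_iff, neg_neg]; tauto

lemma Hs_n3 (v1 v2 v3 : ℝ × ℝ) : Hs v1 v2 (-v3) = Hs v1 v2 v3 := by
  ext x; simp only [Hs, Set.mem_insert_iff, Set.mem_singleton_iff, neg_neg]; tauto

lemma Hs_s (v1 v2 v3 : ℝ × ℝ) : Hs v1 v3 v2 = Hs v1 v2 v3 := by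
  ext x; simp only [Hs, Set.mem_insert_iff, Set.mem_singleton_iff]; tauto

open MeasureTheory in
lemma LBcyc {p Dl : ℝ} (hp : 1 < p) (hD : CfgBound p Dl) {v1 v2 v3 : ℝ × ℝ} (h12 : 0 ≤ det2 v1 v2) (h23 : 0 ≤ det2 v2 v3)
    (h13 : 0 ≤ det2 v1 v3) (hb : ballD p ⊆ convexHull ℝ (Hs v1 v2 v3)) :
    ENNReal.ofReal (4 * Dl) ≤ volume (convexHull ℝ (Hs v1 v2 v3)) := by
  have e1 : ∀ v w : ℝ × ℝ, det2 v (-w) = det2 w v := fun v w => by unfold det2; simp; ring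
  have e2 : ∀ v w : ℝ × ℝ, det2 (-v) (-w) = det2 v w := fun v w => by unfold det2; simp
  rcases le_total (det2 v1 v2) (det2 v1 v3) with a | a
  · rcases le_total (det2 v2 v3) (det2 v1 v3) with b | b
    · exact LBcore hp hD h12 h23 a b hb
    · -- d23 max : (v3, -v1, -v2)
      have := LBcore hp hD (v1 := v3) (v2 := -v1) (v3 := -v2) (by rwa [e1]) (by rwa [e2]) (by rwa [e1, e1])
        (by rw [e2, e1]; linarith) (by rwa [Hs_cyc v2 v3 (-v1), Hs_cyc])
      rwa [Hs_cyc v2 v3 (-v1), Hs_cyc] at this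
  · rcases le_total (det2 v1 v2) (det2 v2 v3) with b | b
    · have := LBcore hp hD (v1 := v3) (v2 := -v1) (v3 := -v2) (by rwa [e1]) (by rwa [e2]) (by rw [e1, e1]; linarith)
        (by rw [e2, e1]; linarith) (by rwa [Hs_cyc v2 v3 (-v1), Hs_cyc])
      rwa [Hs_cyc v2 v3 (-v1), Hs_cyc] at this
    · have := LBcore hp hD (v1 := v2) (v2 := v3) (v3 := -v1) h23 (by rwa [e1]) (by rwa [e1])
        (by rw [e1, e1]; linarith) (by rwa [Hs_cyc])
      rwa [Hs_cyc] at this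

open MeasureTheory in
theorem LB {p Dl : ℝ} (hp : 1 < p) (hD : CfgBound p Dl) (v1 v2 v3 : ℝ × ℝ)
    (hb : ballD p ⊆ convexHull ℝ (Hs v1 v2 v3)) :
    ENNReal.ofReal (4 * Dl) ≤ volume (convexHull ℝ (Hs v1 v2 v3)) := by
  have main : ∀ v1 v2 v3 : ℝ × ℝ, 0 ≤ det2 v1 v3 → ballD p ⊆ convexHull ℝ (Hs v1 v2 v3) →
      ENNReal.ofReal (4 * Dl) ≤ volume (convexHull ℝ (Hs v1 v2 v3)) := by
    intro v1 v2 v3 h13 hb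
    rcases le_total 0 (det2 v1 v2) with a | a <;> rcases le_total 0 (det2 v2 v3) with b | b
    · exact LBcyc hp hD a b h13 hb
    · have := LBcyc hp hD (v1 := v1) (v2 := v3) (v3 := v2) h13 (by rw [det2_swap]; linarith) a (by rwa [Hs_s])
      rwa [Hs_s] at this
    · have := LBcyc hp hD (v1 := v1) (v2 := v3) (v3 := -v2) h13 (by rw [det2_neg_right, ← det2_swap]; exact b)
        (by rw [det2_neg_right]; linarith) (by rwa [Hs_n3, Hs_s])
      rwa [Hs_n3, Hs_s] at this
    · have := LBcyc hp hD (v1 := v1) (v2 := -v2) (v3 := v3) (by rw [det2_neg_right]; linarith)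
        (by rw [det2_neg_left]; linarith) h13 (by rwa [Hs_n2])
      rwa [Hs_n2] at this
  rcases le_total 0 (det2 v1 v3) with h | h
  · exact main _ _ _ h hb
  · have := main v1 v2 (-v3) (by rw [det2_neg_right]; linarith) (by rwa [Hs_n3])
    rwa [Hs_n3] at this

open MeasureTheory in
lemma HexUB {p : ℝ} {v1 v2 v3 : ℝ × ℝ} (p12 : 0 < det2 v1 v2) (p23 : 0 < det2 v2 v3) (p13 : 0 < det2 v1 v3)
    (t1 : det2 v1 v2 ≤ det2 v2 v3 + det2 v1 v3) (t2 : det2 v2 v3 ≤ det2 v1 v2 + det2 v1 v3) (t3 : det2 v1 v3 ≤ det2 v1 v2 + det2 v2 v3)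
    (S1 : ∀ q ∈ ballD p, |det2 q (v2 - v1)| ≤ det2 v1 v2) (S2 : ∀ q ∈ ballD p, |det2 q (v3 - v2)| ≤ det2 v2 v3)
    (S3 : ∀ q ∈ ballD p, |det2 q (-v1 - v3)| ≤ det2 v1 v3) :
    ballD p ⊆ convexHull ℝ (Hs v1 v2 v3) ∧
      volume (convexHull ℝ (Hs v1 v2 v3)) ≤ ENNReal.ofReal (det2 v1 v2 + det2 v2 v3 + det2 v1 v3) := by
  have hK := convex_convexHull ℝ (Hs v1 v2 v3)
  have hs := hull_symm v1 v2 v3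
  have k1 : v1 ∈ convexHull ℝ (Hs v1 v2 v3) := subset_convexHull ℝ _ (by simp [Hs])
  have k2 : v2 ∈ convexHull ℝ (Hs v1 v2 v3) := subset_convexHull ℝ _ (by simp [Hs])
  have k3 : v3 ∈ convexHull ℝ (Hs v1 v2 v3) := subset_convexHull ℝ _ (by simp [Hs])
  have h0 : (0 : ℝ × ℝ) ∈ convexHull ℝ (Hs v1 v2 v3) := by
    have := hK k1 (hs _ k1) (show (0:ℝ) ≤ 1/2 by norm_num) (show (0:ℝ) ≤ 1/2 by norm_num) (by norm_num)
    simpa using this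
  have e31 : det2 v3 (-v1) = det2 v1 v3 := by rw [det2_neg_right, ← det2_swap]
  set P := Tc v1 v2 ∪ Tc v2 v3 ∪ Tc v3 (-v1) with hP
  have sP : P ⊆ convexHull ℝ (Hs v1 v2 v3) := Set.union_subset (Set.union_subset (Tc_sub hK h0 k1 k2 p12) (Tc_sub hK h0 k2 k3 p23))
    (Tc_sub hK h0 k3 (hs _ k1) (by rw [e31]; exact p13))
  have half : ∀ q, 0 ≤ det2 v1 q → |det2 q (v2 - v1)| ≤ det2 v1 v2 → |det2 q (v3 - v2)| ≤ det2 v2 v3 →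
      |det2 q (-v1 - v3)| ≤ det2 v1 v3 → q ∈ P := by
    intro q hq a1 a2 a3
    have l1 : det2 q (v2 - v1) = det2 q v2 + det2 v1 q := by unfold det2; simp; ring
    have l2 : det2 q (v3 - v2) = det2 q v3 + det2 v2 q := by unfold det2; simp; ring
    have l3 : det2 q (-v1 - v3) = det2 q (-v1) + det2 v3 q := by unfold det2; simp; ring
    have b1 := (le_abs_self _).trans a1
    have b2 := (le_abs_self _).trans a2
    have b3 := (le_abs_self _).trans a3
    rcases le_or_gt 0 (det2 q v2) with c | c
    · exact Or.inl (Or.inl ⟨c, hq, by linarith⟩)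
    · rcases le_or_gt 0 (det2 q v3) with c' | c'
      · exact Or.inl (Or.inr ⟨c', by rw [det2_swap]; linarith, by linarith⟩)
      · refine Or.inr ⟨by rw [det2_neg_right, ← det2_swap]; exact hq, by rw [det2_swap]; linarith, ?_⟩
        rw [e31]; linarith
  have full : ∀ q, |det2 q (v2 - v1)| ≤ det2 v1 v2 → |det2 q (v3 - v2)| ≤ det2 v2 v3 →
      |det2 q (-v1 - v3)| ≤ det2 v1 v3 → q ∈ P ∪ -P := by
    intro q a1 a2 a3
    rcases le_total 0 (det2 v1 q) with h | h
    · exact Or.inl (half q h a1 a2 a3)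
    · refine Or.inr (half (-q) (by rw [det2_neg_right]; linarith) ?_ ?_ ?_) <;> rwa [det2_neg_left, abs_neg]
  have sPP : P ∪ -P ⊆ convexHull ℝ (Hs v1 v2 v3) := by
    apply Set.union_subset sP
    intro q hq
    have := hs _ (sP (Set.mem_neg.1 hq))
    rwa [neg_neg] at this
  refine ⟨fun q hq => sPP (full q (S1 q hq) (S2 q hq) (S3 q hq)), ?_⟩
  have hsub : convexHull ℝ (Hs v1 v2 v3) ⊆ P ∪ -P := by
    intro q hq
    refine full q (hull_strip ?_ ?_ ?_ q hq) (hull_strip ?_ ?_ ?_ q hq) (hull_strip ?_ ?_ ?_ q hq)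
    · have : det2 v1 (v2 - v1) = det2 v1 v2 := by unfold det2; simp; ring
      rw [this, abs_of_pos p12]
    · have : det2 v2 (v2 - v1) = det2 v1 v2 := by unfold det2; simp; ring
      rw [this, abs_of_pos p12]
    · have : det2 v3 (v2 - v1) = det2 v1 v3 - det2 v2 v3 := by unfold det2; simp; ring
      rw [this, abs_le]; constructor <;> linarith
    · have : det2 v1 (v3 - v2) = det2 v1 v3 - det2 v1 v2 := by unfold det2; simp; ring
      rw [this, abs_le]; constructor <;> linarith
    · have : det2 v2 (v3 - v2) = det2 v2 v3 := by unfold det2; simp; ring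
      rw [this, abs_of_pos p23]
    · have : det2 v3 (v3 - v2) = det2 v2 v3 := by unfold det2; simp; ring
      rw [this, abs_of_pos p23]
    · have : det2 v1 (-v1 - v3) = - det2 v1 v3 := by unfold det2; simp; ring
      rw [this, abs_neg, abs_of_pos p13]
    · have : det2 v2 (-v1 - v3) = det2 v1 v2 - det2 v2 v3 := by unfold det2; simp; ring
      rw [this, abs_le]; constructor <;> linarith
    · have : det2 v3 (-v1 - v3) = det2 v1 v3 := by unfold det2; simp; ring
      rw [this, abs_of_pos p13]
  have vP : volume P ≤ ENNReal.ofReal ((det2 v1 v2 + det2 v2 v3 + det2 v1 v3) / 2) := by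
    calc volume P ≤ volume (Tc v1 v2 ∪ Tc v2 v3) + volume (Tc v3 (-v1)) := measure_union_le _ _
      _ ≤ (volume (Tc v1 v2) + volume (Tc v2 v3)) + volume (Tc v3 (-v1)) := by gcongr; exact measure_union_le _ _
      _ ≤ (ENNReal.ofReal (det2 v1 v2 / 2) + ENNReal.ofReal (det2 v2 v3 / 2)) + ENNReal.ofReal (det2 v1 v3 / 2) := by
        gcongr
        · exact Tc_vol p12
        · exact Tc_vol p23
        · have := Tc_vol (v := v3) (w := -v1) (by rw [e31]; exact p13)
          rwa [e31] at this
      _ = _ := by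
        rw [← ENNReal.ofReal_add (by positivity) (by positivity), ← ENNReal.ofReal_add (by positivity) (by positivity)]
        congr 1; ring
  calc volume (convexHull ℝ (Hs v1 v2 v3)) ≤ volume (P ∪ -P) := measure_mono hsub
    _ ≤ volume P + volume (-P) := measure_union_le _ _
    _ = volume P + volume P := by rw [Measure.measure_neg]
    _ ≤ ENNReal.ofReal ((det2 v1 v2 + det2 v2 v3 + det2 v1 v3) / 2) + ENNReal.ofReal ((det2 v1 v2 + det2 v2 v3 + det2 v1 v3) / 2) := by gcongr
    _ = _ := by
      rw [← ENNReal.ofReal_add (by positivity) (by positivity)]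
      congr 1; ring

lemma rpow_tangent0 {x y n : ℝ} (hx : 0 < x) (hy : 0 ≤ y) (hn : 1 ≤ n) : x ^ n + n * x ^ (n - 1) * (y - x) ≤ y ^ n := by
  rcases eq_or_lt_of_le hy with h | h
  · rw [← h, Real.zero_rpow (by linarith)]
    have e := rpow_pred (p := n) hx
    have : 0 < x ^ (n - 1) := by positivity
    rw [e]
    nlinarith [mul_nonneg (mul_pos hx this).le (sub_nonneg.2 hn)]
  · exact rpow_tangent hx h hn

lemma tan_line {p x y : ℝ} (hp : 1 < p) (hx : 0 < x) (hy : 0 < y) (h : x ^ p + y ^ p = 1) {q : ℝ × ℝ} (hq : q ∈ ballD p) :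
    x ^ (p - 1) * |q.1| + y ^ (p - 1) * |q.2| ≤ 1 := by
  have hq' : |q.1| ^ p + |q.2| ^ p < 1 := hq
  have a := rpow_tangent0 hx (abs_nonneg q.1) hp.le
  have b := rpow_tangent0 hy (abs_nonneg q.2) hp.le
  have ex := rpow_pred (p := p) hx
  have ey := rpow_pred (p := p) hy
  have : p * (x ^ (p - 1) * |q.1| + y ^ (p - 1) * |q.2| - 1) ≤ 0 := by
    have : p * (x ^ (p - 1) * |q.1| + y ^ (p - 1) * |q.2| - 1) =
      p * x ^ (p - 1) * (|q.1| - x) + p * y ^ (p - 1) * (|q.2| - y) + p * (x * x ^ (p-1) + y * y ^ (p-1) - 1) := by ring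
    rw [this, ← ex, ← ey, h]; linarith
  nlinarith

/-- slope form of `tan_line` -/
lemma tan_line' {p x y : ℝ} (hp : 1 < p) (hx : 0 < x) (hy : 0 < y) (h : x ^ p + y ^ p = 1) {q : ℝ × ℝ} (hq : q ∈ ballD p) :
    (x / y) ^ (p - 1) * |q.1| + |q.2| ≤ (x / y) ^ (p - 1) * x + y := by
  have a := tan_line hp hx hy h hq
  have ex := rpow_pred (p := p) hx
  have ey := rpow_pred (p := p) hy
  rw [Real.div_rpow hx.le hy.le]
  have hY : 0 < y ^ (p - 1) := by positivity
  rw [← sub_nonneg]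
  have : x ^ (p - 1) / y ^ (p - 1) * x + y - (x ^ (p - 1) / y ^ (p - 1) * |q.1| + |q.2|) =
    (x * x ^ (p-1) + y * y ^ (p-1) - (x ^ (p - 1) * |q.1| + y ^ (p - 1) * |q.2|)) / y ^ (p - 1) := by
    field_simp
  rw [this, ← ex, ← ey, h]
  apply div_nonneg _ hY.le; linarith

lemma ball_swap {p : ℝ} {q : ℝ × ℝ} (hq : q ∈ ballD p) : (q.2, q.1) ∈ ballD p := by
  have hq' : |q.1| ^ p + |q.2| ^ p < 1 := hq
  show |q.2| ^ p + |q.1| ^ p < 1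
  linarith

lemma abs_combo {m x y : ℝ} (hm : 0 ≤ m) : |m * x + y| ≤ m * |x| + |y| := by
  have := abs_add_le (m * x) y
  rwa [abs_mul, abs_of_nonneg hm] at this

lemma ball_fst {p : ℝ} (hp : 1 < p) {q : ℝ × ℝ} (hq : q ∈ ballD p) : |q.1| ≤ 1 := by
  have hq' : |q.1| ^ p + |q.2| ^ p < 1 := hq
  by_contra hn
  push Not at hn
  have := Real.one_lt_rpow hn (by linarith : 0 < p)
  have h2 : 0 ≤ |q.2| ^ p := by positivity
  linarith

open MeasureTheory in
theorem UB0 {p : ℝ} (hp : 1 < p) : ∃ v1 v2 v3 : ℝ × ℝ, ballD p ⊆ convexHull ℝ (Hs v1 v2 v3) ∧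
    volume (convexHull ℝ (Hs v1 v2 v3)) ≤ ENNReal.ofReal (2 * ((2 : ℝ) ^ p - 1) ^ (1 / p)) := by
  set Y := ((2 : ℝ) ^ p - 1) ^ (1 / p) / 2 with hY
  have h2 : (2:ℝ) < 2 ^ p := by
    have := Real.rpow_lt_rpow_of_exponent_lt (show (1:ℝ) < 2 by norm_num) hp
    rwa [Real.rpow_one] at this
  have hY0 : 0 < Y := by
    have : 0 < ((2 : ℝ) ^ p - 1) ^ (1 / p) := Real.rpow_pos_of_pos (by linarith) _
    linarith
  have hYh : 1 / 2 < Y := by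
    have : 1 < ((2 : ℝ) ^ p - 1) ^ (1 / p) := Real.one_lt_rpow (by linarith) (by positivity)
    linarith
  have hc : (1/2:ℝ) ^ p + Y ^ p = 1 := by
    rw [hY, Real.div_rpow (Real.rpow_nonneg (by linarith) _) (by norm_num), ← Real.rpow_mul (by linarith),
      one_div_mul_cancel (by linarith), Real.rpow_one, Real.div_rpow (by norm_num) (by norm_num), Real.one_rpow]
    field_simp; ring
  set m := ((1/2) / Y) ^ (p - 1) with hm
  have hm0 : 0 < m := by positivity
  have hm1 : m < 1 := Real.rpow_lt_one (by positivity) (by rw [div_lt_one hY0]; exact hYh) (by linarith)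
  have hT : ∀ q ∈ ballD p, m * |q.1| + |q.2| ≤ m * (1/2) + Y := fun q hq => tan_line' hp (by norm_num) hY0 hc hq
  have f12 : det2 ((1:ℝ), -(Y - m/2)) ((1:ℝ), Y - m/2) = 2 * (Y - m / 2) := by simp [det2]; ring
  have f23 : det2 ((1:ℝ), Y - m/2) ((0:ℝ), Y + m/2) = Y + m / 2 := by simp [det2]
  have f13 : det2 ((1:ℝ), -(Y - m/2)) ((0:ℝ), Y + m/2) = Y + m / 2 := by simp [det2]
  have := HexUB (p := p) (v1 := ((1:ℝ), -(Y - m/2))) (v2 := ((1:ℝ), Y - m/2)) (v3 := ((0:ℝ), Y + m/2))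
    (by rw [f12]; linarith) (by rw [f23]; linarith) (by rw [f13]; linarith)
    (by rw [f12, f23, f13]; linarith) (by rw [f12, f23, f13]; linarith) (by rw [f12, f23, f13]; linarith)
    (by
      intro q hq
      have e : det2 q (((1:ℝ), Y - m/2) - ((1:ℝ), -(Y - m/2))) = 2 * (Y - m / 2) * q.1 := by simp [det2]; ring
      rw [f12, e, abs_mul, abs_of_pos (by linarith)]
      nlinarith [ball_fst hp hq])
    (by
      intro q hq
      have e : det2 q (((0:ℝ), Y + m/2) - ((1:ℝ), Y - m/2)) = m * q.1 + q.2 := by simp [det2]; ring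
      rw [f23, e]
      have := hT q hq
      have := abs_combo (x := q.1) (y := q.2) hm0.le
      linarith)
    (by
      intro q hq
      have e : det2 q (-((1:ℝ), -(Y - m/2)) - ((0:ℝ), Y + m/2)) = m * (-q.1) + q.2 := by simp [det2]; ring
      rw [f13, e]
      have := hT q hq
      have := abs_combo (x := -q.1) (y := q.2) hm0.le
      rw [abs_neg] at this
      linarith)
  refine ⟨_, _, _, this.1, this.2.trans (le_of_eq ?_)⟩
  rw [f12, f23, f13]
  congr 1
  rw [hY]; ring

open MeasureTheory in
set_option maxHeartbeats 1000000 in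
theorem UB1 {p s : ℝ} (hp : 1 < p) (hs : 0 < s) (hst : (1 + s) ^ p + s ^ p = 2) :
    ∃ v1 v2 v3 : ℝ × ℝ, ballD p ⊆ convexHull ℝ (Hs v1 v2 v3) ∧
    volume (convexHull ℝ (Hs v1 v2 v3)) ≤ ENNReal.ofReal (4 * ((1 + 2 * s) * (4:ℝ) ^ (-1 / p))) := by
  set X := (1/2:ℝ) ^ (1 / p) with hX
  have hX0 : 0 < X := by positivity
  have hXp : X ^ p = 1 / 2 := by
    rw [hX, ← Real.rpow_mul (by norm_num), one_div_mul_cancel (by linarith), Real.rpow_one]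
  have hXX : X * X = (4:ℝ) ^ (-1 / p) := by
    rw [hX, ← Real.mul_rpow (by norm_num) (by norm_num), neg_div, Real.rpow_neg (by norm_num), ← Real.inv_rpow (by norm_num)]
    norm_num
  have c1 : (X * s) ^ p + (X * (1 + s)) ^ p = 1 := by
    rw [Real.mul_rpow hX0.le hs.le, Real.mul_rpow hX0.le (by linarith), hXp]; linarith
  have c2 : X ^ p + X ^ p = 1 := by rw [hXp]; norm_num
  set μ := ((X * s) / (X * (1 + s))) ^ (p - 1) with hμ
  have hμ0 : 0 < μ := by positivity
  have hμ1 : μ < 1 := Real.rpow_lt_one (by positivity) (by rw [div_lt_one (by positivity)]; nlinarith) (by linarith)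
  have T1 : ∀ q ∈ ballD p, μ * |q.1| + |q.2| ≤ μ * (X * s) + X * (1 + s) := fun q hq => tan_line' hp (by positivity) (by positivity) c1 hq
  have T2 : ∀ q ∈ ballD p, μ * |q.2| + |q.1| ≤ μ * (X * s) + X * (1 + s) := fun q hq => T1 _ (ball_swap hq)
  have T3 : ∀ q ∈ ballD p, |q.1| + |q.2| ≤ 2 * X := fun q hq => by
    have := tan_line' hp hX0 hX0 c2 hq
    rw [div_self hX0.ne', Real.one_rpow] at this
    linarith
  set e := μ * (X * s) + X * (1 + s) with he
  have heX : X < e := by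
    have : 0 < μ * (X * s) := by positivity
    have : 0 < X * s := by positivity
    rw [he]; linarith
  obtain ⟨k, hk0, hk⟩ : ∃ k : ℝ, 0 < k ∧ k * (1 + μ) = 1 := ⟨1 / (1 + μ), by positivity, by field_simp⟩
  have f12 : det2 (k * (e + 2 * X * μ), k * (e - 2 * X)) (k * e, k * e) = 2 * X * e * k := by
    simp [det2]; linear_combination (2 * X * e * k) * hk
  have f23 : det2 (k * e, k * e) (k * (e - 2 * X), k * (e + 2 * X * μ)) = 2 * X * e * k := by
    simp [det2]; linear_combination (2 * X * e * k) * hk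
  have f13 : det2 (k * (e + 2 * X * μ), k * (e - 2 * X)) (k * (e - 2 * X), k * (e + 2 * X * μ)) = 4 * X * k * (e - X * (1 - μ)) := by
    simp [det2]; linear_combination (4 * X * k * (e - X * (1 - μ))) * hk
  have hXk : 0 < X * k := by positivity
  have hg : 0 < e - X * (1 - μ) := by nlinarith
  have hg1 : e - X * (1 - μ) ≤ e := by nlinarith
  have q12 : 0 < 2 * X * e * k := by have : 0 < e := by linarith
                                     positivity
  have q13 : 0 < 4 * X * k * (e - X * (1 - μ)) := by positivity
  have := HexUB (p := p) (v1 := (k * (e + 2 * X * μ), k * (e - 2 * X))) (v2 := (k * e, k * e)) (v3 := (k * (e - 2 * X), k * (e + 2 * X * μ)))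
    (by rwa [f12]) (by rwa [f23]) (by rwa [f13])
    (by rw [f12, f23, f13]; linarith) (by rw [f12, f23, f13]; linarith)
    (by rw [f12, f23, f13]; nlinarith [mul_le_mul_of_nonneg_left hg1 hXk.le])
    (by
      intro q hq
      have e1 : det2 q ((k * e, k * e) - (k * (e + 2 * X * μ), k * (e - 2 * X))) = 2 * X * k * (μ * q.2 + q.1) := by simp [det2]; ring
      rw [f12, e1, abs_mul, abs_of_pos (by positivity)]
      have := T2 q hq
      have := abs_combo (x := q.2) (y := q.1) hμ0.le
      have h3 : |μ * q.2 + q.1| ≤ e := by linarith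
      nlinarith [mul_le_mul_of_nonneg_left h3 hXk.le])
    (by
      intro q hq
      have e1 : det2 q ((k * (e - 2 * X), k * (e + 2 * X * μ)) - (k * e, k * e)) = 2 * X * k * (μ * q.1 + q.2) := by simp [det2]; ring
      rw [f23, e1, abs_mul, abs_of_pos (by positivity)]
      have := T1 q hq
      have := abs_combo (x := q.1) (y := q.2) hμ0.le
      have h3 : |μ * q.1 + q.2| ≤ e := by linarith
      nlinarith [mul_le_mul_of_nonneg_left h3 hXk.le])
    (by
      intro q hq
      have e1 : det2 q (-(k * (e + 2 * X * μ), k * (e - 2 * X)) - (k * (e - 2 * X), k * (e + 2 * X * μ))) =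
          2 * k * (e - X * (1 - μ)) * (q.2 - q.1) := by simp [det2]; ring
      rw [f13, e1, abs_mul, abs_of_pos (by positivity)]
      have := T3 q hq
      have := abs_sub q.2 q.1
      have h3 : |q.2 - q.1| ≤ 2 * X := by linarith
      nlinarith [mul_le_mul_of_nonneg_left h3 (show 0 ≤ 2 * k * (e - X * (1 - μ)) by positivity)])
  refine ⟨_, _, _, this.1, this.2.trans (le_of_eq ?_)⟩
  rw [f12, f23, f13]
  congr 1
  rw [← hXX, he]
  linear_combination (4 * X * X * (1 + 2 * s)) * hk

lemma tau_star {p τ : ℝ} (hp : 1 < p) (h0 : 0 ≤ τ) (h1 : τ < 1) (h : 2 * (1 - τ) ^ p = 1 + τ ^ p) :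
    0 < τ / (1 - τ) ∧ (1 + τ / (1 - τ)) ^ p + (τ / (1 - τ)) ^ p = 2 ∧ 1 + 2 * (τ / (1 - τ)) = (1 + τ) / (1 - τ) := by
  have h2 : 0 < 1 - τ := by linarith
  have hpos : 0 < τ := by
    rcases eq_or_lt_of_le h0 with e | e
    · rw [← e, Real.zero_rpow (by linarith)] at h
      norm_num at h
    · exact e
  refine ⟨by positivity, ?_, by field_simp; ring⟩
  have e1 : 1 + τ / (1 - τ) = 1 / (1 - τ) := by field_simp; ring
  have h3 : 0 < (1 - τ) ^ p := by positivity
  rw [e1, Real.div_rpow (by norm_num) h2.le, Real.div_rpow h0 h2.le, Real.one_rpow, ← add_div, div_eq_iff h3.ne']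
  linarith

lemma val1 {p τ : ℝ} (h1 : 1 + 2 * (τ / (1 - τ)) = (1 + τ) / (1 - τ)) :
    4 * ((1 + 2 * (τ / (1 - τ))) * (4:ℝ) ^ (-1 / p)) = (4 : ℝ) ^ (1 - 1 / p) * (1 + τ) / (1 - τ) := by
  rw [h1, show (1:ℝ) - 1 / p = 1 + -1 / p by ring, Real.rpow_add (by norm_num), Real.rpow_one]
  ring

open MeasureTheory

/-- there is `p₀ ∈ (2.57, 2.58)` such that for all `p > 1`, the infimum of
areas of centrally symmetric hexagons `conv{±v₁, ±v₂, ±v₃}` containing `D_p` equals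
`4^(1-1/p)·(1+τ_p)/(1-τ_p)` if `1 < p ≤ 2` or `p ≥ p₀`, and equals `2·(2^p-1)^(1/p)`
if `2 ≤ p ≤ p₀`. -/
theorem stmt_17 :
    ∃ p₀ : ℝ, 2.57 < p₀ ∧ p₀ < 2.58 ∧
      ∀ p : ℝ, 1 < p → ∀ τ : ℝ, 0 ≤ τ → τ < 1 → 2 * (1 - τ) ^ p = 1 + τ ^ p →
        ((p ≤ 2 ∨ p₀ ≤ p) →
          sInf {A : ENNReal | ∃ v₁ v₂ v₃ : ℝ × ℝ,
              ballD p ⊆ convexHull ℝ ({v₁, v₂, v₃, -v₁, -v₂, -v₃} : Set (ℝ × ℝ)) ∧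
              A = volume (convexHull ℝ ({v₁, v₂, v₃, -v₁, -v₂, -v₃} : Set (ℝ × ℝ)))} =
            ENNReal.ofReal ((4 : ℝ) ^ (1 - 1 / p) * (1 + τ) / (1 - τ))) ∧
        ((2 ≤ p ∧ p ≤ p₀) →
          sInf {A : ENNReal | ∃ v₁ v₂ v₃ : ℝ × ℝ,
              ballD p ⊆ convexHull ℝ ({v₁, v₂, v₃, -v₁, -v₂, -v₃} : Set (ℝ × ℝ)) ∧
              A = volume (convexHull ℝ ({v₁, v₂, v₃, -v₁, -v₂, -v₃} : Set (ℝ × ℝ)))} =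
            ENNReal.ofReal (2 * ((2 : ℝ) ^ p - 1) ^ (1 / p))) := by
  obtain ⟨p₀, h1, h2, h⟩ := analytic_main
  refine ⟨p₀, h1, h2, fun p hp τ ht0 ht1 hτ => ⟨fun hc => ?_, fun hc => ?_⟩⟩
  · obtain ⟨s0, s1, s2⟩ := tau_star hp ht0 ht1 hτ
    have hfg : ff p (τ / (1 - τ)) = gg p (τ / (1 - τ)) := by unfold ff gg; linarith
    have hcfg := cfg_of hp ((h p hp).1 hc _ s0.le hfg)
    rw [exp_GGss (by linarith) s0.le] at hcfg
    rw [← val1 s2]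
    apply le_antisymm
    · obtain ⟨v1, v2, v3, a, b⟩ := UB1 hp s0 s1
      refine le_trans (sInf_le ?_) b
      exact ⟨v1, v2, v3, a, rfl⟩
    · apply le_sInf
      rintro A ⟨v1, v2, v3, a, rfl⟩
      exact LB hp hcfg v1 v2 v3 a
  · have hcfg := cfg_of hp ((h p hp).2 hc)
    rw [exp_GG10 (by linarith)] at hcfg
    apply le_antisymm
    · obtain ⟨v1, v2, v3, a, b⟩ := UB0 hp
      refine le_trans (sInf_le ?_) b
      exact ⟨v1, v2, v3, a, rfl⟩
    · apply le_sInf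
      rintro A ⟨v1, v2, v3, a, rfl⟩
      have := LB hp hcfg v1 v2 v3 a
      rwa [show 4 * (((2:ℝ) ^ p - 1) ^ (1 / p) / 2) = 2 * ((2:ℝ) ^ p - 1) ^ (1 / p) by ring] at this
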